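/- Let k be a field, G an affine algebraic group over k (not necessarily smooth or connected), and X a normal quasi-projective G-variety. Then X admits an ample G-linearized line bundle; equivalently, X admits a G-equivariant immersion into the projectivization of a finite-dimensional G-module. -/

import Mathlib

open AlgebraicGeometry CategoryTheory CategoryTheory.Limits Opposite

universe u

noncomputable section

/-- The spectrum of the field `k`, the base of all schemes considered. -/
abbrev Spk (k : Type u) [Field k] : Scheme.{u} := Spec (CommRingCat.of k)

/-- A scheme over the field `k`: a scheme together with a structure morphism to `Spec k`. -/
structure SchemeOver (k : Type u) [Field k] : Type (u + 1) where
  carrier : Scheme.{u}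
  str : carrier ⟶ Spk k

variable (k : Type u) [Field k]

/-- A group scheme over `k`, presented via its functor of points: for every scheme `T`
and every pair of `T`-points lying over the same `T`-point of `Spec k`, a product point,
together with unit and inverse, satisfying the group axioms functorially. -/
structure GroupSchemeOver extends SchemeOver k where
  mul : ∀ {T : Scheme.{u}} (a b : T ⟶ carrier), a ≫ str = b ≫ str → (T ⟶ carrier)
  one : Spk k ⟶ carrier
  inv : ∀ {T : Scheme.{u}}, (T ⟶ carrier) → (T ⟶ carrier)
  mul_str : ∀ {T : Scheme.{u}} (a b : T ⟶ carrier) (h), mul a b h ≫ str = a ≫ str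
  one_str : one ≫ str = 𝟙 (Spk k)
  inv_str : ∀ {T : Scheme.{u}} (a : T ⟶ carrier), inv a ≫ str = a ≫ str
  mul_natural : ∀ {T' T : Scheme.{u}} (g : T' ⟶ T) (a b : T ⟶ carrier) (h h'),
    g ≫ mul a b h = mul (g ≫ a) (g ≫ b) h'
  inv_natural : ∀ {T' T : Scheme.{u}} (g : T' ⟶ T) (a : T ⟶ carrier),
    g ≫ inv a = inv (g ≫ a)
  mul_assoc : ∀ {T : Scheme.{u}} (a b c : T ⟶ carrier) (h₁ h₂ h₃ h₄),
    mul (mul a b h₁) c h₂ = mul a (mul b c h₃) h₄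
  one_mul : ∀ {T : Scheme.{u}} (a : T ⟶ carrier) (h), mul (a ≫ str ≫ one) a h = a
  mul_one : ∀ {T : Scheme.{u}} (a : T ⟶ carrier) (h), mul a (a ≫ str ≫ one) h = a
  inv_mul : ∀ {T : Scheme.{u}} (a : T ⟶ carrier) (h), mul (inv a) a h = a ≫ str ≫ one

variable {k}

theorem GroupSchemeOver.mul_congr (G : GroupSchemeOver k) {T : Scheme.{u}}
    {a a' b b' : T ⟶ G.carrier} (ha : a = a') (hb : b = b') (h h') :
    G.mul a b h = G.mul a' b' h' := by subst ha; subst hb; rfl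

/-- A homomorphism of group schemes over `k`. -/
structure GroupHom (G H : GroupSchemeOver k) where
  hom : G.carrier ⟶ H.carrier
  hom_str : hom ≫ H.str = G.str
  hom_one : G.one ≫ hom = H.one
  hom_mul : ∀ {T : Scheme.{u}} (a b : T ⟶ G.carrier) (h h'),
    G.mul a b h ≫ hom = H.mul (a ≫ hom) (b ≫ hom) h'

/-- An action of a group scheme `G` over `k` on a scheme `X` over `k`, presented via
its functor of points. -/
structure ActionOver (G : GroupSchemeOver k) (X : SchemeOver k) where
  act : ∀ {T : Scheme.{u}} (g : T ⟶ G.carrier) (x : T ⟶ X.carrier),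
    g ≫ G.str = x ≫ X.str → (T ⟶ X.carrier)
  act_str : ∀ {T : Scheme.{u}} (g : T ⟶ G.carrier) (x : T ⟶ X.carrier) (h),
    act g x h ≫ X.str = x ≫ X.str
  act_natural : ∀ {T' T : Scheme.{u}} (f : T' ⟶ T) (g : T ⟶ G.carrier)
    (x : T ⟶ X.carrier) (h h'), f ≫ act g x h = act (f ≫ g) (f ≫ x) h'
  one_act : ∀ {T : Scheme.{u}} (x : T ⟶ X.carrier) (h), act (x ≫ X.str ≫ G.one) x h = x
  mul_act : ∀ {T : Scheme.{u}} (g g' : T ⟶ G.carrier) (x : T ⟶ X.carrier) (h₁ h₂ h₃ h₄),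
    act (G.mul g g' h₁) x h₂ = act g (act g' x h₃) h₄

theorem ActionOver.act_congr {G : GroupSchemeOver k} {X : SchemeOver k}
    (α : ActionOver G X) {T : Scheme.{u}} {g g' : T ⟶ G.carrier} {x x' : T ⟶ X.carrier}
    (hg : g = g') (hx : x = x') (h h') : α.act g x h = α.act g' x' h' := by
  subst hg; subst hx; rfl

/-- The action of a group scheme on itself by left translations. -/
def GroupSchemeOver.selfAction (G : GroupSchemeOver k) : ActionOver G G.toSchemeOver where
  act g x h := G.mul g x h
  act_str g x h := (G.mul_str g x h).trans h
  act_natural f g x h h' := G.mul_natural f g x h h'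
  one_act x h := G.one_mul x h
  mul_act g g' x h₁ h₂ h₃ h₄ := G.mul_assoc g g' x h₁ h₂ h₃ h₄

/-- Restriction of an action along a homomorphism of group schemes. -/
def ActionOver.res {G H : GroupSchemeOver k} {X : SchemeOver k} (φ : GroupHom H G)
    (α : ActionOver G X) : ActionOver H X where
  act g x h := α.act (g ≫ φ.hom) x (by rw [Category.assoc, φ.hom_str, h])
  act_str g x h := α.act_str _ _ _
  act_natural f g x h h' := by
    refine (α.act_natural f (g ≫ φ.hom) x _ ?_).trans (α.act_congr ?_ rfl _ _)
    · simp only [Category.assoc, φ.hom_str, ← h']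
    · simp only [Category.assoc]
  one_act x h := by
    refine (α.act_congr ?_ rfl _ ?_).trans (α.one_act x ?_)
    · simp only [Category.assoc, φ.hom_one]
    · simp only [Category.assoc, G.one_str, Category.comp_id]
    · simp only [Category.assoc, G.one_str, Category.comp_id]
  mul_act g g' x h₁ h₂ h₃ h₄ := by
    have hg : g ≫ H.str = x ≫ X.str := (H.mul_str g g' h₁).symm.trans h₂
    have hg' : g' ≫ H.str = x ≫ X.str := h₁.symm.trans hg
    have p1 : (g ≫ φ.hom) ≫ G.str = (g' ≫ φ.hom) ≫ G.str := by
      simp only [Category.assoc, φ.hom_str]; exact h₁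
    have p3 : (g' ≫ φ.hom) ≫ G.str = x ≫ X.str := by
      simp only [Category.assoc, φ.hom_str]; exact hg'
    refine (α.act_congr (φ.hom_mul g g' h₁ p1) rfl _ ?_).trans
      (α.mul_act (g ≫ φ.hom) (g' ≫ φ.hom) x p1 ?_ p3 ?_)
    · rw [G.mul_str]
      simp only [Category.assoc, φ.hom_str]; exact hg
    · rw [G.mul_str]
      simp only [Category.assoc, φ.hom_str]; exact hg
    · rw [α.act_str]
      simp only [Category.assoc, φ.hom_str]; exact hg
/-! ### Vector bundles and line bundles, geometrically -/

/-- The data underlying a (geometric) vector bundle on a scheme `X`: a total space `π : tot ⟶ X`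
together with a fiberwise `Γ(T, ⊤)`-module structure on the `T`-points of `tot` over a fixed
`T`-point of `X`, functorially in `T`. -/
structure VecBundleData (X : Scheme.{u}) : Type (u + 1) where
  tot : Scheme.{u}
  π : tot ⟶ X
  zero : X ⟶ tot
  zero_π : zero ≫ π = 𝟙 X
  add : ∀ {T : Scheme.{u}} (a b : T ⟶ tot), a ≫ π = b ≫ π → (T ⟶ tot)
  smul : ∀ {T : Scheme.{u}} (f : Γ(T, ⊤)) (a : T ⟶ tot), T ⟶ tot
  add_π : ∀ {T : Scheme.{u}} (a b : T ⟶ tot) (h), add a b h ≫ π = a ≫ π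
  smul_π : ∀ {T : Scheme.{u}} (f : Γ(T, ⊤)) (a : T ⟶ tot), smul f a ≫ π = a ≫ π
  add_natural : ∀ {T' T : Scheme.{u}} (g : T' ⟶ T) (a b : T ⟶ tot) (h h'),
    g ≫ add a b h = add (g ≫ a) (g ≫ b) h'
  smul_natural : ∀ {T' T : Scheme.{u}} (g : T' ⟶ T) (f : Γ(T, ⊤)) (a : T ⟶ tot),
    g ≫ smul f a = smul (g.appTop f) (g ≫ a)
  add_comm : ∀ {T : Scheme.{u}} (a b : T ⟶ tot) (h h'), add a b h = add b a h'
  add_assoc : ∀ {T : Scheme.{u}} (a b c : T ⟶ tot) (h₁ h₂ h₃ h₄),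
    add (add a b h₁) c h₂ = add a (add b c h₃) h₄
  zero_add : ∀ {T : Scheme.{u}} (a : T ⟶ tot) (h), add ((a ≫ π) ≫ zero) a h = a
  one_smul : ∀ {T : Scheme.{u}} (a : T ⟶ tot), smul 1 a = a
  mul_smul : ∀ {T : Scheme.{u}} (f g : Γ(T, ⊤)) (a : T ⟶ tot), smul (f * g) a = smul f (smul g a)
  smul_add : ∀ {T : Scheme.{u}} (f : Γ(T, ⊤)) (a b : T ⟶ tot) (h h'),
    smul f (add a b h) = add (smul f a) (smul f b) h'
  add_smul : ∀ {T : Scheme.{u}} (f g : Γ(T, ⊤)) (a : T ⟶ tot) (h),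
    smul (f + g) a = add (smul f a) (smul g a) h
  zero_smul : ∀ {T : Scheme.{u}} (a : T ⟶ tot), smul 0 a = (a ≫ π) ≫ zero
  smul_zero : ∀ {T : Scheme.{u}} (f : Γ(T, ⊤)) (x : T ⟶ X), smul f (x ≫ zero) = x ≫ zero

namespace VecBundleData

variable {X : Scheme.{u}} (E : VecBundleData X)

theorem add_congr {T : Scheme.{u}} {a a' b b' : T ⟶ E.tot} (ha : a = a') (hb : b = b')
    (h h') : E.add a b h = E.add a' b' h' := by subst ha; subst hb; rfl

/-- The fiber of a vector bundle over a `T`-point of the base. -/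
abbrev Fiber {T : Scheme.{u}} (x : T ⟶ X) : Type u := { a : T ⟶ E.tot // a ≫ E.π = x }

instance fiberZero {T : Scheme.{u}} (x : T ⟶ X) : Zero (E.Fiber x) :=
  ⟨⟨x ≫ E.zero, by rw [Category.assoc, E.zero_π, Category.comp_id]⟩⟩

instance fiberAdd {T : Scheme.{u}} (x : T ⟶ X) : Add (E.Fiber x) :=
  ⟨fun a b => ⟨E.add a.1 b.1 (a.2.trans b.2.symm), (E.add_π _ _ _).trans a.2⟩⟩

instance fiberSMul {T : Scheme.{u}} (x : T ⟶ X) : SMul Γ(T, ⊤) (E.Fiber x) :=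
  ⟨fun f a => ⟨E.smul f a.1, (E.smul_π _ _).trans a.2⟩⟩

@[simp] theorem coe_fiber_zero {T : Scheme.{u}} (x : T ⟶ X) :
    ((0 : E.Fiber x) : T ⟶ E.tot) = x ≫ E.zero := rfl

@[simp] theorem coe_fiber_add {T : Scheme.{u}} (x : T ⟶ X) (a b : E.Fiber x) :
    ((a + b : E.Fiber x) : T ⟶ E.tot) = E.add a.1 b.1 (a.2.trans b.2.symm) := rfl

@[simp] theorem coe_fiber_smul {T : Scheme.{u}} (x : T ⟶ X) (f : Γ(T, ⊤)) (a : E.Fiber x) :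
    ((f • a : E.Fiber x) : T ⟶ E.tot) = E.smul f a.1 := rfl

instance {T : Scheme.{u}} (x : T ⟶ X) : AddCommMonoid (E.Fiber x) where
  add_assoc a b c := Subtype.ext (E.add_assoc _ _ _ _ _ _ _)
  add_comm a b := Subtype.ext (E.add_comm _ _ _ _)
  zero_add a := Subtype.ext (by
    have hz : ((a.1 ≫ E.π) ≫ E.zero) ≫ E.π = a.1 ≫ E.π := by
      rw [Category.assoc, E.zero_π, Category.comp_id]
    show E.add (x ≫ E.zero) a.1 _ = a.1
    exact (E.add_congr (by rw [a.2]) rfl _ hz).trans (E.zero_add a.1 hz))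
  add_zero a := Subtype.ext (by
    have hz : ((a.1 ≫ E.π) ≫ E.zero) ≫ E.π = a.1 ≫ E.π := by
      rw [Category.assoc, E.zero_π, Category.comp_id]
    have hz' : (x ≫ E.zero) ≫ E.π = a.1 ≫ E.π := by
      rw [Category.assoc, E.zero_π, Category.comp_id, a.2]
    show E.add a.1 (x ≫ E.zero) _ = a.1
    exact (E.add_comm _ _ _ hz').trans
      ((E.add_congr (by rw [a.2]) rfl _ hz).trans (E.zero_add a.1 hz)))
  nsmul := nsmulRec
  nsmul_zero _ := rfl
  nsmul_succ _ _ := rfl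

instance {T : Scheme.{u}} (x : T ⟶ X) : Module Γ(T, ⊤) (E.Fiber x) where
  one_smul a := Subtype.ext (E.one_smul a.1)
  mul_smul f g a := Subtype.ext (E.mul_smul f g a.1)
  smul_zero f := Subtype.ext (E.smul_zero f x)
  smul_add f a b := Subtype.ext (E.smul_add f a.1 b.1 _ _)
  add_smul f g a := Subtype.ext (E.add_smul f g a.1 _)
  zero_smul a := Subtype.ext ((E.zero_smul a.1).trans (by rw [a.2]; rfl))

/-- A family of `n` local sections of `E` over an open subset `U` is a frame if every point
of the total space over `U` is, in a unique way, a linear combination of these sections. -/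
def IsFrame {n : ℕ} (U : X.Opens) (s : Fin n → (U.toScheme ⟶ E.tot)) : Prop :=
  ∃ hs : ∀ i, s i ≫ E.π = U.ι,
    ∀ {T : Scheme.{u}} (x : T ⟶ U.toScheme),
      Function.Bijective (fun f : Fin n → Γ(T, ⊤) =>
        (∑ i, f i • (⟨x ≫ s i, by rw [Category.assoc, hs i]⟩ : E.Fiber (x ≫ U.ι))))

/-- A family of `n` global sections of `E` is a global frame if every point of the total
space is, in a unique way, a linear combination of these sections. -/
def IsGlobalFrame {n : ℕ} (s : Fin n → (X ⟶ E.tot)) : Prop :=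
  ∃ hs : ∀ i, s i ≫ E.π = 𝟙 X,
    ∀ {T : Scheme.{u}} (x : T ⟶ X),
      Function.Bijective (fun f : Fin n → Γ(T, ⊤) =>
        (∑ i, f i • (⟨x ≫ s i, by rw [Category.assoc, hs i, Category.comp_id]⟩ : E.Fiber x)))

end VecBundleData

/-- A (geometric) vector bundle of rank `n` on `X`: bundle data which is locally trivial,
i.e. admits local frames around every point of `X`. -/
structure VecBundle (n : ℕ) (X : Scheme.{u}) extends VecBundleData X where
  locTriv : ∀ x : X, ∃ (U : X.Opens) (s : Fin n → (U.toScheme ⟶ tot)),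
    x ∈ U ∧ toVecBundleData.IsFrame U s

/-- A (geometric) line bundle on a scheme. -/
abbrev LineBundle (X : Scheme.{u}) := VecBundle 1 X

/-- A morphism of total spaces of vector bundles over `X` is linear if it commutes with the
projections, the fiberwise additions and the fiberwise scalar multiplications. -/
def IsLinearHom {X : Scheme.{u}} (E F : VecBundleData X) (φ : E.tot ⟶ F.tot) : Prop :=
  (φ ≫ F.π = E.π) ∧
  (∀ {T : Scheme.{u}} (a b : T ⟶ E.tot) (h h'), E.add a b h ≫ φ = F.add (a ≫ φ) (b ≫ φ) h') ∧
  (∀ {T : Scheme.{u}} (f : Γ(T, ⊤)) (a : T ⟶ E.tot), E.smul f a ≫ φ = F.smul f (a ≫ φ))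

/-- Two vector bundles on `X` are isomorphic if there is a linear isomorphism between them. -/
def VBIso {X : Scheme.{u}} {n m : ℕ} (E : VecBundle n X) (F : VecBundle m X) : Prop :=
  ∃ φ : E.tot ⟶ F.tot, IsLinearHom E.toVecBundleData F.toVecBundleData φ ∧ IsIso φ

/-- `F` is a pullback of the vector bundle `E` along `g : Y ⟶ X`. -/
def IsPullbackBundle {Y X : Scheme.{u}} (g : Y ⟶ X) {n : ℕ} (E : VecBundle n X)
    (F : VecBundle n Y) : Prop :=
  ∃ τ : F.tot ⟶ E.tot,
    (τ ≫ E.π = F.π ≫ g) ∧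
    (∀ {T : Scheme.{u}} (a b : T ⟶ F.tot) (h h'), F.add a b h ≫ τ = E.add (a ≫ τ) (b ≫ τ) h') ∧
    (∀ {T : Scheme.{u}} (f : Γ(T, ⊤)) (a : T ⟶ F.tot), F.smul f a ≫ τ = E.smul f (a ≫ τ)) ∧
    (∀ {T : Scheme.{u}} (y : T ⟶ Y) (a : T ⟶ E.tot), a ≫ E.π = y ≫ g →
      ∃! b : T ⟶ F.tot, b ≫ F.π = y ∧ b ≫ τ = a)

/-- A vector bundle is trivial if it admits a global frame. -/
def IsTrivialBundle {X : Scheme.{u}} {n : ℕ} (E : VecBundle n X) : Prop :=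
  ∃ s : Fin n → (X ⟶ E.tot), E.toVecBundleData.IsGlobalFrame s

/-- `N` is a tensor product of the line bundles `L` and `M`: witnessed by a fiberwise
bilinear pairing taking local frames to local frames. -/
def IsTensor {X : Scheme.{u}} (L M N : LineBundle X) : Prop :=
  ∃ β : ∀ {T : Scheme.{u}} (a : T ⟶ L.tot) (b : T ⟶ M.tot), a ≫ L.π = b ≫ M.π → (T ⟶ N.tot),
    (∀ {T : Scheme.{u}} (a : T ⟶ L.tot) (b : T ⟶ M.tot) (h), β a b h ≫ N.π = a ≫ L.π) ∧
    (∀ {T' T : Scheme.{u}} (g : T' ⟶ T) (a : T ⟶ L.tot) (b : T ⟶ M.tot) (h h'),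
      g ≫ β a b h = β (g ≫ a) (g ≫ b) h') ∧
    (∀ {T : Scheme.{u}} (a a' : T ⟶ L.tot) (b : T ⟶ M.tot) (h₁ h₂ h₃ h₄ h₅),
      β (L.add a a' h₁) b h₂ = N.add (β a b h₃) (β a' b h₄) h₅) ∧
    (∀ {T : Scheme.{u}} (a : T ⟶ L.tot) (b b' : T ⟶ M.tot) (h₁ h₂ h₃ h₄ h₅),
      β a (M.add b b' h₁) h₂ = N.add (β a b h₃) (β a b' h₄) h₅) ∧
    (∀ {T : Scheme.{u}} (f : Γ(T, ⊤)) (a : T ⟶ L.tot) (b : T ⟶ M.tot) (h₁ h₂),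
      β (L.smul f a) b h₁ = N.smul f (β a b h₂)) ∧
    (∀ {T : Scheme.{u}} (f : Γ(T, ⊤)) (a : T ⟶ L.tot) (b : T ⟶ M.tot) (h₁ h₂),
      β a (M.smul f b) h₁ = N.smul f (β a b h₂)) ∧
    (∀ (U : X.Opens) (sL : Fin 1 → (U.toScheme ⟶ L.tot)) (sM : Fin 1 → (U.toScheme ⟶ M.tot)),
      L.toVecBundleData.IsFrame U sL → M.toVecBundleData.IsFrame U sM →
      ∀ (h : sL 0 ≫ L.π = sM 0 ≫ M.π),
        N.toVecBundleData.IsFrame (n := 1) U (fun _ => β (sL 0) (sM 0) h))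

/-- `N` is an `m`-th tensor power of the line bundle `L`. -/
def IsTensorPow {X : Scheme.{u}} (L : LineBundle X) : ℕ → LineBundle X → Prop
  | 0, N => IsTrivialBundle N
  | m + 1, N => ∃ M : LineBundle X, IsTensorPow L m M ∧ IsTensor M L N

/-- A line bundle is ample if the base is quasi-compact and quasi-separated and the
non-vanishing loci of global sections of positive tensor powers give an affine open cover. -/
def IsAmple {X : Scheme.{u}} (L : LineBundle X) : Prop :=
  CompactSpace X ∧ QuasiSeparatedSpace X ∧
  ∀ x : X, ∃ (m : ℕ), 0 < m ∧ ∃ (N : LineBundle X), IsTensorPow L m N ∧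
    ∃ (s : X ⟶ N.tot), s ≫ N.π = 𝟙 X ∧
      ∃ U : X.Opens, IsAffineOpen U ∧ x ∈ U ∧
        (U : Set X) = {y : X | s.base y ≠ N.zero.base y}
/-! ### Properties of schemes and group schemes over `k` -/

/-- An algebraic group over `k` is a group scheme of finite type over `k`. -/
def GroupSchemeOver.IsAlgebraic {k : Type u} [Field k] (G : GroupSchemeOver k) : Prop :=
  LocallyOfFiniteType G.str ∧ QuasiCompact G.str

/-- A scheme of finite type over `k`. -/
def SchemeOver.IsFiniteType {k : Type u} [Field k] (X : SchemeOver k) : Prop :=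
  LocallyOfFiniteType X.str ∧ QuasiCompact X.str

/-- A variety over `k`: an integral separated scheme of finite type over `k`. -/
def SchemeOver.IsVariety {k : Type u} [Field k] (X : SchemeOver k) : Prop :=
  IsIntegral X.carrier ∧ AlgebraicGeometry.IsSeparated X.str ∧ X.IsFiniteType

/-- A scheme is normal if all its local rings are integrally closed domains. -/
def IsNormalScheme (X : Scheme.{u}) : Prop :=
  ∀ x : X, IsDomain (X.presheaf.stalk x) ∧ IsIntegrallyClosed (X.presheaf.stalk x)

/-- The base change of a scheme over `k` to the algebraic closure of `k`. -/
def SchemeOver.geomFiber {k : Type u} [Field k] (X : SchemeOver k) : Scheme.{u} :=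
  pullback X.str (Spec.map (CommRingCat.ofHom (algebraMap k (AlgebraicClosure k))))

/-- A scheme over `k` is geometrically integral if its base change to an algebraic
closure of `k` is integral. -/
def SchemeOver.IsGeomIntegral {k : Type u} [Field k] (X : SchemeOver k) : Prop :=
  IsIntegral X.geomFiber

/-- A scheme over `k` is geometrically connected if its base change to an algebraic
closure of `k` is connected. -/
def SchemeOver.IsGeomConnected {k : Type u} [Field k] (X : SchemeOver k) : Prop :=
  ConnectedSpace X.geomFiber

/-- A scheme over `k` is geometrically irreducible if its base change to an algebraic
closure of `k` is irreducible. -/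
def SchemeOver.IsGeomIrreducible {k : Type u} [Field k] (X : SchemeOver k) : Prop :=
  IrreducibleSpace X.geomFiber

/-- An open subscheme of a scheme over `k`, as a scheme over `k`. -/
def SchemeOver.ofOpens {k : Type u} [Field k] (X : SchemeOver k) (U : X.carrier.Opens) :
    SchemeOver k :=
  ⟨U.toScheme, U.ι ≫ X.str⟩

/-- A scheme over `k` is quasi-projective if it is separated, of finite type, and carries
an ample line bundle. -/
def SchemeOver.IsQuasiProjective {k : Type u} [Field k] (X : SchemeOver k) : Prop :=
  AlgebraicGeometry.IsSeparated X.str ∧ X.IsFiniteType ∧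
    ∃ L : LineBundle X.carrier, IsAmple L

/-- An open subset of `X` is stable under an action of `G` if the action preserves its
`T`-points, for all `T`. -/
def ActionOver.Stable {k : Type u} [Field k] {G : GroupSchemeOver k} {X : SchemeOver k}
    (α : ActionOver G X) (U : X.carrier.Opens) : Prop :=
  ∀ {T : Scheme.{u}} (g : T ⟶ G.carrier) (x : T ⟶ X.carrier) (h),
    Set.range x.base ⊆ (U : Set X.carrier) →
      Set.range (α.act g x h).base ⊆ (U : Set X.carrier)

/-- A `G`-linearization of a vector bundle `E` on a `G`-scheme `X`: an action of `G` on the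
total space of `E`, lifting the action on `X` and acting linearly on the fibers (equivalently,
an action of `G × 𝔾ₘ` on `E` for which the projection is equivariant and `𝔾ₘ` acts by
multiplication on the fibers). -/
structure LinearizationData {k : Type u} [Field k] {G : GroupSchemeOver k} {X : SchemeOver k}
    (α : ActionOver G X) {n : ℕ} (E : VecBundle n X.carrier) where
  lact : ∀ {T : Scheme.{u}} (g : T ⟶ G.carrier) (e : T ⟶ E.tot),
    g ≫ G.str = (e ≫ E.π) ≫ X.str → (T ⟶ E.tot)
  lact_π : ∀ {T : Scheme.{u}} (g : T ⟶ G.carrier) (e : T ⟶ E.tot) (h h'),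
    lact g e h ≫ E.π = α.act g (e ≫ E.π) h'
  lact_natural : ∀ {T' T : Scheme.{u}} (f : T' ⟶ T) (g : T ⟶ G.carrier) (e : T ⟶ E.tot) (h h'),
    f ≫ lact g e h = lact (f ≫ g) (f ≫ e) h'
  one_lact : ∀ {T : Scheme.{u}} (e : T ⟶ E.tot) (h), lact (((e ≫ E.π) ≫ X.str) ≫ G.one) e h = e
  mul_lact : ∀ {T : Scheme.{u}} (g g' : T ⟶ G.carrier) (e : T ⟶ E.tot) (h₁ h₂ h₃ h₄),
    lact (G.mul g g' h₁) e h₂ = lact g (lact g' e h₃) h₄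
  lact_add : ∀ {T : Scheme.{u}} (g : T ⟶ G.carrier) (a b : T ⟶ E.tot) (h₁ h₂ h₃ h₄ h₅),
    lact g (E.add a b h₁) h₂ = E.add (lact g a h₃) (lact g b h₄) h₅
  lact_smul : ∀ {T : Scheme.{u}} (g : T ⟶ G.carrier) (f : Γ(T, ⊤)) (a : T ⟶ E.tot) (h₁ h₂),
    lact g (E.smul f a) h₁ = E.smul f (lact g a h₂)

/-- A vector bundle is `G`-linearized (linearizable) if it admits a linearization. -/
def ActionOver.IsLinearized {k : Type u} [Field k] {G : GroupSchemeOver k} {X : SchemeOver k}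
    (α : ActionOver G X) {n : ℕ} (E : VecBundle n X.carrier) : Prop :=
  Nonempty (LinearizationData α E)

/-- Equivariance of a morphism relative to a homomorphism of group schemes. -/
def IsEquivariantRel {k : Type u} [Field k] {G H : GroupSchemeOver k} {X Y : SchemeOver k}
    (φ : GroupHom G H) (α : ActionOver G X) (β : ActionOver H Y)
    (f : X.carrier ⟶ Y.carrier) : Prop :=
  f ≫ Y.str = X.str ∧
  ∀ {T : Scheme.{u}} (g : T ⟶ G.carrier) (x : T ⟶ X.carrier) (h h'),
    α.act g x h ≫ f = β.act (g ≫ φ.hom) (x ≫ f) h'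

/-- Equivariance of a morphism of `G`-schemes. -/
def IsEquivariant {k : Type u} [Field k] {G : GroupSchemeOver k} {X Y : SchemeOver k}
    (α : ActionOver G X) (β : ActionOver G Y) (f : X.carrier ⟶ Y.carrier) : Prop :=
  f ≫ Y.str = X.str ∧
  ∀ {T : Scheme.{u}} (g : T ⟶ G.carrier) (x : T ⟶ X.carrier) (h h'),
    α.act g x h ≫ f = β.act g (x ≫ f) h'

/-- A `T`-point of `G` acts trivially if it acts trivially on all points of `X` over `T`. -/
def ActionOver.ActsTrivially {k : Type u} [Field k] {G : GroupSchemeOver k}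
    {X : SchemeOver k} (α : ActionOver G X) {T : Scheme.{u}} (g : T ⟶ G.carrier) : Prop :=
  ∀ {T' : Scheme.{u}} (t : T' ⟶ T) (x : T' ⟶ X.carrier) (h), α.act (t ≫ g) x h = x

/-- An action is almost faithful if its kernel is finite, i.e. all trivially acting points
factor through a fixed closed subscheme of `G` which is finite over `k`. -/
def ActionOver.IsAlmostFaithful {k : Type u} [Field k] {G : GroupSchemeOver k}
    {X : SchemeOver k} (α : ActionOver G X) : Prop :=
  ∃ (K : Scheme.{u}) (ι : K ⟶ G.carrier), IsClosedImmersion ι ∧ IsFinite (ι ≫ G.str) ∧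
    ∀ {T : Scheme.{u}} (g : T ⟶ G.carrier), α.ActsTrivially g → ∃ g' : T ⟶ K, g' ≫ ι = g

/-- An abelian variety over `k` is a smooth connected proper algebraic group over `k`. -/
def GroupSchemeOver.IsAbelianVariety {k : Type u} [Field k] (G : GroupSchemeOver k) : Prop :=
  G.IsAlgebraic ∧ IsSmooth G.str ∧ ConnectedSpace G.carrier ∧ IsProper G.str

set_option linter.all false

section PartKron
open MvPolynomial
theorem kron_val {K σ : Type*} [Field K] (A : ValuationSubring K)
    (p q : MvPolynomial σ K) (h : ∀ n, coeff n (p * q) ∈ A) (m n : σ →₀ ℕ) :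
    coeff m p * coeff n q ∈ A := by
  classical
  by_cases hp : p = 0
  · simp [hp, A.zero_mem]
  by_cases hq : q = 0
  · simp [hq, A.zero_mem]
  have key : ∀ r : MvPolynomial σ K, r ≠ 0 → ∃ m0, coeff m0 r ≠ 0 ∧
      ∀ m, coeff m r / coeff m0 r ∈ A := by
    intro r hr
    obtain ⟨m0, hm0, hmax⟩ := Finset.exists_max_image r.support (fun m => A.valuation (coeff m r))
      (by simpa [Finset.nonempty_iff_ne_empty] using hr)
    rw [mem_support_iff] at hm0
    refine ⟨m0, hm0, fun m => ?_⟩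
    by_cases hm : coeff m r = 0
    · simp [hm, A.zero_mem]
    rw [← A.valuation_le_one_iff, map_div₀]
    have := hmax m (mem_support_iff.mpr hm)
    exact div_le_one_of_le₀ this zero_le
  have lift : ∀ r : MvPolynomial σ K, r ≠ 0 → ∃ m0, coeff m0 r ≠ 0 ∧ ∃ r' : MvPolynomial σ A,
      r = C (coeff m0 r) * MvPolynomial.map (algebraMap A K) r' ∧ coeff m0 r' = 1 := by
    intro r hr
    obtain ⟨m0, h0, h1⟩ := key r hr
    have : C ((coeff m0 r)⁻¹) * r ∈ Set.range (MvPolynomial.map (σ := σ) (algebraMap A K)) := by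
      rw [MvPolynomial.mem_range_map_iff_coeffs_subset]
      intro c hc
      simp only [Finset.mem_coe, MvPolynomial.mem_coeffs_iff] at hc
      obtain ⟨n, hn, rfl⟩ := hc
      refine ⟨⟨_, h1 n⟩, ?_⟩
      simp [div_eq_inv_mul]
    obtain ⟨r', hr'⟩ := this
    refine ⟨m0, h0, r', ?_, ?_⟩
    · rw [hr', ← mul_assoc, ← C_mul, mul_inv_cancel₀ h0, C_1, one_mul]
    · have := congrArg (coeff m0) hr'
      rw [coeff_map, coeff_C_mul, inv_mul_cancel₀ h0] at this
      exact Subtype.ext this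
  obtain ⟨m0, hm0, p', hpe, hp1⟩ := lift p hp
  obtain ⟨n0, hn0, q', hqe, hq1⟩ := lift q hq
  set a := coeff m0 p
  set b := coeff n0 q
  have hpr : MvPolynomial.map (IsLocalRing.residue A) p' ≠ 0 := fun h0 => by
    have := congrArg (coeff m0) h0
    simp [coeff_map, hp1] at this
  have hqr : MvPolynomial.map (IsLocalRing.residue A) q' ≠ 0 := fun h0 => by
    have := congrArg (coeff n0) h0
    simp [coeff_map, hq1] at this
  have hne := mul_ne_zero hpr hqr
  rw [← map_mul] at hne
  obtain ⟨l, hl⟩ := MvPolynomial.ne_zero_iff.mp hne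
  rw [coeff_map, IsLocalRing.residue_ne_zero_iff_isUnit] at hl
  have hpq : p * q = C (a * b) * MvPolynomial.map (algebraMap A K) (p' * q') := by
    rw [map_mul, map_mul]
    conv_lhs => rw [hpe, hqe]
    ring
  have hab : a * b ∈ A := by
    have h1 := h l
    rw [hpq, coeff_C_mul, coeff_map] at h1
    obtain ⟨w, hw⟩ := hl.exists_right_inv
    have h2 := A.mul_mem _ _ h1 w.2
    have : (algebraMap A K) (coeff l (p' * q')) * (w : K) = 1 := by
      have := congrArg (algebraMap A K) hw
      simpa using this
    rwa [mul_assoc, this, mul_one] at h2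
  rw [hpe, hqe, coeff_C_mul, coeff_C_mul, coeff_map, coeff_map]
  have := A.mul_mem _ _ hab (A.mul_mem _ _ (coeff m p').2 (coeff n q').2)
  convert this using 1
  simp only [ValuationSubring.algebraMap_apply]
  ring

theorem kron {K σ : Type*} [Field K] (B : Subring K) [IsIntegrallyClosedIn B K]
    (p q : MvPolynomial σ K) (h : ∀ n, coeff n (p * q) ∈ B) (m n : σ →₀ ℕ) :
    coeff m p * coeff n q ∈ B := by
  by_contra hc
  obtain ⟨V, hV, hn⟩ := Subring.exists_le_valuationSubring_of_isIntegrallyClosedIn hc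
  exact hn (kron_val V p q (fun n => hV (h n)) m n)

theorem kron2 {K σ : Type*} [Field K] (B : Subring K) [IsIntegrallyClosedIn B K]
    (p q : Polynomial (MvPolynomial σ K)) (h : ∀ n i, coeff n ((p * q).coeff i) ∈ B)
    (m n : σ →₀ ℕ) (i j : ℕ) :
    coeff m (p.coeff i) * coeff n (q.coeff j) ∈ B := by
  classical
  have e := fun (r : Polynomial (MvPolynomial σ K)) (m : σ →₀ ℕ) (i : ℕ) =>
    optionEquivLeft_coeff_coeff K ((optionEquivLeft K σ).symm r) i m
  simp only [AlgEquiv.apply_symm_apply] at e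
  rw [e, e]
  refine kron B _ _ (fun l => ?_) _ _
  rw [← map_mul]
  have := h l.some (l none)
  rw [e] at this
  convert this using 2
  simp
end PartKron

section PartGen
open MvPolynomial

variable {k H : Type u} [Field k] [CommRing H] [Algebra k H]

/-- extended family with `e none = 1`. -/
def eExt {J : Type} {R : Type*} [One R] (ε : J → R) : Option J → R := fun o => o.elim 1 ε

/-- universal coordinates on the incidence variety. -/
def wvec (D : Type) {J : Type} [Fintype J] (ε : J → H) : D × Option J → MvPolynomial (D × J) H :=
  fun p => match p with
    | (i, some j) => X (i, j)
    | (i, none) => - ∑ j, C (ε j) * X (i, j)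

theorem wvec_rel (D : Type) {J : Type} [Fintype J] (ε : J → H) (i : D) :
    ∑ j, wvec D ε (i, j) * C (eExt ε j) = 0 := by
  rw [Fintype.sum_option]
  simp [wvec, eExt, mul_comm]

def wmap (D : Type) {J : Type} [Fintype J] (ε : J → H) :
    MvPolynomial (D × Option J) k →ₐ[k] MvPolynomial (D × J) H := aeval (wvec D ε)

theorem wmap_not_inj [Nontrivial H] {J : Type} [Fintype J] (ε : J → H) :
    ¬ Function.Injective (wmap (k := k) (Option J) ε) := by
  classical
  intro hinj
  let M : Matrix (Option J) (Option J) (MvPolynomial (Option J × Option J) k) :=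
    Matrix.of fun i j => X (i, j)
  have hM : M.det ≠ 0 := Matrix.det_mvPolynomialX_ne_zero (Option J) k
  apply hM
  apply hinj
  rw [map_zero]
  let N := (wmap (k := k) (Option J) ε).toRingHom.mapMatrix M
  have hN : wmap (k := k) (Option J) ε M.det = N.det := (RingHom.map_det _ _)
  rw [hN]
  have hv : N.mulVec (fun j => C (eExt ε j)) = 0 := by
    funext i
    have := wvec_rel (Option J) ε i
    simpa [N, M, Matrix.mulVec, dotProduct, wmap] using this
  have h2 := congrArg (fun v => N.adjugate.mulVec v none) hv
  simp only [Matrix.mulVec_mulVec, Matrix.adjugate_mul] at h2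
  simpa [eExt, Matrix.smul_mulVec] using h2

theorem wmap_inj_zero [Nontrivial H] {J : Type} [Fintype J] (ε : J → H) (D : Type) [IsEmpty D] :
    Function.Injective (wmap (k := k) D ε) := by
  have : ∀ p : MvPolynomial (D × Option J) k, wmap D ε p = C (algebraMap k H (coeff 0 p)) := by
    intro p
    rw [MvPolynomial.eq_C_of_isEmpty p]
    simp [wmap]
  intro p q hpq
  rw [this, this] at hpq
  have h1 := (algebraMap k H).injective (MvPolynomial.C_injective _ _ hpq)
  rw [MvPolynomial.eq_C_of_isEmpty p, MvPolynomial.eq_C_of_isEmpty q, h1]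

theorem wmap_congr {J : Type} [Fintype J] (ε : J → H) {D D' : Type} (e : D ≃ D')
    (h : Function.Injective (wmap (k := k) D ε)) : Function.Injective (wmap (k := k) D' ε) := by
  have key : (wmap (k := k) D' ε) =
     ((rename (Equiv.prodCongr e (Equiv.refl J)) : _ →ₐ[H] _).restrictScalars k).comp
      ((wmap D ε).comp (rename (Equiv.prodCongr e.symm (Equiv.refl _)))) := by
    apply MvPolynomial.algHom_ext
    rintro ⟨i, _ | j⟩ <;> simp [wmap, wvec]
  rw [key]
  simp only [AlgHom.coe_comp, AlgHom.coe_restrictScalars']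
  exact (rename_injective _ (Equiv.injective _)).comp (h.comp (rename_injective _ (Equiv.injective _)))

theorem exists_generic [Nontrivial H] {J : Type} [Fintype J] (ε : J → H) :
    ∃ d : ℕ, Function.Injective (wmap (k := k) (Fin d) ε) ∧
      ¬ Function.Injective (wmap (k := k) (Option (Fin d)) ε) := by
  classical
  by_contra hc
  push Not at hc
  have : ∀ d : ℕ, Function.Injective (wmap (k := k) (Fin d) ε) := by
    intro d
    induction d with
    | zero => exact wmap_inj_zero ε _
    | succ d ih => exact wmap_congr ε (finSuccEquivLast (n := d)).symm (hc d ih)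
  exact wmap_not_inj (k := k) ε (wmap_congr ε (Fintype.equivFin (Option J)).symm (this _))

end PartGen

section PartGenB
open MvPolynomial TensorProduct
theorem alg_descend {L L' S : Type*} [Field L] [Field L'] [Algebra L L'] [CommRing S] [Algebra L S]
    (s : S) (h : _root_.IsIntegral L' ((1 : L') ⊗ₜ[L] s)) : _root_.IsIntegral L s := by
  by_contra hs
  have hli : LinearIndependent L (fun n : ℕ => s ^ n) := by
    rw [← isAlgebraic_iff_isIntegral] at hs
    rw [linearIndependent_iff]
    intro l hl
    by_contra hl0
    refine hs ⟨⟨AddMonoidAlgebra.ofCoeff l⟩, ?_, ?_⟩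
    · intro h0; apply hl0; ext n
      have := congrArg (fun q => Polynomial.coeff q n) h0
      simpa using this
    · rw [← hl, Polynomial.aeval_def, Polynomial.eval₂_eq_sum, Polynomial.sum_def, Finsupp.linearCombination_apply, Finsupp.sum]
      simp [Algebra.smul_def, Polynomial.support, Polynomial.coeff]
  have h2 := Module.Flat.linearIndependent_one_tmul (S := L') hli
  obtain ⟨P, hP, hP0⟩ := isAlgebraic_iff_isIntegral.mpr h
  apply hP
  rw [linearIndependent_iff'] at h2
  rw [Polynomial.aeval_eq_sum_range] at hP0
  ext n
  by_cases hn : n ∈ Finset.range (P.natDegree + 1)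
  · refine h2 _ P.coeff ?_ n hn
    rw [← hP0]
    refine Finset.sum_congr rfl fun i _ => ?_
    simp [Algebra.TensorProduct.tmul_pow]
  · simp at hn
    exact Polynomial.coeff_eq_zero_of_natDegree_lt (by omega)

theorem fin_lemma' {L S L' : Type u} [Field L] [CommRing S] [Algebra L S] {J : Type} [Fintype J]
    [Field L'] [Algebra L L'] [Algebra (MvPolynomial (Option J) L) L']
    [IsFractionRing (MvPolynomial (Option J) L) L'] [IsScalarTower L (MvPolynomial (Option J) L) L']
    (ε : J → S) (p : MvPolynomial (Option J) L) (hp : p ≠ 0)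
    (hz : ∀ (R : Type u) [CommRing R] [Algebra L R] (i : S →ₐ[L] R) (a : J → R),
      aeval (fun o : Option J => o.elim (- ∑ j, i (ε j) * a j) a) p = 0) (j : J) :
    _root_.IsIntegral L (ε j) := by
  classical
  have main : ∀ c : Option J → L, _root_.IsIntegral L' (∑ j, (1 : L') ⊗ₜ[L] ε j *
      algebraMap L' (L' ⊗[L] S) (algebraMap (MvPolynomial (Option J) L) L' (X (some j) + C (c (some j))))) := by
    intro c
    let a : J → L' := fun j => algebraMap (MvPolynomial (Option J) L) L' (X (some j) + C (c (some j)))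
    let P : Polynomial L' := aeval (fun o : Option J => o.elim Polynomial.X (fun j => Polynomial.C (a j))) p
    have hP : P ≠ 0 := by
      intro h0
      have h1 : Polynomial.eval (algebraMap (MvPolynomial (Option J) L) L' (X none + C (c none))) P =
          algebraMap (MvPolynomial (Option J) L) L' (aeval (fun o => X o + C (c o)) p) := by
        simp only [P]
        rw [← Polynomial.coe_aeval_eq_eval, ← AlgHom.restrictScalars_apply L, ← AlgHom.comp_apply,
          show algebraMap (MvPolynomial (Option J) L) L' (aeval (fun o => X o + C (c o)) p) =
            IsScalarTower.toAlgHom L (MvPolynomial (Option J) L) L' (aeval (fun o => X o + C (c o)) p) from rfl,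
          ← AlgHom.comp_apply]
        congr 1
        apply MvPolynomial.algHom_ext
        rintro (_ | j) <;> simp [a]
      rw [h0, Polynomial.eval_zero] at h1
      have h2 : aeval (fun o => X o + C (c o)) p = 0 :=
        (IsFractionRing.injective (MvPolynomial (Option J) L) L') (by rw [← h1, map_zero])
      apply hp
      have h3 := congrArg (aeval (fun o => X o - C (c o) : Option J → MvPolynomial (Option J) L)) h2
      rw [map_zero, ← AlgHom.comp_apply] at h3
      rw [← h3]
      conv_lhs => rw [← AlgHom.id_apply (R := L) p]
      congr 1
      apply MvPolynomial.algHom_ext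
      simp
    have h4 := hz (L' ⊗[L] S) Algebra.TensorProduct.includeRight (fun j => algebraMap L' _ (a j))
    have h5 : Polynomial.aeval (- ∑ j, (1 : L') ⊗ₜ[L] ε j * algebraMap L' (L' ⊗[L] S) (a j)) P = 0 := by
      rw [← h4]
      simp only [P]
      rw [← AlgHom.restrictScalars_apply L, ← AlgHom.comp_apply]
      congr 1
      apply MvPolynomial.algHom_ext
      rintro (_ | j) <;> simp
    have h6 : IsAlgebraic L' (- ∑ j, (1 : L') ⊗ₜ[L] ε j * algebraMap L' (L' ⊗[L] S) (a j)) := ⟨P, hP, h5⟩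
    have h7 := h6.isIntegral.neg
    rwa [neg_neg] at h7
  have h1 := main (fun _ => 0)
  have h2 := main (fun o => if o = some j then 1 else 0)
  apply alg_descend (L' := L')
  have h3 := h2.sub h1
  rw [← Finset.sum_sub_distrib] at h3
  simp only [← mul_sub, ← map_sub] at h3
  rw [Finset.sum_eq_single j] at h3
  · simpa using h3
  · intro b _ hb
    simp [hb]
  · simp

theorem fin_lemma {L S : Type u} [Field L] [CommRing S] [Algebra L S] {J : Type} [Fintype J]
    (ε : J → S) (p : MvPolynomial (Option J) L) (hp : p ≠ 0)
    (hz : ∀ (R : Type u) [CommRing R] [Algebra L R] (i : S →ₐ[L] R) (a : J → R),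
      aeval (fun o : Option J => o.elim (- ∑ j, i (ε j) * a j) a) p = 0) (j : J) :
    _root_.IsIntegral L (ε j) :=
  fin_lemma' (L' := FractionRing (MvPolynomial (Option J) L)) ε p hp hz j

/-- The algebra of the generic finite linear section. -/
structure GenAlg (k : Type u) {H : Type u} [Field k] [CommRing H] [Algebra k H] {J : Type} [Fintype J]
    (ε : J → H) (D : Type) (L : Type u) [Field L] [Algebra (MvPolynomial (D × Option J) k) L] where
  A : Type u
  [cr : CommRing A]
  [alg : Algebra L A]
  nontriv : Nontrivial A
  fin : Module.Finite L A
  γ : H →+* A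
  γ_k : ∀ c : k, γ (algebraMap k H c) = algebraMap L A (algebraMap (MvPolynomial (D × Option J) k) L (C c))
  rel : ∀ i, ∑ o, algebraMap L A (algebraMap (MvPolynomial (D × Option J) k) L (X (i, o))) * γ (eExt ε o) = 0
  univ : ∀ (R : Type u) [CommRing R] (lam : L →+* R) (g : H →+* R),
    (∀ c : k, g (algebraMap k H c) = lam (algebraMap (MvPolynomial (D × Option J) k) L (C c))) →
    (∀ i, ∑ o, lam (algebraMap (MvPolynomial (D × Option J) k) L (X (i, o))) * g (eExt ε o) = 0) →
    ∃ χ : A →+* R, χ.comp (algebraMap L A) = lam ∧ χ.comp γ = g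
  uniq : ∀ (R : Type u) [CommRing R] (χ χ' : A →+* R),
    χ.comp (algebraMap L A) = χ'.comp (algebraMap L A) → χ.comp γ = χ'.comp γ → χ = χ'
  flat : (eval₂Hom γ (fun p : D × J => algebraMap L A
    (algebraMap (MvPolynomial (D × Option J) k) L (X (p.1, some p.2))))).Flat

attribute [instance] GenAlg.cr GenAlg.alg GenAlg.nontriv GenAlg.fin

section construct
variable {k H : Type u} [Field k] [CommRing H] [Algebra k H] {J : Type} [Fintype J]
    (ε : J → H) (D : Type) (L : Type u) [Field L] [Algebra (MvPolynomial (D × Option J) k) L]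
    [IsFractionRing (MvPolynomial (D × Option J) k) L]

/-- underlying localization -/
abbrev genM : Submonoid (MvPolynomial (D × J) H) :=
  (nonZeroDivisors (MvPolynomial (D × Option J) k)).map (wmap (k := k) D ε)

theorem wmap_factor {R : Type*} [CommRing R] (lam : L →+* R) (g : H →+* R)
    (hk : ∀ c : k, g (algebraMap k H c) = lam (algebraMap (MvPolynomial (D × Option J) k) L (C c)))
    (hrel : ∀ i, ∑ o, lam (algebraMap (MvPolynomial (D × Option J) k) L (X (i, o))) * g (eExt ε o) = 0) :
    (eval₂Hom g (fun p : D × J => lam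
    (algebraMap (MvPolynomial (D × Option J) k) L (X (p.1, some p.2))))).comp (wmap (k := k) D ε).toRingHom
     = lam.comp (algebraMap _ L) := by
  apply MvPolynomial.ringHom_ext
  · intro c
    simp [wmap, hk]
  · rintro ⟨i, _ | j⟩
    · have := hrel i
      rw [Fintype.sum_option] at this
      simp [eExt] at this
      simp [wmap, wvec]
      rw [add_eq_zero_iff_eq_neg] at this
      rw [this]
      congr 1
      apply Finset.sum_congr rfl
      intros; rw [mul_comm]
    · simp [wmap, wvec]



def genLam (A : Type u) [CommRing A] [Algebra (MvPolynomial (D × J) H) A] [IsLocalization (genM (k := k) ε D) A] : L →+* A :=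
  IsLocalization.lift (M := nonZeroDivisors (MvPolynomial (D × Option J) k))
    (g := (algebraMap (MvPolynomial (D × J) H) A).comp (wmap (k := k) D ε).toRingHom)
    (fun y => by
      have h := IsLocalization.map_units (M := genM (k := k) ε D) A
        ⟨wmap D ε y.1, Submonoid.mem_map_of_mem (wmap (k := k) D ε) y.2⟩
      exact h)

theorem genLam_alg (A : Type u) [CommRing A] [Algebra (MvPolynomial (D × J) H) A] [IsLocalization (genM (k := k) ε D) A] (p : MvPolynomial (D × Option J) k) : genLam (k := k) ε D L A (algebraMap _ L p) =
    algebraMap _ _ (wmap (k := k) D ε p) := by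
  simp only [genLam, IsLocalization.lift_eq]
  rfl

theorem exists_genAlg_aux (A : Type u) [CommRing A] [Algebra (MvPolynomial (D × J) H) A] [IsLocalization (genM (k := k) ε D) A] (hinj : Function.Injective (wmap (k := k) D ε)) 
    (hninj : ¬ Function.Injective (wmap (k := k) (Option D) ε)) (hgen : Algebra.adjoin k (Set.range ε) = ⊤) :
    Nonempty (GenAlg k ε D L) := by
  classical
  let γ : H →+* A := (algebraMap (MvPolynomial (D × J) H) A).comp C
  letI : Algebra L A := (genLam (k := k) ε D L A).toAlgebra
  have halg : ∀ p : MvPolynomial (D × Option J) k, algebraMap L A (algebraMap _ L p) =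
    algebraMap _ _ (wmap (k := k) D ε p) := genLam_alg ε D L A
  have hγk : ∀ c : k, γ (algebraMap k H c) = algebraMap L A (algebraMap (MvPolynomial (D × Option J) k) L (C c)) := by
    intro c
    rw [halg]
    simp [γ, wmap]
  have hrel : ∀ i, ∑ o, algebraMap L A (algebraMap (MvPolynomial (D × Option J) k) L (X (i, o))) * γ (eExt ε o) = 0 := by
    intro i
    simp only [halg, γ, RingHom.comp_apply, ← map_mul, ← map_sum]
    rw [← map_zero (algebraMap (MvPolynomial (D × J) H) A), ← wvec_rel D ε i]
    simp [wmap]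
  have hnt : Nontrivial A := by
    haveI : Nontrivial H := by
      by_contra h
      haveI := not_nontrivial_iff_subsingleton.mp h
      exact hninj (fun p q _ => by
        exfalso
        have : (1 : MvPolynomial (D × Option J) k) = 0 := hinj (Subsingleton.elim _ _)
        exact one_ne_zero this)
    rw [← not_subsingleton_iff_nontrivial, IsLocalization.subsingleton_iff (S := A) (M := genM (k := k) ε D)]
    rintro ⟨p, hp, h0⟩
    have : p = 0 := hinj (by rw [map_zero]; exact h0)
    exact nonZeroDivisors.ne_zero hp this
  have hev : (eval₂Hom γ (fun p : D × J => algebraMap L A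
    (algebraMap (MvPolynomial (D × Option J) k) L (X (p.1, some p.2))))) = algebraMap (MvPolynomial (D × J) H) A := by
    apply MvPolynomial.ringHom_ext
    · intro c; simp [γ]
    · intro p; simp [halg, wmap, wvec]
  have h_integral : ∀ j, _root_.IsIntegral L (γ (ε j)) := by
    rw [injective_iff_map_eq_zero] at hninj
    push Not at hninj
    obtain ⟨q0, hq0, hq0'⟩ := hninj
    let T : MvPolynomial (Option D × Option J) k →+* MvPolynomial (Option J) L :=
      eval₂Hom ((C.comp (algebraMap (MvPolynomial (D × Option J) k) L)).comp C)
        (fun p => p.1.elim (X p.2) (fun i => C (algebraMap (MvPolynomial (D × Option J) k) L (X (i, p.2)))))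
    have hT : Function.Injective T := by
      let e : Option D × Option J ≃ Option J ⊕ (D × Option J) :=
        { toFun := fun p => p.1.elim (Sum.inl p.2) (fun i => Sum.inr (i, p.2))
          invFun := fun s => s.elim (fun o => (none, o)) (fun p => (some p.1, p.2))
          left_inv := by rintro ⟨_ | i, o⟩ <;> rfl
          right_inv := by rintro (o | ⟨i, o⟩) <;> rfl }
      have : T = ((MvPolynomial.map (algebraMap (MvPolynomial (D × Option J) k) L)).comp
          (sumAlgEquiv k (Option J) (D × Option J)).toRingHom).comp (rename (R := k) e).toRingHom := by
        apply MvPolynomial.ringHom_ext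
        · intro c; simp [T]
        · rintro ⟨_ | i, o⟩ <;> simp [T, e]
      rw [this]
      simp only [RingHom.coe_comp]
      exact ((map_injective _ (IsFractionRing.injective _ _)).comp (AlgEquiv.injective _)).comp
        (rename_injective _ e.injective)
    apply fin_lemma (fun j => γ (ε j)) (T q0) (by rw [Ne, ← map_zero T, hT.eq_iff]; exact hq0')
    intro R _ _ i a
    let W : MvPolynomial (Option D × J) H →+* R := eval₂Hom ((i : A →+* R).comp γ)
      (fun p => p.1.elim (a p.2) (fun i' => algebraMap L R (algebraMap (MvPolynomial (D × Option J) k) L (X (i', some p.2)))))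
    have : ((aeval (fun o : Option J => o.elim (- ∑ j, i (γ (ε j)) * a j) a) :
        MvPolynomial (Option J) L →ₐ[L] R) : MvPolynomial (Option J) L →+* R).comp T = W.comp (wmap (k := k) (Option D) ε).toRingHom := by
      apply MvPolynomial.ringHom_ext
      · intro c
        simp [T, W, wmap]
        rw [← i.commutes, ← hγk]
      · rintro ⟨_ | i', _ | j⟩
        · simp [T, W, wmap, wvec]
        · simp [T, W, wmap, wvec]
        · simp [T, W, wmap, wvec]
          have := congrArg i (hrel i')
          rw [Fintype.sum_option] at this
          simp [eExt] at this
          rw [add_eq_zero_iff_eq_neg] at this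
          rw [this]
          congr 1
          apply Finset.sum_congr rfl
          intros; rw [mul_comm]
        · simp [T, W, wmap, wvec]
    have h2 := congrArg (fun φ => φ q0) this
    simp only [RingHom.comp_apply] at h2
    refine h2.trans ?_
    have : (wmap (k := k) (Option D) ε).toRingHom q0 = 0 := hq0
    rw [this, map_zero]
  have hfin : Module.Finite L A := by
    let S : Subalgebra L A := Algebra.adjoin L (Set.range (fun j => γ (ε j)))
    have hS : S = ⊤ := by
      have hγS : ∀ h, γ h ∈ S := by
        intro h
        have hh : h ∈ Algebra.adjoin k (Set.range ε) := by rw [hgen]; trivial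
        induction hh using Algebra.adjoin_induction with
        | mem x hx => obtain ⟨j, rfl⟩ := hx; exact Algebra.subset_adjoin ⟨j, rfl⟩
        | algebraMap r => rw [hγk]; exact S.algebraMap_mem _
        | add x y _ _ hx hy => rw [map_add]; exact S.add_mem hx hy
        | mul x y _ _ hx hy => rw [map_mul]; exact S.mul_mem hx hy
      have hO : ∀ p, algebraMap (MvPolynomial (D × J) H) A p ∈ S := by
        intro p
        induction p using MvPolynomial.induction_on with
        | C a => exact hγS a
        | add p q hp hq => rw [map_add]; exact S.add_mem hp hq
        | mul_X p n hp =>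
          rw [map_mul]
          refine S.mul_mem hp ?_
          have := halg (X (n.1, some n.2))
          simp [wmap, wvec] at this
          rw [← this]
          exact S.algebraMap_mem _
      rw [eq_top_iff]
      rintro z -
      obtain ⟨x, ⟨_, m, hm, rfl⟩, rfl⟩ := IsLocalization.exists_mk'_eq (genM (k := k) ε D) z
      have hm0 : algebraMap (MvPolynomial (D × Option J) k) L m ≠ 0 := by
        rw [Ne, IsFractionRing.to_map_eq_zero_iff]; exact nonZeroDivisors.ne_zero hm
      rw [show IsLocalization.mk' A x (⟨_, m, hm, rfl⟩ : genM (k := k) ε D) =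
        algebraMap _ A x * algebraMap L A (algebraMap (MvPolynomial (D × Option J) k) L m)⁻¹ from ?_]
      · exact S.mul_mem (hO _) (S.algebraMap_mem _)
      · rw [IsLocalization.mk'_eq_iff_eq_mul]
        change _ = _ * algebraMap (MvPolynomial (D × J) H) A (wmap (k := k) D ε m)
        rw [mul_assoc, ← halg, ← map_mul, inv_mul_cancel₀ hm0, map_one, mul_one]
    have h1 : (Algebra.adjoin L (Set.range (fun j => γ (ε j)))).toSubmodule.FG :=
      fg_adjoin_of_finite (Set.finite_range _) (by rintro _ ⟨j, rfl⟩; exact h_integral j)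
    change S.toSubmodule.FG at h1
    rw [hS] at h1
    exact ⟨h1⟩
  refine ⟨{ A := A, nontriv := hnt, fin := hfin, γ := γ, γ_k := hγk, rel := hrel, univ := ?_, uniq := ?_, flat := ?_ }⟩
  · intro R _ lam g hk hr
    let Φ : MvPolynomial (D × J) H →+* R := eval₂Hom g (fun p : D × J => lam
      (algebraMap (MvPolynomial (D × Option J) k) L (X (p.1, some p.2))))
    have hΦ := wmap_factor ε D L lam g hk hr
    have hu : ∀ y : genM (k := k) ε D, IsUnit (Φ y) := by
      rintro ⟨_, m, hm, rfl⟩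
      have := congrArg (fun φ => φ m) hΦ
      simp only [RingHom.comp_apply] at this
      change IsUnit (Φ ((wmap (k := k) D ε).toRingHom m))
      rw [this]
      exact (IsLocalization.map_units L ⟨m, hm⟩).map lam
    refine ⟨IsLocalization.lift hu, ?_, ?_⟩
    · apply IsLocalization.ringHom_ext (nonZeroDivisors (MvPolynomial (D × Option J) k))
      apply MvPolynomial.ringHom_ext
      · intro c
        simp only [RingHom.comp_apply, halg, IsLocalization.lift_eq]
        exact congrArg (fun φ => φ (C c)) hΦ
      · intro m
        simp only [RingHom.comp_apply, halg, IsLocalization.lift_eq]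
        exact congrArg (fun φ => φ (X m)) hΦ
    · ext h
      simp [γ, Φ]
  · intro R _ χ χ' h1 h2
    apply IsLocalization.ringHom_ext (genM (k := k) ε D)
    apply MvPolynomial.ringHom_ext
    · intro c; exact congrArg (fun φ => φ c) h2
    · intro p
      have := congrArg (fun φ => φ (algebraMap (MvPolynomial (D × Option J) k) L (X (p.1, some p.2)))) h1
      simp only [RingHom.comp_apply, halg] at this
      simpa [wmap, wvec] using this
  · rw [hev]
    exact RingHom.flat_algebraMap_iff.mpr (IsLocalization.flat A (genM (k := k) ε D))

end construct

theorem exists_genAlg {k H : Type u} [Field k] [CommRing H] [Algebra k H] [Nontrivial H] {J : Type} [Fintype J]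
    (ε : J → H) (hgen : Algebra.adjoin k (Set.range ε) = ⊤) :
    ∃ d : ℕ, ∀ (L : Type u) [Field L] [Algebra (MvPolynomial (Fin d × Option J) k) L]
    [IsFractionRing (MvPolynomial (Fin d × Option J) k) L], Nonempty (GenAlg k ε (Fin d) L) := by
  obtain ⟨d, h1, h2⟩ := exists_generic (k := k) ε
  exact ⟨d, fun L _ _ _ => exists_genAlg_aux ε (Fin d) L (Localization (genM (k := k) ε (Fin d))) h1 h2 hgen⟩

end PartGenB

section PartNorm
open Polynomial

variable {n : Type*} [Fintype n] [DecidableEq n] {S R : Type*} [CommRing S] [CommRing R] [Algebra S R]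
  (b : Module.Basis n S R)

/-- polynomial multiplication matrix -/
def Mb : R[X] →+* Matrix n n S[X] :=
  (matPolyEquiv (R := S) (n := n)).symm.toRingEquiv.toRingHom.comp
    (Polynomial.mapRingHom (Algebra.leftMulMatrix b).toRingHom)

theorem Mb_coeff (p : R[X]) (i j : n) (m : ℕ) :
    (Mb b p i j).coeff m = b.repr (p.coeff m * b j) i := by
  rw [← Algebra.leftMulMatrix_eq_repr_mul]
  have h := matPolyEquiv_coeff_apply (R := S) ((matPolyEquiv (R := S) (n := n)).symm (p.map (Algebra.leftMulMatrix b).toRingHom)) m i j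
  rw [AlgEquiv.apply_symm_apply] at h
  change ((matPolyEquiv (R := S) (n := n)).symm (p.map (Algebra.leftMulMatrix b).toRingHom) i j).coeff m = _
  rw [← h, Polynomial.coeff_map]
  rfl

/-- norm of a polynomial -/
def nmb (p : R[X]) : S[X] := (Mb b p).det

theorem nmb_mul (p q : R[X]) : nmb b (p * q) = nmb b p * nmb b q := by
  simp [nmb]

theorem nmb_one : nmb b (1 : R[X]) = 1 := by simp [nmb]

theorem nmb_unit_C (r : R) (hr : IsUnit r) : ∃ u : S, IsUnit u ∧ nmb b (C r) = C u := by
  have h : Mb b (C r) = (Algebra.leftMulMatrix b r).map C := by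
    ext i j m
    rw [Mb_coeff, Matrix.map_apply]
    rw [Polynomial.coeff_C, Polynomial.coeff_C]
    split_ifs
    · rw [Algebra.leftMulMatrix_eq_repr_mul]
    · simp
  refine ⟨(Algebra.leftMulMatrix b r).det, ?_, ?_⟩
  · rw [← Matrix.isUnit_iff_isUnit_det]
    exact hr.map _
  · rw [nmb, h]
    exact (RingHom.map_det (C : S →+* S[X]) _).symm

theorem Mb_sum (p : R[X]) (j : n) :
    ∑ i, (Mb b p i j).map (algebraMap S R) * C (b i) = p * C (b j) := by
  ext m
  simp only [Polynomial.finsetSum_coeff, Polynomial.coeff_mul_C, Polynomial.coeff_map, Mb_coeff]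
  simp only [← Algebra.smul_def]
  exact b.sum_repr (p.coeff m * b j)

theorem dvd_nmb (p : R[X]) : p ∣ (nmb b p).map (algebraMap S R) := by
  let M : Matrix n n R[X] := (Mb b p).map (Polynomial.mapRingHom (algebraMap S R))
  have hM : (nmb b p).map (algebraMap S R) = M.det :=
    RingHom.map_det (Polynomial.mapRingHom (algebraMap S R)) _
  have hv : Matrix.vecMul (fun i => C (b i)) (M - p • (1 : Matrix n n R[X])) = 0 := by
    funext j
    have := Mb_sum b p j
    simp only [Matrix.vecMul, dotProduct, Matrix.sub_apply, Matrix.smul_apply, mul_sub, Finset.sum_sub_distrib, Pi.zero_apply]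
    rw [sub_eq_zero]
    simp only [M, Matrix.map_apply, coe_mapRingHom]
    simp only [mul_comm (C (b _))]
    rw [this]
    simp [Matrix.one_apply]
  have hd : ∀ i, (M - p • (1 : Matrix n n R[X])).det * C (b i) = 0 := by
    intro i
    have := congrArg (fun v => Matrix.vecMul v (M - p • (1 : Matrix n n R[X])).adjugate i) hv
    simp only [Matrix.vecMul_vecMul, Matrix.mul_adjugate] at this
    simpa [Matrix.vecMul_smul] using this
  have hd0 : (M - p • (1 : Matrix n n R[X])).det = 0 := by
    have h1 : (1 : R[X]) = ∑ i, C (b.repr 1 i • b i) := by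
      rw [← map_sum, b.sum_repr, map_one]
    rw [← mul_one (M - p • (1 : Matrix n n R[X])).det, h1, Finset.mul_sum]
    refine Finset.sum_eq_zero fun i _ => ?_
    rw [Algebra.smul_def (b.repr 1 i) (b i), C_mul, mul_left_comm, hd, mul_zero]
  rw [hM, ← Ideal.mem_span_singleton, ← Ideal.Quotient.eq_zero_iff_mem]
  rw [← map_zero (Ideal.Quotient.mk (Ideal.span {p})), ← hd0, RingHom.map_det, RingHom.map_det]
  congr 1
  ext i j
  have hp : Ideal.Quotient.mk (Ideal.span {p}) p = 0 :=
    Ideal.Quotient.eq_zero_iff_mem.mpr (Ideal.mem_span_singleton_self p)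
  simp [hp]

theorem nmb_basechange {S' R' : Type*} [CommRing S'] [CommRing R'] [Algebra S' R'] (b' : Module.Basis n S' R')
    (τ : S →+* S') (ρ : R →+* R') (h1 : ρ.comp (algebraMap S R) = (algebraMap S' R').comp τ)
    (h2 : ∀ i, ρ (b i) = b' i) (p : R[X]) : nmb b' (p.map ρ) = (nmb b p).map τ := by
  rw [nmb, nmb]
  refine Eq.trans ?_ (RingHom.map_det (Polynomial.mapRingHom τ) _).symm
  congr 1
  ext i j m
  simp only [RingHom.mapMatrix_apply, Matrix.map_apply, coe_mapRingHom, coeff_map, Mb_coeff]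
  have : ρ (p.coeff m * b j) = ∑ i, τ (b.repr (p.coeff m * b j) i) • b' i := by
    conv_lhs => rw [← b.sum_repr (p.coeff m * b j)]
    rw [map_sum]
    refine Finset.sum_congr rfl fun i _ => ?_
    rw [Algebra.smul_def, map_mul, h2, Algebra.smul_def]
    congr 1
    exact RingHom.congr_fun h1 _
  rw [← h2, ← map_mul, this, b'.repr_sum_self]

theorem nmb_basis {n' : Type*} [Fintype n'] [DecidableEq n'] {R' : Type*} [CommRing R'] [Algebra S R']
    (b' : Module.Basis n' S R') (e : R ≃ₐ[S] R') (p : R[X]) : nmb b' (p.map (e : R →+* R')) = nmb b p := by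
  let b1 : Module.Basis n S R' := b.map e.toLinearEquiv
  have h1 : nmb b1 (p.map (e : R →+* R')) = nmb b p := by
    have := nmb_basechange b b1 (RingHom.id S) (e : R →+* R') (by ext; simp) (by intro i; simp [b1]) p
    simpa using this
  rw [← h1]
  set q := p.map (e : R →+* R')
  let P : Matrix n' n S[X] := (b'.toMatrix b1).map C
  let Q : Matrix n n' S[X] := (b1.toMatrix b').map C
  have hPQ : P * Q = 1 := by
    simp only [P, Q]
    rw [← Matrix.map_mul, Module.Basis.toMatrix_mul_toMatrix_flip]
    simp
  have hQP : Q * P = 1 := by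
    simp only [P, Q]
    rw [← Matrix.map_mul, Module.Basis.toMatrix_mul_toMatrix_flip]
    simp
  have key : Mb b' q = P * Mb b1 q * Q := by
    ext i j m
    rw [Mb_coeff]
    have hm : (P * Mb b1 q * Q).map (fun f => f.coeff m) = b'.toMatrix b1 * (Algebra.leftMulMatrix b1 (q.coeff m)) * b1.toMatrix b' := by
      ext i j
      simp only [P, Q, Matrix.map_apply, Matrix.mul_apply, Polynomial.finsetSum_coeff, coeff_mul_C, coeff_C_mul, Mb_coeff, Algebra.leftMulMatrix_eq_repr_mul]
    have := congrFun (congrFun hm i) j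
    rw [Matrix.map_apply] at this
    rw [this]
    rw [Algebra.leftMulMatrix_apply, basis_toMatrix_mul_linearMap_toMatrix_mul_basis_toMatrix, LinearMap.toMatrix_apply]
    rfl
  rw [nmb, nmb, key]
  exact Matrix.det_conj_of_mul_eq_one hPQ hQP

theorem nmb_ne_zero {κ R : Type*} [Field κ] [CommRing R] [Algebra κ R] (b : Module.Basis n κ R)
    (p : R[X]) (hp : Ideal.span (Set.range p.coeff) = ⊤) [Nontrivial R] : nmb b p ≠ 0 := by
  intro h0
  obtain ⟨v, hv, hMv⟩ := Matrix.exists_mulVec_eq_zero_iff.mpr h0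
  let r : R[X] := ∑ j, (v j).map (algebraMap κ R) * C (b j)
  have hr : r ≠ 0 := by
    intro hr0
    apply hv
    funext j
    ext m
    have := congrArg (fun q => b.repr (q.coeff m) j) hr0
    simp only [r, Polynomial.finsetSum_coeff, coeff_mul_C, coeff_map, ← Algebra.smul_def] at this
    rw [b.repr_sum_self] at this
    simpa using this
  have hpr : p * r = 0 := by
    simp only [r, Finset.mul_sum]
    have : ∀ j, p * ((v j).map (algebraMap κ R) * C (b j)) =
        ∑ i, (Mb b p i j * v j).map (algebraMap κ R) * C (b i) := by
      intro j
      rw [mul_left_comm, ← Mb_sum b p j, Finset.mul_sum]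
      refine Finset.sum_congr rfl fun i _ => ?_
      rw [Polynomial.map_mul]; ring
    simp only [this]
    rw [Finset.sum_comm]
    refine Finset.sum_eq_zero fun i _ => ?_
    rw [← Finset.sum_mul, ← Polynomial.map_sum]
    have := congrFun hMv i
    simp only [Matrix.mulVec, dotProduct, Pi.zero_apply] at this
    rw [this]; simp
  have hnz : p ∉ nonZeroDivisors R[X] := by
    intro h
    exact hr ((mul_left_mem_nonZeroDivisors_eq_zero_iff h).mp hpr)
  rw [Polynomial.notMem_nonZeroDivisors_iff] at hnz
  obtain ⟨a, ha, ha0⟩ := hnz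
  apply ha
  have : ∀ x ∈ Ideal.span (Set.range p.coeff), a * x = 0 := by
    intro x hx
    induction hx using Submodule.span_induction with
    | mem x h => obtain ⟨m, rfl⟩ := h; simpa using congrArg (fun q => q.coeff m) ha0
    | zero => simp
    | add x y _ _ hx hy => rw [mul_add, hx, hy, add_zero]
    | smul c x _ hx => rw [smul_eq_mul, mul_left_comm, hx, mul_zero]
  simpa using this 1 (by rw [hp]; trivial)

end PartNorm

section PartTA
open MvPolynomial TensorProduct

variable {k H : Type u} [Field k] [CommRing H] [Algebra k H] {J : Type} [Fintype J]
    {ε : J → H} {D : Type} {L : Type u} [Field L] [Algebra (MvPolynomial (D × Option J) k) L]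
    (GA : GenAlg k ε D L) {S : Type u} [CommRing S]

/-- Coordinates in a ring `S` over `L`. -/
def wL (GA : GenAlg k ε D L) (lam : L →+* S) (p : D × Option J) : S := lam (algebraMap (MvPolynomial (D × Option J) k) L (X p))

/-- constants -/
def kL (GA : GenAlg k ε D L) (lam : L →+* S) : k →+* S := lam.comp ((algebraMap (MvPolynomial (D × Option J) k) L).comp C)

/-- `S` with its `L`-algebra structure via `lam`. -/
def RL (lam : L →+* S) : Type u := S

instance (lam : L →+* S) : CommRing (RL lam) := inferInstanceAs (CommRing S)
instance (lam : L →+* S) : Algebra L (RL lam) := lam.toAlgebra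
instance (lam : L →+* S) : Algebra S (RL lam) := inferInstanceAs (Algebra S S)

def TA (lam : L →+* S) : Type u := RL lam ⊗[L] GA.A

instance (lam : L →+* S) : CommRing (TA GA lam) := inferInstanceAs (CommRing (RL lam ⊗[L] GA.A))
instance (lam : L →+* S) : Algebra S (TA GA lam) := inferInstanceAs (Algebra (RL lam) (RL lam ⊗[L] GA.A))

def TAi (lam : L →+* S) : GA.A →+* TA GA lam :=
  (Algebra.TensorProduct.includeRight : GA.A →ₐ[L] RL lam ⊗[L] GA.A).toRingHom

def TAg (lam : L →+* S) : H →+* TA GA lam := (TAi GA lam).comp GA.γ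

def TAb (lam : L →+* S) : Module.Basis (Fin (Module.finrank L GA.A)) S (TA GA lam) :=
  Algebra.TensorProduct.basis (RL lam) (Module.finBasis L GA.A)

theorem TAb_apply (lam : L →+* S) (i) : TAb GA lam i = TAi GA lam (Module.finBasis L GA.A i) := by
  exact Algebra.TensorProduct.basis_apply _ _

theorem TAi_alg (lam : L →+* S) : (TAi GA lam).comp (algebraMap L GA.A) = (algebraMap S (TA GA lam)).comp lam := by
  ext x
  exact (Algebra.TensorProduct.includeRight : GA.A →ₐ[L] RL lam ⊗[L] GA.A).commutes x

theorem TAi_alg' (lam : L →+* S) (x : L) : TAi GA lam (algebraMap L GA.A x) = algebraMap S (TA GA lam) (lam x) :=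
  RingHom.congr_fun (TAi_alg GA lam) x

theorem TA_lift {R : Type u} [CommRing R] (lam : L →+* S) (σ : S →+* R) (χ : GA.A →+* R)
    (h : χ.comp (algebraMap L GA.A) = σ.comp lam) :
    ∃ Χ : TA GA lam →+* R, Χ.comp (algebraMap S (TA GA lam)) = σ ∧ Χ.comp (TAi GA lam) = χ := by
  letI : Algebra L R := (σ.comp lam).toAlgebra
  let σ' : RL lam →ₐ[L] R := { σ with commutes' := fun x => rfl }
  let χ' : GA.A →ₐ[L] R := { χ with commutes' := fun x => RingHom.congr_fun h x }
  refine ⟨(Algebra.TensorProduct.lift σ' χ' (fun _ _ => Commute.all _ _)).toRingHom, ?_, ?_⟩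
  · ext x
    exact (Algebra.TensorProduct.lift_tmul σ' χ' (fun _ _ => Commute.all _ _) x 1).trans (by rw [map_one, mul_one]; rfl)
  · ext x
    exact (Algebra.TensorProduct.lift_tmul σ' χ' (fun _ _ => Commute.all _ _) 1 x).trans (by simp [χ'])

theorem TA_ext {R : Type u} [CommRing R] (lam : L →+* S) (Χ Χ' : TA GA lam →+* R)
    (h1 : Χ.comp (algebraMap S (TA GA lam)) = Χ'.comp (algebraMap S (TA GA lam)))
    (h2 : Χ.comp (TAg GA lam) = Χ'.comp (TAg GA lam)) : Χ = Χ' := by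
  have h3 : Χ.comp (TAi GA lam) = Χ'.comp (TAi GA lam) := by
    apply GA.uniq
    · rw [RingHom.comp_assoc, RingHom.comp_assoc, TAi_alg, ← RingHom.comp_assoc, h1, RingHom.comp_assoc]
    · exact h2
  ext z
  change RL lam ⊗[L] GA.A at z
  induction z using TensorProduct.induction_on with
  | zero => exact (map_zero Χ).trans (map_zero Χ').symm
  | add x y hx hy => exact (map_add Χ x y).trans ((congrArg₂ (· + ·) hx hy).trans (map_add Χ' x y).symm)
  | tmul s a =>
    have e : (s ⊗ₜ[L] a : RL lam ⊗[L] GA.A) = (algebraMap S (TA GA lam) s * TAi GA lam a : TA GA lam) := by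
      change _ = ((s : RL lam) ⊗ₜ[L] (1 : GA.A) * (1 : RL lam) ⊗ₜ[L] a : RL lam ⊗[L] GA.A)
      simp
    rw [e]
    exact (map_mul Χ _ _).trans ((congrArg₂ (· * ·) (RingHom.congr_fun h1 s) (RingHom.congr_fun h3 a)).trans (map_mul Χ' _ _).symm)

theorem TAg_k (lam : L →+* S) : (TAg GA lam).comp (algebraMap k H) = (algebraMap S (TA GA lam)).comp (kL GA lam) := by
  ext c
  simp only [TAg, kL, RingHom.comp_apply, GA.γ_k, TAi_alg']

theorem TA_rel (lam : L →+* S) (i : D) :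
    ∑ o, algebraMap S (TA GA lam) (wL GA lam (i, o)) * TAg GA lam (eExt ε o) = 0 := by
  have := congrArg (TAi GA lam) (GA.rel i)
  rw [map_zero, map_sum] at this
  rw [← this]
  refine Finset.sum_congr rfl fun o _ => ?_
  rw [map_mul, TAi_alg']
  rfl

theorem TA_univ {R : Type u} [CommRing R] (lam : L →+* S) (σ : S →+* R) (g : H →+* R)
    (h1 : g.comp (algebraMap k H) = σ.comp (kL GA lam))
    (h2 : ∀ i, ∑ o, σ (wL GA lam (i, o)) * g (eExt ε o) = 0) :
    ∃ Χ : TA GA lam →+* R, Χ.comp (algebraMap S (TA GA lam)) = σ ∧ Χ.comp (TAg GA lam) = g := by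
  obtain ⟨χ, hχ1, hχ2⟩ := GA.univ R (σ.comp lam) g (fun c => RingHom.congr_fun h1 c) h2
  obtain ⟨Χ, h3, h4⟩ := TA_lift GA lam σ χ hχ1
  exact ⟨Χ, h3, by rw [TAg, ← RingHom.comp_assoc, h4, hχ2]⟩

theorem TA_map_exists {S' : Type u} [CommRing S'] (lam : L →+* S) (τ : S →+* S') :
    ∃ ρ : TA GA lam →+* TA GA (τ.comp lam), ρ.comp (algebraMap S _) = (algebraMap S' _).comp τ ∧
      ρ.comp (TAi GA lam) = TAi GA (τ.comp lam) :=
  TA_lift GA lam _ _ (by rw [TAi_alg, RingHom.comp_assoc])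

def TAmap {S' : Type u} [CommRing S'] (lam : L →+* S) (τ : S →+* S') : TA GA lam →+* TA GA (τ.comp lam) :=
  (TA_map_exists GA lam τ).choose

theorem TAmap_alg {S' : Type u} [CommRing S'] (lam : L →+* S) (τ : S →+* S') :
    (TAmap GA lam τ).comp (algebraMap S _) = (algebraMap S' _).comp τ := (TA_map_exists GA lam τ).choose_spec.1

theorem TAmap_i {S' : Type u} [CommRing S'] (lam : L →+* S) (τ : S →+* S') :
    (TAmap GA lam τ).comp (TAi GA lam) = TAi GA (τ.comp lam) := (TA_map_exists GA lam τ).choose_spec.2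

theorem TAmap_g {S' : Type u} [CommRing S'] (lam : L →+* S) (τ : S →+* S') :
    (TAmap GA lam τ).comp (TAg GA lam) = TAg GA (τ.comp lam) := by
  rw [TAg, ← RingHom.comp_assoc, TAmap_i]; rfl

/-- the norm -/
def nm (lam : L →+* S) (p : Polynomial (TA GA lam)) : Polynomial S := nmb (TAb GA lam) p

theorem nm_map {S' : Type u} [CommRing S'] (lam : L →+* S) (τ : S →+* S') (p : Polynomial (TA GA lam)) :
    nm GA (τ.comp lam) (p.map (TAmap GA lam τ)) = (nm GA lam p).map τ := by
  apply nmb_basechange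
  · exact TAmap_alg GA lam τ
  · intro i
    rw [TAb_apply, TAb_apply]
    exact RingHom.congr_fun (TAmap_i GA lam τ) _

theorem nm_iso (lam lam' : L →+* S) (e : TA GA lam ≃ₐ[S] TA GA lam') (p : Polynomial (TA GA lam)) :
    nm GA lam' (p.map (e : TA GA lam →+* TA GA lam')) = nm GA lam p := nmb_basis _ _ e p

instance TA_nontrivial (lam : L →+* S) [Nontrivial S] : Nontrivial (TA GA lam) := by
  have : Nonempty (Fin (Module.finrank L GA.A)) := by
    rw [← Fin.pos_iff_nonempty]
    exact Module.finrank_pos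
  exact (TAb GA lam).repr.toEquiv.nontrivial

instance TA_finite (lam : L →+* S) : Module.Finite S (TA GA lam) := Module.Finite.of_basis (TAb GA lam)

theorem semilocal_of_finite (S R : Type*) [CommRing S] [IsLocalRing S] [CommRing R] [Algebra S R] [Module.Finite S R] :
    Finite (MaximalSpectrum R) := by
  let I := (IsLocalRing.maximalIdeal S).map (algebraMap S R)
  letI : Module.Finite (S ⧸ IsLocalRing.maximalIdeal S) (R ⧸ I) := by
    haveI : Module.Finite S (R ⧸ I) := inferInstance
    exact Module.Finite.of_restrictScalars_finite S _ _
  letI : Field (S ⧸ IsLocalRing.maximalIdeal S) := Ideal.Quotient.field _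
  haveI : IsArtinianRing (R ⧸ I) := IsArtinianRing.of_finite (S ⧸ IsLocalRing.maximalIdeal S) (R ⧸ I)
  have hI : ∀ M : MaximalSpectrum R, I ≤ M.asIdeal := fun M => by
    haveI := M.isMaximal
    rw [Ideal.map_le_iff_le_comap]
    have : (M.asIdeal.comap (algebraMap S R)).IsMaximal :=
      Ideal.isMaximal_comap_of_isIntegral_of_isMaximal (R := S) M.asIdeal
    exact (IsLocalRing.eq_maximalIdeal this).ge
  let F : MaximalSpectrum R → MaximalSpectrum (R ⧸ I) := fun M =>
    ⟨M.asIdeal.map (Ideal.Quotient.mk I), by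
      haveI := M.isMaximal
      exact Ideal.IsMaximal.map_of_surjective_of_ker_le Ideal.Quotient.mk_surjective
        (by rw [Ideal.mk_ker]; exact hI M)⟩
  refine Finite.of_injective F fun M M' h => ?_
  have h1 := congrArg (fun N => (MaximalSpectrum.asIdeal N).comap (Ideal.Quotient.mk I)) h
  ext1
  simpa [F, Ideal.comap_map_of_surjective _ Ideal.Quotient.mk_surjective, ← RingHom.ker_eq_comap_bot, Ideal.mk_ker,
    sup_eq_left.mpr (hI _)] using h1

end PartTA

section PartPres

/-- stalk element in the function field -/
abbrev tK (X : Scheme.{u}) [IrreducibleSpace X] (p : X) : X.presheaf.stalk p →+* X.functionField :=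
  algebraMap (X.presheaf.stalk p) X.functionField

theorem tK_inj (X : Scheme.{u}) [IsIntegral X] (p : X) : Function.Injective (tK X p) :=
  IsFractionRing.injective _ _

abbrev gm (T : Scheme.{u}) (t : T) : Γ(T, ⊤) →+* T.presheaf.stalk t := (T.presheaf.germ ⊤ t trivial).hom

theorem gm_ext {T : Scheme.{u}} {a b : Γ(T, ⊤)} (h : ∀ t, gm T t a = gm T t b) : a = b :=
  TopCat.Presheaf.section_ext T.sheaf ⊤ a b (fun x _ => h x)

theorem gm_stalkMap {T' T : Scheme.{u}} (f : T' ⟶ T) (t : T') (a : Γ(T, ⊤)) :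
    (f.stalkMap t).hom (gm T (f t) a) = gm T' t (f.appTop a) :=
  f.germ_stalkMap_apply ⊤ t trivial a

/-- a family of functions on `T` represents the homogeneous coordinates `c` of the point `y` -/
def Pres {X T : Scheme.{u}} [IrreducibleSpace X] {ι : Type*} (c : ι → X.functionField) (y : T ⟶ X)
    (a : ι → Γ(T, ⊤)) : Prop :=
  ∀ t : T, ∃ (α : ι) (b : ι → X.presheaf.stalk (y t)), c α ≠ 0 ∧ (∀ β, tK X _ (b β) * c α = c β) ∧
    IsUnit (gm T t (a α)) ∧ ∀ β, gm T t (a β) = (y.stalkMap t).hom (b β) * gm T t (a α)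

variable {X T : Scheme.{u}} {ι : Type*}

theorem Pres.comp [IrreducibleSpace X] {T' : Scheme.{u}} {c : ι → X.functionField} {y : T ⟶ X} {a : ι → Γ(T, ⊤)}
    (h : Pres c y a) (f : T' ⟶ T) : Pres c (f ≫ y) (fun i => f.appTop (a i)) := by
  intro t
  obtain ⟨α, b, h1, h2, h3, h4⟩ := h (f t)
  refine ⟨α, b, h1, h2, ?_, fun β => ?_⟩
  · rw [← gm_stalkMap]
    exact h3.map _
  · rw [← gm_stalkMap, h4, map_mul, ← gm_stalkMap, Scheme.Hom.stalkMap_comp]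
    rfl

theorem Pres.cross [IsIntegral X] {c : ι → X.functionField} {y : T ⟶ X} {a a' : ι → Γ(T, ⊤)}
    (h : Pres c y a) (h' : Pres c y a') (β γ : ι) : a β * a' γ = a γ * a' β := by
  apply gm_ext
  intro t
  obtain ⟨α, b, h1, h2, h3, h4⟩ := h t
  obtain ⟨α', b', h1', h2', h3', h4'⟩ := h' t
  have e : b β * b' γ = b γ * b' β := by
    apply tK_inj X
    rw [map_mul, map_mul]
    apply mul_right_cancel₀ (mul_ne_zero h1 h1')
    calc _ = (tK X _ (b β) * c α) * (tK X _ (b' γ) * c α') := by ring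
      _ = (tK X _ (b γ) * c α) * (tK X _ (b' β) * c α') := by rw [h2, h2, h2', h2']; ring
      _ = _ := by ring
  have e' := congrArg (y.stalkMap t).hom e
  rw [map_mul, map_mul] at e'
  rw [map_mul, map_mul, h4 β, h4 γ, h4' β, h4' γ]
  linear_combination (gm T t (a α)) * (gm T t (a' α')) * e'

theorem Pres.zero [IsIntegral X] {c : ι → X.functionField} {y : T ⟶ X} {a : ι → Γ(T, ⊤)}
    (h : Pres c y a) {β : ι} (hβ : c β = 0) : a β = 0 := by
  apply gm_ext
  intro t
  obtain ⟨α, b, h1, h2, h3, h4⟩ := h t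
  have : b β = 0 := by
    apply tK_inj X
    have := h2 β
    rw [hβ] at this
    rw [map_zero]
    exact (mul_eq_zero.mp this).resolve_right h1
  rw [h4, this, map_zero, zero_mul, map_zero]

/-- ring version -/
def PresS [IrreducibleSpace X] {R : Type u} [CommRing R] (c : ι → X.functionField)
    (y : Spec (CommRingCat.of R) ⟶ X) (a : ι → R) : Prop :=
  Pres c y (fun i => (Scheme.ΓSpecIso (CommRingCat.of R)).inv (a i))

abbrev smap {R R' : Type u} [CommRing R] [CommRing R'] (τ : R →+* R') :
    Spec (CommRingCat.of R') ⟶ Spec (CommRingCat.of R) := Spec.map (CommRingCat.ofHom τ)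

theorem smap_comp {R R' R'' : Type u} [CommRing R] [CommRing R'] [CommRing R''] (τ : R →+* R') (τ' : R' →+* R'') :
    smap (τ'.comp τ) = smap τ' ≫ smap τ := by
  rw [smap, CommRingCat.ofHom_comp, Spec.map_comp]

theorem PresS.map [IrreducibleSpace X] {R R' : Type u} [CommRing R] [CommRing R'] {c : ι → X.functionField}
    {y : Spec (CommRingCat.of R) ⟶ X} {a : ι → R} (h : PresS c y a) (τ : R →+* R') :
    PresS c (smap τ ≫ y) (fun i => τ (a i)) := by
  have := Pres.comp h (smap τ)
  unfold PresS
  convert this using 2 with i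
  exact ConcreteCategory.congr_hom (Scheme.ΓSpecIso_inv_naturality (CommRingCat.ofHom τ)) (a i)

theorem ΓSpec_inj {R : Type u} [CommRing R] : Function.Injective (Scheme.ΓSpecIso (CommRingCat.of R)).inv := by
  apply (ConcreteCategory.bijective_of_isIso _).1

theorem PresS.cross [IsIntegral X] {R : Type u} [CommRing R] {c : ι → X.functionField}
    {y : Spec (CommRingCat.of R) ⟶ X} {a a' : ι → R}
    (h : PresS c y a) (h' : PresS c y a') (β γ : ι) : a β * a' γ = a γ * a' β := by
  apply ΓSpec_inj
  rw [map_mul, map_mul]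
  exact Pres.cross h h' β γ

theorem PresS.zero [IsIntegral X] {R : Type u} [CommRing R] {c : ι → X.functionField}
    {y : Spec (CommRingCat.of R) ⟶ X} {a : ι → R}
    (h : PresS c y a) {β : ι} (hβ : c β = 0) : a β = 0 := by
  apply ΓSpec_inj
  rw [map_zero]
  exact Pres.zero h hβ

theorem gm_spec_mem {R : Type u} [CommRing R] (t : Spec (CommRingCat.of R)) (r : R)
    (h : IsUnit (gm _ t ((Scheme.ΓSpecIso (CommRingCat.of R)).inv r))) : r ∉ t.asIdeal := by
  intro hr
  haveI : t.asIdeal.IsPrime := t.isPrime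
  have := @IsLocalization.AtPrime.isUnit_to_map_iff R _ ((Spec (CommRingCat.of R)).presheaf.stalk t) _
    (StructureSheaf.stalkAlgebra R t) t.asIdeal _ (StructureSheaf.IsLocalization.to_stalk R t) r
  exact (this.mp h) hr

theorem PresS.span [IrreducibleSpace X] {R : Type u} [CommRing R] {c : ι → X.functionField}
    {y : Spec (CommRingCat.of R) ⟶ X} {a : ι → R} (h : PresS c y a) : Ideal.span (Set.range a) = ⊤ := by
  by_contra hne
  obtain ⟨M, hM, hle⟩ := Ideal.exists_le_maximal _ hne
  obtain ⟨α, b, h1, h2, h3, h4⟩ := h ⟨M, hM.isPrime⟩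
  exact gm_spec_mem _ _ h3 (hle (Ideal.subset_span ⟨α, rfl⟩))

theorem unit_of_cross {R : Type*} [CommRing R] {a a' : ι → R} (h : ∀ β γ, a β * a' γ = a γ * a' β)
    (h1 : Ideal.span (Set.range a) = ⊤) (h2 : Ideal.span (Set.range a') = ⊤) :
    ∃ z, IsUnit z ∧ ∀ β, a' β = z * a β := by
  have key : ∀ {a a' : ι → R}, (∀ β γ, a β * a' γ = a γ * a' β) → Ideal.span (Set.range a) = ⊤ →
      ∃ z, ∀ β, a' β = z * a β := by
    intro a a' h h1
    have : (1 : R) ∈ Ideal.span (Set.range a) := by rw [h1]; trivial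
    obtain ⟨u, hu⟩ := Finsupp.mem_ideal_span_range_iff_exists_finsupp.mp this
    refine ⟨u.sum fun i x => x * a' i, fun β => ?_⟩
    calc a' β = (u.sum fun i x => x * a i) * a' β := by rw [hu, one_mul]
      _ = _ := by
        rw [Finsupp.sum, Finsupp.sum, Finset.sum_mul, Finset.sum_mul]
        refine Finset.sum_congr rfl fun i _ => ?_
        rw [mul_assoc, h, mul_assoc]; ring
  obtain ⟨z, hz⟩ := key h h1
  obtain ⟨z', hz'⟩ := key (fun β γ => by rw [mul_comm, h, mul_comm]) h2
  refine ⟨z, ?_, hz⟩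
  have : (1 : R) ∈ Ideal.span (Set.range a) := by rw [h1]; trivial
  obtain ⟨u, hu⟩ := Finsupp.mem_ideal_span_range_iff_exists_finsupp.mp this
  refine IsUnit.of_mul_eq_one z' ?_
  calc z * z' = z * z' * (u.sum fun i x => x * a i) := by rw [hu, mul_one]
    _ = u.sum fun i x => x * a i := by
      rw [Finsupp.sum, Finset.mul_sum]
      refine Finset.sum_congr rfl fun i _ => ?_
      conv_rhs => rw [hz' i, hz i]
      ring
    _ = 1 := hu

theorem PresS.unique [IsIntegral X] {R : Type u} [CommRing R] {c : ι → X.functionField}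
    {y : Spec (CommRingCat.of R) ⟶ X} {a a' : ι → R}
    (h : PresS c y a) (h' : PresS c y a') : ∃ z, IsUnit z ∧ ∀ β, a' β = z * a β :=
  unit_of_cross (h.cross h') h.span h'.span

theorem Pres.smul [IrreducibleSpace X] {c : ι → X.functionField} {y : T ⟶ X} {a : ι → Γ(T, ⊤)}
    (h : Pres c y a) {u : Γ(T, ⊤)} (hu : IsUnit u) : Pres c y (fun i => u * a i) := by
  intro t
  obtain ⟨α, b, h1, h2, h3, h4⟩ := h t
  refine ⟨α, b, h1, h2, ?_, fun β => ?_⟩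
  · rw [map_mul]; exact (hu.map _).mul h3
  · rw [map_mul, map_mul, h4]; ring

theorem PresS.smul [IrreducibleSpace X] {R : Type u} [CommRing R] {c : ι → X.functionField}
    {y : Spec (CommRingCat.of R) ⟶ X} {a : ι → R} (h : PresS c y a) {u : R} (hu : IsUnit u) :
    PresS c y (fun i => u * a i) := by
  have := Pres.smul h (hu.map (Scheme.ΓSpecIso (CommRingCat.of R)).inv.hom)
  unfold PresS
  convert this using 2 with i
  exact map_mul (Scheme.ΓSpecIso (CommRingCat.of R)).inv.hom _ _

/-- chart of the homogeneous coordinates `c` at a point -/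
def Chart [IrreducibleSpace X] (c : ι → X.functionField) (p : X) (α : ι) (b : ι → X.presheaf.stalk p) : Prop :=
  c α ≠ 0 ∧ ∀ β, tK X _ (b β) * c α = c β

theorem Chart.one [IsIntegral X] {c : ι → X.functionField} {p : X} {α : ι} {b : ι → X.presheaf.stalk p}
    (h : Chart c p α b) : b α = 1 := by
  apply tK_inj X
  apply mul_right_cancel₀ h.1
  rw [h.2, map_one, one_mul]

abbrev fstalk (X : Scheme.{u}) (p : X) : Spec (CommRingCat.of (X.presheaf.stalk p)) ⟶ X := X.fromSpecStalk p

theorem Chart.pres [IsIntegral X] {c : ι → X.functionField} {p : X} {α : ι} {b : ι → X.presheaf.stalk p}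
    (h : Chart c p α b) : PresS c (fstalk X p) b := by
  intro t
  have hsp : (fstalk X p) t ⤳ p := by
    have : (fstalk X p) t ∈ Set.range (X.fromSpecStalk p) := ⟨t, rfl⟩
    rw [Scheme.range_fromSpecStalk] at this
    exact this
  have key : ∀ β, ∃ b' : X.presheaf.stalk ((fstalk X p) t), tK X _ b' = tK X _ (b β) ∧
      ((fstalk X p).stalkMap t).hom b' = gm _ t ((Scheme.ΓSpecIso (CommRingCat.of (X.presheaf.stalk p))).inv (b β)) := by
    intro β
    obtain ⟨U, hpU, g, hg⟩ := TopCat.Presheaf.exists_germ_eq X.presheaf (b β)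
    have hq : (fstalk X p) t ∈ U := hsp.mem_open U.2 hpU
    haveI : Nonempty U := ⟨⟨p, hpU⟩⟩
    refine ⟨X.presheaf.germ U _ hq g, ?_, ?_⟩
    · rw [← hg]
      exact (Scheme.algebraMap_germ_eq_germToFunctionField X hq g).trans
        (Scheme.algebraMap_germ_eq_germToFunctionField X hpU g).symm
    · refine (Scheme.Hom.germ_stalkMap_apply (fstalk X p) U t hq g).trans ?_
      have e := ConcreteCategory.congr_hom (Scheme.fromSpecStalk_app (X := X) (U := U) hpU) g
      rw [← hg]
      refine (congrArg _ e).trans ?_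
      exact TopCat.Presheaf.germ_res_apply (Spec (X.presheaf.stalk p)).presheaf (homOfLE le_top) t hq _
  choose b' hb1 hb2 using key
  refine ⟨α, b', h.1, fun β => ?_, ?_, fun β => ?_⟩
  · rw [hb1]; exact h.2 β
  · change IsUnit (gm _ t ((Scheme.ΓSpecIso (CommRingCat.of (X.presheaf.stalk p))).inv (b α)))
    rw [h.one, map_one, map_one]; exact isUnit_one
  · change _ = _ * gm _ t ((Scheme.ΓSpecIso (CommRingCat.of (X.presheaf.stalk p))).inv (b α))
    rw [← hb2 β, h.one, map_one, map_one, mul_one]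

theorem PresS.local_elim [IrreducibleSpace X] {S : Type u} [CommRing S] [IsLocalRing S] {c : ι → X.functionField}
    {x : Spec (CommRingCat.of S) ⟶ X} {a : ι → S} (h : PresS c x a) :
    ∃ (p : X) (φ : X.presheaf.stalk p →+* S) (α : ι) (b : ι → X.presheaf.stalk p), IsLocalHom φ ∧
      x = smap φ ≫ fstalk X p ∧ Chart c p α b ∧ IsUnit (a α) ∧ ∀ β, a β = φ (b β) * a α := by
  obtain ⟨α, b, h1, h2, h3, h4⟩ := h (IsLocalRing.closedPoint S)
  have key : ∀ s : S, (stalkClosedPointIso (CommRingCat.of S)).hom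
      (gm _ (IsLocalRing.closedPoint S) ((Scheme.ΓSpecIso (CommRingCat.of S)).inv s)) = s := by
    intro s
    have := ConcreteCategory.congr_hom (germ_stalkClosedPointIso_hom (CommRingCat.of S)) ((Scheme.ΓSpecIso (CommRingCat.of S)).inv s)
    refine this.trans ?_
    exact ConcreteCategory.congr_hom (Scheme.ΓSpecIso (CommRingCat.of S)).inv_hom_id s
  refine ⟨x (IsLocalRing.closedPoint S), (Scheme.stalkClosedPointTo x).hom, α, b,
    inferInstance, (Scheme.Spec_stalkClosedPointTo_fromSpecStalk x).symm, ⟨h1, h2⟩, ?_, fun β => ?_⟩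
  · have := h3.map (stalkClosedPointIso (CommRingCat.of S)).hom.hom
    rw [← key (a α)]; exact this
  · have := congrArg (stalkClosedPointIso (CommRingCat.of S)).hom (h4 β)
    rw [key, map_mul, key] at this
    exact this

theorem local_point {S : Type u} [CommRing S] [IsLocalRing S] (x : Spec (CommRingCat.of S) ⟶ X) :
    ∃ (p : X) (φ : X.presheaf.stalk p →+* S), IsLocalHom φ ∧ x = smap φ ≫ fstalk X p :=
  ⟨x (IsLocalRing.closedPoint S), (Scheme.stalkClosedPointTo x).hom,
    inferInstance, (Scheme.Spec_stalkClosedPointTo_fromSpecStalk x).symm⟩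

end PartPres

section PartSemi

variable {X T : Scheme.{u}} {ι : Type*}

theorem glue_stalk (T : Scheme.{u}) (V : T.Opens) (A : ∀ t : T, T.presheaf.stalk t)
    (h : ∀ t ∈ V, ∃ (W : T.Opens) (_ : t ∈ W) (s : Γ(T, W)), ∀ t' (ht' : t' ∈ W), T.presheaf.germ W t' ht' s = A t') :
    ∃ a : Γ(T, V), ∀ t (ht : t ∈ V), T.presheaf.germ V t ht a = A t := by
  choose W hW s hs using h
  let U : V → T.Opens := fun t => W t.1 t.2 ⊓ V
  let sf : ∀ t : V, Γ(T, U t) := fun t => T.presheaf.map (homOfLE inf_le_left).op (s t.1 t.2)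
  have hsf : ∀ (t : V) t' (ht' : t' ∈ U t), T.presheaf.germ (U t) t' ht' (sf t) = A t' := by
    intro t t' ht'
    rw [← hs t.1 t.2 t' ht'.1]
    exact TopCat.Presheaf.germ_res_apply T.presheaf (homOfLE inf_le_left) t' ht' _
  obtain ⟨a, ha, -⟩ := TopCat.Sheaf.existsUnique_gluing' T.sheaf U V (fun t => homOfLE inf_le_right)
    (fun t ht => by
      rw [TopologicalSpace.Opens.mem_iSup]
      exact ⟨⟨t, ht⟩, hW t ht, ht⟩) sf (by
      intro i j
      apply TopCat.Presheaf.section_ext T.sheaf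
      intro t ht
      refine (TopCat.Presheaf.germ_res_apply T.presheaf (TopologicalSpace.Opens.infLELeft (U i) (U j)) t ht _).trans ?_
      refine Eq.trans ?_ (TopCat.Presheaf.germ_res_apply T.presheaf (TopologicalSpace.Opens.infLERight (U i) (U j)) t ht _).symm
      rw [hsf, hsf])
  refine ⟨a, fun t ht => ?_⟩
  rw [← hsf ⟨t, ht⟩ t ⟨hW t ht, ht⟩, ← ha ⟨t, ht⟩]
  exact (TopCat.Presheaf.germ_res_apply T.presheaf (homOfLE inf_le_right) t _ _).symm

theorem tK_sp [IrreducibleSpace X] {p q : X} (h : q ⤳ p) (b : X.presheaf.stalk p) :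
    tK X q (X.presheaf.stalkSpecializes h b) = tK X p b :=
  ConcreteCategory.congr_hom (TopCat.Presheaf.stalkSpecializes_comp X.presheaf
    ((genericPoint_spec X).specializes trivial) h) b

theorem Chart.sp [IrreducibleSpace X] {c : ι → X.functionField} {p q : X} {α : ι} {b : ι → X.presheaf.stalk p}
    (h : Chart c p α b) (hq : q ⤳ p) : Chart c q α (fun β => X.presheaf.stalkSpecializes hq (b β)) :=
  ⟨h.1, fun β => by rw [tK_sp]; exact h.2 β⟩

theorem Chart.chart [IsIntegral X] {c : ι → X.functionField} {p : X} {α α' : ι} {b b' : ι → X.presheaf.stalk p}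
    (h : Chart c p α b) (h' : Chart c p α' b') : ∃ z, IsUnit z ∧ ∀ β, b' β = z * b β := by
  have e : ∀ β, b' β = b' α * b β := by
    intro β
    apply tK_inj X
    apply mul_right_cancel₀ h'.1
    rw [h'.2, map_mul, mul_assoc, mul_comm (tK X p (b β)), ← mul_assoc, h'.2, mul_comm, h.2]
  refine ⟨b' α, IsUnit.of_mul_eq_one (b α') ?_, e⟩
  rw [← e, h'.one]

theorem Chart.germ [IsIntegral X] [Finite ι] {c : ι → X.functionField} {p : X} {α : ι} {b : ι → X.presheaf.stalk p}
    (h : Chart c p α b) : ∃ (U : X.Opens) (hp : p ∈ U) (g : ι → Γ(X, U)), (∀ β, X.presheaf.germ U p hp (g β) = b β) ∧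
      ∀ q (hq : q ∈ U), Chart c q α (fun β => X.presheaf.germ U q hq (g β)) := by
  have : ∀ β, ∃ (U : X.Opens) (hp : p ∈ U) (g : Γ(X, U)), X.presheaf.germ U p hp g = b β :=
    fun β => TopCat.Presheaf.exists_germ_eq X.presheaf (b β)
  choose U hU g hg using this
  have hp : p ∈ ⨅ β, U β := by
    rw [← SetLike.mem_coe, TopologicalSpace.Opens.coe_iInf]
    exact Set.mem_iInter.mpr hU
  refine ⟨⨅ β, U β, hp, fun β => X.presheaf.map (homOfLE (iInf_le U β)).op (g β), fun β => ?_, fun q hq => ⟨h.1, fun β => ?_⟩⟩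
  · rw [← hg]
    exact TopCat.Presheaf.germ_res_apply X.presheaf (homOfLE (iInf_le U β)) p hp (g β)
  · rw [← h.2 β, ← hg β]
    congr 1
    haveI : Nonempty (⨅ β, U β : X.Opens) := ⟨⟨p, hp⟩⟩
    haveI : Nonempty (U β) := ⟨⟨p, hU β⟩⟩
    have e := TopCat.Presheaf.germ_res_apply X.presheaf (homOfLE (iInf_le U β)) q hq (g β)
    dsimp only
    rw [e]
    exact (Scheme.algebraMap_germ_eq_germToFunctionField X _ (g β)).trans
        (Scheme.algebraMap_germ_eq_germToFunctionField X _ (g β)).symm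

theorem exists_presS_aux [IsIntegral X] [Fintype ι] [DecidableEq ι] {R : Type u} [CommRing R]
    [Finite (MaximalSpectrum R)] {c : ι → X.functionField}
    (hcov : ∀ p : X, ∃ α b, Chart c p α b) (y : Spec (CommRingCat.of R) ⟶ X) : ∃ a, PresS c y a := by
  choose αc bc hc using hcov
  let iR : R → Γ(Spec (CommRingCat.of R), ⊤) := (Scheme.ΓSpecIso (CommRingCat.of R)).inv
  let pt : MaximalSpectrum R → Spec (CommRingCat.of R) := fun M => ⟨M.asIdeal, M.isMaximal.isPrime⟩
  -- CRT
  have hcrt : ∀ j : ι, ∃ r : R, ∀ M : MaximalSpectrum R, r - (if j = αc (y (pt M)) then 1 else 0) ∈ M.asIdeal := by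
    intro j
    obtain ⟨r, hr⟩ := Ideal.pi_quotient_surjective (I := fun M : MaximalSpectrum R => M.asIdeal)
      (fun M N hMN => Ideal.isCoprime_iff_sup_eq.mpr
        (M.isMaximal.coprime_of_ne N.isMaximal (fun h => hMN (MaximalSpectrum.ext h))))
      (fun M => Ideal.Quotient.mk _ (if j = αc (y (pt M)) then 1 else 0))
    exact ⟨r, fun M => (Ideal.Quotient.eq).mp (hr M)⟩
  choose lam hlam using hcrt
  -- denominators
  let Dn : ∀ (t : Spec (CommRingCat.of R)) (b : ι → X.presheaf.stalk (y t)), (Spec (CommRingCat.of R)).presheaf.stalk t :=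
    fun t b => ∑ j, gm _ t (iR (lam j)) * (y.stalkMap t).hom (b j)
  have hD0 : ∀ M, IsUnit (Dn (pt M) (bc (y (pt M)))) := by
    intro M
    have hmem : ∀ r ∈ M.asIdeal, gm _ (pt M) (iR r) ∈ IsLocalRing.maximalIdeal ((Spec (CommRingCat.of R)).presheaf.stalk (pt M)) := by
      intro r hr hu
      exact gm_spec_mem (pt M) r hu hr
    have : Dn (pt M) (bc (y (pt M))) - 1 ∈ IsLocalRing.maximalIdeal ((Spec (CommRingCat.of R)).presheaf.stalk (pt M)) := by
      have e1 : (1 : (Spec (CommRingCat.of R)).presheaf.stalk (pt M)) =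
          ∑ j, gm _ (pt M) (iR (if j = αc (y (pt M)) then 1 else 0)) * (y.stalkMap (pt M)).hom (bc (y (pt M)) j) := by
        rw [Finset.sum_eq_single (αc (y (pt M)))]
        · rw [if_pos rfl, (hc _).one]
          simp only [iR, map_one, mul_one]
        · intro j _ hj
          rw [if_neg hj]
          simp only [iR, map_zero, zero_mul]
        · simp
      rw [e1, ← Finset.sum_sub_distrib]
      refine Ideal.sum_mem _ fun j _ => ?_
      rw [← sub_mul, ← map_sub]
      refine Ideal.mul_mem_right _ _ ?_
      have := hmem _ (hlam j M)
      simp only [iR, map_sub] at this ⊢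
      exact this
    by_contra hn
    have h1 : Dn (pt M) (bc (y (pt M))) ∈ IsLocalRing.maximalIdeal _ := hn
    have := Ideal.sub_mem _ h1 this
    rw [sub_sub_cancel] at this
    exact this isUnit_one
  have hD : ∀ t α b, Chart c (y t) α b → IsUnit (Dn t b) := by
    intro t α b hb
    obtain ⟨M, hM, hle⟩ := Ideal.exists_le_maximal t.asIdeal t.isPrime.ne_top
    let M' : MaximalSpectrum R := ⟨M, hM⟩
    have hsp : t ⤳ pt M' := (PrimeSpectrum.le_iff_specializes _ _).mp hle
    have hsp' : y t ⤳ y (pt M') := hsp.map y.continuous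
    have h1 := (hD0 M').map ((Spec (CommRingCat.of R)).presheaf.stalkSpecializes hsp).hom
    have e : ((Spec (CommRingCat.of R)).presheaf.stalkSpecializes hsp).hom (Dn (pt M') (bc (y (pt M')))) =
        Dn t (fun β => X.presheaf.stalkSpecializes hsp' (bc _ β)) := by
      simp only [Dn, map_sum, map_mul]
      refine Finset.sum_congr rfl fun j _ => ?_
      congr 1
      · exact TopCat.Presheaf.germ_stalkSpecializes_apply (Spec (CommRingCat.of R)).presheaf (U := ⊤) (hy := trivial) hsp _
      · exact (ConcreteCategory.congr_hom (y.stalkSpecializes_stalkMap t (pt M') hsp) (bc _ j)).symm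
    rw [e] at h1
    obtain ⟨z, hz, hz'⟩ := hb.chart ((hc (y (pt M'))).sp hsp')
    have e2 : Dn t (fun β => X.presheaf.stalkSpecializes hsp' (bc _ β)) = (y.stalkMap t).hom z * Dn t b := by
      simp only [Dn, Finset.mul_sum]
      refine Finset.sum_congr rfl fun j _ => ?_
      rw [hz', map_mul]; ring
    rw [e2] at h1
    exact isUnit_of_mul_isUnit_right h1
  let A : ι → ∀ t : Spec (CommRingCat.of R), (Spec (CommRingCat.of R)).presheaf.stalk t := fun β t =>
    (y.stalkMap t).hom (bc (y t) β) * ↑((hD t _ _ (hc (y t))).unit⁻¹)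
  have hA : ∀ β t α b, Chart c (y t) α b → A β t * Dn t b = (y.stalkMap t).hom (b β) := by
    intro β t α b hb
    obtain ⟨z, hz, hz'⟩ := (hc (y t)).chart hb
    have e2 : Dn t b = (y.stalkMap t).hom z * Dn t (bc (y t)) := by
      simp only [Dn, Finset.mul_sum]
      refine Finset.sum_congr rfl fun j _ => ?_
      rw [hz', map_mul]; ring
    rw [e2, hz', map_mul]
    have := (hD t _ _ (hc (y t))).val_inv_mul
    simp only [A]
    linear_combination (y.stalkMap t).hom (bc (y t) β) * (y.stalkMap t).hom z * this
  have hglue : ∀ β, ∃ a : Γ(Spec (CommRingCat.of R), ⊤), ∀ t, gm _ t a = A β t := by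
    intro β
    obtain ⟨a, ha⟩ := glue_stalk (Spec (CommRingCat.of R)) ⊤ (A β) (by
      intro t _
      obtain ⟨U, hp, g, hg, hU⟩ := (hc (y t)).germ
      let W := y ⁻¹ᵁ U
      let B : ι → Γ(Spec (CommRingCat.of R), W) := fun j => y.app U (g j)
      let D : Γ(Spec (CommRingCat.of R), W) := ∑ j, (Spec (CommRingCat.of R)).presheaf.map (homOfLE le_top).op (iR (lam j)) * B j
      have hB : ∀ j t' (ht' : t' ∈ W), (Spec (CommRingCat.of R)).presheaf.germ W t' ht' (B j) =
          (y.stalkMap t').hom (X.presheaf.germ U (y t') ht' (g j)) := fun j t' ht' =>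
        (y.germ_stalkMap_apply U t' ht' (g j)).symm
      have hDg : ∀ t' (ht' : t' ∈ W), (Spec (CommRingCat.of R)).presheaf.germ W t' ht' D =
          Dn t' (fun j => X.presheaf.germ U (y t') ht' (g j)) := by
        intro t' ht'
        simp only [D, Dn, map_sum, map_mul]
        refine Finset.sum_congr rfl fun j _ => ?_
        rw [hB]
        congr 1
        exact TopCat.Presheaf.germ_res_apply (Spec (CommRingCat.of R)).presheaf (homOfLE le_top) t' ht' _
      have hDu : IsUnit D := by
        refine RingedSpace.isUnit_of_isUnit_germ (Spec (CommRingCat.of R)).toSheafedSpace W D fun t' ht' => ?_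
        have := hD t' _ _ (hU (y t') ht')
        rw [← hDg t' ht'] at this
        exact this
      refine ⟨W, hp, B β * ↑hDu.unit⁻¹, fun t' ht' => ?_⟩
      have h1 := hA β t' _ _ (hU (y t') ht')
      rw [← hDg t' ht', ← hB β t' ht'] at h1
      rw [map_mul, ← h1, mul_assoc, ← map_mul, hDu.mul_val_inv, map_one, mul_one])
    exact ⟨a, fun t => ha t trivial⟩
  choose a ha using hglue
  have hinv : ∀ g : Γ(Spec (CommRingCat.of R), ⊤), iR ((Scheme.ΓSpecIso (CommRingCat.of R)).hom g) = g := fun g =>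
    ConcreteCategory.congr_hom (Scheme.ΓSpecIso (CommRingCat.of R)).hom_inv_id g
  refine ⟨fun i => (Scheme.ΓSpecIso (CommRingCat.of R)).hom (a i), fun t => ⟨αc (y t), bc (y t), (hc _).1, (hc _).2, ?_, fun β => ?_⟩⟩
  · change IsUnit (gm _ t (iR ((Scheme.ΓSpecIso (CommRingCat.of R)).hom (a _))))
    rw [hinv, ha]
    have := hA (αc (y t)) t _ _ (hc (y t))
    rw [(hc (y t)).one, map_one] at this
    exact IsUnit.of_mul_eq_one _ this
  · change gm _ t (iR ((Scheme.ΓSpecIso (CommRingCat.of R)).hom (a _))) = _ * gm _ t (iR ((Scheme.ΓSpecIso (CommRingCat.of R)).hom (a _)))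
    rw [hinv, hinv, ha, ha]
    have h1 := hA (αc (y t)) t _ _ (hc (y t))
    have h2 := hA β t _ _ (hc (y t))
    rw [(hc (y t)).one, map_one] at h1
    rw [← h2, mul_assoc, mul_comm _ (A _ t), h1, mul_one]

theorem exists_presS [IsIntegral X] {R : Type u} [CommRing R]
    [Finite (MaximalSpectrum R)] {c : ι → X.functionField} (hfin : {i | c i ≠ 0}.Finite)
    (hcov : ∀ p : X, ∃ α b, Chart c p α b) (y : Spec (CommRingCat.of R) ⟶ X) : ∃ a, PresS c y a := by
  classical
  let ι' := {i // c i ≠ 0}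
  haveI : Fintype ι' := hfin.fintype
  obtain ⟨a, ha⟩ := exists_presS_aux (ι := ι') (c := fun i => c i.1) (fun p => by
    obtain ⟨α, b, h⟩ := hcov p
    exact ⟨⟨α, h.1⟩, fun i => b i.1, h.1, fun β => h.2 β.1⟩) y
  refine ⟨fun i => if h : c i ≠ 0 then a ⟨i, h⟩ else 0, fun t => ?_⟩
  obtain ⟨α, b, h1, h2, h3, h4⟩ := ha t
  refine ⟨α.1, fun i => if h : c i ≠ 0 then b ⟨i, h⟩ else 0, h1, fun β => ?_, ?_, fun β => ?_⟩
  · by_cases h : c β ≠ 0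
    · dsimp only; rw [dif_pos h]; exact h2 ⟨β, h⟩
    · dsimp only; rw [dif_neg h, map_zero, zero_mul]; push Not at h; exact h.symm
  · simp only [dif_pos α.2]; exact h3
  · by_cases h : c β ≠ 0
    · simp only [dif_pos h, dif_pos α.2]; exact h4 ⟨β, h⟩
    · simp only [dif_neg h, map_zero, zero_mul]

end PartSemi

section PartGrp

variable {k : Type u} [Field k] (G : GroupSchemeOver k)

abbrev GH : Type u := Γ(G.carrier, ⊤)

/-- ring hom of a morphism of spectra -/
abbrev pre {R R' : Type u} [CommRing R] [CommRing R'] (z : Spec (CommRingCat.of R') ⟶ Spec (CommRingCat.of R)) : R →+* R' :=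
  (Spec.preimage z).hom

theorem smap_pre {R R' : Type u} [CommRing R] [CommRing R'] (z : Spec (CommRingCat.of R') ⟶ Spec (CommRingCat.of R)) :
    smap (pre z) = z := Spec.map_preimage z

theorem pre_smap {R R' : Type u} [CommRing R] [CommRing R'] (τ : R →+* R') : pre (smap τ) = τ := by
  unfold pre smap
  rw [Spec.preimage_map]; rfl

theorem smap_inj {R R' : Type u} [CommRing R] [CommRing R'] {τ τ' : R →+* R'} (h : smap τ = smap τ') : τ = τ' := by
  rw [← pre_smap τ, h, pre_smap]

variable [IsAffine G.carrier]

def kH : k →+* GH G := pre (R' := GH G) (G.carrier.isoSpec.inv ≫ G.str)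

instance instGHAlg : Algebra k (GH G) := (kH G).toAlgebra

variable {R R' : Type u} [CommRing R] [CommRing R']

def gpt (φ : GH G →+* R) : Spec (CommRingCat.of R) ⟶ G.carrier := smap φ ≫ G.carrier.isoSpec.inv

def ptr (y : Spec (CommRingCat.of R) ⟶ G.carrier) : GH G →+* R := pre (R := GH G) (y ≫ G.carrier.isoSpec.hom)

@[simp] theorem gpt_ptr (y : Spec (CommRingCat.of R) ⟶ G.carrier) : gpt G (ptr G y) = y := by
  unfold gpt ptr
  rw [smap_pre, Category.assoc]
  exact (congrArg (y ≫ ·) G.carrier.isoSpec.hom_inv_id).trans (Category.comp_id _)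

@[simp] theorem ptr_gpt (φ : GH G →+* R) : ptr G (gpt G φ) = φ := by
  unfold gpt ptr
  rw [Category.assoc]
  refine Eq.trans (congrArg pre ?_) (pre_smap φ)
  exact (congrArg (smap φ ≫ ·) G.carrier.isoSpec.inv_hom_id).trans (Category.comp_id _)

theorem gpt_comp (φ : GH G →+* R) (τ : R →+* R') : smap τ ≫ gpt G φ = gpt G (τ.comp φ) := by
  unfold gpt
  rw [smap_comp, Category.assoc]

theorem ptr_comp (y : Spec (CommRingCat.of R) ⟶ G.carrier) (τ : R →+* R') : ptr G (smap τ ≫ y) = τ.comp (ptr G y) := by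
  conv_lhs => rw [← gpt_ptr G y, gpt_comp, ptr_gpt]

theorem gpt_str (φ : GH G →+* R) : gpt G φ ≫ G.str = smap (φ.comp (kH G)) := by
  unfold gpt
  rw [smap_comp, kH, smap_pre, Category.assoc]

theorem compat_iff (a b : GH G →+* R) : gpt G a ≫ G.str = gpt G b ≫ G.str ↔ a.comp (kH G) = b.comp (kH G) := by
  rw [gpt_str, gpt_str]
  exact ⟨smap_inj, congrArg _⟩

open Classical in
def rmul (a b : GH G →+* R) : GH G →+* R :=
  if h : a.comp (kH G) = b.comp (kH G) then ptr G (G.mul (gpt G a) (gpt G b) ((compat_iff G a b).mpr h)) else a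

theorem rmul_def {a b : GH G →+* R} (h : a.comp (kH G) = b.comp (kH G)) :
    gpt G (rmul G a b) = G.mul (gpt G a) (gpt G b) ((compat_iff G a b).mpr h) := by
  unfold rmul
  rw [dif_pos h, gpt_ptr]

def rinv (a : GH G →+* R) : GH G →+* R := ptr G (G.inv (gpt G a))

theorem rinv_def (a : GH G →+* R) : gpt G (rinv G a) = G.inv (gpt G a) := gpt_ptr _ _

def rone (κ : k →+* R) : GH G →+* R := ptr G (smap κ ≫ G.one)

theorem rone_def (κ : k →+* R) : gpt G (rone G κ) = smap κ ≫ G.one := gpt_ptr _ _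

theorem gpt_inj {a b : GH G →+* R} (h : gpt G a = gpt G b) : a = b := by
  rw [← ptr_gpt G a, h, ptr_gpt]

@[simp] theorem rmul_k (a b : GH G →+* R) : (rmul G a b).comp (kH G) = a.comp (kH G) := by
  by_cases h : a.comp (kH G) = b.comp (kH G)
  · rw [← compat_iff, rmul_def G h, G.mul_str]
  · rw [rmul, dif_neg h]

@[simp] theorem rinv_k (a : GH G →+* R) : (rinv G a).comp (kH G) = a.comp (kH G) := by
  rw [← compat_iff, rinv_def, G.inv_str]

@[simp] theorem rone_k (κ : k →+* R) : (rone G κ).comp (kH G) = κ := by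
  apply smap_inj
  rw [← gpt_str, rone_def, Category.assoc, G.one_str, Category.comp_id]

theorem rmul_nat {a b : GH G →+* R} (h : a.comp (kH G) = b.comp (kH G)) (τ : R →+* R') :
    τ.comp (rmul G a b) = rmul G (τ.comp a) (τ.comp b) := by
  have h' : (τ.comp a).comp (kH G) = (τ.comp b).comp (kH G) := by
    rw [RingHom.comp_assoc, h, RingHom.comp_assoc]
  apply gpt_inj
  rw [← gpt_comp, rmul_def G h, rmul_def G h', G.mul_natural _ _ _ _ (by rw [gpt_comp, gpt_comp, compat_iff, h'])]
  exact G.mul_congr (gpt_comp _ _ _) (gpt_comp _ _ _) _ _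

theorem rinv_nat (a : GH G →+* R) (τ : R →+* R') : τ.comp (rinv G a) = rinv G (τ.comp a) := by
  apply gpt_inj
  rw [← gpt_comp, rinv_def, rinv_def, G.inv_natural, gpt_comp]

theorem rone_nat (κ : k →+* R) (τ : R →+* R') : τ.comp (rone G κ) = rone G (τ.comp κ) := by
  apply gpt_inj
  rw [← gpt_comp, rone_def, rone_def, smap_comp, Category.assoc]

theorem rmul_assoc {a b c : GH G →+* R} (h : a.comp (kH G) = b.comp (kH G)) (h' : b.comp (kH G) = c.comp (kH G)) :
    rmul G (rmul G a b) c = rmul G a (rmul G b c) := by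
  have e1 : (rmul G a b).comp (kH G) = c.comp (kH G) := by rw [rmul_k, h, h']
  have e2 : a.comp (kH G) = (rmul G b c).comp (kH G) := by rw [rmul_k, h]
  apply gpt_inj
  rw [rmul_def G e1, rmul_def G e2]
  refine (G.mul_congr (rmul_def G h) rfl _ ?_).trans ((G.mul_assoc _ _ _ _ ?_ ((compat_iff G b c).mpr h') ?_).trans
    (G.mul_congr rfl (rmul_def G h').symm _ _))
  · rw [G.mul_str, compat_iff, h, h']
  · rw [G.mul_str, compat_iff, h, h']
  · rw [G.mul_str, compat_iff, h]

theorem rone_mul (a : GH G →+* R) (κ : k →+* R) (hκ : κ = a.comp (kH G)) : rmul G (rone G κ) a = a := by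
  subst hκ
  have h : (rone G (a.comp (kH G))).comp (kH G) = a.comp (kH G) := rone_k _ _
  apply gpt_inj
  rw [rmul_def G h]
  have e : gpt G (rone G (a.comp (kH G))) = gpt G a ≫ G.str ≫ G.one := by
    rw [rone_def, ← gpt_str, Category.assoc]
  exact (G.mul_congr e rfl _ (by rw [← e, compat_iff, h])).trans (G.one_mul _ _)

theorem rmul_one (a : GH G →+* R) (κ : k →+* R) (hκ : κ = a.comp (kH G)) : rmul G a (rone G κ) = a := by
  subst hκ
  have h : a.comp (kH G) = (rone G (a.comp (kH G))).comp (kH G) := (rone_k _ _).symm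
  apply gpt_inj
  rw [rmul_def G h]
  have e : gpt G (rone G (a.comp (kH G))) = gpt G a ≫ G.str ≫ G.one := by
    rw [rone_def, ← gpt_str, Category.assoc]
  exact (G.mul_congr rfl e _ (by rw [← e, compat_iff, ← h])).trans (G.mul_one _ _)

theorem rinv_mul (a : GH G →+* R) (κ : k →+* R) (hκ : κ = a.comp (kH G)) : rmul G (rinv G a) a = rone G κ := by
  subst hκ
  have h : (rinv G a).comp (kH G) = a.comp (kH G) := rinv_k _ _
  apply gpt_inj
  rw [rmul_def G h]
  have e : gpt G (rone G (a.comp (kH G))) = gpt G a ≫ G.str ≫ G.one := by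
    rw [rone_def, ← gpt_str, Category.assoc]
  rw [e]
  exact (G.mul_congr (rinv_def _ _) rfl _ (by rw [← rinv_def, compat_iff, h])).trans (G.inv_mul _ _)

theorem rmul_inv (a : GH G →+* R) (κ : k →+* R) (hκ : κ = a.comp (kH G)) : rmul G a (rinv G a) = rone G κ := by
  have hb : (rinv G a).comp (kH G) = a.comp (kH G) := rinv_k _ _
  have hbb : (rinv G (rinv G a)).comp (kH G) = (rinv G a).comp (kH G) := rinv_k _ _
  have h1 := rinv_mul G a κ hκ
  have h2 := rinv_mul G (rinv G a) κ (hκ.trans hb.symm)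
  calc rmul G a (rinv G a) = rmul G (rone G κ) (rmul G a (rinv G a)) := (rone_mul G _ κ (by rw [rmul_k, hκ])).symm
    _ = rmul G (rmul G (rinv G (rinv G a)) (rinv G a)) (rmul G a (rinv G a)) := by rw [h2]
    _ = rmul G (rinv G (rinv G a)) (rmul G (rinv G a) (rmul G a (rinv G a))) :=
        rmul_assoc G hbb (by rw [rmul_k, hb])
    _ = rmul G (rinv G (rinv G a)) (rmul G (rmul G (rinv G a) a) (rinv G a)) := by rw [rmul_assoc G hb hb.symm]
    _ = rmul G (rinv G (rinv G a)) (rinv G a) := by rw [h1, rone_mul G _ κ (hκ.trans hb.symm)]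
    _ = rone G κ := h2

variable {X : SchemeOver k} (α : ActionOver G X)

/-- `k`-structure of a point -/
def kst (X : SchemeOver k) (x : Spec (CommRingCat.of R) ⟶ X.carrier) : k →+* R := pre (x ≫ X.str)

theorem kst_def (X : SchemeOver k) (x : Spec (CommRingCat.of R) ⟶ X.carrier) : x ≫ X.str = smap (kst X x) := (smap_pre _).symm

theorem kst_comp (X : SchemeOver k) (x : Spec (CommRingCat.of R) ⟶ X.carrier) (τ : R →+* R') :
    kst X (smap τ ≫ x) = τ.comp (kst X x) := by
  apply smap_inj
  rw [← kst_def, Category.assoc, kst_def, smap_comp]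

theorem acompat_iff (g : GH G →+* R) (x : Spec (CommRingCat.of R) ⟶ X.carrier) :
    gpt G g ≫ G.str = x ≫ X.str ↔ g.comp (kH G) = kst X x := by
  rw [gpt_str, kst_def]
  exact ⟨smap_inj, congrArg _⟩

variable {G}

open Classical in
def ract (g : GH G →+* R) (x : Spec (CommRingCat.of R) ⟶ X.carrier) : Spec (CommRingCat.of R) ⟶ X.carrier :=
  if h : g.comp (kH G) = kst X x then α.act (gpt G g) x ((acompat_iff G g x).mpr h) else x

theorem ract_def {g : GH G →+* R} {x : Spec (CommRingCat.of R) ⟶ X.carrier} (h : g.comp (kH G) = kst X x) :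
    ract α g x = α.act (gpt G g) x ((acompat_iff G g x).mpr h) := by
  unfold ract
  rw [dif_pos h]

@[simp] theorem ract_k (g : GH G →+* R) (x : Spec (CommRingCat.of R) ⟶ X.carrier) : kst X (ract α g x) = kst X x := by
  by_cases h : g.comp (kH G) = kst X x
  · apply smap_inj
    rw [← kst_def, ← kst_def, ract_def α h, α.act_str]
  · rw [ract, dif_neg h]

theorem ract_nat {g : GH G →+* R} {x : Spec (CommRingCat.of R) ⟶ X.carrier} (h : g.comp (kH G) = kst X x) (τ : R →+* R') :
    smap τ ≫ ract α g x = ract α (τ.comp g) (smap τ ≫ x) := by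
  have h' : (τ.comp g).comp (kH G) = kst X (smap τ ≫ x) := by
    rw [kst_comp, ← h, RingHom.comp_assoc]
  rw [ract_def α h, ract_def α h', α.act_natural _ _ _ _ (by rw [gpt_comp, acompat_iff, h'])]
  exact α.act_congr (gpt_comp _ _ _) rfl _ _

theorem ract_mul {g g' : GH G →+* R} {x : Spec (CommRingCat.of R) ⟶ X.carrier} (h : g.comp (kH G) = kst X x)
    (h' : g'.comp (kH G) = kst X x) : ract α (rmul G g g') x = ract α g (ract α g' x) := by
  have e0 : g.comp (kH G) = g'.comp (kH G) := h.trans h'.symm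
  have e1 : (rmul G g g').comp (kH G) = kst X x := by rw [rmul_k, h]
  have e2 : g.comp (kH G) = kst X (ract α g' x) := by rw [ract_k, h]
  rw [ract_def α e1, ract_def α e2]
  refine (α.act_congr (rmul_def G e0) rfl _ ?_).trans ((α.mul_act _ _ _ _ ?_ ((acompat_iff G g' x).mpr h') ?_).trans
    (α.act_congr rfl (ract_def α h').symm _ _))
  · rw [← rmul_def G e0, acompat_iff, e1]
  · rw [G.mul_str, acompat_iff, h]
  · rw [α.act_str, acompat_iff, h]

theorem ract_one (κ : k →+* R) (x : Spec (CommRingCat.of R) ⟶ X.carrier) (hκ : κ = kst X x) : ract α (rone G κ) x = x := by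
  subst hκ
  have h : (rone G (kst X x)).comp (kH G) = kst X x := rone_k _ _
  rw [ract_def α h]
  have e : gpt G (rone G (kst X x)) = x ≫ X.str ≫ G.one := by
    rw [rone_def, ← kst_def, Category.assoc]
  exact (α.act_congr e rfl _ (by rw [← e, acompat_iff, h])).trans (α.one_act _ _)

end PartGrp

section PartGData
open TensorProduct

variable {k : Type u} [Field k] (G : GroupSchemeOver k) [IsAffine G.carrier]

/-- linear representation data of the regular representation -/
structure GData (n : ℕ) where
  ε : Fin n → GH G
  gen : Algebra.adjoin k (Set.range ε) = ⊤
  m : Option (Fin n) → Option (Fin n) → GH G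
  act : ∀ {R : Type u} [CommRing R] (a b : GH G →+* R), a.comp (kH G) = b.comp (kH G) →
    ∀ j, rmul G a b (eExt ε j) = ∑ i, a (eExt ε i) * b (m i j)
  mul : ∀ {R : Type u} [CommRing R] (a b : GH G →+* R), a.comp (kH G) = b.comp (kH G) →
    ∀ i j, rmul G a b (m i j) = ∑ l, a (m i l) * b (m l j)
  one : ∀ {R : Type u} [CommRing R] (κ : k →+* R) (i j), rone G κ (m i j) = if i = j then 1 else 0

abbrev iL : GH G →+* GH G ⊗[k] GH G := (Algebra.TensorProduct.includeLeft : GH G →ₐ[k] GH G ⊗[k] GH G).toRingHom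
abbrev iR : GH G →+* GH G ⊗[k] GH G := (Algebra.TensorProduct.includeRight : GH G →ₐ[k] GH G ⊗[k] GH G).toRingHom

theorem kH_eq : kH G = algebraMap k (GH G) := rfl

theorem iLR_k : (iL G).comp (kH G) = (iR G).comp (kH G) := by
  rw [kH_eq]
  ext r
  simp [Algebra.TensorProduct.algebraMap_apply, TensorProduct.tmul_smul, Algebra.algebraMap_eq_smul_one,
    TensorProduct.smul_tmul']

def gΔ : GH G →+* GH G ⊗[k] GH G := rmul G (iL G) (iR G)

theorem gΔ_k (r : k) : gΔ G (algebraMap k _ r) = algebraMap k _ r := by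
  have := RingHom.congr_fun (rmul_k G (iL G) (iR G)) r
  refine this.trans ?_
  exact AlgHom.commutes (Algebra.TensorProduct.includeLeft : GH G →ₐ[k] GH G ⊗[k] GH G) r

def gΔa : GH G →ₐ[k] GH G ⊗[k] GH G := { gΔ G with commutes' := gΔ_k G }

theorem exists_lift2 {A B : Type u} [CommRing A] [CommRing B] [Algebra k A] [Algebra k B] {R : Type u} [CommRing R]
    (a : A →+* R) (b : B →+* R) (h : a.comp (algebraMap k A) = b.comp (algebraMap k B)) :
    ∃ t : A ⊗[k] B →+* R, ∀ x y, t (x ⊗ₜ y) = a x * b y := by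
  letI := (a.comp (algebraMap k A)).toAlgebra
  let a' : A →ₐ[k] R := { a with commutes' := fun r => rfl }
  let b' : B →ₐ[k] R := { b with commutes' := fun r => (RingHom.congr_fun h r).symm }
  exact ⟨(Algebra.TensorProduct.lift a' b' (fun _ _ => Commute.all _ _)).toRingHom,
    fun x y => Algebra.TensorProduct.lift_tmul _ _ _ _ _⟩

theorem rmul_eq {R : Type u} [CommRing R] (a b : GH G →+* R) (h : a.comp (kH G) = b.comp (kH G))
    (t : GH G ⊗[k] GH G →+* R) (ht : ∀ x y, t (x ⊗ₜ y) = a x * b y) (f : GH G) : rmul G a b f = t (gΔ G f) := by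
  have h1 : t.comp (iL G) = a := by
    ext x
    exact (ht x 1).trans (by simp)
  have h2 : t.comp (iR G) = b := by
    ext x
    exact (ht 1 x).trans (by simp)
  have := rmul_nat G (iLR_k G) t
  rw [h1, h2] at this
  exact RingHom.congr_fun this.symm f

theorem rmul_sum {R : Type u} [CommRing R] (a b : GH G →+* R) (h : a.comp (kH G) = b.comp (kH G))
    {ι : Type*} (s : Finset ι) (v w : ι → GH G) (f : GH G) (hf : gΔ G f = ∑ i ∈ s, v i ⊗ₜ w i) :
    rmul G a b f = ∑ i ∈ s, a (v i) * b (w i) := by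
  obtain ⟨t, ht⟩ := exists_lift2 (k := k) a b h
  rw [rmul_eq G a b h t ht, hf, map_sum]
  exact Finset.sum_congr rfl fun i _ => ht _ _

/-- coefficients of the comultiplication -/
def gc {ι : Type u} (u : Module.Basis ι k (GH G)) (f : GH G) : ι →₀ GH G :=
  (Algebra.TensorProduct.basis (GH G) u).repr (gΔ G f)

theorem gc_spec {ι : Type u} (u : Module.Basis ι k (GH G)) (f : GH G) (s : Finset ι) (hs : (gc G u f).support ⊆ s) :
    gΔ G f = ∑ i ∈ s, gc G u f i ⊗ₜ[k] u i := by
  conv_lhs => rw [← (Algebra.TensorProduct.basis (GH G) u).linearCombination_repr (gΔ G f)]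
  rw [Finsupp.linearCombination_apply]
  refine (Finsupp.sum_of_support_subset (gc G u f) hs _ (by simp)).trans ?_
  refine Finset.sum_congr rfl fun i _ => ?_
  rw [Algebra.TensorProduct.basis_apply, TensorProduct.smul_tmul', smul_eq_mul, mul_one]

theorem gc_coassoc {ι : Type u} (u : Module.Basis ι k (GH G)) (f : GH G) (l : ι) :
    gΔ G (gc G u f l) = ∑ j ∈ (gc G u f).support, gc G u f j ⊗ₜ[k] gc G u (u j) l := by
  classical
  let Q := GH G ⊗[k] GH G
  let j12 : Q →+* Q ⊗[k] GH G := (Algebra.TensorProduct.includeLeft : Q →ₐ[k] Q ⊗[k] GH G).toRingHom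
  let i3 : GH G →+* Q ⊗[k] GH G := (Algebra.TensorProduct.includeRight : GH G →ₐ[k] Q ⊗[k] GH G).toRingHom
  let i1 : GH G →+* Q ⊗[k] GH G := j12.comp (iL G)
  let i2 : GH G →+* Q ⊗[k] GH G := j12.comp (iR G)
  have e12 : i1.comp (kH G) = i2.comp (kH G) := by
    rw [RingHom.comp_assoc, iLR_k, RingHom.comp_assoc]
  have e23 : i2.comp (kH G) = i3.comp (kH G) := by
    rw [← e12]
    ext r
    change ((algebraMap k (GH G) r ⊗ₜ[k] (1 : GH G)) ⊗ₜ[k] (1 : GH G) : Q ⊗[k] GH G) = 1 ⊗ₜ[k] (algebraMap k (GH G) r)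
    rw [Algebra.algebraMap_eq_smul_one]
    rw [← TensorProduct.smul_tmul', ← TensorProduct.smul_tmul', TensorProduct.tmul_smul]
    rfl
  have key := RingHom.congr_fun (rmul_assoc G e12 e23) f
  let s := (gc G u f).support
  let s' : Finset ι := s ∪ s.biUnion fun j => (gc G u (u j)).support
  rw [rmul_sum G _ _ (by rw [rmul_k, e12, e23]) s' _ _ f (gc_spec G u f s' Finset.subset_union_left),
    rmul_sum G _ _ (by rw [rmul_k, e12]) s _ _ f (gc_spec G u f s subset_rfl)] at key
  have hL : ∀ x, rmul G i1 i2 x = (gΔ G x) ⊗ₜ[k] (1 : GH G) := fun x =>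
    (RingHom.congr_fun (rmul_nat G (iLR_k G) j12) x).symm
  have hR : ∀ j ∈ s, rmul G i2 i3 (u j) = ∑ l ∈ s', ((1 : GH G) ⊗ₜ[k] gc G u (u j) l) ⊗ₜ[k] u l := by
    intro j hj
    rw [rmul_sum G i2 i3 e23 s' _ _ (u j) (gc_spec G u (u j) s' ((Finset.subset_biUnion_of_mem (fun j => (gc G u (u j)).support) hj).trans Finset.subset_union_right))]
    refine Finset.sum_congr rfl fun l _ => ?_
    change (((1 : GH G) ⊗ₜ[k] gc G u (u j) l) ⊗ₜ[k] (1 : GH G)) * ((1 : Q) ⊗ₜ[k] u l) = _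
    rw [Algebra.TensorProduct.tmul_mul_tmul, mul_one, one_mul]
  have key2 : ∑ l ∈ s', (gΔ G (gc G u f l)) ⊗ₜ[k] u l =
      ∑ l ∈ s', (∑ j ∈ s, gc G u f j ⊗ₜ[k] gc G u (u j) l) ⊗ₜ[k] u l := by
    calc _ = ∑ l ∈ s', rmul G i1 i2 (gc G u f l) * i3 (u l) := by
          refine Finset.sum_congr rfl fun l _ => ?_
          rw [hL]
          change _ = ((gΔ G (gc G u f l)) ⊗ₜ[k] (1 : GH G)) * ((1 : Q) ⊗ₜ[k] u l)
          rw [Algebra.TensorProduct.tmul_mul_tmul, mul_one, one_mul]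
      _ = _ := key
      _ = ∑ j ∈ s, ∑ l ∈ s', ((gc G u f j ⊗ₜ[k] gc G u (u j) l) ⊗ₜ[k] u l : Q ⊗[k] GH G) := by
          refine Finset.sum_congr rfl fun j hj => ?_
          rw [hR j hj, Finset.mul_sum]
          refine Finset.sum_congr rfl fun l _ => ?_
          change ((gc G u f j ⊗ₜ[k] (1 : GH G)) ⊗ₜ[k] (1 : GH G)) * (((1 : GH G) ⊗ₜ[k] gc G u (u j) l) ⊗ₜ[k] u l) = _
          rw [Algebra.TensorProduct.tmul_mul_tmul, Algebra.TensorProduct.tmul_mul_tmul, mul_one, one_mul, one_mul]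
      _ = _ := by
          rw [Finset.sum_comm]
          refine Finset.sum_congr rfl fun l _ => ?_
          rw [TensorProduct.sum_tmul]
  let b := Algebra.TensorProduct.basis Q u
  have hb : ∀ (q : Q) l, (q ⊗ₜ[k] u l : Q ⊗[k] GH G) = q • b l := by
    intro q l
    rw [Algebra.TensorProduct.basis_apply, TensorProduct.smul_tmul', smul_eq_mul, mul_one]
  simp only [hb] at key2
  by_cases hl : l ∈ s'
  · exact (linearIndependent_iff'.mp b.linearIndependent s' (fun l => gΔ G (gc G u f l) - ∑ j ∈ s, gc G u f j ⊗ₜ[k] gc G u (u j) l)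
      (by simp only [sub_smul, Finset.sum_sub_distrib, key2, sub_self]) l hl) |> sub_eq_zero.mp
  · have h1 : gc G u f l = 0 := Finsupp.notMem_support_iff.mp fun h => hl (Finset.mem_union_left _ h)
    rw [h1, map_zero]
    refine (Finset.sum_eq_zero fun j hj => ?_).symm
    rw [Finsupp.notMem_support_iff.mp fun h => hl (Finset.mem_union_right _ (Finset.mem_biUnion.mpr ⟨j, hj, h⟩)),
      TensorProduct.tmul_zero]

theorem gc_self {ι : Type u} (u : Module.Basis ι k (GH G)) (f : GH G) :
    f = ∑ j ∈ (gc G u f).support, (rone G (RingHom.id k) (u j)) • gc G u f j := by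
  have h := RingHom.congr_fun (rmul_one G (RingHom.id (GH G)) (kH G) rfl) f
  rw [rmul_sum G (RingHom.id (GH G)) (rone G (kH G)) (rone_k _ _).symm _ _ _ f (gc_spec G u f _ subset_rfl)] at h
  refine h.symm.trans (Finset.sum_congr rfl fun j _ => ?_)
  have := RingHom.congr_fun (rone_nat G (RingHom.id k) (kH G)) (u j)
  rw [RingHom.comp_id] at this
  rw [← this, Algebra.smul_def, mul_comm]
  rfl

/-- `v` has comultiplication with left factors in the span of `e`. -/
def DGood {n : ℕ} (e : Option (Fin n) → GH G) : Submodule k (GH G) where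
  carrier := {v | ∃ m : Option (Fin n) → GH G, gΔ G v = ∑ i, e i ⊗ₜ[k] m i}
  add_mem' := by
    rintro a b ⟨m, hm⟩ ⟨m', hm'⟩
    refine ⟨fun i => m i + m' i, ?_⟩
    rw [map_add, hm, hm', ← Finset.sum_add_distrib]
    exact Finset.sum_congr rfl fun i _ => (TensorProduct.tmul_add _ _ _).symm
  zero_mem' := ⟨fun i => 0, by simp⟩
  smul_mem' := by
    rintro c a ⟨m, hm⟩
    refine ⟨fun i => c • m i, ?_⟩
    rw [show gΔ G (c • a) = c • gΔ G a from map_smul (gΔa G) c a, hm, Finset.smul_sum]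
    exact Finset.sum_congr rfl fun i _ => (TensorProduct.tmul_smul _ _ _).symm

theorem tmul_good {n : ℕ} (e : Option (Fin n) → GH G) (v h : GH G) (hv : v ∈ Submodule.span k (Set.range e)) :
    ∃ m : Option (Fin n) → GH G, (v ⊗ₜ[k] h : GH G ⊗[k] GH G) = ∑ i, e i ⊗ₜ[k] m i := by
  obtain ⟨c, rfl⟩ := (Submodule.mem_span_range_iff_exists_fun k).mp hv
  refine ⟨fun i => c i • h, ?_⟩
  rw [TensorProduct.sum_tmul]
  exact Finset.sum_congr rfl fun i _ => TensorProduct.smul_tmul _ _ _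

theorem exists_gdata [Algebra.FiniteType k (GH G)] : ∃ n, Nonempty (GData G n) := by
  classical
  haveI : Nontrivial (GH G) := (rone G (RingHom.id k)).domain_nontrivial
  obtain ⟨F, hF⟩ := (inferInstance : Algebra.FiniteType k (GH G)).out
  let u := Module.Basis.ofVectorSpace k (GH G)
  let W : Finset (GH G) := {1} ∪ F.biUnion fun g => (gc G u g).support.image (gc G u g)
  let V := Submodule.span k (W : Set (GH G))
  have h1 : (1 : GH G) ∈ V := Submodule.subset_span (by simp [W])
  have hgc : ∀ g ∈ F, ∀ l, gc G u g l ∈ V := by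
    intro g hg l
    by_cases hl : gc G u g l = 0
    · rw [hl]; exact zero_mem _
    · refine Submodule.subset_span ?_
      refine Finset.mem_union_right _ (Finset.mem_biUnion.mpr ⟨g, hg, Finset.mem_image.mpr ⟨l, ?_, rfl⟩⟩)
      exact Finsupp.mem_support_iff.mpr hl
  have hFV : ∀ g ∈ F, g ∈ V := by
    intro g hg
    rw [gc_self G u g]
    exact Submodule.sum_mem _ fun j _ => Submodule.smul_mem _ _ (hgc g hg j)
  -- choose a basis of V containing 1
  have hli : LinearIndepOn k id ({1} : Set (GH G)) := by
    rw [linearIndepOn_singleton_iff]; simp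
  have hsub : ({1} : Set (GH G)) ⊆ (V : Set (GH G)) := by simpa using h1
  let B := hli.extend (t := (W : Set (GH G))) (by simp [W])
  have hB1 : (1 : GH G) ∈ B := hli.subset_extend _ (by simp)
  have hBW : B ⊆ (W : Set (GH G)) := hli.extend_subset _
  have hBli : LinearIndepOn k id B := hli.linearIndepOn_extend _
  have hBspan : (W : Set (GH G)) ⊆ Submodule.span k B := hli.subset_span_extend _
  haveI : Finite B := (W.finite_toSet.subset hBW)
  let B0 := {b : B // b ≠ ⟨1, hB1⟩}
  obtain ⟨n, ⟨eq⟩⟩ := Finite.exists_equiv_fin B0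
  let E : Option (Fin n) ≃ B := (Equiv.optionCongr eq.symm).trans (Equiv.optionSubtypeNe (⟨1, hB1⟩ : B))
  let e : Option (Fin n) → GH G := fun o => (E o : GH G)
  have he1 : e none = 1 := rfl
  have hel : LinearIndependent k e := by
    have := hBli.linearIndependent.comp E E.injective
    exact this
  have her : Set.range e = B := by
    ext x
    constructor
    · rintro ⟨o, rfl⟩; exact (E o).2
    · intro hx
      exact ⟨E.symm ⟨x, hx⟩, by simp [e]⟩
  have heV : Submodule.span k (Set.range e) = V := by
    rw [her]
    exact le_antisymm (Submodule.span_mono hBW) (Submodule.span_le.mpr hBspan)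
  let ε : Fin n → GH G := fun j => e (some j)
  have hε : eExt ε = e := by
    funext o
    cases o
    · exact he1.symm
    · rfl
  have hgen : Algebra.adjoin k (Set.range ε) = ⊤ := by
    rw [← top_le_iff, ← hF]
    refine Algebra.adjoin_le fun g hg => ?_
    have : V ≤ (Algebra.adjoin k (Set.range ε)).toSubmodule := by
      rw [← heV, Submodule.span_le]
      rintro _ ⟨o, rfl⟩
      cases o
      · rw [he1]; exact one_mem (Algebra.adjoin k (Set.range ε))
      · exact Algebra.subset_adjoin ⟨_, rfl⟩
    exact this (hFV g hg)
  have hgood : V ≤ DGood G e := by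
    refine Submodule.span_le.mpr fun w hw => ?_
    rcases Finset.mem_union.mp hw with hw | hw
    · rw [Finset.mem_singleton] at hw
      subst hw
      refine ⟨fun i => if i = none then 1 else 0, ?_⟩
      rw [map_one, Finset.sum_eq_single none]
      · dsimp only; rw [he1, if_pos rfl]; rfl
      · intro i _ hi; dsimp only; rw [if_neg hi, TensorProduct.tmul_zero]
      · simp
    · obtain ⟨g, hg, hw⟩ := Finset.mem_biUnion.mp hw
      obtain ⟨l, -, rfl⟩ := Finset.mem_image.mp hw
      have : ∀ j, ∃ m : Option (Fin n) → GH G, (gc G u g j ⊗ₜ[k] gc G u (u j) l : GH G ⊗[k] GH G) = ∑ i, e i ⊗ₜ[k] m i :=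
        fun j => tmul_good G e _ _ (heV ▸ hgc g hg j)
      choose m hm using this
      refine ⟨fun i => ∑ j ∈ (gc G u g).support, m j i, ?_⟩
      rw [gc_coassoc, Finset.sum_congr rfl fun j _ => hm j, Finset.sum_comm]
      exact Finset.sum_congr rfl fun i _ => (TensorProduct.tmul_sum _ _ _).symm
  have : ∀ j, ∃ m : Option (Fin n) → GH G, gΔ G (e j) = ∑ i, e i ⊗ₜ[k] m i := fun j =>
    hgood (heV ▸ Submodule.subset_span ⟨j, rfl⟩)
  choose m hm using this
  have hact : ∀ {R : Type u} [CommRing R] (a b : GH G →+* R), a.comp (kH G) = b.comp (kH G) →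
      ∀ j, rmul G a b (e j) = ∑ i, a (e i) * b (m j i) := fun a b h j =>
    rmul_sum G a b h _ _ _ _ (hm j)
  -- separation
  have hsep : ∀ {R : Type u} [CommRing R] [Algebra k R] (r r' : Option (Fin n) → R),
      (∑ i, (e i ⊗ₜ[k] r i : GH G ⊗[k] R)) = ∑ i, e i ⊗ₜ[k] r' i → r = r' := by
    intro R _ _ r r' h
    funext i
    obtain ⟨φ, hφ⟩ : ∃ φ : GH G →ₗ[k] k, ∀ l, φ (e l) = if l = i then 1 else 0 := by
      let bb := Module.Basis.extend hel.linearIndepOn_id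
      refine ⟨bb.coord ⟨e i, hel.linearIndepOn_id.subset_extend _ ⟨i, rfl⟩⟩, fun l => ?_⟩
      have : e l = bb ⟨e l, hel.linearIndepOn_id.subset_extend _ ⟨l, rfl⟩⟩ :=
        (Module.Basis.extend_apply_self hel.linearIndepOn_id ⟨e l, hel.linearIndepOn_id.subset_extend _ ⟨l, rfl⟩⟩).symm
      conv_lhs => rw [this]
      rw [Module.Basis.coord_apply, Module.Basis.repr_self, Finsupp.single_apply]
      refine if_congr ?_ rfl rfl
      rw [Subtype.mk.injEq]
      exact hel.injective.eq_iff
    have h2 := congrArg (fun z => TensorProduct.lid k R (LinearMap.rTensor R φ z)) h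
    simpa [hφ, ite_smul, -Fintype.sum_option] using h2
  refine ⟨n, ⟨⟨ε, hgen, fun i j => m j i, ?_, ?_, ?_⟩⟩⟩
  · intro R _ a b h j
    rw [hε]
    exact hact a b h j
  · intro R _ a b h i j
    letI : Algebra k R := (a.comp (kH G)).toAlgebra
    let γ : GH G →+* GH G ⊗[k] R := (Algebra.TensorProduct.includeLeft : GH G →ₐ[k] GH G ⊗[k] R).toRingHom
    let ρ : R →+* GH G ⊗[k] R := (Algebra.TensorProduct.includeRight : R →ₐ[k] GH G ⊗[k] R).toRingHom
    have hγ : γ.comp (kH G) = (ρ.comp a).comp (kH G) := by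
      ext r
      exact ((Algebra.TensorProduct.includeLeft : GH G →ₐ[k] GH G ⊗[k] R).commutes r).trans
        ((Algebra.TensorProduct.includeRight : R →ₐ[k] GH G ⊗[k] R).commutes r).symm
    have hab : (ρ.comp a).comp (kH G) = (ρ.comp b).comp (kH G) := by
      rw [RingHom.comp_assoc, h, RingHom.comp_assoc]
    have key := RingHom.congr_fun (rmul_assoc G hγ hab) (e j)
    rw [← rmul_nat G h, hact _ _ (by rw [rmul_k, hγ, hab]), hact _ _ (by rw [hγ, RingHom.comp_assoc, RingHom.comp_assoc, rmul_k])] at key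
    simp only [hact _ _ hγ, Finset.sum_mul] at key
    rw [Finset.sum_comm] at key
    have t1 : ∀ (x : GH G) (r : R), γ x * ρ r = x ⊗ₜ[k] r := fun x r => by
      change ((x ⊗ₜ[k] (1 : R)) * ((1 : GH G) ⊗ₜ[k] r) : GH G ⊗[k] R) = _
      rw [Algebra.TensorProduct.tmul_mul_tmul, mul_one, one_mul]
    have t2 := hsep (R := R) (fun i => ∑ l, a (m l i) * b (m j l)) (fun i => rmul G a b (m j i)) (by
      simp only [← t1, map_sum, map_mul, Finset.mul_sum, ← mul_assoc]
      exact key)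
    exact (congrFun t2 i).symm
  · intro R _ κ i j
    have t0 : ∀ i j, rone G (RingHom.id k) (m j i) = if i = j then 1 else 0 := by
      intro i j
      have key := RingHom.congr_fun (rmul_one G (RingHom.id (GH G)) (kH G) rfl) (e j)
      rw [hact (RingHom.id (GH G)) (rone G (kH G)) (rone_k _ _).symm] at key
      have h2 : ∀ x, rone G (kH G) x = algebraMap k _ (rone G (RingHom.id k) x) := fun x =>
        (RingHom.congr_fun (rone_nat G (RingHom.id k) (kH G)) x).symm
      have h3 : ∑ i, (rone G (RingHom.id k) (m j i)) • e i = ∑ i, (if i = j then (1:k) else 0) • e i := by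
        simp only [h2, RingHom.id_apply] at key
        simp only [ite_smul, one_smul, zero_smul, Finset.sum_ite_eq', Finset.mem_univ, if_true]
        rw [← key]
        exact Finset.sum_congr rfl fun i _ => by rw [Algebra.smul_def, mul_comm]
      have h4 := linearIndependent_iff'.mp hel Finset.univ (fun i => rone G (RingHom.id k) (m j i) - if i = j then (1:k) else 0)
        (by simp only [sub_smul, Finset.sum_sub_distrib, h3, sub_self]) i (Finset.mem_univ _)
      exact sub_eq_zero.mp h4
    have := RingHom.congr_fun (rone_nat G (RingHom.id k) κ) (m j i)
    rw [RingHom.comp_id] at this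
    rw [← this, RingHom.comp_apply, t0]
    split_ifs <;> simp

end PartGData

section PartNm

variable {k : Type u} [Field k] {G : GroupSchemeOver k} [IsAffine G.carrier] {X : SchemeOver k} (α : ActionOver G X)
    [IsIntegral X.carrier] {n : ℕ} (gd : GData G n) {D : Type} {L : Type u} [Field L]
    [Algebra (MvPolynomial (D × Option (Fin n)) k) L] (GA : GenAlg k gd.ε D L)
    (s : Polynomial X.carrier.functionField)

/-- the translate of a point by the generic solution of the linear equations -/
def γx {S : Type u} [CommRing S] (lam : L →+* S) (x : Spec (CommRingCat.of S) ⟶ X.carrier) :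
    Spec (CommRingCat.of (TA GA lam)) ⟶ X.carrier :=
  ract α (TAg GA lam) (smap (algebraMap S (TA GA lam)) ≫ x)

/-- `N` is a norm of the coordinates of the generic translates of `x` -/
def IsNm {S : Type u} [CommRing S] (lam : L →+* S) (x : Spec (CommRingCat.of S) ⟶ X.carrier) (N : Polynomial S) : Prop :=
  ∃ l : Polynomial (TA GA lam), PresS s.coeff (γx α gd GA lam x) l.coeff ∧ N = nm GA lam l

variable {α gd GA s}

theorem γ_compat {S : Type u} [CommRing S] {lam : L →+* S} {x : Spec (CommRingCat.of S) ⟶ X.carrier}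
    (h : kst X x = kL GA lam) : (TAg GA lam).comp (kH G) = kst X (smap (algebraMap S (TA GA lam)) ≫ x) := by
  rw [kst_comp, h]
  exact TAg_k GA lam

theorem poly_of_coeff {R : Type*} [CommRing R] (a : ℕ → R) (N : ℕ) (h : ∀ i, N ≤ i → a i = 0) :
    ∃ l : Polynomial R, l.coeff = a := by
  refine ⟨∑ i ∈ Finset.range N, Polynomial.monomial i (a i), ?_⟩
  funext i
  rw [Polynomial.finset_sum_coeff]
  simp only [Polynomial.coeff_monomial, Finset.sum_ite_eq', Finset.mem_range]
  split_ifs with hi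
  · rfl
  · exact (h i (not_lt.mp hi)).symm

theorem exists_poly_presS (hcov : ∀ p, ∃ α b, Chart s.coeff p α b) {R : Type u} [CommRing R] [Finite (MaximalSpectrum R)]
    (y : Spec (CommRingCat.of R) ⟶ X.carrier) : ∃ l : Polynomial R, PresS s.coeff y l.coeff := by
  obtain ⟨a, ha⟩ := exists_presS (c := s.coeff) (s.support.finite_toSet.subset fun i hi => Polynomial.mem_support_iff.mpr hi) hcov y
  obtain ⟨l, hl⟩ := poly_of_coeff a (s.natDegree + 1) fun i hi => ha.zero
    (Polynomial.coeff_eq_zero_of_natDegree_lt (by omega))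
  exact ⟨l, hl ▸ ha⟩

theorem exists_isNm (hcov : ∀ p, ∃ α b, Chart s.coeff p α b) {S : Type u} [CommRing S] [IsLocalRing S]
    (lam : L →+* S) (x : Spec (CommRingCat.of S) ⟶ X.carrier) : ∃ N, IsNm α gd GA s lam x N := by
  haveI := semilocal_of_finite S (TA GA lam)
  obtain ⟨l, hl⟩ := exists_poly_presS hcov (γx α gd GA lam x)
  exact ⟨_, l, hl, rfl⟩

theorem IsNm.unique {S : Type u} [CommRing S] {lam : L →+* S} {x : Spec (CommRingCat.of S) ⟶ X.carrier}
    {N N' : Polynomial S} (h : IsNm α gd GA s lam x N) (h' : IsNm α gd GA s lam x N') :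
    ∃ u : S, IsUnit u ∧ N' = Polynomial.C u * N := by
  obtain ⟨l, hl, rfl⟩ := h
  obtain ⟨l', hl', rfl⟩ := h'
  obtain ⟨z, hz, hz'⟩ := hl.unique hl'
  have : l' = Polynomial.C z * l := by
    ext i
    rw [hz' i, Polynomial.coeff_C_mul]
  obtain ⟨u, hu, hu'⟩ := nmb_unit_C (TAb GA lam) z hz
  exact ⟨u, hu, by rw [this, nm, nmb_mul, hu']; rfl⟩

theorem γx_map {S S' : Type u} [CommRing S] [CommRing S'] {lam : L →+* S} {x : Spec (CommRingCat.of S) ⟶ X.carrier}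
    (hk : kst X x = kL GA lam) (τ : S →+* S') :
    smap (TAmap GA lam τ) ≫ γx α gd GA lam x = γx α gd GA (τ.comp lam) (smap τ ≫ x) := by
  unfold γx
  rw [ract_nat α (γ_compat hk), TAmap_g, ← Category.assoc, ← smap_comp, TAmap_alg, smap_comp, Category.assoc]

theorem IsNm.map {S S' : Type u} [CommRing S] [CommRing S'] {lam : L →+* S} {x : Spec (CommRingCat.of S) ⟶ X.carrier}
    {N : Polynomial S} (h : IsNm α gd GA s lam x N) (hk : kst X x = kL GA lam) (τ : S →+* S') :
    IsNm α gd GA s (τ.comp lam) (smap τ ≫ x) (N.map τ) := by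
  obtain ⟨l, hl, rfl⟩ := h
  refine ⟨l.map (TAmap GA lam τ), ?_, (nm_map GA lam τ l).symm⟩
  have := hl.map (TAmap GA lam τ)
  rw [γx_map hk] at this
  convert this using 1
  funext i
  exact Polynomial.coeff_map _ _

theorem IsNm.ne_zero {S : Type u} [Field S] {lam : L →+* S} {x : Spec (CommRingCat.of S) ⟶ X.carrier}
    {N : Polynomial S} (h : IsNm α gd GA s lam x N) : N ≠ 0 := by
  obtain ⟨l, hl, rfl⟩ := h
  exact nmb_ne_zero (TAb GA lam) l hl.span

theorem IsNm.map_ne_zero {S κ : Type u} [CommRing S] [Field κ] {lam : L →+* S} {x : Spec (CommRingCat.of S) ⟶ X.carrier}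
    {N : Polynomial S} (h : IsNm α gd GA s lam x N) (hk : kst X x = kL GA lam) (τ : S →+* κ) : N.map τ ≠ 0 :=
  (h.map hk τ).ne_zero

theorem kL_comp {S S' : Type u} [CommRing S] [CommRing S'] (lam : L →+* S) (τ : S →+* S') :
    kL GA (τ.comp lam) = τ.comp (kL GA lam) := rfl

/-- a solution of the equations gives a divisor of the norm -/
theorem IsNm.dvd {S : Type u} [CommRing S] {lam : L →+* S} {x : Spec (CommRingCat.of S) ⟶ X.carrier}
    {N : Polynomial S} (h : IsNm α gd GA s lam x N) (hk : kst X x = kL GA lam) (g : GH G →+* S)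
    (h1 : g.comp (kH G) = kL GA lam) (h2 : ∀ i, ∑ o, wL GA lam (i, o) * g (eExt gd.ε o) = 0) :
    ∃ l : Polynomial S, PresS s.coeff (ract α g x) l.coeff ∧ l ∣ N := by
  obtain ⟨l, hl, rfl⟩ := h
  obtain ⟨Χ, e1, e2⟩ := TA_univ GA lam (RingHom.id S) g (by rw [RingHom.id_comp]; exact h1) h2
  refine ⟨l.map Χ, ?_, ?_⟩
  · have := hl.map Χ
    rw [γx, ract_nat α (γ_compat hk), e2, ← Category.assoc, ← smap_comp, e1] at this
    have e3 : smap (RingHom.id S) = 𝟙 _ := Spec.map_id _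
    rw [e3, Category.id_comp] at this
    convert this using 1
    funext i
    exact Polynomial.coeff_map _ _
  · obtain ⟨q, hq⟩ := dvd_nmb (TAb GA lam) l
    have := congrArg (Polynomial.map Χ) hq
    rw [Polynomial.map_mul, Polynomial.map_map, e1, Polynomial.map_id] at this
    exact ⟨_, this⟩

/-- substitution -/
theorem IsNm.subst {S : Type u} [CommRing S] {lam lam' : L →+* S} {x : Spec (CommRingCat.of S) ⟶ X.carrier}
    {N : Polynomial S} (h : GH G →+* S) (hk : kst X x = kL GA lam) (hkk : kL GA lam' = kL GA lam)
    (hh : h.comp (kH G) = kL GA lam)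
    (hw : ∀ i o, wL GA lam' (i, o) = ∑ j, h (gd.m o j) * wL GA lam (i, j))
    (hN : IsNm α gd GA s lam' (ract α h x) N) : IsNm α gd GA s lam x N := by
  obtain ⟨l, hl, rfl⟩ := hN
  let A' := algebraMap S (TA GA lam')
  let A := algebraMap S (TA GA lam)
  have c' : (TAg GA lam').comp (kH G) = (A'.comp h).comp (kH G) := by
    rw [RingHom.comp_assoc, hh, ← hkk]; exact TAg_k GA lam'
  have c : (TAg GA lam).comp (kH G) = (A.comp h).comp (kH G) := by
    rw [RingHom.comp_assoc, hh]; exact TAg_k GA lam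
  have ci : (TAg GA lam).comp (kH G) = (rinv G (A.comp h)).comp (kH G) := by
    rw [rinv_k, c]
  -- the forward map
  obtain ⟨F, F1, F2⟩ := TA_univ GA lam A' (rmul G (TAg GA lam') (A'.comp h))
    ((rmul_k _ _ _).trans (by rw [c', RingHom.comp_assoc, hh])) (by
      intro i
      have := TA_rel GA lam' i
      rw [← this]
      simp only [gd.act _ _ c', hw, map_sum, map_mul, Finset.sum_mul, Finset.mul_sum]
      rw [Finset.sum_comm]
      refine Finset.sum_congr rfl fun o _ => Finset.sum_congr rfl fun j _ => ?_
      simp only [RingHom.comp_apply, A']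
      ring)
  -- the backward map
  have hback : ∀ o, TAg GA lam (eExt gd.ε o) = ∑ i, rmul G (TAg GA lam) (rinv G (A.comp h)) (eExt gd.ε i) * (A.comp h) (gd.m i o) := by
    intro o
    rw [← gd.act _ _ (by rw [rmul_k, c]), rmul_assoc G ci (rinv_k _ _), rinv_mul G _ _ rfl, rmul_one G _ _ c.symm]
  obtain ⟨B, B1, B2⟩ := TA_univ GA lam' A (rmul G (TAg GA lam) (rinv G (A.comp h)))
    ((rmul_k _ _ _).trans (by rw [c, RingHom.comp_assoc, hh, hkk])) (by
      intro i
      have := TA_rel GA lam i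
      rw [← this]
      simp only [hback, hw, map_sum, map_mul, Finset.sum_mul, Finset.mul_sum]
      rw [Finset.sum_comm]
      refine Finset.sum_congr rfl fun o _ => Finset.sum_congr rfl fun j _ => ?_
      simp only [RingHom.comp_apply, A]
      ring)
  have FB : F.comp B = RingHom.id _ := by
    apply TA_ext
    · rw [RingHom.comp_assoc, B1, F1]; rfl
    · rw [RingHom.comp_assoc, B2, rmul_nat G ci, F2, rinv_nat, ← RingHom.comp_assoc, F1,
        rmul_assoc G c' (by rw [rinv_k]), rmul_inv G _ _ rfl, rmul_one G _ _ c'.symm, RingHom.id_comp]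
  have BF : B.comp F = RingHom.id _ := by
    apply TA_ext
    · rw [RingHom.comp_assoc, F1, B1]; rfl
    · rw [RingHom.comp_assoc, F2, rmul_nat G c', B2, ← RingHom.comp_assoc, B1,
        rmul_assoc G ci (by rw [rinv_k]), rinv_mul G _ _ rfl, rmul_one G _ _ c.symm, RingHom.id_comp]
  let e : TA GA lam' ≃ₐ[S] TA GA lam :=
    { (RingEquiv.ofRingHom B F BF FB : TA GA lam' ≃+* TA GA lam) with commutes' := fun r => RingHom.congr_fun B1 r }
  refine ⟨l.map (e : TA GA lam' →+* TA GA lam), ?_, (nm_iso GA lam' lam e l).symm⟩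
  have := hl.map B
  have hk' : kst X (ract α h x) = kL GA lam' := by rw [ract_k, hk, hkk]
  have e1 : smap B ≫ γx α gd GA lam' (ract α h x) = γx α gd GA lam x := by
    have t1 : (A.comp h).comp (kH G) = kst X (smap A ≫ x) := by rw [kst_comp, RingHom.comp_assoc, hh, hk]
    rw [γx, ract_nat α (γ_compat hk'), B2, ← Category.assoc, ← smap_comp, B1, ract_nat α (hh.trans hk.symm), ← ract_mul α
      ((rmul_k _ _ _).trans (c.trans t1)) t1, rmul_assoc G ci (by rw [rinv_k]), rinv_mul G _ _ rfl, rmul_one G _ _ c.symm]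
    rfl
  rw [e1] at this
  convert this using 1
  funext i
  exact Polynomial.coeff_map _ _

end PartNm

section PartPrim

theorem prim_dvd_aux {R : Type*} [CommRing R] [IsDomain R] [UniqueFactorizationMonoid R] {f : Polynomial R}
    (hf : f.IsPrimitive) (r : R) (hr : r ≠ 0) :
    ∀ (s : R) (g : Polynomial R), Polynomial.C r * g = Polynomial.C s * f → r ∣ s := by
  induction r using WfDvdMonoid.induction_on_irreducible with
  | zero => exact absurd rfl hr
  | unit u hu => exact fun s g _ => hu.dvd
  | mul a i ha hi ih =>
    intro s g h
    have hip : Prime i := hi.prime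
    have hd : Polynomial.C i ∣ Polynomial.C s * f := by
      rw [← h, map_mul, mul_assoc]
      exact Dvd.intro _ rfl
    rcases (Polynomial.prime_C_iff.mpr hip).dvd_or_dvd hd with h1 | h1
    · rw [Polynomial.C_dvd_iff_dvd_coeff] at h1
      have h2 := h1 0
      rw [Polynomial.coeff_C_zero] at h2
      obtain ⟨s', rfl⟩ := h2
      refine mul_dvd_mul_left i (ih ha s' g ?_)
      rw [map_mul, map_mul, mul_assoc, mul_assoc] at h
      exact mul_left_cancel₀ (by simpa using hi.ne_zero) h
    · exact absurd (hf i h1) hi.not_isUnit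

theorem prim_dvd {R : Type*} [CommRing R] [IsDomain R] [UniqueFactorizationMonoid R] {f g : Polynomial R}
    (hf : f.IsPrimitive) {r s : R} (hr : r ≠ 0) (h : Polynomial.C r * g = Polynomial.C s * f) :
    ∃ m, s = r * m ∧ g = Polynomial.C m * f := by
  obtain ⟨m, rfl⟩ := prim_dvd_aux hf r hr s g h
  refine ⟨m, rfl, ?_⟩
  rw [map_mul, mul_assoc] at h
  exact mul_left_cancel₀ (by simpa using hr) h

theorem exists_prim {R F : Type*} [CommRing R] [IsDomain R] [UniqueFactorizationMonoid R] [Field F] [Algebra R F]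
    [IsFractionRing R F] (N : Polynomial F) (hN : N ≠ 0) :
    ∃ (f : Polynomial R) (c : F), f.IsPrimitive ∧ c ≠ 0 ∧ N = Polynomial.C c * f.map (algebraMap R F) := by
  classical
  letI : StrongNormalizationMonoid R := UniqueFactorizationMonoid.normalizationMonoid
  letI := UniqueFactorizationMonoid.toNormalizedGCDMonoid R
  let g := IsLocalization.integerNormalization (nonZeroDivisors R) N
  obtain ⟨b, hb, hg⟩ := IsLocalization.integerNormalization_spec (nonZeroDivisors R) N
  have hb0 : algebraMap R F b ≠ 0 := by
    simpa using nonZeroDivisors.ne_zero hb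
  have hg' : g.map (algebraMap R F) = Polynomial.C (algebraMap R F b) * N := by
    rw [← Polynomial.smul_eq_C_mul, algebraMap_smul]; exact hg
  have hN' : N = Polynomial.C (algebraMap R F b)⁻¹ * g.map (algebraMap R F) := by
    rw [hg', ← mul_assoc, ← Polynomial.C_mul, inv_mul_cancel₀ hb0, Polynomial.C_1, one_mul]
  have hg0 : g ≠ 0 := by
    intro h
    rw [h] at hN'
    simp at hN'
    exact hN hN'
  refine ⟨g.primPart, (algebraMap R F b)⁻¹ * algebraMap R F g.content, g.isPrimitive_primPart, ?_, ?_⟩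
  · refine mul_ne_zero (inv_ne_zero hb0) ?_
    simpa [Polynomial.content_eq_zero_iff] using hg0
  · conv_lhs => rw [hN', g.eq_C_content_mul_primPart]
    rw [Polynomial.map_mul, Polynomial.map_C, Polynomial.C_mul, mul_assoc]

theorem range_intClosed (B K : Type*) [CommRing B] [IsDomain B] [Field K] [Algebra B K] [IsFractionRing B K] [IsIntegrallyClosed B] :
    IsIntegrallyClosedIn (algebraMap B K).range K := by
  letI : Algebra B (algebraMap B K).range := (algebraMap B K).rangeRestrict.toAlgebra
  haveI : IsScalarTower B (algebraMap B K).range K := IsScalarTower.of_algebraMap_eq fun _ => rfl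
  haveI : Algebra.IsIntegral B (algebraMap B K).range := by
    constructor
    rintro ⟨_, b, rfl⟩
    exact isIntegral_algebraMap (x := b)
  rw [isIntegrallyClosedIn_iff]
  refine ⟨Subtype.val_injective, ?_⟩
  intro x hx
  have : _root_.IsIntegral B x := isIntegral_trans x hx
  obtain ⟨y, hy⟩ := IsIntegrallyClosed.isIntegral_iff.mp this
  exact ⟨⟨x, y, hy⟩, rfl⟩

/-- clearing denominators in a multiple of a primitive polynomial -/
theorem alg_core {B K σ : Type*} [CommRing B] [IsDomain B] [Field K] [Algebra B K] [IsFractionRing B K] [IsIntegrallyClosed B]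
    {F : Type*} [Field F] [Algebra (MvPolynomial σ K) F] [IsFractionRing (MvPolynomial σ K) F]
    {f : Polynomial (MvPolynomial σ K)} (hf : f.IsPrimitive)
    (𝔭 : Ideal (MvPolynomial σ B)) [𝔭.IsPrime] {P : Type*} [CommRing P] [Algebra (MvPolynomial σ B) P]
    [IsLocalization.AtPrime P 𝔭] (ι : P →+* F)
    (hι : ι.comp (algebraMap (MvPolynomial σ B) P) = (algebraMap (MvPolynomial σ K) F).comp (MvPolynomial.map (algebraMap B K)))
    (N : Polynomial P) (μ : F) (hN : N.map ι = Polynomial.C μ * f.map (algebraMap (MvPolynomial σ K) F)) :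
    ∃ (t : MvPolynomial σ B) (g : Polynomial (MvPolynomial σ B)) (m : MvPolynomial σ K), t ∉ 𝔭 ∧
      g.map (algebraMap (MvPolynomial σ B) P) = Polynomial.C (algebraMap (MvPolynomial σ B) P t) * N ∧
      g.map (MvPolynomial.map (algebraMap B K)) = Polynomial.C m * f ∧
      ∀ a b j, MvPolynomial.coeff a m * MvPolynomial.coeff b (f.coeff j) ∈ (algebraMap B K).range := by
  obtain ⟨t, ht, hg⟩ := IsLocalization.integerNormalization_spec 𝔭.primeCompl N
  set g := IsLocalization.integerNormalization 𝔭.primeCompl N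
  have hg' : g.map (algebraMap (MvPolynomial σ B) P) = Polynomial.C (algebraMap (MvPolynomial σ B) P t) * N := by
    rw [← Polynomial.smul_eq_C_mul, algebraMap_smul]; exact hg
  -- over F
  have h1 : (g.map (MvPolynomial.map (algebraMap B K))).map (algebraMap (MvPolynomial σ K) F) =
      Polynomial.C (ι (algebraMap _ P t) * μ) * f.map (algebraMap (MvPolynomial σ K) F) := by
    rw [Polynomial.map_map, ← hι, ← Polynomial.map_map, hg', Polynomial.map_mul, Polynomial.map_C, hN, Polynomial.C_mul, mul_assoc]
  obtain ⟨⟨a, b⟩, hab⟩ := IsLocalization.surj (nonZeroDivisors (MvPolynomial σ K)) (ι (algebraMap _ P t) * μ)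
  have hb0 : (b : MvPolynomial σ K) ≠ 0 := nonZeroDivisors.coe_ne_zero b
  obtain ⟨m, hm1, hm2⟩ := prim_dvd (g := g.map (MvPolynomial.map (algebraMap B K))) hf hb0 (s := a) (by
    apply Polynomial.map_injective _ (IsFractionRing.injective (MvPolynomial σ K) F)
    rw [Polynomial.map_mul, Polynomial.map_mul, h1, Polynomial.map_C, Polynomial.map_C, ← mul_assoc, ← Polynomial.C_mul,
      mul_comm (algebraMap _ F _), hab])
  refine ⟨t, g, m, ht, hg', hm2, ?_⟩
  intro a' b' j
  haveI := range_intClosed B K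
  have := kron2 (algebraMap B K).range (Polynomial.C m) f (fun n i => by
    rw [← hm2, Polynomial.coeff_map, MvPolynomial.coeff_map]; exact ⟨_, rfl⟩) a' b' 0 j
  rwa [Polynomial.coeff_C_zero] at this

end PartPrim

section PartCore

/-- all coefficients of a polynomial over a polynomial ring -/
def cf {R σ : Type*} [CommSemiring R] (f : Polynomial (MvPolynomial σ R)) (i : (σ →₀ ℕ) × ℕ) : R :=
  MvPolynomial.coeff i.1 (f.coeff i.2)

theorem cf_ext {R σ : Type*} [CommSemiring R] {f g : Polynomial (MvPolynomial σ R)} (h : ∀ i, cf f i = cf g i) : f = g := by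
  ext i d
  exact h (d, i)

theorem cf_map {R R' σ : Type*} [CommSemiring R] [CommSemiring R'] (f : Polynomial (MvPolynomial σ R)) (φ : R →+* R') (i) :
    cf (f.map (MvPolynomial.map φ)) i = φ (cf f i) := by
  unfold cf
  rw [Polynomial.coeff_map, MvPolynomial.coeff_map]

theorem cf_CC {R σ : Type*} [CommSemiring R] (f : Polynomial (MvPolynomial σ R)) (r : R) (i) :
    cf (Polynomial.C (MvPolynomial.C r) * f) i = r * cf f i := by
  unfold cf
  rw [Polynomial.coeff_C_mul, MvPolynomial.coeff_C_mul]

theorem exists_cf {R R' σ : Type*} [CommSemiring R] [CommSemiring R'] (f : Polynomial (MvPolynomial σ R)) (b : (σ →₀ ℕ) × ℕ → R')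
    (h : ∀ i, cf f i = 0 → b i = 0) : ∃ g : Polynomial (MvPolynomial σ R'), ∀ i, cf g i = b i := by
  classical
  refine ⟨∑ i ∈ f.support, Polynomial.monomial i (∑ d ∈ (f.coeff i).support, MvPolynomial.monomial d (b (d, i))), ?_⟩
  rintro ⟨d, i⟩
  unfold cf
  dsimp only
  rw [Polynomial.finset_sum_coeff]
  simp only [Polynomial.coeff_monomial, Finset.sum_ite_eq']
  split_ifs with hi
  · rw [MvPolynomial.coeff_sum]
    simp only [MvPolynomial.coeff_monomial, Finset.sum_ite_eq']
    split_ifs with hd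
    · rfl
    · exact (h (d, i) (MvPolynomial.notMem_support_iff.mp hd)).symm
  · rw [MvPolynomial.coeff_zero]
    refine (h (d, i) ?_).symm
    unfold cf
    rw [Polynomial.notMem_support_iff.mp hi, MvPolynomial.coeff_zero]

theorem cf_finite {R σ : Type*} [CommSemiring R] (f : Polynomial (MvPolynomial σ R)) : {i | cf f i ≠ 0}.Finite := by
  classical
  refine (f.support.biUnion fun i => (f.coeff i).support.image fun d => (d, i)).finite_toSet.subset ?_
  rintro ⟨d, i⟩ h
  have h' : MvPolynomial.coeff d (f.coeff i) ≠ 0 := h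
  simp only [Finset.coe_biUnion, Set.mem_iUnion, Finset.coe_image, Set.mem_image]
  refine ⟨i, ?_, d, ?_, rfl⟩
  · rw [Finset.mem_coe, Polynomial.mem_support_iff]
    intro h0
    rw [h0, MvPolynomial.coeff_zero] at h'
    exact h' rfl
  · rw [Finset.mem_coe, MvPolynomial.mem_support_iff]; exact h'

section lam
variable {k H : Type u} [Field k] [CommRing H] [Algebra k H] {J : Type} [Fintype J]
    {ε : J → H} {D : Type} {L : Type u} [Field L] [Algebra (MvPolynomial (D × Option J) k) L]
    [IsFractionRing (MvPolynomial (D × Option J) k) L] (GA : GenAlg k ε D L) {S : Type u} [CommRing S]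

theorem lam_eval (lam : L →+* S) (q : MvPolynomial (D × Option J) k) :
    MvPolynomial.eval₂Hom (kL GA lam) (wL GA lam) q = lam (algebraMap (MvPolynomial (D × Option J) k) L q) := by
  have : MvPolynomial.eval₂Hom (kL GA lam) (wL GA lam) = lam.comp (algebraMap (MvPolynomial (D × Option J) k) L) := by
    apply MvPolynomial.ringHom_ext
    · intro r; rw [MvPolynomial.coe_eval₂Hom, MvPolynomial.eval₂_C]; rfl
    · intro r; rw [MvPolynomial.coe_eval₂Hom, MvPolynomial.eval₂_X]; rfl
  exact RingHom.congr_fun this q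

theorem lam_unit (lam : L →+* S) (q : MvPolynomial (D × Option J) k) (hq : q ≠ 0) :
    IsUnit (MvPolynomial.eval₂Hom (kL GA lam) (wL GA lam) q) := by
  rw [lam_eval]
  refine (IsUnit.mk0 _ ?_).map lam
  rwa [Ne, FaithfulSMul.algebraMap_eq_zero_iff]

theorem lam_ext {lam lam' : L →+* S} (h1 : kL GA lam = kL GA lam') (h2 : ∀ p, wL GA lam p = wL GA lam' p) : lam = lam' := by
  apply IsLocalization.ringHom_ext (nonZeroDivisors (MvPolynomial (D × Option J) k))
  apply MvPolynomial.ringHom_ext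
  · exact fun r => RingHom.congr_fun h1 r
  · exact h2

theorem exists_lam (κ : k →+* S) (w : D × Option J → S)
    (h : ∀ q : MvPolynomial (D × Option J) k, q ≠ 0 → IsUnit (MvPolynomial.eval₂Hom κ w q)) :
    ∃ lam : L →+* S, kL GA lam = κ ∧ ∀ p, wL GA lam p = w p := by
  refine ⟨IsLocalization.lift (M := nonZeroDivisors (MvPolynomial (D × Option J) k)) (g := MvPolynomial.eval₂Hom κ w)
    (fun y => h _ (nonZeroDivisors.coe_ne_zero y)), ?_, ?_⟩
  · ext r
    rw [kL, ← RingHom.comp_assoc, IsLocalization.lift_comp, RingHom.comp_apply, MvPolynomial.coe_eval₂Hom, MvPolynomial.eval₂_C]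
  · intro p
    rw [wL, IsLocalization.lift_eq, MvPolynomial.coe_eval₂Hom, MvPolynomial.eval₂_X]
end lam

variable {k : Type u} [Field k] {G : GroupSchemeOver k} [IsAffine G.carrier] {X : SchemeOver k} {α : ActionOver G X}
    [IsIntegral X.carrier] {n : ℕ} {gd : GData G n} {D : Type} {L : Type u} [Field L]
    [Algebra (MvPolynomial (D × Option (Fin n)) k) L]
    [IsFractionRing (MvPolynomial (D × Option (Fin n)) k) L] {GA : GenAlg k gd.ε D L}
    {s : Polynomial X.carrier.functionField}

/-- generic point -/
abbrev xη (X : Scheme.{u}) [IrreducibleSpace X] : Spec (CommRingCat.of X.functionField) ⟶ X := fstalk X (genericPoint X)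

theorem tK_xη (X : Scheme.{u}) [IrreducibleSpace X] (p : X) : smap (tK X p) ≫ fstalk X p = xη X :=
  Scheme.SpecMap_stalkSpecializes_fromSpecStalk ((genericPoint_spec X).specializes trivial)

/-- `f` is a primitive version of the generic norm -/
def IsGen (α : ActionOver G X) (gd : GData G n) (GA : GenAlg k gd.ε D L) (s : Polynomial X.carrier.functionField)
    (f : Polynomial (MvPolynomial (D × Option (Fin n)) X.carrier.functionField)) : Prop :=
  f.IsPrimitive ∧ ∀ (F : Type u) [Field F] [Algebra (MvPolynomial (D × Option (Fin n)) X.carrier.functionField) F]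
    [IsFractionRing (MvPolynomial (D × Option (Fin n)) X.carrier.functionField) F] (lam : L →+* F),
    kL GA lam = ((algebraMap (MvPolynomial (D × Option (Fin n)) X.carrier.functionField) F).comp MvPolynomial.C).comp (kst X (xη X.carrier)) →
    (∀ p, wL GA lam p = algebraMap (MvPolynomial (D × Option (Fin n)) X.carrier.functionField) F (MvPolynomial.X p)) →
    ∃ c, IsNm α gd GA s lam (smap ((algebraMap (MvPolynomial (D × Option (Fin n)) X.carrier.functionField) F).comp MvPolynomial.C) ≫ xη X.carrier)
      (Polynomial.C c * f.map (algebraMap (MvPolynomial (D × Option (Fin n)) X.carrier.functionField) F))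

theorem eval₂Hom_map' {R R' S σ : Type*} [CommSemiring R] [CommSemiring R'] [CommSemiring S] (κ : R →+* R') (φ : R' →+* S) (w : σ → S)
    (q : MvPolynomial σ R) : MvPolynomial.eval₂Hom φ w (MvPolynomial.map κ q) = MvPolynomial.eval₂Hom (φ.comp κ) w q := by
  simp only [MvPolynomial.coe_eval₂Hom, MvPolynomial.eval₂_map]

theorem eval₂Hom_algC {R R' P σ : Type*} [CommSemiring R] [CommSemiring R'] [CommSemiring P] [Algebra (MvPolynomial σ R') P] (κ : R →+* R')
    (q : MvPolynomial σ R) :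
    MvPolynomial.eval₂Hom (((algebraMap (MvPolynomial σ R') P).comp MvPolynomial.C).comp κ) (fun p => algebraMap (MvPolynomial σ R') P (MvPolynomial.X p)) q
      = algebraMap (MvPolynomial σ R') P (MvPolynomial.map κ q) := by
  have : MvPolynomial.eval₂Hom (((algebraMap (MvPolynomial σ R') P).comp MvPolynomial.C).comp κ) (fun p => algebraMap (MvPolynomial σ R') P (MvPolynomial.X p))
      = (algebraMap (MvPolynomial σ R') P).comp (MvPolynomial.map κ) := by
    apply MvPolynomial.ringHom_ext
    · intro r; simp
    · intro r; simp
  exact RingHom.congr_fun this q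

theorem exists_isGen (hcov : ∀ p, ∃ α b, Chart s.coeff p α b) : ∃ f, IsGen α gd GA s f := by
  let PK := MvPolynomial (D × Option (Fin n)) X.carrier.functionField
  let F := FractionRing PK
  have key : ∃ lam : L →+* F, kL GA lam = ((algebraMap PK F).comp MvPolynomial.C).comp (kst X (xη X.carrier)) ∧
      ∀ p, wL GA lam p = algebraMap PK F (MvPolynomial.X p) := by
    apply exists_lam
    intro q hq
    rw [eval₂Hom_algC]
    apply IsUnit.mk0
    rw [Ne, FaithfulSMul.algebraMap_eq_zero_iff]
    intro h0
    exact hq (MvPolynomial.map_injective _ (RingHom.injective _) (h0.trans (map_zero _).symm))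
  obtain ⟨lam, h1, h2⟩ := key
  obtain ⟨N, hN⟩ := exists_isNm (α := α) (gd := gd) (GA := GA) hcov lam (smap ((algebraMap PK F).comp MvPolynomial.C) ≫ xη X.carrier)
  obtain ⟨f, c, hf, hc, hNf⟩ := exists_prim (R := PK) N hN.ne_zero
  refine ⟨f, hf, ?_⟩
  intro F' _ _ _ lam' h1' h2'
  let e : F →+* F' := IsLocalization.lift (M := nonZeroDivisors PK) (g := algebraMap PK F') (fun y => IsUnit.mk0 _ (by
    rw [Ne, FaithfulSMul.algebraMap_eq_zero_iff]
    exact nonZeroDivisors.coe_ne_zero y))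
  have he : e.comp (algebraMap PK F) = algebraMap PK F' := IsLocalization.lift_comp _
  have hk : kst X (smap ((algebraMap PK F).comp MvPolynomial.C) ≫ xη X.carrier) = kL GA lam := by
    rw [kst_comp, h1]
  have hlam : e.comp lam = lam' := by
    apply lam_ext GA
    · rw [kL_comp, h1, h1', ← he]; rfl
    · intro p
      rw [h2', ← he]
      exact congrArg e (h2 p)
  have := hN.map hk e
  rw [hlam, ← Category.assoc, ← smap_comp, ← RingHom.comp_assoc, he, hNf, Polynomial.map_mul, Polynomial.map_C, Polynomial.map_map, he] at this
  exact ⟨_, this⟩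

end PartCore

section PartNmCore

variable {k : Type u} [Field k] {G : GroupSchemeOver k} [IsAffine G.carrier] {X : SchemeOver k} {α : ActionOver G X}
    [IsIntegral X.carrier] {n : ℕ} {gd : GData G n} {D : Type} {L : Type u} [Field L]
    [Algebra (MvPolynomial (D × Option (Fin n)) k) L]
    [IsFractionRing (MvPolynomial (D × Option (Fin n)) k) L] {GA : GenAlg k gd.ε D L}
    {s : Polynomial X.carrier.functionField}

theorem nm_core_aux (hcov : ∀ p, ∃ α b, Chart s.coeff p α b) (hn : IsNormalScheme X.carrier)
    {f : Polynomial (MvPolynomial (D × Option (Fin n)) X.carrier.functionField)} (hf : IsGen α gd GA s f)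
    (p : X.carrier) {S : Type u} [CommRing S] [IsLocalRing S] (φ : X.carrier.presheaf.stalk p →+* S) (lam : L →+* S)
    (hk : φ.comp (kst X (fstalk X.carrier p)) = kL GA lam)
    (𝔭 : Ideal (MvPolynomial (D × Option (Fin n)) (X.carrier.presheaf.stalk p))) [𝔭.IsPrime]
    (h𝔭 : ∀ y, y ∉ 𝔭 ↔ IsUnit (MvPolynomial.eval₂Hom φ (wL GA lam) y))
    (P : Type u) [CommRing P] [Algebra (MvPolynomial (D × Option (Fin n)) (X.carrier.presheaf.stalk p)) P] [IsLocalization.AtPrime P 𝔭]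
    (F : Type u) [Field F] [Algebra (MvPolynomial (D × Option (Fin n)) X.carrier.functionField) F]
    [IsFractionRing (MvPolynomial (D × Option (Fin n)) X.carrier.functionField) F] :
    ∃ (g : Polynomial (MvPolynomial (D × Option (Fin n)) (X.carrier.presheaf.stalk p)))
      (m : MvPolynomial (D × Option (Fin n)) X.carrier.functionField),
      g.map (MvPolynomial.map (tK X.carrier p)) = Polynomial.C m * f ∧
      (∀ a b j, MvPolynomial.coeff a m * MvPolynomial.coeff b (f.coeff j) ∈ (tK X.carrier p).range) ∧
      (∃ j, IsUnit (MvPolynomial.eval₂Hom φ (wL GA lam) (g.coeff j))) ∧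
      ∃ u, IsUnit u ∧ IsNm α gd GA s lam (smap φ ≫ fstalk X.carrier p)
        (Polynomial.C u * g.map (MvPolynomial.eval₂Hom φ (wL GA lam))) := by
  haveI := (hn p).2
  haveI : IsLocalRing P := IsLocalization.AtPrime.isLocalRing P 𝔭
  let B := X.carrier.presheaf.stalk p
  let K := X.carrier.functionField
  let BV := MvPolynomial (D × Option (Fin n)) B
  let PK := MvPolynomial (D × Option (Fin n)) K
  let kp := kst X (fstalk X.carrier p)
  have hkη : kst X (xη X.carrier) = (tK X.carrier p).comp kp := by
    rw [← tK_xη X.carrier p, kst_comp]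
  -- the structure maps
  have key : ∃ lam' : L →+* P, kL GA lam' = ((algebraMap BV P).comp MvPolynomial.C).comp kp ∧
      ∀ p, wL GA lam' p = algebraMap BV P (MvPolynomial.X p) := by
    apply exists_lam
    intro q hq
    rw [eval₂Hom_algC]
    refine IsLocalization.map_units P (⟨_, ?_⟩ : 𝔭.primeCompl)
    change _ ∉ 𝔭
    rw [h𝔭, eval₂Hom_map', hk]
    exact lam_unit GA lam q hq
  obtain ⟨lam', h1, h2⟩ := key
  have hψ : ∃ ψ : P →+* S, ψ.comp (algebraMap BV P) = MvPolynomial.eval₂Hom φ (wL GA lam) :=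
    ⟨IsLocalization.lift (M := 𝔭.primeCompl) (g := MvPolynomial.eval₂Hom φ (wL GA lam)) (fun y => (h𝔭 y.1).mp y.2),
      IsLocalization.lift_comp _⟩
  obtain ⟨ψ, hψ⟩ := hψ
  have hι : ∃ ι : P →+* F, ι.comp (algebraMap BV P) = (algebraMap PK F).comp (MvPolynomial.map (tK X.carrier p)) := by
    refine ⟨IsLocalization.lift (M := 𝔭.primeCompl) (g := (algebraMap PK F).comp (MvPolynomial.map (tK X.carrier p))) (fun y => ?_),
      IsLocalization.lift_comp _⟩
    apply IsUnit.mk0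
    rw [RingHom.comp_apply, Ne, FaithfulSMul.algebraMap_eq_zero_iff]
    intro h0
    have : y.1 = 0 := MvPolynomial.map_injective _ (tK_inj _ _) (h0.trans (map_zero _).symm)
    apply y.2
    rw [this]
    exact 𝔭.zero_mem
  obtain ⟨ι, hι⟩ := hι
  have hψC : ∀ b : B, ψ (algebraMap BV P (MvPolynomial.C b)) = φ b := by
    intro b
    have := RingHom.congr_fun hψ (MvPolynomial.C b)
    rw [MvPolynomial.coe_eval₂Hom, MvPolynomial.eval₂_C] at this
    exact this
  have hψX : ∀ q, ψ (algebraMap BV P (MvPolynomial.X q)) = wL GA lam q := by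
    intro q
    have := RingHom.congr_fun hψ (MvPolynomial.X q)
    rw [MvPolynomial.coe_eval₂Hom, MvPolynomial.eval₂_X] at this
    exact this
  have hιC : (ι.comp ((algebraMap BV P).comp MvPolynomial.C)) = ((algebraMap PK F).comp MvPolynomial.C).comp (tK X.carrier p) := by
    rw [← RingHom.comp_assoc, hι]
    ext b
    exact congrArg (algebraMap PK F) (MvPolynomial.map_C _ _)
  have hlam : ψ.comp lam' = lam := by
    apply lam_ext GA
    · rw [kL_comp, h1, ← hk]
      ext c
      exact hψC _
    · intro q
      exact (congrArg ψ (h2 q)).trans (hψX q)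
  obtain ⟨N, hN⟩ := exists_isNm (α := α) (gd := gd) (GA := GA) hcov lam' (smap ((algebraMap BV P).comp MvPolynomial.C) ≫ fstalk X.carrier p)
  have hk' : kst X (smap ((algebraMap BV P).comp MvPolynomial.C) ≫ fstalk X.carrier p) = kL GA lam' := by
    rw [kst_comp, h1]
  -- comparison with the generic point
  have hNι := hN.map hk' ι
  have hx : smap ι ≫ smap ((algebraMap BV P).comp MvPolynomial.C) ≫ fstalk X.carrier p =
      smap ((algebraMap PK F).comp MvPolynomial.C) ≫ xη X.carrier := by
    rw [← Category.assoc, ← smap_comp, hιC, smap_comp, Category.assoc, tK_xη]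
  rw [hx] at hNι
  obtain ⟨c, hc⟩ := hf.2 F (ι.comp lam') (by rw [kL_comp, h1, hkη, ← RingHom.comp_assoc, hιC]; rfl)
    (by
      intro q
      refine (congrArg ι (h2 q)).trans ?_
      have := RingHom.congr_fun hι (MvPolynomial.X q)
      rw [RingHom.comp_apply, RingHom.comp_apply, MvPolynomial.map_X] at this
      exact this)
  obtain ⟨u, hu, hNu⟩ := hc.unique hNι
  rw [← mul_assoc, ← Polynomial.C_mul] at hNu
  obtain ⟨t, g, m, ht, hg1, hg2, hg3⟩ := alg_core (B := B) (K := K) (F := F) hf.1 𝔭 ι hι N _ hNu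
  have hNψ := hN.map hk' ψ
  rw [hlam, ← Category.assoc, ← smap_comp] at hNψ
  have hx2 : ψ.comp ((algebraMap BV P).comp MvPolynomial.C) = φ := by
    ext b
    exact hψC b
  rw [hx2] at hNψ
  have hgψ : g.map (MvPolynomial.eval₂Hom φ (wL GA lam)) = Polynomial.C (MvPolynomial.eval₂Hom φ (wL GA lam) t) * N.map ψ := by
    rw [← hψ, ← Polynomial.map_map, hg1, Polynomial.map_mul, Polynomial.map_C]; rfl
  have htu : IsUnit (MvPolynomial.eval₂Hom φ (wL GA lam) t) := (h𝔭 t).mp ht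
  refine ⟨g, m, hg2, hg3, ?_, ?_⟩
  · have hne := hNψ.map_ne_zero (by rw [kst_comp, hk]) (IsLocalRing.residue S)
    by_contra hcon
    push Not at hcon
    apply hne
    ext j
    rw [Polynomial.coeff_map, Polynomial.coeff_zero, IsLocalRing.residue_eq_zero_iff, IsLocalRing.mem_maximalIdeal]
    intro hj
    apply hcon j
    have := congrArg (fun q => q.coeff j) hgψ
    rw [Polynomial.coeff_C_mul, Polynomial.coeff_map] at this
    rw [this]
    exact htu.mul hj
  · obtain ⟨v, hv⟩ := htu
    refine ⟨↑(v⁻¹), v⁻¹.isUnit, ?_⟩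
    rw [hgψ, ← mul_assoc, ← Polynomial.C_mul, ← hv, Units.inv_mul, Polynomial.C_1, one_mul]
    exact hNψ

theorem nm_core (hcov : ∀ p, ∃ α b, Chart s.coeff p α b) (hn : IsNormalScheme X.carrier)
    {f : Polynomial (MvPolynomial (D × Option (Fin n)) X.carrier.functionField)} (hf : IsGen α gd GA s f)
    (p : X.carrier) {S : Type u} [CommRing S] [IsLocalRing S] (φ : X.carrier.presheaf.stalk p →+* S) (lam : L →+* S)
    (hk : φ.comp (kst X (fstalk X.carrier p)) = kL GA lam) :
    ∃ (g : Polynomial (MvPolynomial (D × Option (Fin n)) (X.carrier.presheaf.stalk p)))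
      (m : MvPolynomial (D × Option (Fin n)) X.carrier.functionField),
      g.map (MvPolynomial.map (tK X.carrier p)) = Polynomial.C m * f ∧
      (∀ a b j, MvPolynomial.coeff a m * MvPolynomial.coeff b (f.coeff j) ∈ (tK X.carrier p).range) ∧
      (∃ j, IsUnit (MvPolynomial.eval₂Hom φ (wL GA lam) (g.coeff j))) ∧
      ∃ u, IsUnit u ∧ IsNm α gd GA s lam (smap φ ≫ fstalk X.carrier p)
        (Polynomial.C u * g.map (MvPolynomial.eval₂Hom φ (wL GA lam))) := by
  let 𝔭 := (IsLocalRing.maximalIdeal S).comap (MvPolynomial.eval₂Hom φ (wL GA lam))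
  exact nm_core_aux hcov hn hf p φ lam hk 𝔭 (fun y => by
    rw [Ideal.mem_comap, IsLocalRing.mem_maximalIdeal, mem_nonunits_iff, not_not]) (Localization.AtPrime 𝔭)
    (FractionRing (MvPolynomial (D × Option (Fin n)) X.carrier.functionField))

theorem gen_chart (hcov : ∀ p, ∃ α b, Chart s.coeff p α b) (hn : IsNormalScheme X.carrier)
    {f : Polynomial (MvPolynomial (D × Option (Fin n)) X.carrier.functionField)} (hf : IsGen α gd GA s f)
    (p : X.carrier) : ∃ β b, Chart (cf f) p β b := by
  let B := X.carrier.presheaf.stalk p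
  let κ := IsLocalRing.ResidueField B
  let Pκ := MvPolynomial (D × Option (Fin n)) κ
  let S := FractionRing Pκ
  let φ : B →+* S := ((algebraMap Pκ S).comp MvPolynomial.C).comp (IsLocalRing.residue B)
  have key : ∃ lam : L →+* S, kL GA lam = φ.comp (kst X (fstalk X.carrier p)) ∧
      ∀ p, wL GA lam p = algebraMap Pκ S (MvPolynomial.X p) := by
    apply exists_lam
    intro q hq
    have := eval₂Hom_algC (P := S) ((IsLocalRing.residue B).comp (kst X (fstalk X.carrier p))) q
    rw [← RingHom.comp_assoc] at this
    rw [this]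
    apply IsUnit.mk0
    rw [Ne, FaithfulSMul.algebraMap_eq_zero_iff]
    intro h0
    exact hq (MvPolynomial.map_injective _ (RingHom.injective _) (h0.trans (map_zero _).symm))
  obtain ⟨lam, h1, h2⟩ := key
  obtain ⟨g, m, hg, hm, ⟨j, hj⟩, -⟩ := nm_core hcov hn hf p φ lam h1.symm
  have e : MvPolynomial.eval₂Hom φ (wL GA lam) = (algebraMap Pκ S).comp (MvPolynomial.map (IsLocalRing.residue B)) := by
    apply MvPolynomial.ringHom_ext
    · intro r
      rw [MvPolynomial.coe_eval₂Hom, MvPolynomial.eval₂_C]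
      exact congrArg (algebraMap Pκ S) (MvPolynomial.map_C (IsLocalRing.residue B) r).symm
    · intro r
      rw [MvPolynomial.coe_eval₂Hom, MvPolynomial.eval₂_X, RingHom.comp_apply, MvPolynomial.map_X, h2]
  rw [e] at hj
  have hj' : MvPolynomial.map (IsLocalRing.residue B) (g.coeff j) ≠ 0 := by
    intro h0
    rw [RingHom.comp_apply, h0, map_zero] at hj
    exact not_isUnit_zero hj
  obtain ⟨d, hd⟩ := MvPolynomial.ne_zero_iff.mp hj'
  rw [MvPolynomial.coeff_map, Ne, IsLocalRing.residue_eq_zero_iff, IsLocalRing.mem_maximalIdeal, mem_nonunits_iff, not_not] at hd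
  choose r hr using hm
  classical
  have hsum : MvPolynomial.coeff d (g.coeff j) = ∑ x ∈ Finset.HasAntidiagonal.antidiagonal d, r x.1 x.2 j := by
    apply tK_inj X.carrier p
    rw [map_sum]
    simp only [hr]
    rw [← MvPolynomial.coeff_mul, ← Polynomial.coeff_C_mul, ← hg, Polynomial.coeff_map, MvPolynomial.coeff_map]
  have : ∃ x ∈ Finset.HasAntidiagonal.antidiagonal d, IsUnit (r x.1 x.2 j) := by
    by_contra hcon
    push Not at hcon
    rw [hsum] at hd
    exact (Ideal.sum_mem (IsLocalRing.maximalIdeal B) fun x hx => (IsLocalRing.mem_maximalIdeal _).mpr (hcon x hx)) hd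
  obtain ⟨x, -, v, hv⟩ := this
  have hv0 : tK X.carrier p (v : B) ≠ 0 := (v.isUnit.map (tK X.carrier p)).ne_zero
  have hprod := hr x.1 x.2 j
  rw [← hv] at hprod
  refine ⟨(x.2, j), fun β => ↑(v⁻¹) * r x.1 β.1 β.2, ?_, ?_⟩
  · intro h0
    have h0' : MvPolynomial.coeff x.2 (f.coeff j) = 0 := h0
    rw [h0', mul_zero] at hprod
    exact hv0 hprod
  · intro β
    change _ * MvPolynomial.coeff x.2 (f.coeff j) = MvPolynomial.coeff β.1 (f.coeff β.2)
    have hm0 : MvPolynomial.coeff x.1 m ≠ 0 := by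
      intro h0
      rw [h0, zero_mul] at hprod
      exact hv0 hprod
    rw [map_mul, hr]
    have hinv : tK X.carrier p (↑(v⁻¹) : B) * tK X.carrier p (v : B) = 1 := by
      rw [← map_mul, Units.inv_mul, map_one]
    rw [hprod] at hinv
    linear_combination (MvPolynomial.coeff β.1 (f.coeff β.2)) * hinv

theorem nm_star (hcov : ∀ p, ∃ α b, Chart s.coeff p α b) (hn : IsNormalScheme X.carrier)
    {f : Polynomial (MvPolynomial (D × Option (Fin n)) X.carrier.functionField)} (hf : IsGen α gd GA s f)
    {S : Type u} [CommRing S] [IsLocalRing S] {lam : L →+* S} {x : Spec (CommRingCat.of S) ⟶ X.carrier}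
    (hk : kst X x = kL GA lam) {a : Polynomial (MvPolynomial (D × Option (Fin n)) S)} (ha : PresS (cf f) x (cf a))
    {N : Polynomial S} (hN : IsNm α gd GA s lam x N) :
    ∃ u, IsUnit u ∧ N = Polynomial.C u * a.map (MvPolynomial.eval (wL GA lam)) := by
  obtain ⟨p, φ, β, b, hφ, rfl, hch, hau, hab⟩ := ha.local_elim
  rw [kst_comp] at hk
  obtain ⟨g, m, hg, hm, ⟨j, hj⟩, u, hu, hNm⟩ := nm_core hcov hn hf p φ lam hk
  obtain ⟨z, hz, hzN⟩ := hNm.unique hN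
  obtain ⟨fB, hfB⟩ := exists_cf f b (fun i hi => by
    apply tK_inj X.carrier p
    have := hch.2 i
    rw [hi] at this
    rw [map_zero]
    exact (mul_eq_zero.mp this).resolve_right hch.1)
  have hffB : f = Polynomial.C (MvPolynomial.C (cf f β)) * fB.map (MvPolynomial.map (tK X.carrier p)) := by
    apply cf_ext
    intro i
    rw [cf_CC, cf_map, hfB, mul_comm, hch.2]
  have hM : ∃ M, MvPolynomial.map (tK X.carrier p) M = m * MvPolynomial.C (cf f β) := by
    have : m * MvPolynomial.C (cf f β) ∈ Set.range (MvPolynomial.map (σ := D × Option (Fin n)) (tK X.carrier p)) := by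
      rw [MvPolynomial.mem_range_map_iff_coeffs_subset]
      rintro c hc
      rw [Finset.mem_coe, MvPolynomial.mem_coeffs_iff] at hc
      obtain ⟨d, -, rfl⟩ := hc
      rw [mul_comm, MvPolynomial.coeff_C_mul, mul_comm]
      exact hm d β.1 β.2
    exact this
  obtain ⟨M, hM⟩ := hM
  have hgM : g = Polynomial.C M * fB := by
    apply Polynomial.map_injective _ (MvPolynomial.map_injective (σ := D × Option (Fin n)) _ (tK_inj X.carrier p))
    rw [hg, Polynomial.map_mul, Polynomial.map_C, hM, Polynomial.C_mul, mul_assoc, ← hffB]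
  have hMu : IsUnit (MvPolynomial.eval₂Hom φ (wL GA lam) M) := by
    rw [hgM, Polynomial.coeff_C_mul, map_mul] at hj
    exact isUnit_of_mul_isUnit_left hj
  have haf : a = Polynomial.C (MvPolynomial.C (cf a β)) * fB.map (MvPolynomial.map φ) := by
    apply cf_ext
    intro i
    rw [cf_CC, cf_map, hfB, mul_comm, hab]
  have e : (MvPolynomial.eval (wL GA lam)).comp (MvPolynomial.map φ) = MvPolynomial.eval₂Hom φ (wL GA lam) := by
    apply MvPolynomial.ringHom_ext
    · intro r; simp
    · intro r; simp
  have haw : a.map (MvPolynomial.eval (wL GA lam)) = Polynomial.C (cf a β) * fB.map (MvPolynomial.eval₂Hom φ (wL GA lam)) := by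
    conv_lhs => rw [haf]
    rw [Polynomial.map_mul, Polynomial.map_C, MvPolynomial.eval_C, Polynomial.map_map, e]
  obtain ⟨v, hv⟩ := hau
  refine ⟨z * u * MvPolynomial.eval₂Hom φ (wL GA lam) M * ↑(v⁻¹), ((hz.mul hu).mul hMu).mul v⁻¹.isUnit, ?_⟩
  rw [hzN, haw, hgM, Polynomial.map_mul, Polynomial.map_C]
  simp only [← mul_assoc, ← Polynomial.C_mul]
  congr 2
  rw [← hv, mul_assoc _ _ (v : S), Units.inv_mul, mul_one]

end PartNmCore

section PartSub

theorem eq_of_local {R : Type u} [CommRing R] {x y : R}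
    (h : ∀ (S : Type u) [CommRing S] [IsLocalRing S] (τ : R →+* S), τ x = τ y) : x = y := by
  by_contra hne
  let I : Ideal R := { carrier := {r | r * x = r * y}, add_mem' := fun {a b} ha hb => by
                         change _ = _ at ha hb ⊢; rw [add_mul, add_mul, ha, hb]
                       zero_mem' := by change _ = _; simp
                       smul_mem' := fun c a ha => by
                         change _ = _ at ha ⊢; rw [smul_eq_mul, mul_assoc, mul_assoc, ha] }
  have hI : I ≠ ⊤ := by
    intro h0
    have : (1 : R) ∈ I := by rw [h0]; trivial
    change 1 * x = 1 * y at this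
    rw [one_mul, one_mul] at this
    exact hne this
  obtain ⟨M, hM, hIM⟩ := Ideal.exists_le_maximal I hI
  have := h (Localization.AtPrime M) (algebraMap R _)
  rw [IsLocalization.eq_iff_exists M.primeCompl] at this
  obtain ⟨c, hc⟩ := this
  exact c.2 (hIM hc)

variable {k : Type u} [Field k] {G : GroupSchemeOver k} [IsAffine G.carrier] {n : ℕ} (gd : GData G n) {D : Type}

/-- linear substitution -/
def Sb (D : Type) {R : Type u} [CommRing R] (h : GH G →+* R) :
    MvPolynomial (D × Option (Fin n)) R →+* MvPolynomial (D × Option (Fin n)) R :=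
  MvPolynomial.eval₂Hom MvPolynomial.C (fun p => ∑ j, MvPolynomial.C (h (gd.m p.2 j)) * MvPolynomial.X (p.1, j))

variable {R R' : Type u} [CommRing R] [CommRing R']

theorem Sb_C (h : GH G →+* R) (r : R) : Sb gd D h (MvPolynomial.C r) = MvPolynomial.C r := by
  unfold Sb; simp

theorem Sb_X (h : GH G →+* R) (p) : Sb gd D h (MvPolynomial.X p) = ∑ j, MvPolynomial.C (h (gd.m p.2 j)) * MvPolynomial.X (p.1, j) := by
  unfold Sb; rw [MvPolynomial.coe_eval₂Hom, MvPolynomial.eval₂_X]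

theorem Sb_mul {h h' : GH G →+* R} (hc : h.comp (kH G) = h'.comp (kH G)) :
    (Sb gd D h').comp (Sb gd D h) = Sb gd D (rmul G h h') := by
  apply MvPolynomial.ringHom_ext
  · intro r
    rw [RingHom.comp_apply, Sb_C, Sb_C, Sb_C]
  · intro p
    rw [RingHom.comp_apply, Sb_X, Sb_X, map_sum]
    simp only [map_mul, Sb_C, Sb_X, gd.mul _ _ hc, map_sum, Finset.sum_mul, Finset.mul_sum, mul_assoc]
    rw [Finset.sum_comm]

theorem Sb_one (κ : k →+* R) : Sb gd D (rone G κ) = RingHom.id _ := by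
  apply MvPolynomial.ringHom_ext
  · intro r
    rw [Sb_C]; rfl
  · intro p
    rw [Sb_X]
    simp only [gd.one]
    simp [-Fintype.sum_option, Finset.sum_ite_eq]

theorem Sb_inv (h : GH G →+* R) : (Sb gd D (rinv G h)).comp (Sb gd D h) = RingHom.id _ := by
  rw [Sb_mul gd (rinv_k _ _).symm, rmul_inv G _ _ rfl, Sb_one]

theorem Sb_inv' (h : GH G →+* R) : (Sb gd D h).comp (Sb gd D (rinv G h)) = RingHom.id _ := by
  rw [Sb_mul gd (rinv_k _ _), rinv_mul G _ _ rfl, Sb_one]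

theorem Sb_map (h : GH G →+* R) (τ : R →+* R') :
    (MvPolynomial.map τ).comp (Sb gd D h) = (Sb gd D (τ.comp h)).comp (MvPolynomial.map τ) := by
  apply MvPolynomial.ringHom_ext
  · intro r
    simp only [RingHom.comp_apply, Sb_C, MvPolynomial.map_C]
  · intro p
    simp only [RingHom.comp_apply, Sb_X, MvPolynomial.map_X, map_sum, map_mul, MvPolynomial.map_C]

theorem Sb_eval (h : GH G →+* R) (w : D × Option (Fin n) → R) :
    (MvPolynomial.eval w).comp (Sb gd D h) = MvPolynomial.eval (fun p => ∑ j, h (gd.m p.2 j) * w (p.1, j)) := by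
  apply MvPolynomial.ringHom_ext
  · intro r
    simp only [RingHom.comp_apply, Sb_C, MvPolynomial.eval_C]
  · intro p
    simp only [RingHom.comp_apply, Sb_X, MvPolynomial.eval_X, map_sum, map_mul, MvPolynomial.eval_C]

theorem Sb_degree [Nontrivial R] (h : GH G →+* R) (p : MvPolynomial (D × Option (Fin n)) R) :
    (Sb gd D h p).totalDegree ≤ p.totalDegree := by
  have key : ∀ d : (D × Option (Fin n)) →₀ ℕ, ∀ r : R, (Sb gd D h (MvPolynomial.monomial d r)).totalDegree ≤ d.sum fun _ e => e := by
    intro d r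
    rw [MvPolynomial.monomial_eq, map_mul, Sb_C]
    refine (MvPolynomial.totalDegree_mul _ _).trans ?_
    rw [MvPolynomial.totalDegree_C, zero_add, Finsupp.prod, map_prod]
    refine (MvPolynomial.totalDegree_finset_prod _ _).trans ?_
    refine Finset.sum_le_sum fun i _ => ?_
    rw [map_pow]
    refine (MvPolynomial.totalDegree_pow _ _).trans ?_
    have : (Sb gd D h (MvPolynomial.X i)).totalDegree ≤ 1 := by
      rw [Sb_X]
      refine (MvPolynomial.totalDegree_finset_sum _ _).trans (Finset.sup_le fun j _ => ?_)
      refine (MvPolynomial.totalDegree_mul _ _).trans ?_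
      rw [MvPolynomial.totalDegree_C, MvPolynomial.totalDegree_X]
    exact (Nat.mul_le_mul_left _ this).trans (by rw [mul_one])
  conv_lhs => rw [p.as_sum, map_sum]
  refine (MvPolynomial.totalDegree_finset_sum _ _).trans (Finset.sup_le fun d hd => ?_)
  exact (key d _).trans (MvPolynomial.le_totalDegree hd)

/-- coefficientwise application of a linear functional -/
def lc {κ E σ : Type*} [CommRing κ] [CommRing E] [Algebra κ E] (ℓ : E →ₗ[κ] κ) (p : MvPolynomial σ E) : MvPolynomial σ κ :=
  ∑ d ∈ p.support, MvPolynomial.monomial d (ℓ (MvPolynomial.coeff d p))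

theorem coeff_lc {κ E σ : Type*} [CommRing κ] [CommRing E] [Algebra κ E] (ℓ : E →ₗ[κ] κ) (p : MvPolynomial σ E) (d) :
    MvPolynomial.coeff d (lc ℓ p) = ℓ (MvPolynomial.coeff d p) := by
  classical
  unfold lc
  rw [MvPolynomial.coeff_sum]
  simp only [MvPolynomial.coeff_monomial, Finset.sum_ite_eq']
  split_ifs with hd
  · rfl
  · rw [MvPolynomial.notMem_support_iff.mp hd, map_zero]

theorem lc_mul {κ E σ : Type*} [CommRing κ] [CommRing E] [Algebra κ E] (ℓ : E →ₗ[κ] κ) (q : MvPolynomial σ κ) (p : MvPolynomial σ E) :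
    lc ℓ (MvPolynomial.map (algebraMap κ E) q * p) = q * lc ℓ p := by
  classical
  ext d
  rw [coeff_lc, MvPolynomial.coeff_mul, MvPolynomial.coeff_mul, map_sum]
  refine Finset.sum_congr rfl fun i _ => ?_
  rw [MvPolynomial.coeff_map, ← Algebra.smul_def, map_smul, coeff_lc, smul_eq_mul]

theorem map_regular {κ E σ : Type*} [Field κ] [CommRing E] [Algebra κ E] {q : MvPolynomial σ κ} (hq : q ≠ 0) :
    MvPolynomial.map (algebraMap κ E) q ∈ nonZeroDivisors (MvPolynomial σ E) := by
  rw [mem_nonZeroDivisors_iff]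
  have : ∀ p, MvPolynomial.map (algebraMap κ E) q * p = 0 → p = 0 := by
    intro p hp
    ext d
    rw [MvPolynomial.coeff_zero, ← Module.forall_dual_apply_eq_zero_iff κ]
    intro ℓ
    have h1 := lc_mul ℓ q p
    rw [hp] at h1
    have h2 : lc ℓ (0 : MvPolynomial σ E) = 0 := by
      ext d; rw [coeff_lc]; simp
    rw [h2] at h1
    have h3 := (mul_eq_zero.mp h1.symm).resolve_left hq
    rw [← coeff_lc ℓ p d, h3, MvPolynomial.coeff_zero]
  exact ⟨this, fun p hp => this p (by rw [mul_comm]; exact hp)⟩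

theorem Sb_regular {k : Type u} [Field k] {G : GroupSchemeOver k} [IsAffine G.carrier] {n : ℕ} (gd : GData G n) {D : Type}
    {R : Type u} [CommRing R] (h : GH G →+* R) {q : MvPolynomial (D × Option (Fin n)) R}
    (hq : q ∈ nonZeroDivisors (MvPolynomial (D × Option (Fin n)) R)) :
    Sb gd D h q ∈ nonZeroDivisors (MvPolynomial (D × Option (Fin n)) R) := by
  rw [mem_nonZeroDivisors_iff] at hq ⊢
  have : ∀ p, Sb gd D h q * p = 0 → p = 0 := by
    intro p hp
    have := congrArg (Sb gd D (rinv G h)) hp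
    rw [map_mul, ← RingHom.comp_apply, Sb_inv, RingHom.id_apply, map_zero] at this
    have := congrArg (Sb gd D h) (hq.1 _ this)
    rw [← RingHom.comp_apply, Sb_inv', RingHom.id_apply, map_zero] at this
    exact this
  exact ⟨this, fun p hp => this p (by rw [mul_comm]; exact hp)⟩

end PartSub

section PartEq

theorem tK_gen (X : Scheme.{u}) [IrreducibleSpace X] : tK X (genericPoint X) = RingHom.id _ := by
  change (X.presheaf.stalkSpecializes _).hom = _
  rw [TopCat.Presheaf.stalkSpecializes_refl]
  rfl

variable {k : Type u} [Field k] {G : GroupSchemeOver k} [IsAffine G.carrier] {X : SchemeOver k} {α : ActionOver G X}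
    [IsIntegral X.carrier] {n : ℕ} {gd : GData G n} {D : Type} {L : Type u} [Field L]
    [Algebra (MvPolynomial (D × Option (Fin n)) k) L]
    [IsFractionRing (MvPolynomial (D × Option (Fin n)) k) L] {GA : GenAlg k gd.ε D L}
    {s : Polynomial X.carrier.functionField}

theorem presS_generic {X : Scheme.{u}} [IsIntegral X] {ι : Type*} {c : ι → X.functionField} (h : ∃ i, c i ≠ 0) :
    PresS c (xη X) c := by
  obtain ⟨i, hi⟩ := h
  have hch : Chart c (genericPoint X) i (fun j => c j / c i) := by
    refine ⟨hi, fun β => ?_⟩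
    rw [tK_gen]
    exact div_mul_cancel₀ _ hi
  have := hch.pres.smul (IsUnit.mk0 _ hi)
  convert this using 1
  funext β
  exact (mul_div_cancel₀ _ hi).symm

theorem isGen_ne {f : Polynomial (MvPolynomial (D × Option (Fin n)) X.carrier.functionField)} (hf : IsGen α gd GA s f) :
    ∃ β, cf f β ≠ 0 := by
  by_contra! h
  have h0 : f = 0 := cf_ext fun i => by rw [h i]; simp [cf]
  exact hf.1.ne_zero h0

theorem gen_cross (hcov : ∀ p, ∃ α b, Chart s.coeff p α b) (hn : IsNormalScheme X.carrier)
    {f : Polynomial (MvPolynomial (D × Option (Fin n)) X.carrier.functionField)} (hf : IsGen α gd GA s f)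
    {E : Type u} [CommRing E] (θ : X.carrier.functionField →+* E) (h : GH G →+* E)
    (hh : h.comp (kH G) = kst X (smap θ ≫ xη X.carrier))
    {a' : Polynomial (MvPolynomial (D × Option (Fin n)) E)}
    (ha' : PresS (cf f) (ract α h (smap θ ≫ xη X.carrier)) (cf a')) (i j : ℕ) :
    MvPolynomial.map θ (f.coeff i) * Sb gd D h (a'.coeff j) = MvPolynomial.map θ (f.coeff j) * Sb gd D h (a'.coeff i) := by
  apply IsLocalization.injective (FractionRing (MvPolynomial (D × Option (Fin n)) E)) (le_refl (nonZeroDivisors (MvPolynomial (D × Option (Fin n)) E)))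
  apply eq_of_local
  intro S _ _ τ
  simp only [← RingHom.comp_apply τ]
  generalize hρ : τ.comp (algebraMap (MvPolynomial (D × Option (Fin n)) E) (FractionRing (MvPolynomial (D × Option (Fin n)) E))) = ρ
  have hunit : ∀ q ∈ nonZeroDivisors (MvPolynomial (D × Option (Fin n)) E), IsUnit (ρ q) := by
    intro q hq
    rw [← hρ]
    exact (IsLocalization.map_units (FractionRing (MvPolynomial (D × Option (Fin n)) E)) (⟨q, hq⟩ : nonZeroDivisors (MvPolynomial (D × Option (Fin n)) E))).map τ
  clear hρ τ
  let φ : E →+* S := ρ.comp MvPolynomial.C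
  let κ := θ.comp (kst X (xη X.carrier))
  letI : Algebra k E := κ.toAlgebra
  have eA : ∀ (q : MvPolynomial (D × Option (Fin n)) k), MvPolynomial.eval₂Hom (φ.comp κ) (fun p => ρ (MvPolynomial.X p)) q = ρ (MvPolynomial.map κ q) := by
    intro q
    have : MvPolynomial.eval₂Hom (φ.comp κ) (fun p => ρ (MvPolynomial.X p)) = ρ.comp (MvPolynomial.map κ) := by
      apply MvPolynomial.ringHom_ext
      · intro r; simp [φ]
      · intro r; simp
    exact RingHom.congr_fun this q
  have eB : ∀ (q : MvPolynomial (D × Option (Fin n)) k), MvPolynomial.eval₂Hom (φ.comp κ) (fun p => ρ (Sb gd D h (MvPolynomial.X p))) q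
      = ρ (Sb gd D h (MvPolynomial.map κ q)) := by
    intro q
    have : MvPolynomial.eval₂Hom (φ.comp κ) (fun p => ρ (Sb gd D h (MvPolynomial.X p))) = (ρ.comp (Sb gd D h)).comp (MvPolynomial.map κ) := by
      apply MvPolynomial.ringHom_ext
      · intro r; simp [φ, Sb_C]
      · intro r; simp
    exact RingHom.congr_fun this q
  obtain ⟨lam, l1, l2⟩ := exists_lam GA (φ.comp κ) (fun p => ρ (MvPolynomial.X p)) (fun q hq => by
    rw [eA]; exact hunit _ (map_regular (κ := k) (E := E) hq))
  obtain ⟨lam', l1', l2'⟩ := exists_lam GA (φ.comp κ) (fun p => ρ (Sb gd D h (MvPolynomial.X p))) (fun q hq => by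
    rw [eB]; exact hunit _ (Sb_regular gd h (map_regular (κ := k) (E := E) hq)))
  have hx : kst X (smap φ ≫ smap θ ≫ xη X.carrier) = kL GA lam := by
    rw [l1, kst_comp, kst_comp]
  have hx' : kst X (smap φ ≫ ract α h (smap θ ≫ xη X.carrier)) = kL GA lam' := by
    rw [l1', kst_comp, ract_k, kst_comp]
  obtain ⟨N, hN⟩ := exists_isNm (α := α) (gd := gd) (GA := GA) hcov lam' (smap φ ≫ ract α h (smap θ ≫ xη X.carrier))
  have hN2 : IsNm α gd GA s lam (smap φ ≫ smap θ ≫ xη X.carrier) N := by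
    refine IsNm.subst (lam' := lam') (φ.comp h) hx (l1'.trans l1.symm) ?_ ?_ ?_
    · rw [RingHom.comp_assoc, hh, l1, kst_comp]
    · intro i o
      rw [l2', Sb_X, map_sum]
      refine Finset.sum_congr rfl fun j _ => ?_
      rw [l2, map_mul]; rfl
    · rw [← ract_nat α hh]; exact hN
  have hP1 := ((presS_generic (isGen_ne hf)).map θ).map φ
  have hP2 := ha'.map φ
  have t1 : (fun β => φ (θ (cf f β))) = cf ((f.map (MvPolynomial.map θ)).map (MvPolynomial.map φ)) := by
    funext β; rw [cf_map, cf_map]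
  have t2 : (fun β => φ (cf a' β)) = cf (a'.map (MvPolynomial.map φ)) := by
    funext β; rw [cf_map]
  rw [t1] at hP1
  rw [t2] at hP2
  obtain ⟨u, hu, hu2⟩ := nm_star hcov hn hf hx hP1 hN2
  obtain ⟨u', hu', hu2'⟩ := nm_star hcov hn hf hx' hP2 hN
  have e1 : (MvPolynomial.eval (wL GA lam)).comp (MvPolynomial.map φ) = ρ := by
    apply MvPolynomial.ringHom_ext
    · intro r; simp [φ]
    · intro r; simp [l2]
  have e2 : (MvPolynomial.eval (wL GA lam')).comp (MvPolynomial.map φ) = ρ.comp (Sb gd D h) := by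
    apply MvPolynomial.ringHom_ext
    · intro r; simp [φ, Sb_C]
    · intro r; simp [l2']
  have c1 : ∀ i, N.coeff i = u * ρ (MvPolynomial.map θ (f.coeff i)) := by
    intro i
    rw [hu2, Polynomial.coeff_C_mul, Polynomial.map_map, e1, Polynomial.coeff_map, Polynomial.coeff_map]
  have c2 : ∀ i, N.coeff i = u' * ρ (Sb gd D h (a'.coeff i)) := by
    intro i
    rw [hu2', Polynomial.coeff_C_mul, Polynomial.map_map, e2, Polynomial.coeff_map]; rfl
  rw [map_mul, map_mul]
  apply (hu.mul hu').mul_left_cancel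
  have h1 := c1 i
  have h2 := c2 j
  have h3 := c1 j
  have h4 := c2 i
  calc u * u' * (ρ (MvPolynomial.map θ (f.coeff i)) * ρ (Sb gd D h (a'.coeff j)))
      = (u * ρ (MvPolynomial.map θ (f.coeff i))) * (u' * ρ (Sb gd D h (a'.coeff j))) := by ring
    _ = (u * ρ (MvPolynomial.map θ (f.coeff j))) * (u' * ρ (Sb gd D h (a'.coeff i))) := by
        rw [← h1, ← h2, ← h3, ← h4, mul_comm]
    _ = _ := by ring

theorem eq_generic (hcov : ∀ p, ∃ α b, Chart s.coeff p α b) (hn : IsNormalScheme X.carrier)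
    {f : Polynomial (MvPolynomial (D × Option (Fin n)) X.carrier.functionField)} (hf : IsGen α gd GA s f)
    {E : Type u} [CommRing E] (θ : X.carrier.functionField →+* E) (h : GH G →+* E)
    (hh : h.comp (kH G) = kst X (smap θ ≫ xη X.carrier))
    {a' : Polynomial (MvPolynomial (D × Option (Fin n)) E)}
    (ha' : PresS (cf f) (ract α h (smap θ ≫ xη X.carrier)) (cf a')) (β γ) :
    cf (a'.map (Sb gd D h)) β * θ (cf f γ) = cf (a'.map (Sb gd D h)) γ * θ (cf f β) := by
  rcases subsingleton_or_nontrivial E with hE | hE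
  · exact Subsingleton.elim _ _
  letI : Algebra X.carrier.functionField E := θ.toAlgebra
  have hθ : algebraMap X.carrier.functionField E = θ := rfl
  rw [← sub_eq_zero, ← Module.forall_dual_apply_eq_zero_iff X.carrier.functionField]
  intro ℓ
  obtain ⟨g, hg⟩ := poly_of_coeff (fun i => lc ℓ (Sb gd D h (a'.coeff i))) (a'.natDegree + 1) (by
    intro i hi
    have : a'.coeff i = 0 := Polynomial.coeff_eq_zero_of_natDegree_lt (by omega)
    rw [this, map_zero]
    ext d; rw [coeff_lc]; simp)
  have hg' : ∀ i, g.coeff i = lc ℓ (Sb gd D h (a'.coeff i)) := fun i => congrFun hg i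
  have hf0 : ∃ i0, f.coeff i0 ≠ 0 := by
    by_contra! h0
    exact hf.1.ne_zero (Polynomial.ext fun i => by rw [h0 i]; simp)
  obtain ⟨i0, hi0⟩ := hf0
  have hcr : Polynomial.C (f.coeff i0) * g = Polynomial.C (g.coeff i0) * f := by
    ext1 j
    rw [Polynomial.coeff_C_mul, Polynomial.coeff_C_mul, hg', hg', mul_comm (lc _ _), ← lc_mul, ← lc_mul, hθ,
      gen_cross hcov hn hf θ h hh ha']
  obtain ⟨m, -, hm⟩ := prim_dvd hf.1 hi0 hcr
  have hdeg : (g.coeff i0).totalDegree ≤ (f.coeff i0).totalDegree := by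
    have d1 : (lc ℓ (Sb gd D h (a'.coeff i0))).totalDegree ≤ (Sb gd D h (a'.coeff i0)).totalDegree := by
      refine Finset.sup_mono ?_
      intro d hd
      rw [MvPolynomial.mem_support_iff] at hd ⊢
      intro h0
      rw [coeff_lc, h0, map_zero] at hd
      exact hd rfl
    have d2 : (a'.coeff i0).totalDegree ≤ (f.coeff i0).totalDegree := by
      refine Finset.sup_mono ?_
      intro d hd
      rw [MvPolynomial.mem_support_iff] at hd ⊢
      intro h0
      exact hd (ha'.zero (β := (d, i0)) h0)
    rw [hg']
    exact (d1.trans (Sb_degree gd h _)).trans d2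
  have hmz : ∃ z, m = MvPolynomial.C z := by
    by_cases hm0 : m = 0
    · exact ⟨0, by rw [hm0, map_zero]⟩
    · rw [hm, Polynomial.coeff_C_mul, MvPolynomial.totalDegree_mul_of_isDomain hm0 hi0] at hdeg
      exact ⟨_, MvPolynomial.totalDegree_eq_zero_iff_eq_C.mp (by omega)⟩
  obtain ⟨z, rfl⟩ := hmz
  have hz : ∀ β, ℓ (cf (a'.map (Sb gd D h)) β) = z * cf f β := by
    intro β
    unfold cf
    rw [Polynomial.coeff_map, ← coeff_lc, ← hg', hm, Polynomial.coeff_C_mul, MvPolynomial.coeff_C_mul]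
  rw [map_sub, mul_comm _ (θ _), mul_comm _ (θ _), ← hθ, ← Algebra.smul_def, ← Algebra.smul_def, map_smul, map_smul, hz, hz,
    smul_eq_mul, smul_eq_mul]
  ring

end PartEq

section PartEqL

open TensorProduct in
theorem exists_univ {k H B K R : Type u} [Field k] [CommRing H] [Algebra k H] [CommRing B] [IsDomain B] [Algebra k B]
    [Field K] [Algebra B K] [IsFractionRing B K] [CommRing R] [IsLocalRing R] (h : H →+* R) (φ : B →+* R)
    (hc : φ.comp (algebraMap k B) = h.comp (algebraMap k H)) :
    ∃ (C : Type u) (_ : CommRing C) (_ : IsLocalRing C) (E : Type u) (_ : CommRing E) (hC : H →+* C) (φC : B →+* C) (χ : C →+* R)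
      (ι : C →+* E) (θ : K →+* E), χ.comp hC = h ∧ χ.comp φC = φ ∧
      φC.comp (algebraMap k B) = hC.comp (algebraMap k H) ∧ Function.Injective ι ∧ θ.comp (algebraMap B K) = ι.comp φC := by
  obtain ⟨t, ht⟩ := exists_lift2 (k := k) φ h hc
  let 𝔭 : Ideal (B ⊗[k] H) := (IsLocalRing.maximalIdeal R).comap t
  haveI : 𝔭.IsPrime := inferInstance
  let C := Localization.AtPrime 𝔭
  let hC : H →+* C := (algebraMap (B ⊗[k] H) C).comp (Algebra.TensorProduct.includeRight : H →ₐ[k] B ⊗[k] H).toRingHom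
  let φC : B →+* C := (algebraMap (B ⊗[k] H) C).comp (algebraMap B (B ⊗[k] H))
  have hu : ∀ y : 𝔭.primeCompl, IsUnit (t y) := by
    intro y
    by_contra h0
    exact y.2 ((IsLocalRing.mem_maximalIdeal _).mpr h0)
  let χ : C →+* R := IsLocalization.lift hu
  have hχ : χ.comp (algebraMap (B ⊗[k] H) C) = t := IsLocalization.lift_comp hu
  let M : Submonoid C := (nonZeroDivisors B).map φC
  have hM : M ≤ nonZeroDivisors C := by
    rintro _ ⟨b, hb, rfl⟩
    haveI : Module.Flat (B ⊗[k] H) C := IsLocalization.flat C 𝔭.primeCompl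
    haveI : Module.Flat B C := Module.Flat.trans B (B ⊗[k] H) C
    have hreg := Module.Flat.isSMulRegular_of_nonZeroDivisors (M := C) hb
    have hb' : ∀ c : C, φC b * c = b • c := by
      intro c
      rw [Algebra.smul_def]; rfl
    have : ∀ c, φC b * c = 0 → c = 0 := by
      intro c hc
      apply hreg
      change b • c = b • 0
      rw [← hb', hc, smul_zero]
    rw [mem_nonZeroDivisors_iff]
    exact ⟨this, fun c hc => this c (by rw [mul_comm]; exact hc)⟩
  let E := Localization M
  have hθ : ∀ y : nonZeroDivisors B, IsUnit (((algebraMap C E).comp φC) y) := by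
    intro y
    exact IsLocalization.map_units E (⟨φC y, y, y.2, rfl⟩ : M)
  refine ⟨C, inferInstance, inferInstance, E, inferInstance, hC, φC, χ, algebraMap C E, IsLocalization.lift hθ, ?_, ?_, ?_, ?_, ?_⟩
  · rw [← RingHom.comp_assoc, hχ]
    ext x
    change t (1 ⊗ₜ x) = _
    rw [ht, map_one, one_mul]
  · rw [← RingHom.comp_assoc, hχ]
    ext x
    change t (x ⊗ₜ 1) = _
    rw [ht, map_one, mul_one]
  · ext x
    change algebraMap (B ⊗[k] H) C ((algebraMap k B x) ⊗ₜ 1) = algebraMap (B ⊗[k] H) C (1 ⊗ₜ (algebraMap k H x))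
    congr 1
    rw [Algebra.algebraMap_eq_smul_one, Algebra.algebraMap_eq_smul_one, TensorProduct.smul_tmul]
  · exact IsLocalization.injective E hM
  · exact IsLocalization.lift_comp hθ

variable {k : Type u} [Field k] {G : GroupSchemeOver k} [IsAffine G.carrier] {X : SchemeOver k} {α : ActionOver G X}
    [IsIntegral X.carrier] {n : ℕ} {gd : GData G n} {D : Type} {L : Type u} [Field L]
    [Algebra (MvPolynomial (D × Option (Fin n)) k) L]
    [IsFractionRing (MvPolynomial (D × Option (Fin n)) k) L] {GA : GenAlg k gd.ε D L}
    {s : Polynomial X.carrier.functionField}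

theorem exists_cf_presS (hcov : ∀ p, ∃ α b, Chart s.coeff p α b) (hn : IsNormalScheme X.carrier)
    {f : Polynomial (MvPolynomial (D × Option (Fin n)) X.carrier.functionField)} (hf : IsGen α gd GA s f)
    {R : Type u} [CommRing R] [Finite (MaximalSpectrum R)]
    (y : Spec (CommRingCat.of R) ⟶ X.carrier) : ∃ a : Polynomial (MvPolynomial (D × Option (Fin n)) R), PresS (cf f) y (cf a) := by
  obtain ⟨a, ha⟩ := exists_presS (cf_finite f) (gen_chart hcov hn hf) y
  obtain ⟨l, hl⟩ := exists_cf f a (fun i hi => ha.zero hi)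
  refine ⟨l, ?_⟩
  have : cf l = a := funext hl
  rw [this]; exact ha

theorem eq_local (hcov : ∀ p, ∃ α b, Chart s.coeff p α b) (hn : IsNormalScheme X.carrier)
    {f : Polynomial (MvPolynomial (D × Option (Fin n)) X.carrier.functionField)} (hf : IsGen α gd GA s f)
    {R : Type u} [CommRing R] [IsLocalRing R] (h : GH G →+* R) (x : Spec (CommRingCat.of R) ⟶ X.carrier)
    (hh : h.comp (kH G) = kst X x)
    {a a' : Polynomial (MvPolynomial (D × Option (Fin n)) R)} (ha : PresS (cf f) x (cf a))
    (ha' : PresS (cf f) (ract α h x) (cf a')) (β γ) :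
    cf (a'.map (Sb gd D h)) β * cf a γ = cf (a'.map (Sb gd D h)) γ * cf a β := by
  obtain ⟨p, φ, hφ, rfl⟩ := local_point x
  let kp := kst X (fstalk X.carrier p)
  letI : Algebra k (X.carrier.presheaf.stalk p) := kp.toAlgebra
  rw [kst_comp] at hh
  obtain ⟨C, _, _, E, _, hC, φC, χ, ι, θ, e1, e2, e3, e4, e5⟩ :=
    exists_univ (k := k) (K := X.carrier.functionField) h φ hh.symm
  have e3' : hC.comp (kH G) = kst X (smap φC ≫ fstalk X.carrier p) := by
    rw [kst_comp]; exact e3.symm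
  obtain ⟨b, hb⟩ := exists_cf_presS hcov hn hf (smap φC ≫ fstalk X.carrier p)
  obtain ⟨b', hb'⟩ := exists_cf_presS hcov hn hf (ract α hC (smap φC ≫ fstalk X.carrier p))
  have xE : smap ι ≫ smap φC ≫ fstalk X.carrier p = smap θ ≫ xη X.carrier := by
    rw [← Category.assoc, ← smap_comp, ← e5, smap_comp, Category.assoc, tK_xη]
  have cE : (ι.comp hC).comp (kH G) = kst X (smap θ ≫ xη X.carrier) := by
    rw [← xE, kst_comp, ← e3', RingHom.comp_assoc]
  have hbE := hb.map ι
  have hbE' := hb'.map ι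
  rw [ract_nat α e3', xE] at hbE'
  rw [xE] at hbE
  have t1 : (fun i => ι (cf b' i)) = cf (b'.map (MvPolynomial.map ι)) := by funext i; rw [cf_map]
  rw [t1] at hbE'
  have key := eq_generic hcov hn hf θ (ι.comp hC) cE hbE'
  obtain ⟨z, hz, hzb⟩ := ((presS_generic (isGen_ne hf)).map θ).unique hbE
  have hsub : ∀ i, cf ((b'.map (MvPolynomial.map ι)).map (Sb gd D (ι.comp hC))) i = ι (cf (b'.map (Sb gd D hC)) i) := by
    intro i
    rw [Polynomial.map_map, ← Sb_map, ← Polynomial.map_map, cf_map]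
  have keyC : ∀ β γ, cf (b'.map (Sb gd D hC)) β * cf b γ = cf (b'.map (Sb gd D hC)) γ * cf b β := by
    intro β γ
    apply e4
    rw [map_mul, map_mul, ← hsub, ← hsub, hzb, hzb, mul_left_comm, key β γ, mul_left_comm]
  have hbR := hb.map χ
  have hbR' := hb'.map χ
  rw [ract_nat α e3', e1, ← Category.assoc, ← smap_comp, e2] at hbR'
  rw [← Category.assoc, ← smap_comp, e2] at hbR
  obtain ⟨u, hu, hub⟩ := hbR.unique ha
  obtain ⟨u', hu', hub'⟩ := hbR'.unique ha'
  have ea' : a' = Polynomial.C (MvPolynomial.C u') * b'.map (MvPolynomial.map χ) := by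
    apply cf_ext; intro i; rw [cf_CC, cf_map, hub']
  have hs : ∀ i, cf (a'.map (Sb gd D h)) i = u' * χ (cf (b'.map (Sb gd D hC)) i) := by
    intro i
    rw [ea', Polynomial.map_mul, Polynomial.map_C, Sb_C, cf_CC, Polynomial.map_map, ← e1, ← Sb_map, ← Polynomial.map_map, cf_map]
  rw [hs, hs, hub, hub]
  have := congrArg χ (keyC β γ)
  rw [map_mul, map_mul] at this
  linear_combination u' * u * this

theorem eq_main (hcov : ∀ p, ∃ α b, Chart s.coeff p α b) (hn : IsNormalScheme X.carrier)
    {f : Polynomial (MvPolynomial (D × Option (Fin n)) X.carrier.functionField)} (hf : IsGen α gd GA s f)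
    {R : Type u} [CommRing R] (h : GH G →+* R) (x : Spec (CommRingCat.of R) ⟶ X.carrier)
    (hh : h.comp (kH G) = kst X x)
    {a a' : Polynomial (MvPolynomial (D × Option (Fin n)) R)} (ha : PresS (cf f) x (cf a))
    (ha' : PresS (cf f) (ract α h x) (cf a')) :
    ∃ z, IsUnit z ∧ ∀ β, cf (a'.map (Sb gd D h)) β = z * cf a β := by
  refine unit_of_cross (a := cf a) (a' := cf (a'.map (Sb gd D h))) ?_ ha.span ?_
  · intro β γ
    apply eq_of_local
    intro S _ _ τ
    have h1 := ha.map τ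
    have h2 := ha'.map τ
    rw [ract_nat α hh] at h2
    have t1 : (fun i => τ (cf a i)) = cf (a.map (MvPolynomial.map τ)) := by funext i; rw [cf_map]
    have t2 : (fun i => τ (cf a' i)) = cf (a'.map (MvPolynomial.map τ)) := by funext i; rw [cf_map]
    rw [t1] at h1
    rw [t2] at h2
    have key := eq_local hcov hn hf (τ.comp h) (smap τ ≫ x) (by rw [kst_comp, ← hh, RingHom.comp_assoc]) h1 h2
    have hsub : ∀ i, cf ((a'.map (MvPolynomial.map τ)).map (Sb gd D (τ.comp h))) i = τ (cf (a'.map (Sb gd D h)) i) := by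
      intro i
      rw [Polynomial.map_map, ← Sb_map, ← Polynomial.map_map, cf_map]
    have := key γ β
    rw [hsub, hsub, cf_map, cf_map] at this
    rw [map_mul, map_mul, mul_comm, this, mul_comm]
  · by_contra hne
    obtain ⟨M, hM, hle⟩ := Ideal.exists_le_maximal _ hne
    have h0 : (a'.map (Sb gd D h)).map (MvPolynomial.map (Ideal.Quotient.mk M)) = 0 := by
      apply cf_ext
      intro i
      rw [cf_map, Ideal.Quotient.eq_zero_iff_mem.mpr (hle (Ideal.subset_span ⟨i, rfl⟩))]
      simp [cf]
    have h1 : ∀ i, cf a' i ∈ M := by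
      intro i
      rw [← Ideal.Quotient.eq_zero_iff_mem, ← cf_map]
      have e : a' = (a'.map (Sb gd D h)).map (Sb gd D (rinv G h)) := by
        rw [Polynomial.map_map, Sb_inv, Polynomial.map_id]
      rw [e, Polynomial.map_map, Sb_map, ← Polynomial.map_map, h0, Polynomial.map_zero]
      simp [cf]
    apply hM.ne_top
    rw [Ideal.eq_top_iff_one]
    have : (1 : R) ∈ Ideal.span (Set.range (cf a')) := by rw [ha'.span]; trivial
    refine (Ideal.span_le.mpr ?_) this
    rintro _ ⟨i, rfl⟩
    exact h1 i

end PartEqL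

section PartYr
variable {k : Type u} [Field k] {G : GroupSchemeOver k} [IsAffine G.carrier] {n : ℕ} (gd : GData G n) (D : Type)

/-- restriction to the solutions -/
def Yr {R : Type u} [CommRing R] (a : GH G →+* R) :
    MvPolynomial (D × Option (Fin n)) R →+* MvPolynomial (D × Fin n) R :=
  MvPolynomial.eval₂Hom MvPolynomial.C (fun p => p.2.elim (-∑ j, MvPolynomial.C (a (gd.ε j)) * MvPolynomial.X (p.1, j))
    (fun j => MvPolynomial.X (p.1, j)))

/-- a section of the restriction -/
def Yi (n : ℕ) (R : Type u) [CommRing R] : MvPolynomial (D × Fin n) R →+* MvPolynomial (D × Option (Fin n)) R :=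
  MvPolynomial.eval₂Hom MvPolynomial.C (fun p => MvPolynomial.X (p.1, some p.2))

variable {D} {R R' : Type u} [CommRing R] [CommRing R']

theorem Yr_C (a : GH G →+* R) (r : R) : Yr gd D a (MvPolynomial.C r) = MvPolynomial.C r := by
  unfold Yr; simp

theorem Yr_some (a : GH G →+* R) (i j) : Yr gd D a (MvPolynomial.X (i, some j)) = MvPolynomial.X (i, j) := by
  unfold Yr; rw [MvPolynomial.coe_eval₂Hom, MvPolynomial.eval₂_X]; rfl

theorem Yr_none (a : GH G →+* R) (i) : Yr gd D a (MvPolynomial.X (i, none)) =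
    -∑ j, MvPolynomial.C (a (gd.ε j)) * MvPolynomial.X (i, j) := by
  unfold Yr; rw [MvPolynomial.coe_eval₂Hom, MvPolynomial.eval₂_X]; rfl

theorem Yi_C (r : R) : Yi D n R (MvPolynomial.C r) = MvPolynomial.C r := by
  unfold Yi; simp

theorem Yi_X (p) : Yi D n R (MvPolynomial.X p) = MvPolynomial.X (p.1, some p.2) := by
  unfold Yi; simp

theorem Yr_Yi (a : GH G →+* R) : (Yr gd D a).comp (Yi D n R) = RingHom.id _ := by
  apply MvPolynomial.ringHom_ext
  · intro r; rw [RingHom.comp_apply, Yi_C, Yr_C]; rfl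
  · intro p; rw [RingHom.comp_apply, Yi_X, Yr_some]; rfl

theorem Yr_rel (a : GH G →+* R) (i) : ∑ o, MvPolynomial.C (a (eExt gd.ε o)) * Yr gd D a (MvPolynomial.X (i, o)) = 0 := by
  rw [Fintype.sum_option]
  simp only [eExt, Option.elim, Yr_none, Yr_some, map_one, one_mul, neg_add_cancel]

/-- a homomorphism killing the relations factors -/
theorem Yr_factor (a : GH G →+* R) {P : Type*} [CommRing P] (φ : MvPolynomial (D × Option (Fin n)) R →+* P)
    (h : ∀ i, ∑ o, φ (MvPolynomial.C (a (eExt gd.ε o))) * φ (MvPolynomial.X (i, o)) = 0) :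
    (φ.comp (Yi D n R)).comp (Yr gd D a) = φ := by
  apply MvPolynomial.ringHom_ext
  · intro r; rw [RingHom.comp_apply, Yr_C, RingHom.comp_apply, Yi_C]
  · rintro ⟨i, _ | j⟩
    · have := h i
      rw [Fintype.sum_option] at this
      simp only [eExt, Option.elim, map_one, one_mul] at this
      rw [RingHom.comp_apply, Yr_none, map_neg, map_sum, eq_neg_of_add_eq_zero_left this]
      congr 1
      refine Finset.sum_congr rfl fun j _ => ?_
      rw [map_mul, RingHom.comp_apply, RingHom.comp_apply, Yi_C, Yi_X]
    · rw [RingHom.comp_apply, Yr_some, RingHom.comp_apply, Yi_X]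

theorem Yr_map (a : GH G →+* R) (τ : R →+* R') :
    (MvPolynomial.map τ).comp (Yr gd D a) = (Yr gd D (τ.comp a)).comp (MvPolynomial.map τ) := by
  apply MvPolynomial.ringHom_ext
  · intro r
    simp only [RingHom.comp_apply, Yr_C, MvPolynomial.map_C]
  · rintro ⟨i, _ | j⟩
    · simp only [RingHom.comp_apply, Yr_none, MvPolynomial.map_X, map_neg, map_sum, map_mul, MvPolynomial.map_C]
    · simp only [RingHom.comp_apply, Yr_some, MvPolynomial.map_X]

/-- translation -/
def Yt (b h : GH G →+* R) : MvPolynomial (D × Fin n) R →+* MvPolynomial (D × Fin n) R :=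
  ((Yr gd D (rmul G b h)).comp (Sb gd D h)).comp (Yi D n R)

theorem Yt_Yr {b h : GH G →+* R} (hc : b.comp (kH G) = h.comp (kH G)) :
    (Yt gd (D := D) b h).comp (Yr gd D b) = (Yr gd D (rmul G b h)).comp (Sb gd D h) := by
  apply Yr_factor
  intro i
  rw [← Yr_rel gd (D := D) (rmul G b h) i]
  simp only [RingHom.comp_apply, Sb_C, Sb_X, Yr_C, map_sum, map_mul, gd.act b h hc, Finset.mul_sum, Finset.sum_mul]
  rw [Finset.sum_comm]
  refine Finset.sum_congr rfl fun o _ => Finset.sum_congr rfl fun j _ => ?_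
  ring

theorem Yt_inv {b h : GH G →+* R} (hc : b.comp (kH G) = h.comp (kH G)) :
    (Yt gd (D := D) (rmul G b h) (rinv G h)).comp (Yt gd b h) = RingHom.id _ := by
  have e : rmul G (rmul G b h) (rinv G h) = b := by
    rw [rmul_assoc G hc (rinv_k _ _).symm, rmul_inv G h _ rfl, rmul_one G b _ hc.symm]
  have h1 := Yt_Yr gd (D := D) hc
  have h2 := Yt_Yr gd (D := D) (b := rmul G b h) (h := rinv G h) (by rw [rmul_k, rinv_k, hc])
  rw [e] at h2
  have h3 : ((Yt gd (D := D) (rmul G b h) (rinv G h)).comp (Yt gd b h)).comp (Yr gd D b) = Yr gd D b := by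
    rw [RingHom.comp_assoc, h1, ← RingHom.comp_assoc, h2, RingHom.comp_assoc, Sb_inv, RingHom.comp_id]
  rw [← Yr_Yi gd b]
  conv_rhs => rw [← h3]
  rw [RingHom.comp_assoc _ (Yr gd D b), Yr_Yi, RingHom.comp_id]

theorem Yt_regular {b h : GH G →+* R} (hc : b.comp (kH G) = h.comp (kH G)) {q : MvPolynomial (D × Fin n) R}
    (hq : q ∈ nonZeroDivisors (MvPolynomial (D × Fin n) R)) : Yt gd b h q ∈ nonZeroDivisors (MvPolynomial (D × Fin n) R) := by
  have e : rmul G (rmul G b h) (rinv G h) = b := by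
    rw [rmul_assoc G hc (rinv_k _ _).symm, rmul_inv G h _ rfl, rmul_one G b _ hc.symm]
  have h1 := Yt_inv gd (D := D) hc
  have h2 := Yt_inv gd (D := D) (b := rmul G b h) (h := rinv G h) (by rw [rmul_k, rinv_k, hc])
  have ei : rinv G (rinv G h) = h := by
    have e1 : (rinv G (rinv G h)).comp (kH G) = h.comp (kH G) := by rw [rinv_k, rinv_k]
    rw [← rmul_one G (rinv G (rinv G h)) _ rfl, e1, ← rinv_mul G h _ rfl, ← rmul_assoc G (by rw [rinv_k]) (rinv_k _ _),
      rinv_mul G (rinv G h) _ rfl, rone_mul]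
    rw [rinv_k]
  rw [e, ei] at h2
  rw [mem_nonZeroDivisors_iff] at hq ⊢
  have key : ∀ p, Yt gd b h q * p = 0 → p = 0 := by
    intro p hp
    have h3 := congrArg (Yt gd (D := D) (rmul G b h) (rinv G h)) hp
    rw [map_mul, map_zero] at h3
    rw [show Yt gd (rmul G b h) (rinv G h) (Yt gd b h q) = q from RingHom.congr_fun h1 q] at h3
    have h4 := hq.1 _ h3
    rw [← show Yt gd b h (Yt gd (rmul G b h) (rinv G h) p) = p from RingHom.congr_fun h2 p, h4, map_zero]
  exact ⟨key, fun p hp => key p (by rw [mul_comm]; exact hp)⟩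

/-- the value of the transported variables -/
def yv (g : GH G →+* R) (w : D × Option (Fin n) → R) (p : D × Option (Fin n)) : R := ∑ j, g (gd.m p.2 j) * w (p.1, j)

theorem yv_rel (g : GH G →+* R) (w : D × Option (Fin n) → R) (h : ∀ i, ∑ o, w (i, o) * g (eExt gd.ε o) = 0)
    (κ : k →+* R) (hκ : κ = g.comp (kH G)) (i) : ∑ o, rone G κ (eExt gd.ε o) * yv gd g w (i, o) = 0 := by
  rw [← h i]
  unfold yv
  have : ∀ j, g (eExt gd.ε j) = ∑ o, rone G κ (eExt gd.ε o) * g (gd.m o j) := by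
    intro j
    rw [← gd.act _ _ (by rw [rone_k, hκ]), rone_mul G g κ hκ]
  simp only [this, Finset.mul_sum]
  rw [Finset.sum_comm]
  refine Finset.sum_congr rfl fun o _ => Finset.sum_congr rfl fun j _ => ?_
  ring

theorem yv_eval (g : GH G →+* R) (w : D × Option (Fin n) → R) (h : ∀ i, ∑ o, w (i, o) * g (eExt gd.ε o) = 0)
    (κ : k →+* R) (hκ : κ = g.comp (kH G)) :
    (MvPolynomial.eval (fun p : D × Fin n => yv gd g w (p.1, some p.2))).comp (Yr gd D (rone G κ)) = (MvPolynomial.eval w).comp (Sb gd D g) := by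
  have h1 : (MvPolynomial.eval w).comp (Sb gd D g) = MvPolynomial.eval (yv gd g w) := Sb_eval gd g w
  rw [h1, ← Yr_factor gd (rone G κ) (MvPolynomial.eval (yv gd g w))]
  · congr 1
    apply MvPolynomial.ringHom_ext
    · intro r; simp [Yi_C]
    · intro p; simp [Yi_X]
  · intro i
    simp only [MvPolynomial.eval_C, MvPolynomial.eval_X]
    exact yv_rel gd g w h κ hκ i

end PartYr

section PartYinj
variable {k : Type u} [Field k] {G : GroupSchemeOver k} [IsAffine G.carrier] {n : ℕ} {gd : GData G n} {D : Type} {L : Type u} [Field L]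
    [Algebra (MvPolynomial (D × Option (Fin n)) k) L]
    [IsFractionRing (MvPolynomial (D × Option (Fin n)) k) L] (GA : GenAlg k gd.ε D L)

/-- generic coordinates -/
abbrev wA (p : D × Option (Fin n)) : GA.A := wL GA (algebraMap L GA.A) p

theorem inj_A : Function.Injective (MvPolynomial.eval₂Hom (GA.γ.comp (kH G)) (fun p : D × Fin n => yv gd GA.γ (wA GA) (p.1, some p.2))) := by
  rw [injective_iff_map_eq_zero]
  intro q hq
  by_contra hne
  have h1 := map_regular (E := GH G) hne
  let κ := kH G
  have hc : (rone G κ).comp (kH G) = (RingHom.id (GH G)).comp (kH G) := by rw [rone_k]; rfl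
  have h2 := Yt_regular gd (D := D) hc h1
  have h3 := GA.flat
  algebraize [MvPolynomial.eval₂Hom GA.γ (fun p : D × Fin n => algebraMap L GA.A
    (algebraMap (MvPolynomial (D × Option (Fin n)) k) L (MvPolynomial.X (p.1, some p.2))))]
  have h4 := Module.Flat.isSMulRegular_of_nonZeroDivisors (M := GA.A) h2
  have hm : rmul G (rone G κ) (RingHom.id (GH G)) = RingHom.id (GH G) := by
    apply rone_mul
    rfl
  let F := MvPolynomial.eval₂Hom GA.γ (fun p : D × Fin n => algebraMap L GA.A
    (algebraMap (MvPolynomial (D × Option (Fin n)) k) L (MvPolynomial.X (p.1, some p.2))))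
  have hF : F.comp (Yr gd D (RingHom.id (GH G))) = MvPolynomial.eval₂Hom GA.γ (wA GA) := by
    rw [← Yr_factor gd (RingHom.id (GH G)) (MvPolynomial.eval₂Hom GA.γ (wA GA))]
    · congr 1
      apply MvPolynomial.ringHom_ext
      · intro r; simp [F, Yi_C]
      · intro p; simp [F, Yi_X, wL]
    · intro i
      have := GA.rel i
      simp only [MvPolynomial.coe_eval₂Hom, MvPolynomial.eval₂_C, MvPolynomial.eval₂_X]
      rw [← this]
      refine Finset.sum_congr rfl fun o _ => ?_
      rw [mul_comm]; rfl
  have e : (F.comp (Yt gd (D := D) (rone G κ) (RingHom.id (GH G)))).comp (MvPolynomial.map (algebraMap k (GH G)))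
     = (MvPolynomial.eval₂Hom (GA.γ.comp (kH G)) (fun p : D × Fin n => yv gd GA.γ (wA GA) (p.1, some p.2))) := by
    unfold Yt
    rw [hm]
    have e0 : ∀ q, F (Yr gd D (RingHom.id (GH G)) q) = MvPolynomial.eval₂Hom GA.γ (wA GA) q := fun q => RingHom.congr_fun hF q
    apply MvPolynomial.ringHom_ext
    · intro r; simp only [RingHom.comp_apply, MvPolynomial.map_C, Yi_C, Sb_C, e0, kH_eq, MvPolynomial.coe_eval₂Hom, MvPolynomial.eval₂_C]
    · intro p
      simp only [RingHom.comp_apply, MvPolynomial.map_X, Yi_X, Sb_X, e0, map_sum, map_mul, MvPolynomial.coe_eval₂Hom, MvPolynomial.eval₂_C, MvPolynomial.eval₂_X]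
      rfl
  have e2 := RingHom.congr_fun e q
  rw [hq] at e2
  have : (1 : GA.A) = 0 := by
    apply h4
    change _ • (1 : GA.A) = _ • (0 : GA.A)
    rw [smul_zero, Algebra.smul_def, mul_one]
    exact e2
  exact one_ne_zero this

open TensorProduct in
theorem inj_tensor {k K A σ : Type*} [Field k] [Field K] [CommRing A] [Algebra k K] [Algebra k A] (y : σ → A)
    (h : Function.Injective (MvPolynomial.eval₂Hom (algebraMap k A) y)) :
    Function.Injective (MvPolynomial.eval₂Hom (algebraMap K (K ⊗[k] A)) (fun p => (1 : K) ⊗ₜ[k] y p)) := by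
  rw [injective_iff_map_eq_zero] at h ⊢
  intro r hr
  have key : ∀ ℓ : K →ₗ[k] k, ∀ r : MvPolynomial σ K, TensorProduct.lid k A (TensorProduct.map ℓ LinearMap.id (MvPolynomial.eval₂Hom (algebraMap K (K ⊗[k] A)) (fun p => (1 : K) ⊗ₜ[k] y p) r))
      = MvPolynomial.eval₂Hom (algebraMap k A) y (lc ℓ r) := by
    intro ℓ r
    have hd : ∀ d : σ →₀ ℕ, (d.prod fun n e => ((1 : K) ⊗ₜ[k] y n) ^ e) = (1 : K) ⊗ₜ[k] (d.prod fun n e => y n ^ e) := by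
      intro d
      have : ∀ z : A, (1 : K) ⊗ₜ[k] z = (Algebra.TensorProduct.includeRight : A →ₐ[k] K ⊗[k] A) z := fun _ => rfl
      simp only [this]
      rw [Finsupp.prod, Finsupp.prod, map_prod]
      simp only [map_pow]
    rw [MvPolynomial.coe_eval₂Hom, MvPolynomial.eval₂_eq, lc, map_sum, map_sum, map_sum]
    refine Finset.sum_congr rfl fun d _ => ?_
    rw [MvPolynomial.coe_eval₂Hom, MvPolynomial.eval₂_monomial]
    have h1 := hd d
    rw [Finsupp.prod] at h1
    rw [h1, Algebra.TensorProduct.algebraMap_apply, Algebra.TensorProduct.tmul_mul_tmul, one_mul, mul_one,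
      TensorProduct.map_tmul, TensorProduct.lid_tmul, Algebra.smul_def]
    rfl
  ext d
  rw [MvPolynomial.coeff_zero]
  rw [← Module.forall_dual_apply_eq_zero_iff k]
  intro ℓ
  rw [← coeff_lc, h (lc ℓ r), MvPolynomial.coeff_zero]
  rw [← key, hr, map_zero, map_zero]
end PartYinj

section PartM6
variable {k : Type u} [Field k] {G : GroupSchemeOver k} [IsAffine G.carrier] {X : SchemeOver k} {α : ActionOver G X}
    [IsIntegral X.carrier] {n : ℕ} {gd : GData G n} {D : Type} {L : Type u} [Field L]
    [Algebra (MvPolynomial (D × Option (Fin n)) k) L]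
    [IsFractionRing (MvPolynomial (D × Option (Fin n)) k) L] {GA : GenAlg k gd.ε D L}
    {s : Polynomial X.carrier.functionField}

theorem Y_key (hcov : ∀ p, ∃ α b, Chart s.coeff p α b) (hn : IsNormalScheme X.carrier)
    {f : Polynomial (MvPolynomial (D × Option (Fin n)) X.carrier.functionField)} (hf : IsGen α gd GA s f)
    {S : Type u} [CommRing S] [IsLocalRing S] (lam : L →+* S) (g : GH G →+* S) (x : Spec (CommRingCat.of S) ⟶ X.carrier)
    (hk : kst X x = kL GA lam) (h1 : g.comp (kH G) = kL GA lam) (h2 : ∀ i, ∑ o, wL GA lam (i, o) * g (eExt gd.ε o) = 0)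
    {a : Polynomial (MvPolynomial (D × Option (Fin n)) S)} (ha : PresS (cf f) x (cf a)) :
    ∃ N v, IsNm α gd GA s lam (ract α (rinv G g) x) N ∧ IsUnit v ∧
      (a.map (Yr gd D (rone G (kst X x)))).map (MvPolynomial.eval (fun p : D × Fin n => yv gd g (wL GA lam) (p.1, some p.2)))
        = Polynomial.C v * N := by
  have hgx : g.comp (kH G) = kst X x := h1.trans hk.symm
  have hix : (rinv G g).comp (kH G) = kst X x := by rw [rinv_k, hgx]
  obtain ⟨N, hN⟩ := exists_isNm (gd := gd) (α := α) (GA := GA) hcov lam (ract α (rinv G g) x)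
  obtain ⟨b, hb⟩ := exists_cf_presS hcov hn hf (ract α (rinv G g) x)
  obtain ⟨u, hu, hNu⟩ := nm_star hcov hn hf (by rw [ract_k, hk]) hb hN
  have e : ract α g (ract α (rinv G g) x) = x := by
    rw [← ract_mul α hgx hix, rmul_inv G g _ rfl, ract_one]
    exact hgx
  obtain ⟨z, hz, hzb⟩ := eq_main hcov hn hf g (ract α (rinv G g) x) (by rw [ract_k, hgx]) hb (by rw [e]; exact ha)
  have e1 : a.map (Sb gd D g) = Polynomial.C (MvPolynomial.C z) * b := by
    apply cf_ext
    intro i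
    rw [hzb, cf_CC]
  refine ⟨N, z * hu.unit⁻¹, hN, hz.mul (hu.unit⁻¹).isUnit, ?_⟩
  rw [Polynomial.map_map, yv_eval gd g (wL GA lam) h2 _ hgx.symm, ← Polynomial.map_map, e1, Polynomial.map_mul, hNu,
    Polynomial.map_C, MvPolynomial.eval_C, ← mul_assoc, ← Polynomial.C_mul, mul_assoc, hu.val_inv_mul, mul_one]

open TensorProduct in
/-- some coefficient of the restriction is a unit -/
theorem Y_unit (hcov : ∀ p, ∃ α b, Chart s.coeff p α b) (hn : IsNormalScheme X.carrier)
    {f : Polynomial (MvPolynomial (D × Option (Fin n)) X.carrier.functionField)} (hf : IsGen α gd GA s f)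
    (p : X.carrier) (β) (b : Polynomial (MvPolynomial (D × Option (Fin n)) (X.carrier.presheaf.stalk p)))
    (hb : Chart (cf f) p β (cf b)) :
    ∃ i, IsUnit (cf (b.map (Yr gd D (rone G (kst X (fstalk X.carrier p))))) i) := by
  let B := X.carrier.presheaf.stalk p
  let κ := IsLocalRing.ResidueField B
  letI : Algebra k κ := ((IsLocalRing.residue B).comp (kst X (fstalk X.carrier p))).toAlgebra
  letI : Algebra k GA.A := (GA.γ.comp (kH G)).toAlgebra
  have hnt : Nontrivial (κ ⊗[k] GA.A) := inferInstance
  obtain ⟨M, hM⟩ := Ideal.exists_maximal (κ ⊗[k] GA.A)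
  let S := (κ ⊗[k] GA.A) ⧸ M
  letI : Field S := Ideal.Quotient.field M
  let μ : κ ⊗[k] GA.A →+* S := Ideal.Quotient.mk M
  let θ : κ →+* S := μ.comp (algebraMap κ (κ ⊗[k] GA.A))
  let ι : GA.A →+* S := μ.comp (Algebra.TensorProduct.includeRight : GA.A →ₐ[k] κ ⊗[k] GA.A).toRingHom
  have hι : θ.comp (algebraMap k κ) = ι.comp (algebraMap k GA.A) := by
    ext c
    change μ ((algebraMap k κ c) ⊗ₜ 1) = μ (1 ⊗ₜ (algebraMap k GA.A c))
    congr 1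
    rw [Algebra.algebraMap_eq_smul_one, Algebra.algebraMap_eq_smul_one, TensorProduct.smul_tmul]
  let φ : B →+* S := θ.comp (IsLocalRing.residue B)
  let lam : L →+* S := ι.comp (algebraMap L GA.A)
  let g : GH G →+* S := ι.comp GA.γ
  have hkA : GA.γ.comp (kH G) = kL GA (algebraMap L GA.A) := by
    ext c; exact GA.γ_k c
  have h1 : g.comp (kH G) = kL GA lam := by
    rw [kL_comp, ← hkA]; rfl
  have hk : kst X (smap φ ≫ fstalk X.carrier p) = kL GA lam := by
    rw [← h1, kst_comp]
    exact hι
  have h2 : ∀ i, ∑ o, wL GA lam (i, o) * g (eExt gd.ε o) = 0 := by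
    intro i
    have := congrArg ι (GA.rel i)
    rw [map_sum, map_zero] at this
    rw [← this]
    refine Finset.sum_congr rfl fun o _ => ?_
    rw [map_mul]; rfl
  have hP := hb.pres.map φ
  have hP' : PresS (cf f) (smap φ ≫ fstalk X.carrier p) (cf (b.map (MvPolynomial.map φ))) := by
    convert hP using 1
    funext i
    rw [cf_map]
  obtain ⟨N, v, hN, hv, hNv⟩ := Y_key hcov hn hf lam g _ hk h1 h2 hP'
  have hN0 := hN.ne_zero
  have hne : (b.map (MvPolynomial.map φ)).map (Yr gd D (rone G (kst X (smap φ ≫ fstalk X.carrier p)))) ≠ 0 := by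
    intro h0
    rw [h0, Polynomial.map_zero] at hNv
    exact mul_ne_zero (Polynomial.C_ne_zero.mpr hv.ne_zero) hN0 hNv.symm
  rw [Polynomial.map_map, kst_comp, ← rone_nat, ← Yr_map, ← Polynomial.map_map] at hne
  by_contra hc
  push Not at hc
  apply hne
  apply cf_ext
  intro i
  rw [cf_map]
  have := hc i
  rw [← IsLocalRing.residue_ne_zero_iff_isUnit, not_not] at this
  change θ (IsLocalRing.residue B _) = _
  rw [this, map_zero]
  simp [cf]

open TensorProduct in
theorem Y_dvd (hcov : ∀ p, ∃ α b, Chart s.coeff p α b) (hn : IsNormalScheme X.carrier)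
    {f : Polynomial (MvPolynomial (D × Option (Fin n)) X.carrier.functionField)} (hf : IsGen α gd GA s f) :
    s.map MvPolynomial.C ∣ f.map (Yr gd D (rone G (kst X (xη X.carrier)))) := by
  let K := X.carrier.functionField
  letI : Algebra k K := (kst X (xη X.carrier)).toAlgebra
  letI : Algebra k GA.A := (GA.γ.comp (kH G)).toAlgebra
  have hs0 : s ≠ 0 := by
    rintro rfl
    obtain ⟨a, b, h, _⟩ := hcov (genericPoint X.carrier)
    exact h (by simp)
  have hs : ∃ i, s.coeff i ≠ 0 := ⟨_, Polynomial.leadingCoeff_ne_zero.mpr hs0⟩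
  set s1 := s * Polynomial.C (s.leadingCoeff⁻¹) with hs1
  have hmon : s1.Monic := Polynomial.monic_mul_leadingCoeff_inv hs0
  set s2 : Polynomial (MvPolynomial (D × Fin n) K) := s1.map MvPolynomial.C with hs2
  have hmon2 : s2.Monic := hmon.map _
  set fY := f.map (Yr gd D (rone G (kst X (xη X.carrier)))) with hfY
  have hmod : fY %ₘ s2 = 0 := by
    let ev := MvPolynomial.eval₂Hom (algebraMap K (K ⊗[k] GA.A)) (fun p : D × Fin n => (1 : K) ⊗ₜ[k] yv gd GA.γ (wA GA) (p.1, some p.2))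
    have hinj : Function.Injective ev := inj_tensor _ (inj_A GA)
    apply Polynomial.map_injective ev hinj
    rw [Polynomial.map_zero, Polynomial.map_modByMonic _ hmon2]
    ext i
    rw [Polynomial.coeff_zero]
    apply eq_of_local
    intro S _ _ τ
    let θ : K →+* S := τ.comp (algebraMap K (K ⊗[k] GA.A))
    let ι : GA.A →+* S := τ.comp (Algebra.TensorProduct.includeRight : GA.A →ₐ[k] K ⊗[k] GA.A).toRingHom
    have hι : θ.comp (algebraMap k K) = ι.comp (algebraMap k GA.A) := by
      ext c
      change τ ((algebraMap k K c) ⊗ₜ 1) = τ (1 ⊗ₜ (algebraMap k GA.A c))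
      congr 1
      rw [Algebra.algebraMap_eq_smul_one, Algebra.algebraMap_eq_smul_one, TensorProduct.smul_tmul]
    let lam : L →+* S := ι.comp (algebraMap L GA.A)
    let g : GH G →+* S := ι.comp GA.γ
    have hkA : GA.γ.comp (kH G) = kL GA (algebraMap L GA.A) := by
      ext c; exact GA.γ_k c
    have h1 : g.comp (kH G) = kL GA lam := by
      rw [kL_comp, ← hkA]; rfl
    have hk : kst X (smap θ ≫ xη X.carrier) = kL GA lam := by
      rw [← h1, kst_comp]
      exact hι
    have h2 : ∀ i, ∑ o, wL GA lam (i, o) * g (eExt gd.ε o) = 0 := by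
      intro i
      have := congrArg ι (GA.rel i)
      rw [map_sum, map_zero] at this
      rw [← this]
      refine Finset.sum_congr rfl fun o _ => ?_
      rw [map_mul]; rfl
    have hP := (presS_generic (isGen_ne hf)).map θ
    have hP' : PresS (cf f) (smap θ ≫ xη X.carrier) (cf (f.map (MvPolynomial.map θ))) := by
      convert hP using 1
      funext i
      rw [cf_map]
    obtain ⟨N, v, hN, hv, hNv⟩ := Y_key hcov hn hf lam g _ hk h1 h2 hP'
    have hgx : g.comp (kH G) = kst X (smap θ ≫ xη X.carrier) := h1.trans hk.symm
    have hix : (rinv G g).comp (kH G) = kst X (smap θ ≫ xη X.carrier) := by rw [rinv_k, hgx]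
    obtain ⟨l, hl, hlN⟩ := hN.dvd (by rw [ract_k, hk]) g h1 h2
    have e : ract α g (ract α (rinv G g) (smap θ ≫ xη X.carrier)) = (smap θ ≫ xη X.carrier) := by
      rw [← ract_mul α hgx hix, rmul_inv G g _ rfl, ract_one]
      exact hgx
    rw [e] at hl
    obtain ⟨z, hz, hzl⟩ := ((presS_generic (c := s.coeff) hs).map θ).unique hl
    have hsl : l = s.map θ * Polynomial.C z := by
      ext i
      rw [hzl, Polynomial.coeff_mul_C, Polynomial.coeff_map, mul_comm]
    have hd : s.map θ ∣ Polynomial.C v * N := (Dvd.intro _ hsl.symm).trans (hlN.trans (Dvd.intro_left _ rfl))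
    rw [← hNv] at hd
    have hev : ((f.map (MvPolynomial.map θ)).map (Yr gd D (rone G (kst X (smap θ ≫ xη X.carrier))))).map (MvPolynomial.eval (fun p : D × Fin n => yv gd g (wL GA lam) (p.1, some p.2)))
        = (fY.map ev).map τ := by
      rw [Polynomial.map_map _ _ f, kst_comp, ← rone_nat, ← Yr_map, ← Polynomial.map_map, ← hfY, Polynomial.map_map _ _ fY, Polynomial.map_map _ _ fY]
      congr 1
      apply MvPolynomial.ringHom_ext
      · intro r
        simp [ev, θ]
      · intro p
        simp only [RingHom.comp_apply, MvPolynomial.map_X, MvPolynomial.eval_X, ev, MvPolynomial.coe_eval₂Hom, MvPolynomial.eval₂_X]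
        change _ = ι _
        unfold yv
        rw [map_sum]
        refine Finset.sum_congr rfl fun o _ => ?_
        rw [map_mul]; rfl
    rw [hev] at hd
    have hs1τ : (s2.map ev).map τ = s1.map θ := by
      rw [hs2, Polynomial.map_map, Polynomial.map_map]
      congr 1
      ext r
      simp [ev, θ]
    have hd1 : s1.map θ ∣ (fY.map ev).map τ := by
      refine dvd_trans ?_ hd
      refine ⟨Polynomial.C (θ s.leadingCoeff), ?_⟩
      rw [hs1, Polynomial.map_mul, Polynomial.map_C, mul_assoc, ← Polynomial.C_mul, ← map_mul,
        inv_mul_cancel₀ (Polynomial.leadingCoeff_ne_zero.mpr hs0), map_one, Polynomial.C_1, mul_one]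
    rw [map_zero, ← Polynomial.coeff_map, Polynomial.map_modByMonic _ (hmon2.map _), hs1τ,
      (Polynomial.modByMonic_eq_zero_iff_dvd (hmon.map θ)).mpr hd1, Polynomial.coeff_zero]
  have h3 := (Polynomial.modByMonic_eq_zero_iff_dvd hmon2).mp hmod
  refine dvd_trans ?_ h3
  rw [hs2, hs1, Polynomial.map_mul]
  exact Dvd.intro _ rfl
end PartM6

section PartM6b
variable {k : Type u} [Field k] {G : GroupSchemeOver k} [IsAffine G.carrier] {X : SchemeOver k} {α : ActionOver G X}
    [IsIntegral X.carrier] {n : ℕ} {gd : GData G n} {D : Type} {L : Type u} [Field L]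
    [Algebra (MvPolynomial (D × Option (Fin n)) k) L]
    [IsFractionRing (MvPolynomial (D × Option (Fin n)) k) L] {GA : GenAlg k gd.ε D L}
    {s : Polynomial X.carrier.functionField}

theorem exists_unit_of_sum {R ι : Type*} [CommRing R] [IsLocalRing R] (S : Finset ι) (t : ι → R)
    (h : IsUnit (∑ i ∈ S, t i)) : ∃ i ∈ S, IsUnit (t i) := by
  by_contra hc
  push Not at hc
  have : ∑ i ∈ S, t i ∈ IsLocalRing.maximalIdeal R := Ideal.sum_mem _ fun i hi => hc i hi
  exact this h

theorem M6_sections (hcov : ∀ p, ∃ α b, Chart s.coeff p α b) (hn : IsNormalScheme X.carrier)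
    {f : Polynomial (MvPolynomial (D × Option (Fin n)) X.carrier.functionField)} (hf : IsGen α gd GA s f) :
    ∃ q : Polynomial (MvPolynomial (D × Fin n) X.carrier.functionField), ∀ p β b, Chart (cf f) p β b →
      (∀ i j, ∃ t, tK X.carrier p t * cf f β = s.coeff i * cf q j) ∧
      (∃ i j t, IsUnit t ∧ tK X.carrier p t * cf f β = s.coeff i * cf q j) := by
  obtain ⟨q, hq⟩ := Y_dvd hcov hn hf
  refine ⟨q, fun p β b hb => ?_⟩
  obtain ⟨fB, hfB⟩ := exists_cf f b (fun i hi => by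
    have := hb.2 i
    rw [hi] at this
    apply tK_inj X.carrier
    rw [map_zero]
    exact (mul_eq_zero.mp this).resolve_right hb.1)
  haveI := (hn p).1
  haveI := (hn p).2
  haveI := range_intClosed (X.carrier.presheaf.stalk p) X.carrier.functionField
  have hb' : Chart (cf f) p β (cf fB) := by
    have : cf fB = b := funext hfB
    rw [this]; exact hb
  have hfK : fB.map (MvPolynomial.map (tK X.carrier p)) = Polynomial.C (MvPolynomial.C (cf f β)⁻¹) * f := by
    apply cf_ext
    intro i
    rw [cf_map, cf_CC, eq_inv_mul_iff_mul_eq₀ hb.1, mul_comm]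
    exact hb'.2 i
  have hF : (fB.map (Yr gd D (rone G (kst X (fstalk X.carrier p))))).map (MvPolynomial.map (tK X.carrier p)) =
      s.map MvPolynomial.C * (Polynomial.C (MvPolynomial.C (cf f β)⁻¹) * q) := by
    rw [Polynomial.map_map, Yr_map, rone_nat, ← kst_comp, tK_xη, ← Polynomial.map_map, hfK, Polynomial.map_mul, hq,
      Polynomial.map_C, Yr_C]
    ring
  have hmem : ∀ i j, ∃ t, tK X.carrier p t * cf f β = s.coeff i * cf q j := by
    intro i j
    have := kron2 (algebraMap (X.carrier.presheaf.stalk p) X.carrier.functionField).range (s.map MvPolynomial.C)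
      (Polynomial.C (MvPolynomial.C (cf f β)⁻¹) * q) (fun d l => by
        rw [← hF]
        exact ⟨_, (cf_map _ _ (d, l)).symm⟩) 0 j.1 i j.2
    obtain ⟨t, ht⟩ := this
    refine ⟨t, ?_⟩
    have ht' : tK X.carrier p t = s.coeff i * cf (Polynomial.C (MvPolynomial.C (cf f β)⁻¹) * q) j := by
      refine ht.trans ?_
      congr 1
      rw [Polynomial.coeff_map, MvPolynomial.coeff_zero_C]
    rw [ht', cf_CC, mul_assoc, mul_assoc]
    congr 1
    rw [mul_comm, mul_assoc, mul_inv_cancel₀ hb.1, mul_one]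
  refine ⟨hmem, ?_⟩
  obtain ⟨i₀, hu⟩ := Y_unit hcov hn hf p β fB hb'
  choose t ht using hmem
  have : cf (fB.map (Yr gd D (rone G (kst X (fstalk X.carrier p))))) i₀ =
      ∑ x ∈ Finset.HasAntidiagonal.antidiagonal i₀.2, t x.1 (i₀.1, x.2) := by
    apply tK_inj X.carrier
    rw [← cf_map, hF, map_sum]
    unfold cf
    rw [Polynomial.coeff_mul, MvPolynomial.coeff_sum]
    refine Finset.sum_congr rfl fun x _ => ?_
    apply mul_right_cancel₀ hb.1
    rw [ht, Polynomial.coeff_map, MvPolynomial.coeff_C_mul, Polynomial.coeff_C_mul, MvPolynomial.coeff_C_mul, mul_assoc]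
    congr 1
    rw [mul_comm]
    exact mul_inv_cancel_left₀ hb.1 _
  rw [this] at hu
  obtain ⟨x, -, hx⟩ := exists_unit_of_sum _ _ hu
  exact ⟨_, _, _, hx, ht _ _⟩
end PartM6b

section PartM6c

theorem affine_of_locally_basic {X : Scheme.{u}} {U W : X.Opens} (hU : IsAffineOpen U) (hWU : W ≤ U)
    (h : ∀ y ∈ U, ∃ (V : X.Opens) (_ : y ∈ V) (t : Γ(X, V)), W ⊓ V = X.basicOpen t) : IsAffineOpen W := by
  have h' : ∀ y : U, ∃ g : Γ(X, U), y.1 ∈ X.basicOpen g ∧ IsAffineOpen (W ⊓ X.basicOpen g) := by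
    rintro ⟨y, hy⟩
    obtain ⟨V, hyV, t, ht⟩ := h y hy
    obtain ⟨g, hgV, hyg⟩ := hU.exists_basicOpen_le ⟨y, hyV⟩ hy
    refine ⟨g, hyg, ?_⟩
    have : W ⊓ X.basicOpen g = X.basicOpen (X.presheaf.map (homOfLE hgV).op t) := by
      rw [Scheme.basicOpen_res, ← ht]
      rw [inf_comm W V, ← inf_assoc, inf_eq_left.mpr hgV, inf_comm]
    rw [this]
    exact (hU.basicOpen g).basicOpen _
  choose g hg hga using h'
  have hspan : Ideal.span (Set.range g) = ⊤ := by
    rw [← hU.self_le_iSup_basicOpen_iff]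
    intro y hy
    exact TopologicalSpace.Opens.mem_iSup.mpr ⟨⟨g ⟨y, hy⟩, ⟨y, hy⟩, rfl⟩, hg ⟨y, hy⟩⟩
  let ρ := (X.presheaf.map (homOfLE hWU).op).hom
  refine isAffineOpen_of_isAffineOpen_basicOpen W (ρ '' Set.range g) ?_ ?_
  · rw [← Ideal.map_span, hspan, Ideal.map_top]
  · rintro _ ⟨_, ⟨y, rfl⟩, rfl⟩
    have : X.basicOpen (ρ (g y)) = W ⊓ X.basicOpen (g y) := Scheme.basicOpen_res _ _ _
    rw [this]
    exact hga y

theorem Chart.germ_fin {X : Scheme.{u}} [IsIntegral X] {ι : Type*} {c : ι → X.functionField} (hfin : {i | c i ≠ 0}.Finite) {p : X} {α : ι} {b : ι → X.presheaf.stalk p}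
    (h : Chart c p α b) : ∃ (U : X.Opens) (hp : p ∈ U), ∀ q (hq : q ∈ U), ∃ b', Chart c q α b' := by
  classical
  haveI : Finite {i // c i ≠ 0} := hfin
  have h' : Chart (fun i : {i // c i ≠ 0} => c i.1) p ⟨α, h.1⟩ (fun i => b i.1) := ⟨h.1, fun β => h.2 β.1⟩
  obtain ⟨U, hp, g, _, hg⟩ := h'.germ
  refine ⟨U, hp, fun q hq => ⟨fun i => if hi : c i ≠ 0 then X.presheaf.germ U q hq (g ⟨i, hi⟩) else 0, h.1, fun β => ?_⟩⟩
  by_cases hi : c β ≠ 0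
  · dsimp only
    rw [dif_pos hi]
    exact (hg q hq).2 ⟨β, hi⟩
  · dsimp only
    rw [dif_neg hi, map_zero, zero_mul]
    exact (not_not.mp hi).symm

theorem sec_local {X : Scheme.{u}} [IsIntegral X] {ι : Type*} {c : ι → X.functionField} (hfin : {i | c i ≠ 0}.Finite) {r : X.functionField}
    {y : X} {β : ι} {b : ι → X.presheaf.stalk y} (hb : Chart c y β b) {t : X.presheaf.stalk y} (ht : tK X y t * c β = r) :
    ∃ (V : X.Opens) (hy : y ∈ V) (t' : Γ(X, V)), X.presheaf.germ V y hy t' = t ∧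
      ∀ q (hq : q ∈ V), (∃ b', Chart c q β b') ∧ tK X q (X.presheaf.germ V q hq t') * c β = r := by
  obtain ⟨V₁, hy₁, hq₁⟩ := hb.germ_fin hfin
  obtain ⟨V₂, hy₂, t', ht'⟩ := TopCat.Presheaf.exists_germ_eq X.presheaf t
  refine ⟨V₁ ⊓ V₂, ⟨hy₁, hy₂⟩, X.presheaf.map (homOfLE inf_le_right).op t', ?_, ?_⟩
  · exact (TopCat.Presheaf.germ_res_apply X.presheaf (homOfLE inf_le_right) y _ t').trans ht'
  · intro q hq
    refine ⟨hq₁ q hq.1, ?_⟩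
    have e := TopCat.Presheaf.germ_res_apply X.presheaf (homOfLE (inf_le_right : V₁ ⊓ V₂ ≤ V₂)) q hq t'
    rw [e, ← ht, ← ht']
    congr 1
    haveI : Nonempty V₂ := ⟨⟨y, hy₂⟩⟩
    exact (Scheme.algebraMap_germ_eq_germToFunctionField X _ _).trans
        (Scheme.algebraMap_germ_eq_germToFunctionField X _ _).symm

/-- `r` is a unit at `y` -/
def UnitAt {X : Scheme.{u}} [IsIntegral X] {ι : Type*} (c : ι → X.functionField) (r : X.functionField) (y : X) : Prop :=
  ∃ α b t, Chart c y α b ∧ IsUnit t ∧ tK X y t * c α = r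

theorem UnitAt.unit {X : Scheme.{u}} [IsIntegral X] {ι : Type*} {c : ι → X.functionField} {r : X.functionField} {y : X}
    (h : UnitAt c r y) {β b t} (hb : Chart c y β b) (ht : tK X y t * c β = r) : IsUnit t := by
  obtain ⟨β', b', t', hb', hu, ht'⟩ := h
  obtain ⟨z, hz, hzb⟩ := hb'.chart hb
  have : t' = t * b' β := by
    apply tK_inj X
    apply mul_right_cancel₀ hb'.1
    rw [ht', map_mul, mul_assoc, hb'.2, ht]
  rw [this] at hu
  exact isUnit_of_mul_isUnit_left hu

theorem M6_affine {X : Scheme.{u}} [IsIntegral X] {ι : Type*} {c : ι → X.functionField} (hfin : {i | c i ≠ 0}.Finite) {r : X.functionField}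
    (hcov : ∀ p : X, ∃ α b, Chart c p α b) (hr : ∀ y β b, Chart c y β b → ∃ t, tK X y t * c β = r)
    {U : X.Opens} (hU : IsAffineOpen U) (hrU : ∀ y, UnitAt c r y → y ∈ U) :
    ∃ W : X.Opens, IsAffineOpen W ∧ ∀ y, y ∈ W ↔ UnitAt c r y := by
  have loc : ∀ y : X, ∃ (V : X.Opens) (_ : y ∈ V) (t : Γ(X, V)), ∀ q, q ∈ X.basicOpen t ↔ UnitAt c r q ∧ q ∈ V := by
    intro y
    obtain ⟨β, b, hb⟩ := hcov y
    obtain ⟨t, ht⟩ := hr y β b hb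
    obtain ⟨V, hy, t', htt', h⟩ := sec_local hfin hb ht
    refine ⟨V, hy, t', fun q => ⟨fun hq => ?_, fun hq => ?_⟩⟩
    · have hqV : q ∈ V := X.basicOpen_le _ hq
      rw [Scheme.mem_basicOpen _ _ _ hqV] at hq
      obtain ⟨⟨b', hb'⟩, h2⟩ := h q hqV
      exact ⟨⟨β, b', _, hb', hq, h2⟩, hqV⟩
    · rw [Scheme.mem_basicOpen _ _ _ hq.2]
      obtain ⟨⟨b', hb'⟩, h2⟩ := h q hq.2
      exact hq.1.unit hb' h2
  have hopen : IsOpen {y | UnitAt c r y} := by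
    rw [isOpen_iff_forall_mem_open]
    intro y hy
    obtain ⟨V, hyV, t, h⟩ := loc y
    exact ⟨X.basicOpen t, fun q hq => ((h q).mp hq).1, (X.basicOpen t).2, (h y).mpr ⟨hy, hyV⟩⟩
  refine ⟨⟨_, hopen⟩, ?_, fun y => Iff.rfl⟩
  refine affine_of_locally_basic hU hrU fun y _ => ?_
  obtain ⟨V, hyV, t, h⟩ := loc y
  refine ⟨V, hyV, t, ?_⟩
  ext q
  exact (h q).symm
end PartM6c

section PartM7a

/-- `x` lands in `U` -/
def Lands {T X : Scheme.{u}} (x : T ⟶ X) (U : X.Opens) : Prop := ⊤ ≤ x ⁻¹ᵁ U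

theorem Lands.comp {T T' X : Scheme.{u}} {x : T ⟶ X} {U : X.Opens} (h : Lands x U) (f : T' ⟶ T) : Lands (f ≫ x) U := by
  intro t _
  exact h (x := f t) trivial

/-- pullback of a section along a morphism landing in its domain -/
def pb {T X : Scheme.{u}} (x : T ⟶ X) {U : X.Opens} (h : Lands x U) (s : Γ(X, U)) : Γ(T, ⊤) := (x.appLE U ⊤ h).hom s

theorem pb_nat {T T' X : Scheme.{u}} (f : T' ⟶ T) (x : T ⟶ X) {U : X.Opens} (h : Lands x U) (h') (s : Γ(X, U)) :
    f.appTop (pb x h s) = pb (f ≫ x) h' s := by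
  unfold pb
  rw [← Scheme.Hom.appLE_comp_appLE f x U ⊤ ⊤ h le_top]
  rw [CommRingCat.hom_comp, RingHom.comp_apply]
  congr 1
  exact congrArg CommRingCat.Hom.hom (f.appLE_eq_app (U := ⊤)).symm

theorem pb_congr {T X : Scheme.{u}} {x x' : T ⟶ X} (e : x = x') {U : X.Opens} (h : Lands x U) (h' : Lands x' U) (s : Γ(X, U)) :
    pb x h s = pb x' h' s := by subst e; rfl

theorem pb_one {T X : Scheme.{u}} (x : T ⟶ X) {U : X.Opens} (h : Lands x U) : pb x h (1 : Γ(X, U)) = 1 := map_one _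

/-- cocycle data: `u β α = c_α / c_β` on `U β` -/
structure Coc (X : Scheme.{u}) (ι : Type) where
  U : ι → X.Opens
  cov : ∀ x, ∃ α, x ∈ U α
  u : ∀ (β α : ι), Γ(X, U β)
  u_self : ∀ α, u α α = 1
  u_mul : ∀ (α β γ : ι) {T : Scheme.{u}} (x : T ⟶ X) (hβ : Lands x (U β)) (hγ : Lands x (U γ)),
    pb x hγ (u γ α) = pb x hγ (u γ β) * pb x hβ (u β α)

/-- a scheme representing the line bundle -/
structure LRep {X : Scheme.{u}} {ι : Type} (C : Coc X ι) where
  tot : Scheme.{u}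
  π : tot ⟶ X
  coord : ∀ {T : Scheme.{u}} (l : T ⟶ tot) (α : ι), Lands (l ≫ π) (C.U α) → Γ(T, ⊤)
  coord_nat : ∀ {T' T : Scheme.{u}} (f : T' ⟶ T) (l : T ⟶ tot) α h h', f.appTop (coord l α h) = coord (f ≫ l) α h'
  coord_trans : ∀ {T : Scheme.{u}} (l : T ⟶ tot) α β hα hβ, coord l β hβ = pb (l ≫ π) hβ (C.u β α) * coord l α hα
  mkp : ∀ {T : Scheme.{u}} (x : T ⟶ X) (α : ι) (h : Lands x (C.U α)) (b : Γ(T, ⊤)), T ⟶ tot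
  mkp_π : ∀ {T : Scheme.{u}} (x : T ⟶ X) (α : ι) (h : Lands x (C.U α)) (b : Γ(T, ⊤)), mkp x α h b ≫ π = x
  coord_mkp : ∀ {T : Scheme.{u}} (x : T ⟶ X) (α : ι) (h : Lands x (C.U α)) (b : Γ(T, ⊤)) h', coord (mkp x α h b) α h' = b
  ext : ∀ {T : Scheme.{u}} (l l' : T ⟶ tot), l ≫ π = l' ≫ π → ∀ α h h', coord l α h = coord l' α h' → l = l'

section constr
variable {X : Scheme.{u}} {ι : Type} (C : Coc X ι)

/-- index type of the cover -/
structure CI where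
  W : X.Opens
  α : ι
  le : W ≤ C.U α

instance : Preorder (CI C) where
  le i j := i.W ≤ j.W
  le_refl i := le_refl i.W
  le_trans i j k h h' := le_trans (show i.W ≤ j.W from h) h'

def ciCover : X.OpenCover where
  I₀ := CI C
  X i := i.W
  f i := i.W.ι
  mem₀ := by
    rw [Scheme.presieve₀_mem_precoverage_iff]
    refine ⟨fun x ↦ ?_, inferInstance⟩
    obtain ⟨α, h⟩ := C.cov x
    exact ⟨⟨C.U α, α, le_rfl⟩, by simpa using h⟩

instance : Preorder (ciCover C).I₀ := inferInstanceAs (Preorder (CI C))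

theorem ci_le (i j : (ciCover C).I₀) : i ≤ j ↔ ((ciCover C).f i).opensRange ≤ ((ciCover C).f j).opensRange := by
  have : ∀ i : (ciCover C).I₀, ((ciCover C).f i).opensRange = CI.W i := fun i => Scheme.Opens.opensRange_ι _
  rw [this, this]
  rfl

instance : (ciCover C).LocallyDirected := .ofIsBasisOpensRange (ci_le C _ _) <| by
  rw [TopologicalSpace.Opens.isBasis_iff_nbhd]
  intro V x hx
  obtain ⟨α, h⟩ := C.cov x
  refine ⟨V ⊓ C.U α, ⟨⟨V ⊓ C.U α, α, inf_le_right⟩, Scheme.Opens.opensRange_ι _⟩, ⟨hx, h⟩, inf_le_left⟩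


theorem CI.lands (i : CI C) {T : Scheme.{u}} (y : T ⟶ i.W.toScheme) : Lands (y ≫ i.W.ι) (C.U i.α) := by
  intro t _
  exact i.le (y t).2

theorem Coc.u_inv (C : Coc X ι) (α β : ι) {T : Scheme.{u}} (x : T ⟶ X) (hα : Lands x (C.U α)) (hβ : Lands x (C.U β)) :
    pb x hα (C.u α β) * pb x hβ (C.u β α) = 1 := by
  rw [← C.u_mul, C.u_self, pb_one]

/-- points of the local pieces -/
def tm (i : CI C) {T : Scheme.{u}} (y : T ⟶ i.W.toScheme) (b : Γ(T, ⊤)) : T ⟶ AffineSpace PUnit.{u+1} i.W.toScheme :=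
  AffineSpace.homOfVector y (fun _ => b)

/-- the coordinate -/
def cc (i : CI C) : Γ(AffineSpace PUnit.{u+1} i.W.toScheme, ⊤) := AffineSpace.coord _ PUnit.unit

/-- the projection -/
def pr (i : CI C) : AffineSpace PUnit.{u+1} i.W.toScheme ⟶ i.W.toScheme := AffineSpace PUnit.{u+1} i.W.toScheme ↘ i.W.toScheme

theorem tm_pr (i : CI C) {T : Scheme.{u}} (y : T ⟶ i.W.toScheme) (b : Γ(T, ⊤)) : tm C i y b ≫ pr C i = y :=
  AffineSpace.homOfVector_over _ _

theorem tm_cc (i : CI C) {T : Scheme.{u}} (y : T ⟶ i.W.toScheme) (b : Γ(T, ⊤)) : (tm C i y b).appTop (cc C i) = b :=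
  AffineSpace.homOfVector_appTop_coord _ _ _

theorem tm_ext (i : CI C) {T : Scheme.{u}} {f g : T ⟶ AffineSpace PUnit.{u+1} i.W.toScheme} (h : f ≫ pr C i = g ≫ pr C i)
    (h' : f.appTop (cc C i) = g.appTop (cc C i)) : f = g :=
  AffineSpace.hom_ext h (fun _ => h')

theorem tm_nat (i : CI C) {T T' : Scheme.{u}} (f : T' ⟶ T) (y : T ⟶ i.W.toScheme) (b : Γ(T, ⊤)) :
    f ≫ tm C i y b = tm C i (f ≫ y) (f.appTop b) := by
  apply tm_ext
  · rw [Category.assoc, tm_pr, tm_pr]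
  · rw [tm_cc, Scheme.Hom.comp_appTop, CommRingCat.comp_apply, tm_cc]

/-- transition maps -/
def tr {i j : CI C} (h : i.W ≤ j.W) : AffineSpace PUnit.{u+1} i.W.toScheme ⟶ AffineSpace PUnit.{u+1} j.W.toScheme :=
  tm C j (pr C i ≫ X.homOfLE h) (pb ((pr C i ≫ X.homOfLE h) ≫ j.W.ι) (CI.lands C j _) (C.u j.α i.α) * cc C i)

theorem tr_pr {i j : CI C} (h : i.W ≤ j.W) : tr C h ≫ pr C j = pr C i ≫ X.homOfLE h := tm_pr _ _ _ _

theorem comp_tr {i j : CI C} (h : i.W ≤ j.W) {T : Scheme.{u}} (f : T ⟶ AffineSpace PUnit.{u+1} i.W.toScheme) (h') :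
    (f ≫ tr C h).appTop (cc C j) = pb (f ≫ pr C i ≫ i.W.ι) h' (C.u j.α i.α) * f.appTop (cc C i) := by
  rw [Scheme.Hom.comp_appTop, CommRingCat.comp_apply]
  unfold tr
  rw [tm_cc, map_mul]
  congr 1
  rw [pb_nat _ _ _ (Lands.comp (CI.lands C j _) f)]
  exact pb_congr (by simp) _ _ _

theorem tr_self {i : CI C} (h : i.W ≤ i.W) : tr C h = 𝟙 _ := by
  apply tm_ext
  · rw [tr_pr, Category.id_comp]; simp
  · have := comp_tr C h (𝟙 _) (by rw [Category.id_comp]; exact CI.lands C i _)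
    rw [Category.id_comp, C.u_self, pb_one, one_mul] at this
    exact this

theorem tr_comp {i j l : CI C} (h : i.W ≤ j.W) (h' : j.W ≤ l.W) : tr C h ≫ tr C h' = tr C (h.trans h') := by
  have ij : Lands (pr C i ≫ i.W.ι) (C.U j.α) := by
    have := CI.lands C j (pr C i ≫ X.homOfLE h)
    rwa [Category.assoc, X.homOfLE_ι] at this
  have il : Lands (pr C i ≫ i.W.ι) (C.U l.α) := by
    have := CI.lands C l (pr C i ≫ X.homOfLE (h.trans h'))
    rwa [Category.assoc, X.homOfLE_ι] at this
  apply tm_ext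
  · rw [Category.assoc, tr_pr, tr_pr, ← Category.assoc, tr_pr]; simp
  · have e := tr_pr C h
    rw [comp_tr C h' (tr C h) (by rw [← Category.assoc, e]; simpa using il)]
    have e1 := comp_tr C h (𝟙 _) (by rw [Category.id_comp]; exact ij)
    have e2 := comp_tr C (h.trans h') (𝟙 _) (by rw [Category.id_comp]; exact il)
    rw [Category.id_comp] at e1 e2
    rw [e1, e2, ← mul_assoc]
    congr 1
    rw [pb_congr (x' := pr C i ≫ i.W.ι) (by rw [← Category.assoc, e]; simp) _ il,
      pb_congr (x' := pr C i ≫ i.W.ι) (Category.id_comp _) _ ij, ← C.u_mul]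
    exact pb_congr (Category.id_comp _).symm _ _ _

theorem tr_pullback {i j : CI C} (h : i.W ≤ j.W) : IsPullback (tr C h) (pr C i) (pr C j) (X.homOfLE h) := by
  have hl : ∀ {T : Scheme.{u}} (y : T ⟶ i.W.toScheme), Lands (y ≫ i.W.ι) (C.U j.α) := by
    intro T y
    have := CI.lands C j (y ≫ X.homOfLE h)
    rwa [Category.assoc, X.homOfLE_ι] at this
  refine ⟨⟨tr_pr C h⟩, ⟨PullbackCone.IsLimit.mk _ ?_ ?_ ?_ ?_⟩⟩
  · intro s
    exact tm C i s.snd (pb (s.snd ≫ i.W.ι) (CI.lands C i _) (C.u i.α j.α) * s.fst.appTop (cc C j))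
  · intro s
    apply tm_ext
    · rw [Category.assoc, tr_pr, ← Category.assoc, tm_pr, s.condition]
    · rw [comp_tr C h _ (by rw [← Category.assoc]; exact hl _), tm_cc, ← mul_assoc,
        pb_congr (x' := s.snd ≫ i.W.ι) (by rw [← Category.assoc, tm_pr]) _ (hl _), C.u_inv, one_mul]
  · intro s
    rw [tm_pr]
  · intro s m h1 h2
    apply tm_ext
    · rw [tm_pr, h2]
    · rw [tm_cc, ← h1, comp_tr C h _ (by rw [← Category.assoc]; exact hl _), ← mul_assoc,
        pb_congr (x' := s.snd ≫ i.W.ι) (by rw [← Category.assoc, h2]) _ (hl _), C.u_inv, one_mul]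

theorem ci_trans {i j : (ciCover C).I₀} (h : i ⟶ j) : (ciCover C).trans h = X.homOfLE (show CI.W i ≤ CI.W j from leOfHom h) := by
  refine (cancel_mono ((ciCover C).f j)).mp ?_
  refine (Scheme.Cover.trans_map _ h).trans ?_
  exact (X.homOfLE_ι _).symm

def relG : Scheme.Cover.RelativeGluingData (ciCover C) where
  functor :=
    { obj := fun i => AffineSpace PUnit.{u+1} (CI.W i).toScheme
      map := fun {i j} h => tr C (i := i) (j := j) (leOfHom h)
      map_id := fun i => tr_self C _
      map_comp := fun h h' => (tr_comp C _ _).symm }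
  natTrans :=
    { app := fun i => pr C i
      naturality := fun i j h => by
        refine (tr_pr C (leOfHom h)).trans ?_
        exact congrArg (pr C i ≫ ·) (ci_trans C h).symm }
  equifibered := fun i j h => by
    have e := tr_pullback C (i := i) (j := j) (leOfHom h)
    have e' : (ciCover C).functorOfLocallyDirected.map h = X.homOfLE (show CI.W i ≤ CI.W j from leOfHom h) := ci_trans C h
    rw [← e'] at e
    exact e

instance : Quiver.IsThin (ciCover C).I₀ := fun i j => inferInstance
instance : Small.{u} (ciCover C).I₀ := inferInstanceAs (Small.{u} (CI C))
/-- the inclusion of a local piece -/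
def ιL (i : CI C) : AffineSpace PUnit.{u+1} i.W.toScheme ⟶ (relG C).glued := colimit.ι (relG C).functor i

theorem ιL_pullback (i : CI C) : IsPullback (pr C i) (ιL C i) i.W.ι (relG C).toBase :=
  (relG C).isPullback_natTrans_ι_toBase i

theorem tr_ιL {i j : CI C} (h : i.W ≤ j.W) : tr C h ≫ ιL C j = ιL C i := by
  have h' : @LE.le (ciCover C).I₀ _ i j := h
  exact colimit.w (relG C).functor (homOfLE h')

def lf {T : Scheme.{u}} (x : T ⟶ X) {V : X.Opens} (h : Lands x V) : T ⟶ V.toScheme :=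
  IsOpenImmersion.lift V.ι x (by
    rintro _ ⟨t, rfl⟩
    rw [Scheme.Opens.range_ι]
    exact h (x := t) trivial)

theorem lf_ι {T : Scheme.{u}} (x : T ⟶ X) {V : X.Opens} (h : Lands x V) : lf x h ≫ V.ι = x := IsOpenImmersion.lift_fac _ _ _

/-- the basic index -/
def CI.of (α : ι) : CI C := ⟨C.U α, α, le_rfl⟩

/-- lift to a local piece -/
def lL {T : Scheme.{u}} (l : T ⟶ (relG C).glued) (α : ι) (h : Lands (l ≫ (relG C).toBase) (C.U α)) :
    T ⟶ AffineSpace PUnit.{u+1} (CI.of C α).W.toScheme :=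
  (ιL_pullback C (CI.of C α)).lift (lf (l ≫ (relG C).toBase) h) l (lf_ι _ _)

theorem lL_pr {T : Scheme.{u}} (l : T ⟶ (relG C).glued) (α : ι) (h : Lands (l ≫ (relG C).toBase) (C.U α)) :
    lL C l α h ≫ pr C (CI.of C α) = lf (l ≫ (relG C).toBase) h := (ιL_pullback C (CI.of C α)).lift_fst _ _ _

theorem lL_ι {T : Scheme.{u}} (l : T ⟶ (relG C).glued) (α : ι) (h : Lands (l ≫ (relG C).toBase) (C.U α)) :
    lL C l α h ≫ ιL C (CI.of C α) = l := (ιL_pullback C (CI.of C α)).lift_snd _ _ _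

theorem lL_uniq {T : Scheme.{u}} (l : T ⟶ (relG C).glued) (α : ι) (h : Lands (l ≫ (relG C).toBase) (C.U α))
    (m : T ⟶ AffineSpace PUnit.{u+1} (CI.of C α).W.toScheme) (hm : m ≫ ιL C (CI.of C α) = l) : lL C l α h = m := by
  apply (ιL_pullback C (CI.of C α)).hom_ext
  · rw [lL_pr]
    refine (cancel_mono (C.U α).ι).mp ?_
    rw [lf_ι]
    refine Eq.trans ?_ (Category.assoc _ _ _).symm
    have := (ιL_pullback C (CI.of C α)).w
    change _ = m ≫ (pr C (CI.of C α) ≫ (CI.of C α).W.ι)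
    rw [this, ← Category.assoc, hm]
  · rw [lL_ι, hm]

def theLRep : LRep C where
  tot := (relG C).glued
  π := (relG C).toBase
  coord l α h := (lL C l α h).appTop (cc C (CI.of C α))
  coord_nat f l α h h' := by
    rw [← CommRingCat.comp_apply, ← Scheme.Hom.comp_appTop]
    have : lL C (f ≫ l) α h' = f ≫ lL C l α h := lL_uniq _ _ _ _ _ (by rw [Category.assoc, lL_ι])
    rw [this]
  coord_trans {T} l α β hα hβ := by
    let i : CI C := ⟨C.U α ⊓ C.U β, α, inf_le_left⟩
    have hαβ : Lands (l ≫ (relG C).toBase) (C.U α ⊓ C.U β) := fun t ht => ⟨hα ht, hβ ht⟩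
    let m : T ⟶ AffineSpace PUnit.{u+1} i.W.toScheme := (ιL_pullback C i).lift (lf (l ≫ (relG C).toBase) hαβ) l (lf_ι _ _)
    have hm : m ≫ ιL C i = l := (ιL_pullback C i).lift_snd _ _ _
    have hm' : m ≫ pr C i ≫ i.W.ι = l ≫ (relG C).toBase := by
      rw [(ιL_pullback C i).w, ← Category.assoc, hm]
    have lα : i.W ≤ (CI.of C α).W := inf_le_left
    have lβ : i.W ≤ (CI.of C β).W := inf_le_right
    have eα : lL C l α hα = m ≫ tr C lα := lL_uniq _ _ _ _ _ (by rw [Category.assoc, tr_ιL, hm])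
    have eβ : lL C l β hβ = m ≫ tr C lβ := lL_uniq _ _ _ _ _ (by rw [Category.assoc, tr_ιL, hm])
    rw [eα, eβ, comp_tr _ _ _ (by rw [hm']; exact hβ), comp_tr _ _ _ (by rw [hm']; exact hα)]
    have : C.u (CI.of C α).α i.α = 1 := C.u_self α
    rw [this, pb_one, one_mul]
    congr 1
    exact pb_congr hm' _ _ _
  mkp x α h b := tm C (CI.of C α) (lf x h) b ≫ ιL C (CI.of C α)
  mkp_π x α h b := by
    rw [Category.assoc, ← (ιL_pullback C (CI.of C α)).w, ← Category.assoc, tm_pr]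
    exact lf_ι _ _
  coord_mkp x α h b h' := by
    rw [lL_uniq C _ α h' (tm C (CI.of C α) (lf x h) b) rfl, tm_cc]
  ext l l' e α h h' hc := by
    rw [← lL_ι C l α h, ← lL_ι C l' α h']
    congr 1
    apply tm_ext
    · rw [lL_pr, lL_pr]
      congr 1
    · exact hc
end constr
end PartM7a

section PartM7b

theorem hom_ext_loc {T Y : Scheme.{u}} (l l' : T ⟶ Y) (h : ∀ t : T, ∃ V : T.Opens, t ∈ V ∧ V.ι ≫ l = V.ι ≫ l') : l = l' := by
  choose V hV e using h
  have hc : TopologicalSpace.IsOpenCover V := by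
    rw [TopologicalSpace.IsOpenCover, eq_top_iff]
    intro t _
    exact TopologicalSpace.Opens.mem_iSup.mpr ⟨t, hV t⟩
  exact (T.openCoverOfIsOpenCover V hc).hom_ext _ _ e

theorem glue_hom {T Y : Scheme.{u}} (P : ∀ {T' : Scheme.{u}}, (T' ⟶ T) → Prop)
    (hP : ∀ {T' T'' : Scheme.{u}} (g : T'' ⟶ T') (f : T' ⟶ T), P f → P (g ≫ f))
    (hcov : ∀ t : T, ∃ V : T.Opens, t ∈ V ∧ P V.ι)
    (Λ : ∀ {T' : Scheme.{u}} (f : T' ⟶ T), P f → (T' ⟶ Y))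
    (nat : ∀ {T' T'' : Scheme.{u}} (g : T'' ⟶ T') (f : T' ⟶ T) (h h'), g ≫ Λ f h = Λ (g ≫ f) h') :
    ∃ l : T ⟶ Y, ∀ {T' : Scheme.{u}} (f : T' ⟶ T) (h : P f), f ≫ l = Λ f h := by
  choose V hV hPV using hcov
  have hc : TopologicalSpace.IsOpenCover V := by
    rw [TopologicalSpace.IsOpenCover, eq_top_iff]
    intro t _
    exact TopologicalSpace.Opens.mem_iSup.mpr ⟨t, hV t⟩
  have Λc : ∀ {T' : Scheme.{u}} (f f' : T' ⟶ T) (e : f = f') (h : P f) (h' : P f'), Λ f h = Λ f' h' := by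
    intro T' f f' e h h'
    subst e
    rfl
  let 𝒰 := T.openCoverOfIsOpenCover V hc
  obtain ⟨l, hι⟩ : ∃ l : T ⟶ Y, ∀ i : 𝒰.I₀, 𝒰.f i ≫ l = Λ (V i).ι (hPV i) :=
    ⟨𝒰.glueMorphisms (fun i => Λ (V i).ι (hPV i)) (by
      intro i j
      have h1 : P (pullback.fst (𝒰.f i) (𝒰.f j) ≫ (V i).ι) := hP _ _ (hPV i)
      have h2 : P (pullback.snd (𝒰.f i) (𝒰.f j) ≫ (V j).ι) := hP _ _ (hPV j)
      refine (nat _ _ _ h1).trans ((Λc _ _ ?_ _ _).trans (nat _ _ _ h2).symm)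
      exact pullback.condition), fun i => Scheme.Cover.ι_glueMorphisms _ _ _ i⟩
  refine ⟨l, ?_⟩
  · intro T' f h
    refine hom_ext_loc _ _ fun t => ?_
    refine ⟨f ⁻¹ᵁ V (f t), hV (f t), ?_⟩
    have e : f ∣_ V (f t) ≫ (V (f t)).ι = (f ⁻¹ᵁ V (f t)).ι ≫ f := morphismRestrict_ι _ _
    rw [← Category.assoc, ← e, Category.assoc]
    have := hι (f t)
    refine (congrArg _ this).trans ?_
    rw [nat _ _ _ (hP _ _ (hPV _)), nat _ _ _ (hP _ _ h)]
    exact Λc _ _ e _ _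

variable {X : Scheme.{u}} {ι : Type} {C : Coc X ι} (R : LRep C)

theorem coord_congr {T : Scheme.{u}} {l l' : T ⟶ R.tot} (e : l = l') (α h h') : R.coord l α h = R.coord l' α h' := by
  subst e; rfl

theorem lands_loc (C : Coc X ι) {T : Scheme.{u}} (x : T ⟶ X) (t : T) : ∃ (α : ι) (V : T.Opens), t ∈ V ∧ Lands (V.ι ≫ x) (C.U α) := by
  obtain ⟨α, h⟩ := C.cov (x t)
  refine ⟨α, x ⁻¹ᵁ C.U α, h, ?_⟩
  intro s _
  exact s.2

theorem LRep.ext_loc {T : Scheme.{u}} (l l' : T ⟶ R.tot) (e : l ≫ R.π = l' ≫ R.π)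
    (h : ∀ t : T, ∃ V : T.Opens, t ∈ V ∧ ∃ α, ∃ h h', R.coord (V.ι ≫ l) α h = R.coord (V.ι ≫ l') α h') : l = l' := by
  refine hom_ext_loc _ _ fun t => ?_
  obtain ⟨V, hV, α, h1, h2, e'⟩ := h t
  refine ⟨V, hV, R.ext _ _ ?_ α h1 h2 e'⟩
  rw [Category.assoc, e, Category.assoc]

theorem LRep.ext_all {T : Scheme.{u}} (l l' : T ⟶ R.tot) (e : l ≫ R.π = l' ≫ R.π)
    (h : ∀ {T' : Scheme.{u}} (f : T' ⟶ T) α h h', R.coord (f ≫ l) α h = R.coord (f ≫ l') α h') : l = l' := by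
  refine R.ext_loc l l' e fun t => ?_
  obtain ⟨α, V, hV, hl⟩ := lands_loc C (l ≫ R.π) t
  have h1 : Lands ((V.ι ≫ l) ≫ R.π) (C.U α) := by rw [Category.assoc]; exact hl
  have h2 : Lands ((V.ι ≫ l') ≫ R.π) (C.U α) := by rw [Category.assoc, ← e]; exact hl
  exact ⟨V, hV, α, h1, h2, h V.ι α h1 h2⟩

theorem glueL {T : Scheme.{u}} (x : T ⟶ X) (P : ∀ {T' : Scheme.{u}}, (T' ⟶ T) → Prop)
    (hP : ∀ {T' T'' : Scheme.{u}} (g : T'' ⟶ T') (f : T' ⟶ T), P f → P (g ≫ f))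
    (hcov : ∀ t : T, ∃ V : T.Opens, t ∈ V ∧ P V.ι)
    (Λ : ∀ {T' : Scheme.{u}} (f : T' ⟶ T), P f → ∀ α, Lands (f ≫ x) (C.U α) → Γ(T', ⊤))
    (nat : ∀ {T' T'' : Scheme.{u}} (g : T'' ⟶ T') (f : T' ⟶ T) (h h') α (hα hα'), g.appTop (Λ f h α hα) = Λ (g ≫ f) h' α hα')
    (trans : ∀ {T' : Scheme.{u}} (f : T' ⟶ T) (h) α β (hα hβ), Λ f h β hβ = pb (f ≫ x) hβ (C.u β α) * Λ f h α hα) :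
    ∃ l : T ⟶ R.tot, l ≫ R.π = x ∧ ∀ {T' : Scheme.{u}} (f : T' ⟶ T) (h : P f) α (hα hα'), R.coord (f ≫ l) α hα' = Λ f h α hα := by
  obtain ⟨l, hl⟩ := glue_hom (T := T) (Y := R.tot) (fun f => P f ∧ ∃ α, Lands (f ≫ x) (C.U α))
    (fun g f h => ⟨hP g f h.1, h.2.choose, by rw [Category.assoc]; exact h.2.choose_spec.comp g⟩)
    (by
      intro t
      obtain ⟨V, hV, hPV⟩ := hcov t
      obtain ⟨α, V', hV', hl⟩ := lands_loc C x t
      refine ⟨V ⊓ V', ⟨hV, hV'⟩, ?_, α, ?_⟩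
      · have e : T.homOfLE (inf_le_left : V ⊓ V' ≤ V) ≫ V.ι = (V ⊓ V').ι := Scheme.homOfLE_ι _ _
        rw [← e]
        exact hP _ _ hPV
      · have e : T.homOfLE (inf_le_right : V ⊓ V' ≤ V') ≫ V'.ι = (V ⊓ V').ι := Scheme.homOfLE_ι _ _
        rw [← e, Category.assoc]
        exact hl.comp _)
    (fun f h => R.mkp (f ≫ x) h.2.choose h.2.choose_spec (Λ f h.1 _ h.2.choose_spec))
    (by
      intro T' T'' g f h h'
      suffices hs : ∀ β γ (hβ : Lands (f ≫ x) (C.U β)) (hγ : Lands ((g ≫ f) ≫ x) (C.U γ)),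
          g ≫ R.mkp (f ≫ x) β hβ (Λ f h.1 β hβ) = R.mkp ((g ≫ f) ≫ x) γ hγ (Λ (g ≫ f) h'.1 γ hγ) from hs _ _ _ _
      intro β γ hβ hγ
      have hβ' : Lands ((g ≫ f) ≫ x) (C.U β) := by rw [Category.assoc]; exact hβ.comp g
      have e1 : (g ≫ R.mkp (f ≫ x) β hβ (Λ f h.1 β hβ)) ≫ R.π = (g ≫ f) ≫ x := by
        rw [Category.assoc, R.mkp_π, Category.assoc]
      refine R.ext _ _ (e1.trans (R.mkp_π _ _ _ _).symm) β (e1 ▸ hβ') (by rw [R.mkp_π]; exact hβ') ?_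
      rw [R.coord_trans (R.mkp ((g ≫ f) ≫ x) γ hγ _) γ β (by rw [R.mkp_π]; exact hγ), R.coord_mkp,
        pb_congr (R.mkp_π _ _ _ _) _ hβ', ← trans (g ≫ f) h'.1 γ β hγ hβ', ← nat g f h.1 h'.1 β hβ hβ',
        ← R.coord_nat g _ β (by rw [R.mkp_π]; exact hβ), R.coord_mkp])
  have hπ : l ≫ R.π = x := by
    refine hom_ext_loc _ _ fun t => ?_
    obtain ⟨V, hV, hPV⟩ := hcov t
    obtain ⟨α, V', hV', hl'⟩ := lands_loc C x t
    have hh : P (V ⊓ V').ι ∧ ∃ α, Lands ((V ⊓ V').ι ≫ x) (C.U α) := by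
      refine ⟨?_, α, ?_⟩
      · have e : T.homOfLE (inf_le_left : V ⊓ V' ≤ V) ≫ V.ι = (V ⊓ V').ι := Scheme.homOfLE_ι _ _
        rw [← e]
        exact hP _ _ hPV
      · have e : T.homOfLE (inf_le_right : V ⊓ V' ≤ V') ≫ V'.ι = (V ⊓ V').ι := Scheme.homOfLE_ι _ _
        rw [← e, Category.assoc]
        exact hl'.comp _
    refine ⟨V ⊓ V', ⟨hV, hV'⟩, ?_⟩
    rw [← Category.assoc, hl _ hh, R.mkp_π]
  refine ⟨l, hπ, ?_⟩
  intro T' f h α hα hα'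
  have hh : P f ∧ ∃ α, Lands (f ≫ x) (C.U α) := ⟨h, α, hα⟩
  have e := hl f hh
  have hβ := hh.2.choose_spec
  rw [coord_congr R e α _ (by rw [R.mkp_π]; exact hα), R.coord_trans _ hh.2.choose α (by rw [R.mkp_π]; exact hβ), R.coord_mkp,
        pb_congr (R.mkp_π _ _ _ _) _ hα]
  exact (trans f h _ α hβ hα).symm

end PartM7b

section PartM7c

variable {X : Scheme.{u}} {ι : Type} {C : Coc X ι} (R : LRep C)

theorem lands_of_eq {T T' X Y : Scheme.{u}} {U : X.Opens} {f : T ⟶ T'} {a b : T' ⟶ Y} {p : Y ⟶ X} (h : Lands ((f ≫ a) ≫ p) U) (e : b ≫ p = a ≫ p) :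
    Lands ((f ≫ b) ≫ p) U := by
  rw [Category.assoc, e, ← Category.assoc]; exact h

theorem lands_assoc {T T' X Y : Scheme.{u}} {U : X.Opens} {f : T ⟶ T'} {a : T' ⟶ Y} {p : Y ⟶ X} (h : Lands (f ≫ a ≫ p) U) :
    Lands ((f ≫ a) ≫ p) U := by
  rw [Category.assoc]; exact h

theorem lands_assoc' {T T' X Y : Scheme.{u}} {U : X.Opens} {f : T ⟶ T'} {a : T' ⟶ Y} {p : Y ⟶ X} (h : Lands ((f ≫ a) ≫ p) U) :
    Lands (f ≫ a ≫ p) U := by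
  rw [← Category.assoc]; exact h

theorem LRep.coord_comp {T' T T'' : Scheme.{u}} (g : T'' ⟶ T') (f : T' ⟶ T) (l : T ⟶ R.tot) (α h h') :
    g.appTop (R.coord (f ≫ l) α h) = R.coord ((g ≫ f) ≫ l) α h' := by
  rw [R.coord_nat g _ α _ (by rw [← Category.assoc]; exact h')]
  exact coord_congr R (Category.assoc _ _ _).symm _ _ _

theorem LRep.exists_zero : ∃ l : X ⟶ R.tot, l ≫ R.π = 𝟙 X ∧ ∀ {T' : Scheme.{u}} (f : T' ⟶ X) α hα, R.coord (f ≫ l) α hα = 0 := by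
  obtain ⟨l, h, h'⟩ := glueL R (𝟙 X) (fun _ => True) (fun _ _ _ => trivial) (fun t => ⟨⊤, trivial, trivial⟩)
    (fun f _ α h => 0) (by intros; simp) (by intros; simp)
  refine ⟨l, h, fun f α hα => h' f trivial α ?_ hα⟩
  rw [← h, ← Category.assoc]; exact hα

theorem LRep.exists_add {T : Scheme.{u}} (a b : T ⟶ R.tot) (e : a ≫ R.π = b ≫ R.π) : ∃ l : T ⟶ R.tot, l ≫ R.π = a ≫ R.π ∧
    ∀ {T' : Scheme.{u}} (f : T' ⟶ T) α hα ha hb, R.coord (f ≫ l) α hα = R.coord (f ≫ a) α ha + R.coord (f ≫ b) α hb := by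
  obtain ⟨l, h, h'⟩ := glueL R (a ≫ R.π) (fun _ => True) (fun _ _ _ => trivial) (fun t => ⟨⊤, trivial, trivial⟩)
    (fun f _ α h => R.coord (f ≫ a) α (lands_assoc h) + R.coord (f ≫ b) α (lands_assoc (e ▸ h)))
    (by
      intro T' T'' g f _ _ α hα hα'
      rw [map_add, R.coord_comp, R.coord_comp])
    (by
      intro T' f _ α β hα hβ
      rw [R.coord_trans (f ≫ a) α β (lands_assoc hα), R.coord_trans (f ≫ b) α β (lands_assoc (e ▸ hα)), mul_add,
        pb_congr (Category.assoc f a R.π) _ hβ, pb_congr (x := (f ≫ b) ≫ R.π) (x' := f ≫ a ≫ R.π) (by rw [e, Category.assoc]) _ hβ])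
  refine ⟨l, h, fun f α hα ha hb => h' f trivial α (lands_assoc' ha) hα⟩

theorem LRep.exists_smul {T : Scheme.{u}} (c : Γ(T, ⊤)) (a : T ⟶ R.tot) : ∃ l : T ⟶ R.tot, l ≫ R.π = a ≫ R.π ∧
    ∀ {T' : Scheme.{u}} (f : T' ⟶ T) α hα ha, R.coord (f ≫ l) α hα = f.appTop c * R.coord (f ≫ a) α ha := by
  obtain ⟨l, h, h'⟩ := glueL R (a ≫ R.π) (fun _ => True) (fun _ _ _ => trivial) (fun t => ⟨⊤, trivial, trivial⟩)
    (fun f _ α h => f.appTop c * R.coord (f ≫ a) α (lands_assoc h))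
    (by
      intro T' T'' g f _ _ α hα hα'
      rw [map_mul, R.coord_comp, Scheme.Hom.comp_appTop, CommRingCat.comp_apply])
    (by
      intro T' f _ α β hα hβ
      rw [R.coord_trans (f ≫ a) α β (lands_assoc hα), 
        pb_congr (Category.assoc f a R.π) _ hβ]
      ring)
  refine ⟨l, h, fun f α hα ha => h' f trivial α (lands_assoc' ha) hα⟩

def LRep.zero : X ⟶ R.tot := R.exists_zero.choose
theorem LRep.zero_π : R.zero ≫ R.π = 𝟙 X := R.exists_zero.choose_spec.1
theorem LRep.coord_zero {T' : Scheme.{u}} (f : T' ⟶ X) α hα : R.coord (f ≫ R.zero) α hα = 0 := R.exists_zero.choose_spec.2 f α hα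

def LRep.add {T : Scheme.{u}} (a b : T ⟶ R.tot) (e : a ≫ R.π = b ≫ R.π) : T ⟶ R.tot := (R.exists_add a b e).choose
theorem LRep.add_π {T : Scheme.{u}} (a b : T ⟶ R.tot) (e) : R.add a b e ≫ R.π = a ≫ R.π := (R.exists_add a b e).choose_spec.1
theorem LRep.coord_add {T' T : Scheme.{u}} (a b : T ⟶ R.tot) (e) (f : T' ⟶ T) α hα :
    R.coord (f ≫ R.add a b e) α hα = R.coord (f ≫ a) α (lands_of_eq hα (R.add_π a b e).symm) +
      R.coord (f ≫ b) α (lands_of_eq hα ((R.add_π a b e).trans e).symm) :=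
  (R.exists_add a b e).choose_spec.2 f α hα _ _

def LRep.smul {T : Scheme.{u}} (c : Γ(T, ⊤)) (a : T ⟶ R.tot) : T ⟶ R.tot := (R.exists_smul c a).choose
theorem LRep.smul_π {T : Scheme.{u}} (c : Γ(T, ⊤)) (a : T ⟶ R.tot) : R.smul c a ≫ R.π = a ≫ R.π := (R.exists_smul c a).choose_spec.1
theorem LRep.coord_smul {T' T : Scheme.{u}} (c : Γ(T, ⊤)) (a : T ⟶ R.tot) (f : T' ⟶ T) α hα :
    R.coord (f ≫ R.smul c a) α hα = f.appTop c * R.coord (f ≫ a) α (lands_of_eq hα (R.smul_π c a).symm) :=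
  (R.exists_smul c a).choose_spec.2 f α hα _

/-- the bundle data of a representing scheme -/
def LRep.data : VecBundleData X where
  tot := R.tot
  π := R.π
  zero := R.zero
  zero_π := R.zero_π
  add := R.add
  smul := R.smul
  add_π := R.add_π
  smul_π := R.smul_π
  add_natural := by
    intro T' T g a b h h'
    refine R.ext_all _ _ (by rw [R.add_π, Category.assoc, R.add_π, Category.assoc]) ?_
    intro T'' f α h1 h2
    rw [R.coord_add, coord_congr R (Category.assoc f g _).symm _ _ (by rw [Category.assoc f g]; exact h1), R.coord_add,
      coord_congr R (Category.assoc f g a), coord_congr R (Category.assoc f g b)]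
  smul_natural := by
    intro T' T g c a
    refine R.ext_all _ _ (by rw [R.smul_π, Category.assoc, R.smul_π, Category.assoc]) ?_
    intro T'' f α h1 h2
    rw [R.coord_smul, coord_congr R (Category.assoc f g _).symm _ _ (by rw [Category.assoc f g]; exact h1), R.coord_smul,
      coord_congr R (Category.assoc f g a), Scheme.Hom.comp_appTop, CommRingCat.comp_apply]
  add_comm := by
    intro T a b h h'
    refine R.ext_all _ _ (by rw [R.add_π, R.add_π, h]) ?_
    intro T'' f α h1 h2
    rw [R.coord_add, R.coord_add, add_comm]
  add_assoc := by
    intro T a b c h1 h2 h3 h4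
    refine R.ext_all _ _ (by rw [R.add_π, R.add_π, R.add_π]) ?_
    intro T'' f α h1 h2
    rw [R.coord_add, R.coord_add, R.coord_add, R.coord_add, add_assoc]
  zero_add := by
    intro T a h
    refine R.ext_all _ _ (by rw [R.add_π, h]) ?_
    intro T'' f α h1 h2
    rw [R.coord_add, coord_congr R (Category.assoc f _ R.zero).symm _ _ (by
      rw [Category.assoc _ _ R.π, R.zero_π]
      simpa using h2), R.coord_zero, zero_add]
  one_smul := by
    intro T a
    refine R.ext_all _ _ (by rw [R.smul_π]) ?_
    intro T'' f α h1 h2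
    rw [R.coord_smul, map_one, one_mul]
  mul_smul := by
    intro T c d a
    refine R.ext_all _ _ (by simp only [R.smul_π]) ?_
    intro T'' f α h1 h2
    rw [R.coord_smul, R.coord_smul, R.coord_smul, map_mul, mul_assoc]
  smul_add := by
    intro T c a b h h'
    refine R.ext_all _ _ (by simp only [R.smul_π, R.add_π]) ?_
    intro T'' f α h1 h2
    rw [R.coord_smul, R.coord_add, R.coord_add, R.coord_smul, R.coord_smul, mul_add]
  add_smul := by
    intro T c d a h
    refine R.ext_all _ _ (by simp only [R.smul_π, R.add_π]) ?_
    intro T'' f α h1 h2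
    rw [R.coord_smul, R.coord_add, R.coord_smul, R.coord_smul, map_add, add_mul]
  zero_smul := by
    intro T a
    refine R.ext_all _ _ (by rw [R.smul_π, Category.assoc, R.zero_π, Category.comp_id]) ?_
    intro T'' f α h1 h2
    rw [R.coord_smul, coord_congr R (Category.assoc f _ R.zero).symm _ _ (by
      rw [Category.assoc f]; exact h2), R.coord_zero, map_zero, zero_mul]
  smul_zero := by
    intro T c x
    refine R.ext_all _ _ (by rw [R.smul_π]) ?_
    intro T'' f α h1 h2
    rw [R.coord_smul, coord_congr R (Category.assoc f _ R.zero).symm _ _ (by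
      rw [Category.assoc f]; exact h2), R.coord_zero, mul_zero]

/-- the bijectivity underlying the frame property -/
theorem LRep.bij (α : ι) {T Y : Scheme.{u}} (e : Y ⟶ R.tot) (hY : Lands (e ≫ R.π) (C.U α)) (h1 : R.coord e α hY = 1)
    (x : T ⟶ Y) (y : T ⟶ X) (hx : (x ≫ e) ≫ R.π = y) :
    Function.Bijective (fun f : Fin 1 → Γ(T, ⊤) =>
        (∑ i, f i • (⟨x ≫ e, hx⟩ : R.data.Fiber y))) := by
  subst hx
  have hl : Lands ((x ≫ e) ≫ R.π) (C.U α) := lands_assoc (hY.comp x)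
  have h1' : R.coord (x ≫ e) α hl = 1 := by rw [← R.coord_nat x e α hY hl, h1, map_one]
  have key : ∀ c : Γ(T, ⊤), ∀ h, R.coord (R.smul c (x ≫ e)) α h = c := by
    intro c h
    rw [coord_congr R (Category.id_comp _).symm α h (by rw [Category.id_comp]; exact h), R.coord_smul]
    rw [coord_congr R (Category.id_comp _) _ _ hl, h1', mul_one]
    simp
  have hs : ∀ c : Γ(T, ⊤), Lands (R.smul c (x ≫ e) ≫ R.π) (C.U α) := fun c => by rw [R.smul_π]; exact hl
  have hsum : ∀ f : Fin 1 → Γ(T, ⊤), (∑ i, f i • (⟨x ≫ e, rfl⟩ : R.data.Fiber ((x ≫ e) ≫ R.π))).1 = R.smul (f 0) (x ≫ e) := by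
    intro f
    rw [Fin.sum_univ_one]
    rfl
  constructor
  · intro f g e'
    have e1 : R.smul (f 0) (x ≫ e) = R.smul (g 0) (x ≫ e) := by
      rw [← hsum, ← hsum]
      exact congrArg Subtype.val e'
    funext i
    rw [Subsingleton.elim i 0, ← key (f 0) (hs _), ← key (g 0) (hs _)]
    exact coord_congr R e1 _ _ _
  · intro ⟨a, ha⟩
    have hla : Lands (a ≫ R.π) (C.U α) := by
      have : a ≫ R.π = (x ≫ e) ≫ R.π := ha
      rw [this]; exact hl
    refine ⟨fun _ => R.coord a α hla, Subtype.ext ?_⟩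
    refine (hsum _).trans ?_
    refine R.ext _ _ ?_ α (hs _) hla (key _ _)
    rw [R.smul_π]
    exact Eq.symm ha

theorem LRep.frame (α : ι) (e : (C.U α).toScheme ⟶ R.tot) (he : e ≫ R.π = (C.U α).ι) (hY) (h1 : R.coord e α hY = 1) :
    R.data.IsFrame (n := 1) (C.U α) (fun _ => e) :=
  ⟨fun _ => he, fun x => R.bij α e hY h1 x _ (by rw [Category.assoc, he])⟩

theorem lands_ι (U : X.Opens) : Lands U.ι U := fun t _ => t.2

/-- the line bundle -/
def LRep.bundle : LineBundle X where
  __ := R.data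
  locTriv x := by
    obtain ⟨α, hα⟩ := C.cov x
    refine ⟨C.U α, fun _ => R.mkp (C.U α).ι α (lands_ι _) 1, hα, ?_⟩
    exact R.frame α _ (R.mkp_π _ _ _ _) (by rw [R.mkp_π]; exact lands_ι _) (R.coord_mkp _ _ _ _ _)

/-- the trivial cocycle -/
def trivCoc (X : Scheme.{u}) : Coc X Unit where
  U _ := ⊤
  cov _ := ⟨(), trivial⟩
  u _ _ := 1
  u_self _ := rfl
  u_mul := by intros; simp [pb_one]

theorem lands_top {T : Scheme.{u}} (x : T ⟶ X) : Lands x ⊤ := fun _ _ => trivial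

theorem triv_isTrivial (R : LRep (trivCoc X)) : IsTrivialBundle R.bundle := by
  refine ⟨fun _ => R.mkp (𝟙 X) () (lands_top _) 1, fun _ => R.mkp_π _ _ _ _, fun x => ?_⟩
  exact R.bij () (R.mkp (𝟙 X) () (lands_top _) 1) (lands_top _) (R.coord_mkp _ _ _ _ _) x x
    ((Category.assoc _ _ _).trans ((congrArg _ (R.mkp_π _ _ _ _)).trans (Category.comp_id _)))

theorem frame_smul (E : VecBundleData X) (U : X.Opens) (s : Fin 1 → (U.toScheme ⟶ E.tot)) (hs : E.IsFrame U s) (w : Γ(U.toScheme, ⊤)) (hw : IsUnit w) :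
    E.IsFrame (n := 1) U (fun _ => E.smul w (s 0)) := by
  obtain ⟨h1, h2⟩ := hs
  refine ⟨fun _ => by rw [E.smul_π, h1], ?_⟩
  intro T x
  have hb := h2 x
  have hu : IsUnit (x.appTop w) := hw.map x.appTop.hom
  have hbij : Function.Bijective (fun f : Fin 1 → Γ(T, ⊤) => fun i => f i * x.appTop w) := by
    obtain ⟨v, hv⟩ := hu
    rw [← hv]
    refine ⟨fun f g e => ?_, fun f => ⟨fun i => f i * ↑v⁻¹, ?_⟩⟩
    · funext i
      have := congrFun e i
      simpa using this
    · funext i; simp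
  convert hb.comp hbij using 1
  funext f
  simp only [Function.comp]
  rw [Fin.sum_univ_one, Fin.sum_univ_one, mul_smul]
  congr 1
  apply Subtype.ext
  exact E.smul_natural _ _ _

/-- coordinate on a trivial bundle -/
def mc (M : LRep (trivCoc X)) {T : Scheme.{u}} (a : T ⟶ M.bundle.tot) : Γ(T, ⊤) := M.coord a () (lands_top _)

theorem mc_nat (M : LRep (trivCoc X)) {T T' : Scheme.{u}} (f : T' ⟶ T) (a : T ⟶ M.bundle.tot) : f.appTop (mc M a) = mc M (f ≫ a) :=
  M.coord_nat _ _ _ _ _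

theorem mc_id (M : LRep (trivCoc X)) {T : Scheme.{u}} (a : T ⟶ M.bundle.tot) : mc M (𝟙 T ≫ a) = mc M a := by
  rw [Category.id_comp]

theorem mc_add (M : LRep (trivCoc X)) {T : Scheme.{u}} (a b : T ⟶ M.bundle.tot) (h) : mc M (M.bundle.add a b h) = mc M a + mc M b := by
  rw [← mc_id M (M.bundle.add a b h), ← mc_id M a, ← mc_id M b]
  exact M.coord_add a b h (𝟙 T) () _

theorem mc_smul (M : LRep (trivCoc X)) {T : Scheme.{u}} (c : Γ(T, ⊤)) (a : T ⟶ M.bundle.tot) : mc M (M.bundle.smul c a) = c * mc M a := by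
  rw [← mc_id M (M.bundle.smul c a), ← mc_id M a]
  refine (M.coord_smul c a (𝟙 T) () _).trans ?_
  congr 1

theorem tensor_one (M : LRep (trivCoc X)) (L : LineBundle X) : IsTensor M.bundle L L := by
  refine ⟨fun a b h => L.smul (mc M a) b, ?_, ?_, ?_, ?_, ?_, ?_, ?_⟩
  · intro T a b h
    rw [L.smul_π, h]
  · intro T' T g a b h h'
    rw [L.smul_natural, mc_nat]
  · intro T a a' b h1 h2 h3 h4 h5
    dsimp only
    rw [mc_add, ← L.add_smul]
  · intro T a b b' h1 h2 h3 h4 h5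
    exact L.smul_add _ _ _ _ _
  · intro T f a b h1 h2
    rw [← L.mul_smul]
    dsimp only
    rw [mc_smul]
  · intro T f a b h1 h2
    dsimp only
    rw [← L.mul_smul, ← L.mul_smul, mul_comm]
  · intro U sM sL hM hL h
    refine frame_smul _ U sL hL _ ?_
    obtain ⟨h1, h2⟩ := hM
    obtain ⟨f, hf⟩ := (h2 (𝟙 _)).2 ⟨M.mkp U.ι () (lands_top _) 1, (M.mkp_π _ _ _ _).trans (Category.id_comp _).symm⟩
    have hf' := congrArg Subtype.val hf
    dsimp only at hf'
    rw [Fin.sum_univ_one] at hf'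
    have hf2 : M.bundle.smul (f 0) (𝟙 _ ≫ sM 0) = M.mkp U.ι () (lands_top _) 1 := hf'
    have e1 := congrArg (mc M) hf2
    rw [mc_smul, mc_id] at e1
    have e2 : mc M (M.mkp U.ι () (lands_top _) 1) = 1 := M.coord_mkp _ _ _ _ _
    rw [e2] at e1
    exact IsUnit.of_mul_eq_one_right _ e1

theorem tensorPow_one (L : LineBundle X) : IsTensorPow L 1 L :=
  ⟨(theLRep (trivCoc X)).bundle, triv_isTrivial _, tensor_one _ L⟩

end PartM7c

section PartM7d

theorem sec_of_K {X : Scheme.{u}} [IsIntegral X] (V : X.Opens) (ρ : X.functionField) (h : ∀ y ∈ V, ∃ t, tK X y t = ρ) :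
    ∃ a : Γ(X, V), ∀ y (hy : y ∈ V), tK X y (X.presheaf.germ V y hy a) = ρ := by
  classical
  have h' : ∀ y, ∃ t : X.presheaf.stalk y, y ∈ V → tK X y t = ρ := fun y => by
    by_cases hy : y ∈ V
    · obtain ⟨t, ht⟩ := h y hy
      exact ⟨t, fun _ => ht⟩
    · exact ⟨0, fun h => absurd h hy⟩
  choose A hA using h'
  obtain ⟨a, ha⟩ := glue_stalk X V A (fun y hy => by
    obtain ⟨V₂, hy₂, t', ht'⟩ := TopCat.Presheaf.exists_germ_eq X.presheaf (A y)
    refine ⟨V ⊓ V₂, ⟨hy, hy₂⟩, X.presheaf.map (homOfLE inf_le_right).op t', fun q hq => ?_⟩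
    have e := TopCat.Presheaf.germ_res_apply X.presheaf (homOfLE (inf_le_right : V ⊓ V₂ ≤ V₂)) q hq t'
    refine e.trans (tK_inj X _ ?_)
    rw [hA q hq.1, ← hA y hy, ← ht']
    haveI : Nonempty V₂ := ⟨⟨y, hy₂⟩⟩
    exact (Scheme.algebraMap_germ_eq_germToFunctionField X _ _).trans
        (Scheme.algebraMap_germ_eq_germToFunctionField X _ _).symm)
  exact ⟨a, fun y hy => by rw [ha, hA y hy]⟩

theorem sec_ext_K {X : Scheme.{u}} [IsIntegral X] {V : X.Opens} {a b : Γ(X, V)}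
    (h : ∀ y (hy : y ∈ V), tK X y (X.presheaf.germ V y hy a) = tK X y (X.presheaf.germ V y hy b)) : a = b :=
  TopCat.Presheaf.section_ext X.sheaf V a b (fun y hy => tK_inj X y (h y hy))

variable {X : Scheme.{u}} [IsIntegral X] {ι : Type} {c : ι → X.functionField} 

/-- chart domains -/
def cU (c : ι → X.functionField) (hfin : {i | c i ≠ 0}.Finite) (α : ι) : X.Opens :=
  ⟨{y | ∃ b, Chart c y α b}, by
    rw [isOpen_iff_forall_mem_open]
    intro y hy
    obtain ⟨b, hb⟩ := hy
    obtain ⟨U, hU, h⟩ := Chart.germ_fin hfin hb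
    exact ⟨U, h, U.2, hU⟩⟩

theorem mem_cU {hfin : {i | c i ≠ 0}.Finite} {α : ι} {y : X} : y ∈ cU c hfin α ↔ ∃ b, Chart c y α b := Iff.rfl

theorem cu_exists (c : ι → X.functionField) (hfin : {i | c i ≠ 0}.Finite) (β α : ι) : ∃ a : Γ(X, cU c hfin β), 
    ∀ y (hy : y ∈ cU c hfin β), tK X y (X.presheaf.germ _ y hy a) = c α / c β := 
  sec_of_K _ _ (fun y hy => by
    obtain ⟨b, hb⟩ := hy
    exact ⟨b α, by rw [eq_div_iff hb.1, hb.2]⟩)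

/-- the transition functions -/
def cu (c : ι → X.functionField) (hfin : {i | c i ≠ 0}.Finite) (β α : ι) : Γ(X, cU c hfin β) := (cu_exists c hfin β α).choose

theorem cu_spec (hfin : {i | c i ≠ 0}.Finite) (β α : ι) (y : X) (hy : y ∈ cU c hfin β) :
    tK X y (X.presheaf.germ _ y hy (cu c hfin β α)) = c α / c β := (cu_exists c hfin β α).choose_spec y hy

theorem cu_chart (hfin : {i | c i ≠ 0}.Finite) (β : ι) (y : X) (hy : y ∈ cU c hfin β) :
    Chart c y β (fun α => X.presheaf.germ _ y hy (cu c hfin β α)) := by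
  have hy' := hy
  obtain ⟨b, hb⟩ := hy
  exact ⟨hb.1, fun α => by rw [cu_spec hfin β α y hy', div_mul_cancel₀ _ hb.1]⟩

theorem pb_res {X T : Scheme.{u}} (x : T ⟶ X) {U V : X.Opens} (h : V ≤ U) (hV : Lands x V) (hU : Lands x U) (s : Γ(X, U)) :
    pb x hV (X.presheaf.map (homOfLE h).op s) = pb x hU s := by
  unfold pb
  have := Scheme.Hom.map_appLE x hV (homOfLE h).op
  rw [← this]
  rfl

theorem gm_pb {X T : Scheme.{u}} (x : T ⟶ X) {U : X.Opens} (hU : Lands x U) (s : Γ(X, U)) (t : T) :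
    gm T t (pb x hU s) = (x.stalkMap t).hom (X.presheaf.germ U (x t) (hU (x := t) trivial) s) := by
  have h1 := Scheme.Hom.germ_stalkMap_apply x U t (hU (x := t) trivial) s
  refine Eq.trans ?_ h1.symm
  exact TopCat.Presheaf.germ_res_apply T.presheaf (homOfLE hU) t trivial _

/-- the cocycle of a covering family -/
def cCoc (c : ι → X.functionField) (hfin : {i | c i ≠ 0}.Finite) (hcov : ∀ p : X, ∃ α b, Chart c p α b) : Coc X ι where
  U := cU c hfin
  cov := hcov
  u := cu c hfin
  u_self α := by
    apply sec_ext_K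
    intro y hy
    rw [cu_spec, map_one, map_one]
    obtain ⟨b, hb⟩ := hy
    exact div_self hb.1
  u_mul := by
    intro α β γ T x hβ hγ
    have hV : Lands x (cU c hfin β ⊓ cU c hfin γ) := fun t h => ⟨hβ h, hγ h⟩
    have lβ : cU c hfin β ⊓ cU c hfin γ ≤ cU c hfin β := inf_le_left
    have lγ : cU c hfin β ⊓ cU c hfin γ ≤ cU c hfin γ := inf_le_right
    rw [← pb_res x lβ hV, ← pb_res x lγ hV, ← pb_res x lγ hV]
    refine Eq.trans ?_ (map_mul (x.appLE _ _ hV).hom _ _)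
    refine congrArg _ ?_
    apply sec_ext_K
    intro y hy
    have e : ∀ α, _ := fun α => TopCat.Presheaf.germ_res_apply X.presheaf (homOfLE lγ) y hy (cu c hfin γ α)
    have e' := TopCat.Presheaf.germ_res_apply X.presheaf (homOfLE lβ) y hy (cu c hfin β α)
    rw [map_mul, map_mul]
    refine (congrArg (tK X y) (e α)).trans (Eq.trans ?_ (congrArg₂ (fun a b => tK X y a * tK X y b) (e β) e').symm)
    rw [cu_spec, cu_spec, cu_spec]
    obtain ⟨⟨b, hb⟩, ⟨b', hb'⟩⟩ := hy
    have := hb.1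
    have := hb'.1
    field_simp

theorem cCoc_pres (hfin : {i | c i ≠ 0}.Finite) (hcov : ∀ p : X, ∃ α b, Chart c p α b) {T : Scheme.{u}} (x : T ⟶ X) (α : ι)
    (h : Lands x ((cCoc c hfin hcov).U α)) : Pres c x (fun γ => pb x h ((cCoc c hfin hcov).u α γ)) := by
  intro t
  have hc := cu_chart hfin α (x t) (h (x := t) trivial)
  have h1 : pb x h ((cCoc c hfin hcov).u α α) = 1 := by rw [(cCoc c hfin hcov).u_self, pb_one]
  refine ⟨α, _, hc.1, hc.2, ?_, fun γ => ?_⟩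
  · dsimp only
    rw [h1, map_one]; exact isUnit_one
  · dsimp only
    rw [h1, map_one, mul_one, gm_pb]
    rfl

end PartM7d

section PartM7e

/-- evaluation of global functions at ring-valued points -/
def ev {T : Scheme.{u}} {S : Type u} [CommRing S] (g : Spec (CommRingCat.of S) ⟶ T) : Γ(T, ⊤) →+* S :=
  (Scheme.ΓSpecIso (CommRingCat.of S)).hom.hom.comp g.appTop.hom

theorem ev_nat {T T' : Scheme.{u}} {S : Type u} [CommRing S] (g : Spec (CommRingCat.of S) ⟶ T) (f : T ⟶ T') :
    (ev g).comp f.appTop.hom = ev (g ≫ f) := by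
  unfold ev
  rw [Scheme.Hom.comp_appTop, CommRingCat.hom_comp, RingHom.comp_assoc]

theorem ev_inv {T : Scheme.{u}} {S : Type u} [CommRing S] (g : Spec (CommRingCat.of S) ⟶ T) (s : Γ(T, ⊤)) :
    (Scheme.ΓSpecIso (CommRingCat.of S)).inv (ev g s) = g.appTop s := by
  unfold ev
  exact ConcreteCategory.congr_hom (Scheme.ΓSpecIso (CommRingCat.of S)).hom_inv_id (g.appTop s)

theorem ev_inj {T : Scheme.{u}} {a b : Γ(T, ⊤)}
    (h : ∀ (S : Type u) [CommRing S] (g : Spec (CommRingCat.of S) ⟶ T), ev g a = ev g b) : a = b := by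
  apply gm_ext
  intro t
  have e := congrArg (Scheme.ΓSpecIso (CommRingCat.of (T.presheaf.stalk t))).inv (h (T.presheaf.stalk t) (fstalk T t))
  rw [ev_inv, ev_inv] at e
  have key : ∀ s, (fstalk T t).appTop s = (Scheme.ΓSpecIso (CommRingCat.of (T.presheaf.stalk t))).inv (gm T t s) := by
    intro s
    have e := ConcreteCategory.congr_hom (Scheme.fromSpecStalk_appTop (X := T) (x := t)) s
    refine e.trans ?_
    have h0 : (homOfLE (le_top : (⊤ : (Spec (T.presheaf.stalk t)).Opens) ≤ ⊤)).op = 𝟙 _ := rfl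
    rw [CommRingCat.comp_apply, CommRingCat.comp_apply]
    exact ConcreteCategory.congr_hom ((Spec (T.presheaf.stalk t)).presheaf.map_id _) _
  rw [key, key] at e
  exact ΓSpec_inj e

variable {k : Type u} [Field k] {G : GroupSchemeOver k} [IsAffine G.carrier]

theorem gpt_ev {S : Type u} [CommRing S] (g : Spec (CommRingCat.of S) ⟶ G.carrier) : gpt G (ev g) = g := by
  unfold gpt ev
  rw [smap_comp, smap, smap, CommRingCat.ofHom_hom, CommRingCat.ofHom_hom, SpecMap_ΓSpecIso_hom, Category.assoc]
  have := Scheme.toSpecΓ_naturality g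
  rw [← Category.assoc]
  refine (congrArg (· ≫ _) this.symm).trans ?_
  rw [Category.assoc, Scheme.toSpecΓ_isoSpec_inv, Category.comp_id]

theorem gpt_ev' {T : Scheme.{u}} {S : Type u} [CommRing S] (q : Spec (CommRingCat.of S) ⟶ T) (g : T ⟶ G.carrier) :
    gpt G ((ev q).comp g.appTop.hom) = q ≫ g := by
  rw [ev_nat, gpt_ev]

theorem hom_inj {T : Scheme.{u}} {A : Type u} [CommRing A] {a b : A →+* Γ(T, ⊤)}
    (h : ∀ (S : Type u) [CommRing S] (q : Spec (CommRingCat.of S) ⟶ T), (ev q).comp a = (ev q).comp b) : a = b := by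
  ext r
  exact ev_inj (fun S _ q => RingHom.congr_fun (h S q) r)

theorem top_compat {T : Scheme.{u}} {g g' : T ⟶ G.carrier} (h : g ≫ G.str = g' ≫ G.str) :
    g.appTop.hom.comp (kH G) = g'.appTop.hom.comp (kH G) := by
  apply hom_inj
  intro S _ q
  rw [← RingHom.comp_assoc, ← RingHom.comp_assoc, ← compat_iff, gpt_ev', gpt_ev', Category.assoc, h, Category.assoc]

theorem top_mul {T : Scheme.{u}} {g g' : T ⟶ G.carrier} (h : g ≫ G.str = g' ≫ G.str) :
    (G.mul g g' h).appTop.hom = rmul G g.appTop.hom g'.appTop.hom := by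
  apply hom_inj
  intro S _ q
  rw [rmul_nat G (top_compat h)]
  apply gpt_inj
  rw [gpt_ev', rmul_def]
  · rw [G.mul_natural q g g' h (by rw [Category.assoc, h, Category.assoc])]
    congr 1
    · rw [gpt_ev']
    · rw [gpt_ev']
  · rw [RingHom.comp_assoc, top_compat h, RingHom.comp_assoc]

theorem top_one {T : Scheme.{u}} {e : T ⟶ Spk k} : ∃ κ : k →+* Γ(T, ⊤), (e ≫ G.one).appTop.hom = rone G κ := by
  refine ⟨(e ≫ G.one).appTop.hom.comp (kH G), ?_⟩
  apply hom_inj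
  intro S _ q
  rw [rone_nat]
  apply gpt_inj
  rw [gpt_ev', rone_def, ← RingHom.comp_assoc, ← gpt_str, gpt_ev']
  simp only [Category.assoc]
  rw [← Category.assoc G.one, G.one_str, Category.id_comp]

end PartM7e

section PartM7f

variable {k : Type u} [Field k] {G : GroupSchemeOver k} [IsAffine G.carrier] {X : SchemeOver k} [IsIntegral X.carrier]

/-- the equivariance property of the coefficient vector of `f` -/
def EqvF (α : ActionOver G X) {n : ℕ} (gd : GData G n) {D : Type}
    (f : Polynomial (MvPolynomial (D × Option (Fin n)) X.carrier.functionField)) : Prop :=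
  ∀ (R : Type u) [CommRing R] (h : GH G →+* R) (x : Spec (CommRingCat.of R) ⟶ X.carrier) (hh : h.comp (kH G) = kst X x)
    (a a' : Polynomial (MvPolynomial (D × Option (Fin n)) R)) (ha : PresS (cf f) x (cf a))
    (ha' : PresS (cf f) (ract α h x) (cf a')), ∃ z, IsUnit z ∧ ∀ β, cf (a'.map (Sb gd D h)) β = z * cf a β

variable {α : ActionOver G X} {n : ℕ} {gd : GData G n} {D : Type}
  {f : Polynomial (MvPolynomial (D × Option (Fin n)) X.carrier.functionField)}
  (hc : ∀ p, ∃ β b, Chart (cf f) p β b)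

/-- the cocycle -/
abbrev fC : Coc X.carrier ((D × Option (Fin n) →₀ ℕ) × ℕ) := cCoc (cf f) (cf_finite f) hc

theorem fC_zero (β γ) (h : cf f γ = 0) : (fC hc).u β γ = 0 := by
  apply sec_ext_K
  intro y hy
  refine (cu_spec (cf_finite f) β γ y hy).trans ?_
  rw [h, zero_div, map_zero, map_zero]

theorem avec_exists {T : Scheme.{u}} (y : T ⟶ X.carrier) (β) (hβ : Lands y ((fC hc).U β)) :
    ∃ a : Polynomial (MvPolynomial (D × Option (Fin n)) Γ(T, ⊤)), ∀ γ, cf a γ = pb y hβ ((fC hc).u β γ) :=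
  exists_cf f _ (fun i hi => by rw [fC_zero hc β i hi]; exact map_zero _)

/-- normalized coordinate vector -/
def avec {T : Scheme.{u}} (y : T ⟶ X.carrier) (β) (hβ : Lands y ((fC hc).U β)) :
    Polynomial (MvPolynomial (D × Option (Fin n)) Γ(T, ⊤)) := (avec_exists hc y β hβ).choose

theorem cf_avec {T : Scheme.{u}} (y : T ⟶ X.carrier) (β) (hβ : Lands y ((fC hc).U β)) (γ) :
    cf (avec hc y β hβ) γ = pb y hβ ((fC hc).u β γ) := (avec_exists hc y β hβ).choose_spec γ

theorem cf_avec_self {T : Scheme.{u}} (y : T ⟶ X.carrier) (β) (hβ : Lands y ((fC hc).U β)) :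
    cf (avec hc y β hβ) β = 1 := by
  rw [cf_avec, Coc.u_self, pb_one]

theorem avec_congr {T : Scheme.{u}} {y y' : T ⟶ X.carrier} (e : y = y') (β) (hβ : Lands y ((fC hc).U β)) (hβ') :
    avec hc y β hβ = avec hc y' β hβ' := by subst e; rfl

theorem avec_nat {T T' : Scheme.{u}} (g : T' ⟶ T) (y : T ⟶ X.carrier) (β) (hβ : Lands y ((fC hc).U β)) (hβ') :
    (avec hc y β hβ).map (MvPolynomial.map g.appTop.hom) = avec hc (g ≫ y) β hβ' := by
  apply cf_ext
  intro i
  rw [cf_map, cf_avec, cf_avec]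
  exact pb_nat g y hβ hβ' _

theorem avec_trans {T : Scheme.{u}} (y : T ⟶ X.carrier) (β β') (hβ : Lands y ((fC hc).U β)) (hβ' : Lands y ((fC hc).U β')) :
    avec hc y β' hβ' = Polynomial.C (MvPolynomial.C (pb y hβ' ((fC hc).u β' β))) * avec hc y β hβ := by
  apply cf_ext
  intro i
  rw [cf_CC, cf_avec, cf_avec]
  exact (fC hc).u_mul i β β' y hβ hβ'

theorem avec_presS {T : Scheme.{u}} {S : Type u} [CommRing S] (q : Spec (CommRingCat.of S) ⟶ T)
    (y : T ⟶ X.carrier) (β) (hβ : Lands y ((fC hc).U β)) :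
    PresS (cf f) (q ≫ y) (cf ((avec hc y β hβ).map (MvPolynomial.map (ev q)))) := by
  have h := (cCoc_pres (cf_finite f) hc y β hβ).comp q
  unfold PresS
  refine (congrArg (Pres (cf f) (q ≫ y)) ?_).mp h
  funext i
  rw [cf_map, ev_inv, cf_avec]

variable (gd) in
/-- transition factor -/
def Zc {T : Scheme.{u}} (h : T ⟶ G.carrier) (y : T ⟶ X.carrier) (β) (hβ : Lands y ((fC hc).U β)) (γ : (D × Option (Fin n) →₀ ℕ) × ℕ) : Γ(T, ⊤) :=
  cf ((avec hc y β hβ).map (Sb gd D h.appTop.hom)) γ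

theorem Zc_congr {T : Scheme.{u}} {h h' : T ⟶ G.carrier} (eh : h = h') {y y' : T ⟶ X.carrier} (e : y = y') (β) (hβ : Lands y ((fC hc).U β)) (hβ') (γ) :
    Zc gd hc h y β hβ γ = Zc gd hc h' y' β hβ' γ := by subst e; subst eh; rfl

theorem Zc_main (he : EqvF α gd f) {T : Scheme.{u}} (h : T ⟶ G.carrier) (x : T ⟶ X.carrier) (hh : h ≫ G.str = x ≫ X.str)
    (β) (hβ : Lands (α.act h x hh) ((fC hc).U β)) (γ) (hγ : Lands x ((fC hc).U γ)) :
    (avec hc (α.act h x hh) β hβ).map (Sb gd D h.appTop.hom) =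
      Polynomial.C (MvPolynomial.C (Zc gd hc h (α.act h x hh) β hβ γ)) * avec hc x γ hγ := by
  apply cf_ext
  intro i
  rw [cf_CC]
  unfold Zc
  apply ev_inj
  intro S _ q
  have c1 : ((ev q).comp h.appTop.hom).comp (kH G) = kst X (q ≫ x) := by
    rw [← acompat_iff, gpt_ev', Category.assoc, hh, Category.assoc]
  have e1 : ract α ((ev q).comp h.appTop.hom) (q ≫ x) = q ≫ α.act h x hh := by
    rw [ract_def α c1, α.act_natural q h x hh (by rw [Category.assoc, hh, Category.assoc])]
    exact α.act_congr (gpt_ev' q h) rfl _ _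
  obtain ⟨z, hz, hz'⟩ := he S ((ev q).comp h.appTop.hom) (q ≫ x) c1 _ _ (avec_presS hc q x γ hγ)
    (by rw [e1]; exact avec_presS hc q _ β hβ)
  have key : ∀ j, ev q (cf ((avec hc (α.act h x hh) β hβ).map (Sb gd D h.appTop.hom)) j) = z * ev q (cf (avec hc x γ hγ) j) := by
    intro j
    rw [← cf_map, ← cf_map, ← hz']
    rw [Polynomial.map_map, Polynomial.map_map, Sb_map]
  rw [map_mul, key, key, cf_avec_self, map_one, mul_one]

theorem Zc_nat {T T' : Scheme.{u}} (g : T' ⟶ T) (h : T ⟶ G.carrier) (y : T ⟶ X.carrier) (β) (hβ : Lands y ((fC hc).U β)) (hβ') (γ) :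
    g.appTop (Zc gd hc h y β hβ γ) = Zc gd hc (g ≫ h) (g ≫ y) β hβ' γ := by
  unfold Zc
  rw [← avec_nat hc g y β hβ, Polynomial.map_map, Scheme.Hom.comp_appTop, CommRingCat.hom_comp, ← Sb_map, ← Polynomial.map_map, cf_map]

theorem Zc_trans {T : Scheme.{u}} (h : T ⟶ G.carrier) (y : T ⟶ X.carrier) (β β') (hβ : Lands y ((fC hc).U β)) (hβ' : Lands y ((fC hc).U β')) (γ) :
    Zc gd hc h y β' hβ' γ = pb y hβ' ((fC hc).u β' β) * Zc gd hc h y β hβ γ := by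
  unfold Zc
  rw [avec_trans hc y β β' hβ hβ', Polynomial.map_mul, Polynomial.map_C, Sb_C, cf_CC]

theorem Zc_src (he : EqvF α gd f) {T : Scheme.{u}} (h : T ⟶ G.carrier) (x : T ⟶ X.carrier) (hh : h ≫ G.str = x ≫ X.str)
    (β) (hβ : Lands (α.act h x hh) ((fC hc).U β)) (γ) (hγ : Lands x ((fC hc).U γ)) (δ) :
    Zc gd hc h (α.act h x hh) β hβ δ = Zc gd hc h (α.act h x hh) β hβ γ * pb x hγ ((fC hc).u γ δ) := by
  have e := congrArg (fun p => cf p δ) (Zc_main hc he h x hh β hβ γ hγ)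
  exact e.trans (by rw [cf_CC, cf_avec])

theorem Zc_mul (he : EqvF α gd f) {T : Scheme.{u}} (g g' : T ⟶ G.carrier) (x : T ⟶ X.carrier) (hg : g ≫ G.str = g' ≫ G.str)
    (h' : g' ≫ G.str = x ≫ X.str) (h : g ≫ G.str = α.act g' x h' ≫ X.str)
    (β) (hβ : Lands (α.act g (α.act g' x h') h) ((fC hc).U β)) (γ) (hγ : Lands (α.act g' x h') ((fC hc).U γ)) (δ) :
    Zc gd hc (G.mul g g' hg) (α.act g (α.act g' x h') h) β hβ δ =
      Zc gd hc g (α.act g (α.act g' x h') h) β hβ γ * Zc gd hc g' (α.act g' x h') γ hγ δ := by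
  have e := Zc_main hc he g _ h β hβ γ hγ
  unfold Zc at e ⊢
  rw [top_mul, ← Sb_mul gd (top_compat hg), ← Polynomial.map_map, e, Polynomial.map_mul, Polynomial.map_C, Sb_C, cf_CC, ← e]

theorem Zc_one {T : Scheme.{u}} (e : T ⟶ Spk k) (y : T ⟶ X.carrier) (β) (hβ : Lands y ((fC hc).U β)) :
    Zc gd hc (e ≫ G.one) y β hβ β = 1 := by
  unfold Zc
  obtain ⟨κ, hκ⟩ := top_one (G := G) (e := e)
  rw [hκ, Sb_one, Polynomial.map_id, cf_avec_self]

end PartM7f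

section PartM7g

theorem LRep.ext_all2 {X : Scheme.{u}} {ι : Type} {C : Coc X ι} (R : LRep C) {T : Scheme.{u}} (l l' : T ⟶ R.tot) (e : l ≫ R.π = l' ≫ R.π)
    (x₁ x₂ : T ⟶ X)
    (h : ∀ {T' : Scheme.{u}} (f : T' ⟶ T) α h h' γ δ, Lands (f ≫ x₁) (C.U γ) → Lands (f ≫ x₂) (C.U δ) →
      R.coord (f ≫ l) α h = R.coord (f ≫ l') α h') : l = l' := by
  refine R.ext_loc l l' e fun t => ?_
  obtain ⟨α, V₀, hV₀, hl₀⟩ := lands_loc C (l ≫ R.π) t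
  obtain ⟨γ, V₁, hV₁, hl₁⟩ := lands_loc C x₁ t
  obtain ⟨δ, V₂, hV₂, hl₂⟩ := lands_loc C x₂ t
  let V := V₀ ⊓ (V₁ ⊓ V₂)
  have i0 : V ≤ V₀ := inf_le_left
  have i1 : V ≤ V₁ := inf_le_right.trans inf_le_left
  have i2 : V ≤ V₂ := inf_le_right.trans inf_le_right
  have key : ∀ {W : T.Opens} (i : V ≤ W) {x : T ⟶ X} {U : X.Opens}, Lands (W.ι ≫ x) U → Lands (V.ι ≫ x) U := by
    intro W i x U hW
    rw [← Scheme.homOfLE_ι T i, Category.assoc]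
    exact hW.comp _
  have h1 : Lands ((V.ι ≫ l) ≫ R.π) (C.U α) := by rw [Category.assoc]; exact key i0 hl₀
  have h2 : Lands ((V.ι ≫ l') ≫ R.π) (C.U α) := by rw [Category.assoc, ← e]; exact key i0 hl₀
  exact ⟨V, ⟨hV₀, hV₁, hV₂⟩, α, h1, h2, h V.ι α h1 h2 γ δ (key i1 hl₁) (key i2 hl₂)⟩

variable {k : Type u} [Field k] {G : GroupSchemeOver k} [IsAffine G.carrier] {X : SchemeOver k} [IsIntegral X.carrier]
variable {α : ActionOver G X} {n : ℕ} {gd : GData G n} {D : Type}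
  {f : Polynomial (MvPolynomial (D × Option (Fin n)) X.carrier.functionField)}
  {hc : ∀ p, ∃ β b, Chart (cf f) p β b}

theorem Zcoord_indep (he : EqvF α gd f) (R : LRep (fC hc)) {T : Scheme.{u}} (h : T ⟶ G.carrier) (l : T ⟶ R.tot)
    (y : T ⟶ X.carrier) (hh : h ≫ G.str = (l ≫ R.π) ≫ X.str) (hy : y = α.act h (l ≫ R.π) hh)
    (β) (hβ : Lands y ((fC hc).U β)) (γ δ) (hγ : Lands (l ≫ R.π) ((fC hc).U γ)) (hδ : Lands (l ≫ R.π) ((fC hc).U δ)) :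
    Zc gd hc h y β hβ γ * R.coord l γ hγ = Zc gd hc h y β hβ δ * R.coord l δ hδ := by
  subst hy
  rw [Zc_src hc he h (l ≫ R.π) hh β hβ γ hγ δ, R.coord_trans l δ γ hδ hγ, mul_assoc]

theorem lact_exists (he : EqvF α gd f) (R : LRep (fC hc)) {T : Scheme.{u}} (h : T ⟶ G.carrier) (l : T ⟶ R.tot)
    (hh : h ≫ G.str = (l ≫ R.π) ≫ X.str) :
    ∃ m : T ⟶ R.tot, m ≫ R.π = α.act h (l ≫ R.π) hh ∧ ∀ {T' : Scheme.{u}} (q : T' ⟶ T) (β γ) (hβ : Lands ((q ≫ m) ≫ R.π) ((fC hc).U β))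
      (hγ : Lands ((q ≫ l) ≫ R.π) ((fC hc).U γ)) (hβ' : Lands (q ≫ α.act h (l ≫ R.π) hh) ((fC hc).U β)),
      R.coord (q ≫ m) β hβ = Zc gd hc (q ≫ h) (q ≫ α.act h (l ≫ R.π) hh) β hβ' γ * R.coord (q ≫ l) γ hγ := by
  have ind : ∀ {T' : Scheme.{u}} (q : T' ⟶ T) (β γ δ) (hβ' : Lands (q ≫ α.act h (l ≫ R.π) hh) ((fC hc).U β))
      (hγ : Lands ((q ≫ l) ≫ R.π) ((fC hc).U γ)) (hδ : Lands ((q ≫ l) ≫ R.π) ((fC hc).U δ)),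
      Zc gd hc (q ≫ h) (q ≫ α.act h (l ≫ R.π) hh) β hβ' γ * R.coord (q ≫ l) γ hγ =
      Zc gd hc (q ≫ h) (q ≫ α.act h (l ≫ R.π) hh) β hβ' δ * R.coord (q ≫ l) δ hδ := by
    intro T' q β γ δ hβ hγ hδ
    have c : (q ≫ h) ≫ G.str = ((q ≫ l) ≫ R.π) ≫ X.str := by
      simp only [Category.assoc] at hh ⊢; rw [hh]
    refine Zcoord_indep (α := α) he R (q ≫ h) (q ≫ l) _ c ?_ β hβ γ δ hγ hδ
    rw [α.act_natural q h _ hh (by simpa only [Category.assoc] using c)]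
    exact α.act_congr rfl (Category.assoc _ _ _).symm _ _
  obtain ⟨m, hm, hm'⟩ := glueL R (α.act h (l ≫ R.π) hh) (fun q => ∃ γ, Lands ((q ≫ l) ≫ R.π) ((fC hc).U γ))
    (fun g q hq => ⟨hq.choose, by rw [Category.assoc g q, Category.assoc g]; exact hq.choose_spec.comp g⟩)
    (fun t => by
      obtain ⟨γ, V, hV, hl⟩ := lands_loc (fC hc) (l ≫ R.π) t
      exact ⟨V, hV, γ, by rw [Category.assoc]; exact hl⟩)
    (fun q hq β hβ => Zc gd hc (q ≫ h) (q ≫ α.act h (l ≫ R.π) hh) β hβ hq.choose * R.coord (q ≫ l) hq.choose hq.choose_spec)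
    (by
      intro T' T'' g q hq hq' β hβ hβ'
      dsimp only
      have hγ : Lands (((g ≫ q) ≫ l) ≫ R.π) ((fC hc).U hq.choose) := by
        rw [Category.assoc g q, Category.assoc g]; exact hq.choose_spec.comp g
      rw [ind (g ≫ q) β _ hq.choose hβ' hq'.choose_spec hγ, map_mul, R.coord_comp g q l _ _ hγ,
        Zc_nat hc g _ _ β hβ (by rw [← Category.assoc]; exact hβ')]
      refine congrArg (· * _) ?_
      exact Zc_congr hc (Category.assoc _ _ _).symm (Category.assoc _ _ _).symm _ _ _ _)
    (by
      intro T' q hq β β' hβ hβ'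
      rw [Zc_trans hc _ _ β β' hβ hβ', mul_assoc])
  refine ⟨m, hm, ?_⟩
  intro T' q β γ hβ hγ hβ'
  have hq : ∃ γ, Lands ((q ≫ l) ≫ R.π) ((fC hc).U γ) := ⟨γ, hγ⟩
  rw [hm' q hq β hβ' hβ]
  exact ind q β _ γ hβ' hq.choose_spec hγ

def lact (he : EqvF α gd f) (R : LRep (fC hc)) {T : Scheme.{u}} (h : T ⟶ G.carrier) (l : T ⟶ R.tot)
    (hh : h ≫ G.str = (l ≫ R.π) ≫ X.str) : T ⟶ R.tot := (lact_exists he R h l hh).choose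

theorem lact_π (he : EqvF α gd f) (R : LRep (fC hc)) {T : Scheme.{u}} (h : T ⟶ G.carrier) (l : T ⟶ R.tot)
    (hh : h ≫ G.str = (l ≫ R.π) ≫ X.str) : lact he R h l hh ≫ R.π = α.act h (l ≫ R.π) hh := (lact_exists he R h l hh).choose_spec.1

theorem coord_lact (he : EqvF α gd f) (R : LRep (fC hc)) {T : Scheme.{u}} (h : T ⟶ G.carrier) (l : T ⟶ R.tot)
    (hh : h ≫ G.str = (l ≫ R.π) ≫ X.str) {T' : Scheme.{u}} (q : T' ⟶ T) (β γ) (hβ : Lands ((q ≫ lact he R h l hh) ≫ R.π) ((fC hc).U β))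
      (hγ : Lands ((q ≫ l) ≫ R.π) ((fC hc).U γ)) (h' : T' ⟶ G.carrier) (eh : h' = q ≫ h) (y : T' ⟶ X.carrier) (ey : y = q ≫ lact he R h l hh ≫ R.π) (hβ' : Lands y ((fC hc).U β)) :
      R.coord (q ≫ lact he R h l hh) β hβ = Zc gd hc h' y β hβ' γ * R.coord (q ≫ l) γ hγ := by
  have hb : Lands (q ≫ α.act h (l ≫ R.π) hh) ((fC hc).U β) := by rw [← lact_π he R, ← Category.assoc]; exact hβ
  refine ((lact_exists he R h l hh).choose_spec.2 q β γ hβ hγ hb).trans ?_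
  subst eh
  refine congrArg (· * _) ?_
  exact Zc_congr hc rfl (by rw [ey, lact_π]) _ _ _ _

theorem lact_natural (he : EqvF α gd f) (R : LRep (fC hc)) {T T' : Scheme.{u}} (q : T' ⟶ T) (h : T ⟶ G.carrier) (l : T ⟶ R.tot)
    (hh : h ≫ G.str = (l ≫ R.π) ≫ X.str) (hh') : q ≫ lact he R h l hh = lact he R (q ≫ h) (q ≫ l) hh' := by
  have eπ : (q ≫ lact he R h l hh) ≫ R.π = lact he R (q ≫ h) (q ≫ l) hh' ≫ R.π := by
    rw [Category.assoc, lact_π, lact_π, α.act_natural q h _ hh (by simpa only [Category.assoc] using hh')]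
    exact α.act_congr rfl (Category.assoc _ _ _).symm _ _
  refine R.ext_all2 _ _ eπ ((q ≫ l) ≫ R.π) ((q ≫ l) ≫ R.π) ?_
  intro T'' p β hβ hβ' γ δ hγ _
  have e0 : p ≫ q ≫ lact he R h l hh = (p ≫ q) ≫ lact he R h l hh := (Category.assoc _ _ _).symm
  have e1 : p ≫ q ≫ l = (p ≫ q) ≫ l := (Category.assoc _ _ _).symm
  have hγ' : Lands ((p ≫ q ≫ l) ≫ R.π) ((fC hc).U γ) := by simpa only [Category.assoc] using hγ
  rw [coord_congr R e0 β hβ (by rw [← e0]; exact hβ),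
    coord_lact he R h l hh (p ≫ q) β γ _ (by rw [← e1]; exact hγ') (p ≫ q ≫ h) (Category.assoc _ _ _).symm
    (p ≫ lact he R (q ≫ h) (q ≫ l) hh' ≫ R.π) (by rw [← eπ]; simp only [Category.assoc]) (by rw [← Category.assoc]; exact hβ'),
    coord_lact he R (q ≫ h) (q ≫ l) hh' p β γ hβ' hγ' (p ≫ q ≫ h) rfl (p ≫ lact he R (q ≫ h) (q ≫ l) hh' ≫ R.π) rfl (by rw [← Category.assoc]; exact hβ'),
    coord_congr R e1]

theorem one_lact (he : EqvF α gd f) (R : LRep (fC hc)) {T : Scheme.{u}} (l : T ⟶ R.tot) (hh) :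
    lact he R (((l ≫ R.π) ≫ X.str) ≫ G.one) l hh = l := by
  have eπ : lact he R (((l ≫ R.π) ≫ X.str) ≫ G.one) l hh ≫ R.π = l ≫ R.π := by
    rw [lact_π]
    refine (α.act_congr (by simp only [Category.assoc]) rfl _ ?_).trans (α.one_act (l ≫ R.π) ?_)
    · simpa only [Category.assoc] using hh
    · simpa only [Category.assoc] using hh
  refine R.ext_all _ _ eπ ?_
  intro T'' p β hβ hβ'
  rw [coord_lact he R _ l hh p β β hβ hβ' ((p ≫ ((l ≫ R.π) ≫ X.str)) ≫ G.one) (Category.assoc _ _ _) _ rfl (by rw [← Category.assoc]; exact hβ),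
    Zc_one, one_mul]

theorem mul_lact (he : EqvF α gd f) (R : LRep (fC hc)) {T : Scheme.{u}} (g g' : T ⟶ G.carrier) (l : T ⟶ R.tot) (h₁ h₂ h₃ h₄) :
    lact he R (G.mul g g' h₁) l h₂ = lact he R g (lact he R g' l h₃) h₄ := by
  have h₅ : g ≫ G.str = (α.act g' (l ≫ R.π) h₃) ≫ X.str := by rw [← lact_π he R]; exact h₄
  have eπ' : lact he R g (lact he R g' l h₃) h₄ ≫ R.π = α.act g (α.act g' (l ≫ R.π) h₃) h₅ := by
    rw [lact_π]
    exact α.act_congr rfl (lact_π _ _ _ _ _) _ _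
  have eπ : lact he R (G.mul g g' h₁) l h₂ ≫ R.π = lact he R g (lact he R g' l h₃) h₄ ≫ R.π := by
    rw [eπ', lact_π]
    exact α.mul_act g g' _ h₁ h₂ h₃ h₅
  refine R.ext_all2 _ _ eπ (l ≫ R.π) (lact he R g' l h₃ ≫ R.π) ?_
  intro T'' p β hβ hβ' γ δ hγ hδ
  have c1 : (p ≫ g) ≫ G.str = (p ≫ g') ≫ G.str := by rw [Category.assoc, h₁, Category.assoc]
  have c2 : (p ≫ g') ≫ G.str = (p ≫ l ≫ R.π) ≫ X.str := by rw [Category.assoc, h₃]; simp only [Category.assoc]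
  have e1 : p ≫ α.act g' (l ≫ R.π) h₃ = α.act (p ≫ g') (p ≫ l ≫ R.π) c2 := α.act_natural _ _ _ _ _
  have c3 : (p ≫ g) ≫ G.str = α.act (p ≫ g') (p ≫ l ≫ R.π) c2 ≫ X.str := by rw [← e1, Category.assoc, h₅, Category.assoc]
  have e2 : p ≫ α.act g (α.act g' (l ≫ R.π) h₃) h₅ = α.act (p ≫ g) (α.act (p ≫ g') (p ≫ l ≫ R.π) c2) c3 := by
    rw [α.act_natural p g _ h₅ (by rw [e1]; exact c3)]
    exact α.act_congr rfl e1 _ _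
  have hβ2 : Lands (α.act (p ≫ g) (α.act (p ≫ g') (p ≫ l ≫ R.π) c2) c3) ((fC hc).U β) := by
    rw [← e2, ← eπ', ← Category.assoc]; exact hβ'
  have hδ2 : Lands (α.act (p ≫ g') (p ≫ l ≫ R.π) c2) ((fC hc).U δ) := by
    rw [← e1, ← lact_π he R]; exact hδ
  have hδ3 : Lands ((p ≫ lact he R g' l h₃) ≫ R.π) ((fC hc).U δ) := by rw [Category.assoc]; exact hδ
  have hγ3 : Lands ((p ≫ l) ≫ R.π) ((fC hc).U γ) := by rw [Category.assoc]; exact hγ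
  rw [coord_lact he R _ l h₂ p β γ hβ hγ3 (G.mul (p ≫ g) (p ≫ g') c1) (G.mul_natural _ _ _ _ _).symm _ (by rw [eπ, eπ']; exact e2.symm) hβ2,
    coord_lact he R g (lact he R g' l h₃) h₄ p β δ hβ' hδ3 (p ≫ g) rfl _ (by rw [eπ']; exact e2.symm) hβ2,
    coord_lact he R g' l h₃ p δ γ hδ3 hγ3 (p ≫ g') rfl _ (by rw [lact_π]; exact e1.symm) hδ2,
    Zc_mul hc he _ _ _ c1 c2 c3 β hβ2 δ hδ2 γ, mul_assoc]

theorem lact_add (he : EqvF α gd f) (R : LRep (fC hc)) {T : Scheme.{u}} (g : T ⟶ G.carrier) (a b : T ⟶ R.tot) (h₁ h₂ h₃ h₄ h₅) :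
    lact he R g (R.add a b h₁) h₂ = R.add (lact he R g a h₃) (lact he R g b h₄) h₅ := by
  have e1 : lact he R g (R.add a b h₁) h₂ ≫ R.π = lact he R g a h₃ ≫ R.π := by
    rw [lact_π, lact_π]
    exact α.act_congr rfl (R.add_π _ _ _) _ _
  refine R.ext_all2 _ _ (by rw [R.add_π, e1]) (a ≫ R.π) (a ≫ R.π) ?_
  intro T'' p β hβ hβ' γ δ hγ _
  have hγa : Lands ((p ≫ a) ≫ R.π) ((fC hc).U γ) := by rw [Category.assoc]; exact hγ
  have hγb : Lands ((p ≫ b) ≫ R.π) ((fC hc).U γ) := lands_of_eq hγa h₁.symm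
  have hγc : Lands ((p ≫ R.add a b h₁) ≫ R.π) ((fC hc).U γ) := lands_of_eq hγa (R.add_π _ _ _)
  have hy : Lands (p ≫ lact he R g a h₃ ≫ R.π) ((fC hc).U β) := by rw [← e1, ← Category.assoc]; exact hβ
  rw [R.coord_add, coord_lact he R g _ h₂ p β γ hβ hγc _ rfl _ (by rw [e1]) hy, R.coord_add,
    coord_lact he R g a h₃ p β γ _ hγa _ rfl _ rfl hy, coord_lact he R g b h₄ p β γ _ hγb _ rfl _ (by rw [h₅]) hy, mul_add]

theorem lact_smul (he : EqvF α gd f) (R : LRep (fC hc)) {T : Scheme.{u}} (g : T ⟶ G.carrier) (c : Γ(T, ⊤)) (a : T ⟶ R.tot) (h₁ h₂) :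
    lact he R g (R.smul c a) h₁ = R.smul c (lact he R g a h₂) := by
  have e1 : lact he R g (R.smul c a) h₁ ≫ R.π = lact he R g a h₂ ≫ R.π := by
    rw [lact_π, lact_π]
    exact α.act_congr rfl (R.smul_π _ _) _ _
  refine R.ext_all2 _ _ (by rw [R.smul_π, e1]) (a ≫ R.π) (a ≫ R.π) ?_
  intro T'' p β hβ hβ' γ δ hγ _
  have hγa : Lands ((p ≫ a) ≫ R.π) ((fC hc).U γ) := by rw [Category.assoc]; exact hγ
  have hγc : Lands ((p ≫ R.smul c a) ≫ R.π) ((fC hc).U γ) := lands_of_eq hγa (R.smul_π _ _)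
  have hy : Lands (p ≫ lact he R g a h₂ ≫ R.π) ((fC hc).U β) := by rw [← e1, ← Category.assoc]; exact hβ
  rw [R.coord_smul, coord_lact he R g _ h₁ p β γ hβ hγc _ rfl _ (by rw [e1]) hy, R.coord_smul,
    coord_lact he R g a h₂ p β γ _ hγa _ rfl _ rfl hy, mul_left_comm]

theorem isLinearized (he : EqvF α gd f) (R : LRep (fC hc)) : α.IsLinearized R.bundle :=
  ⟨{ lact := fun g e h => lact he R g e h
     lact_π := fun g e h h' => lact_π he R g e h
     lact_natural := fun q g e h h' => lact_natural he R q g e h h'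
     one_lact := fun e h => one_lact he R e h
     mul_lact := fun g g' e h₁ h₂ h₃ h₄ => mul_lact he R g g' e h₁ h₂ h₃ h₄
     lact_add := fun g a b h₁ h₂ h₃ h₄ h₅ => lact_add he R g a b h₁ h₂ h₃ h₄ h₅
     lact_smul := fun g c a h₁ h₂ => lact_smul he R g c a h₁ h₂ }⟩

end PartM7g

section PartM7h

theorem sec_residue {X E : Scheme.{u}} (s : X ⟶ E) (π : E ⟶ X) (h : s ≫ π = 𝟙 X) (y : X) (p : E) (hp : s y = p) :
    E.fromSpecResidueField p ≫ π ≫ s = E.fromSpecResidueField p := by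
  subst hp
  have : SurjectiveOnStalks (s ≫ π) := by rw [h]; infer_instance
  have hs := SurjectiveOnStalks.of_comp s π
  have hsurj : Function.Surjective (s.residueFieldMap y) := by
    have h1 := s.stalkMap_surjective y
    have h2 : Function.Surjective (X.residue y) := X.residue_surjective y
    have e : (s.residueFieldMap y) ∘ (E.residue (s y)) = (X.residue y) ∘ (s.stalkMap y) := by
      funext a
      exact ConcreteCategory.congr_hom (Scheme.residue_residueFieldMap s y) a
    have h3 : Function.Surjective ((s.residueFieldMap y) ∘ (E.residue (s y))) := by rw [e]; exact h2.comp h1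
    exact h3.of_comp
  have hbij : Function.Bijective (s.residueFieldMap y) := ⟨(s.residueFieldMap y).hom.injective, hsurj⟩
  have hiso : IsIso (s.residueFieldMap y) := (ConcreteCategory.isIso_iff_bijective _).mpr hbij
  rw [← cancel_epi (Spec.map (s.residueFieldMap y))]
  rw [Scheme.Hom.SpecMap_residueFieldMap_fromSpecResidueField_assoc, Scheme.Hom.SpecMap_residueFieldMap_fromSpecResidueField]
  rw [← Category.assoc s, h, Category.id_comp]

variable {X : Scheme.{u}} {E : VecBundleData X}

theorem frame_coef {U : X.Opens} {s : Fin 1 → (U.toScheme ⟶ E.tot)} (hs : E.IsFrame U s) {T : Scheme.{u}} (x : T ⟶ U.toScheme)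
    (a : T ⟶ E.tot) (ha : a ≫ E.π = x ≫ U.ι) : ∃ c, a = E.smul c (x ≫ s 0) := by
  obtain ⟨h1, h2⟩ := hs
  obtain ⟨c, hc⟩ := (h2 x).2 ⟨a, ha⟩
  refine ⟨c 0, ?_⟩
  have := congrArg Subtype.val hc
  simp only [Finset.univ_unique, Fin.default_eq_zero, Finset.sum_singleton] at this
  exact this.symm

theorem frame_inj {U : X.Opens} {s : Fin 1 → (U.toScheme ⟶ E.tot)} (hs : E.IsFrame U s) {T : Scheme.{u}} (x : T ⟶ U.toScheme)
    {c d : Γ(T, ⊤)} (h : E.smul c (x ≫ s 0) = E.smul d (x ≫ s 0)) : c = d := by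
  obtain ⟨h1, h2⟩ := hs
  have := @(h2 x).1 (fun _ => c) (fun _ => d) (by
    dsimp only
    simp only [Finset.univ_unique, Fin.default_eq_zero, Finset.sum_singleton]
    exact Subtype.ext h)
  exact congrFun this 0

theorem vanish_iff {U : X.Opens} {e : Fin 1 → (U.toScheme ⟶ E.tot)} (he : E.IsFrame U e) (s : X ⟶ E.tot) (hs : s ≫ E.π = 𝟙 X)
    (w : Γ(U.toScheme, ⊤)) (hw : U.ι ≫ s = E.smul w (e 0)) (v : U.toScheme) :
    s (U.ι v) ≠ E.zero (U.ι v) ↔ IsUnit (gm U.toScheme v w) := by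
  have eπ : e 0 ≫ E.π = U.ι := he.1 0
  constructor
  · intro hne
    by_contra hnu
    apply hne
    let x := U.toScheme.fromSpecResidueField v
    have hx : ∀ t, x t = v := fun t => Scheme.fromSpecResidueField_apply v t
    have h0 : x.appTop w = 0 := by
      by_contra h0
      have hF := (Scheme.ΓSpecIso (U.toScheme.residueField v)).commRingCatIsoToRingEquiv
      have hu : IsUnit (x.appTop w) := by
        have hne : hF (x.appTop w) ≠ 0 := fun h => h0 (by simpa using h)
        have := (isUnit_iff_ne_zero.mpr hne).map hF.symm
        simpa using this
      have t : Spec (U.toScheme.residueField v) := IsLocalRing.closedPoint _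
      apply hnu
      have := hu.map (gm _ t)
      rw [← gm_stalkMap] at this
      have := isUnit_of_map_unit (x.stalkMap t).hom _ this
      rw [hx] at this
      exact this
    have h1 : x ≫ U.ι ≫ s = (x ≫ U.ι) ≫ E.zero := by
      rw [hw, E.smul_natural, h0, E.zero_smul, Category.assoc x, eπ]
    have t : Spec (U.toScheme.residueField v) := IsLocalRing.closedPoint _
    have h2 := congrArg (fun f : _ ⟶ E.tot => f t) h1
    simp only [Scheme.Hom.comp_apply, hx] at h2
    exact h2
  · intro hu heq
    let p := s (U.ι v)
    let q := E.tot.fromSpecResidueField p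
    have q1 : q ≫ E.π ≫ s = q := sec_residue s E.π hs _ p rfl
    have q2 : q ≫ E.π ≫ E.zero = q := sec_residue E.zero E.π E.zero_π _ p heq.symm
    have hq : ∀ t, (q ≫ E.π) t = U.ι v := by
      intro t
      rw [Scheme.Hom.comp_apply, Scheme.fromSpecResidueField_apply]
      have := congrArg (fun f : X ⟶ X => f (U.ι v)) hs
      simpa using this
    let x : _ ⟶ U.toScheme := IsOpenImmersion.lift U.ι (q ≫ E.π) (by
      rintro _ ⟨t, rfl⟩
      exact ⟨v, (hq t).symm⟩)
    have hx : x ≫ U.ι = q ≫ E.π := IsOpenImmersion.lift_fac _ _ _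
    have h0 : x.appTop w = 0 := by
      apply frame_inj he x
      rw [← E.smul_natural, ← hw, E.zero_smul, Category.assoc x, eπ, ← Category.assoc, hx, Category.assoc, q1, Category.assoc, q2]
    have t : Spec (E.tot.residueField p) := IsLocalRing.closedPoint _
    have hxt : x t = v := by
      apply U.ι.injective
      rw [← Scheme.Hom.comp_apply, hx, hq]
    rw [← hxt] at hu
    have := hu.map (x.stalkMap t).hom
    rw [gm_stalkMap, h0, map_zero] at this
    exact not_isUnit_zero this

end PartM7h

section PartM7i

variable {X : Scheme.{u}} [IsIntegral X] {ι : Type} {c : ι → X.functionField}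

theorem exists_section (hfin : {i | c i ≠ 0}.Finite) (hcov : ∀ p : X, ∃ α b, Chart c p α b) (R : LRep (cCoc c hfin hcov))
    {r : X.functionField} (hr : ∀ y β b, Chart c y β b → ∃ t, tK X y t * c β = r) :
    ∃ σ : X ⟶ R.tot, σ ≫ R.π = 𝟙 X ∧ ∀ y : X, σ y ≠ R.zero y ↔ UnitAt c r y := by
  have ha' : ∀ α, ∃ a : Γ(X, cU c hfin α), ∀ y (hy : y ∈ cU c hfin α), tK X y (X.presheaf.germ _ y hy a) = r / c α := fun α =>
    sec_of_K _ _ (fun y hy => by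
      obtain ⟨b, hb⟩ := hy
      obtain ⟨t, ht⟩ := hr y α b hb
      exact ⟨t, by rw [eq_div_iff hb.1, ht]⟩)
  choose a ha using ha'
  obtain ⟨σ, hσ, hσ'⟩ := glueL R (𝟙 X) (fun _ => True) (fun _ _ _ => trivial) (fun t => ⟨⊤, trivial, trivial⟩)
    (fun f _ α h => pb (f ≫ 𝟙 X) h (a α))
    (by
      intro T' T'' g f _ _ α hα hα'
      refine (pb_nat g (f ≫ 𝟙 X) hα (hα.comp g) (a α)).trans (pb_congr ?_ _ _ _)
      rw [Category.assoc])
    (by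
      intro T' f _ α β hα hβ
      generalize f ≫ 𝟙 X = x at hα hβ ⊢
      have hV : Lands x (cU c hfin β ⊓ cU c hfin α) := fun t h => ⟨hβ h, hα h⟩
      have lβ : cU c hfin β ⊓ cU c hfin α ≤ cU c hfin β := inf_le_left
      have lα : cU c hfin β ⊓ cU c hfin α ≤ cU c hfin α := inf_le_right
      refine (pb_res x lβ hV hβ (a β)).symm.trans (Eq.trans ?_ (congrArg₂ (· * ·) (pb_res x lβ hV hβ (cu c hfin β α)) (pb_res x lα hV hα (a α))))
      refine Eq.trans ?_ (map_mul (x.appLE _ _ hV).hom _ _)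
      refine congrArg _ ?_
      apply sec_ext_K
      intro y hy
      have e1 := TopCat.Presheaf.germ_res_apply X.presheaf (homOfLE lβ) y hy (a β)
      have e2 := TopCat.Presheaf.germ_res_apply X.presheaf (homOfLE lβ) y hy (cu c hfin β α)
      have e3 := TopCat.Presheaf.germ_res_apply X.presheaf (homOfLE lα) y hy (a α)
      rw [map_mul, map_mul]
      refine (congrArg (tK X y) e1).trans (Eq.trans ?_ (congrArg₂ (fun a b => tK X y a * tK X y b) e2 e3).symm)
      rw [ha, ha, cu_spec]
      obtain ⟨⟨b, hb⟩, ⟨b', hb'⟩⟩ := hy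
      have := hb.1
      have := hb'.1
      field_simp)
  refine ⟨σ, hσ, fun y => ?_⟩
  obtain ⟨α, hα⟩ := (cCoc c hfin hcov).cov y
  have hL : Lands (((cCoc c hfin hcov).U α).ι ≫ 𝟙 X) ((cCoc c hfin hcov).U α) := by rw [Category.comp_id]; exact lands_ι _
  let e := R.mkp ((cCoc c hfin hcov).U α).ι α (lands_ι _) 1
  have heπ : e ≫ R.π = ((cCoc c hfin hcov).U α).ι := R.mkp_π _ _ _ _
  have hY : Lands (e ≫ R.π) ((cCoc c hfin hcov).U α) := by rw [heπ]; exact lands_ι _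
  have hf := R.frame α e heπ hY (R.coord_mkp _ _ _ _ _)
  let w := pb (((cCoc c hfin hcov).U α).ι ≫ 𝟙 X) hL (a α)
  have hsm : (R.smul w e) ≫ R.π = ((cCoc c hfin hcov).U α).ι := (R.smul_π w e).trans heπ
  have hw : ((cCoc c hfin hcov).U α).ι ≫ σ = R.smul w e := by
    have hL1 : Lands ((((cCoc c hfin hcov).U α).ι ≫ σ) ≫ R.π) ((cCoc c hfin hcov).U α) := by rw [Category.assoc, hσ]; exact hL
    have hL2 : Lands ((R.smul w e) ≫ R.π) ((cCoc c hfin hcov).U α) := by rw [hsm]; exact lands_ι _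
    refine R.ext _ _ ?_ α hL1 hL2 ?_
    · rw [hsm, Category.assoc, hσ, Category.comp_id]
    · refine (hσ' _ trivial α hL hL1).trans ?_
      have h3 : Lands ((𝟙 _ ≫ R.smul w e) ≫ R.π) ((cCoc c hfin hcov).U α) := by rw [Category.id_comp]; exact hL2
      refine Eq.trans ?_ (coord_congr R (Category.id_comp (R.smul w e)) α h3 hL2)
      refine Eq.trans ?_ (R.coord_smul w e (𝟙 _) α h3).symm
      have h4 : Lands ((𝟙 _ ≫ e) ≫ R.π) ((cCoc c hfin hcov).U α) := by rw [Category.id_comp]; exact hY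
      have h5 := (coord_congr R (Category.id_comp e) α h4 hY).trans (R.coord_mkp _ _ _ _ _)
      refine Eq.trans ?_ (congrArg (_ * ·) h5).symm
      dsimp only
      rw [mul_one]
      simp
      rfl
  have := vanish_iff (E := R.data) hf σ hσ w hw ⟨y, hα⟩
  refine this.trans ?_
  have hg := gm_pb (((cCoc c hfin hcov).U α).ι ≫ 𝟙 X) hL (a α) ⟨y, hα⟩
  rw [show gm _ _ w = _ from hg]
  have hiso : IsIso ((((cCoc c hfin hcov).U α).ι ≫ 𝟙 X).stalkMap ⟨y, hα⟩) := 
    (fun (U : X.Opens) (v : U.toScheme) => (inferInstance : IsIso ((U.ι ≫ 𝟙 X).stalkMap v))) _ _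
  have hloc : ∀ t, IsUnit (((((cCoc c hfin hcov).U α).ι ≫ 𝟙 X).stalkMap ⟨y, hα⟩).hom t) ↔ IsUnit t := 
    fun t => isUnit_map_iff (((((cCoc c hfin hcov).U α).ι ≫ 𝟙 X).stalkMap ⟨y, hα⟩).hom) t
  rw [hloc]
  obtain ⟨b, hb⟩ := id hα
  have hK := ha α y hα
  rw [eq_div_iff hb.1] at hK
  constructor
  · intro h
    exact ⟨α, b, _, hb, h, hK⟩
  · intro h
    exact h.unit hb hK

end PartM7i

section PartM7j

variable {k : Type u} [Field k] {G : GroupSchemeOver k} [IsAffine G.carrier] {X : SchemeOver k} {α : ActionOver G X} [IsIntegral X.carrier] {n : ℕ} {gd : GData G n} {D : Type} {L : Type u} [Field L] [Algebra (MvPolynomial (D × Option (Fin n)) k) L] [IsFractionRing (MvPolynomial (D × Option (Fin n)) k) L] {GA : GenAlg k gd.ε D L} {s : Polynomial X.carrier.functionField}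

theorem poly_fin {K : Type*} [Semiring K] (s : Polynomial K) : {i | s.coeff i ≠ 0}.Finite := by
  refine s.support.finite_toSet.subset fun i hi => ?_
  simpa using hi

theorem ample_gen (hcov : ∀ p, ∃ α b, Chart s.coeff p α b) (hn : IsNormalScheme X.carrier) {f : Polynomial (MvPolynomial (D × Option (Fin n)) X.carrier.functionField)} (hf : IsGen α gd GA s f)
    (hU : ∀ i, s.coeff i ≠ 0 → IsAffineOpen (cU s.coeff (poly_fin s) i)) (h1 : CompactSpace X.carrier) (h2 : QuasiSeparatedSpace X.carrier)
    (hc : ∀ p, ∃ β b, Chart (cf f) p β b) (R : LRep (fC hc)) : IsAmple R.bundle := by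
  refine ⟨h1, h2, fun x => ⟨1, one_pos, R.bundle, tensorPow_one _, ?_⟩⟩
  obtain ⟨q, hq⟩ := M6_sections hcov hn hf
  obtain ⟨β, b, hb⟩ := hc x
  obtain ⟨i, j, t, ht, htr⟩ := (hq x β b hb).2
  have hr : ∀ y β b, Chart (cf f) y β b → ∃ t, tK X.carrier y t * cf f β = s.coeff i * cf q j := fun y β b h => (hq y β b h).1 i j
  have hux : UnitAt (cf f) (s.coeff i * cf q j) x := ⟨β, b, t, hb, ht, htr⟩
  have hsub : ∀ y, UnitAt (cf f) (s.coeff i * cf q j) y → s.coeff i ≠ 0 ∧ y ∈ cU s.coeff (poly_fin s) i := by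
    rintro y ⟨β, b, t, hb, ht, htr⟩
    have ht0 : tK X.carrier y t ≠ 0 := (ht.map (tK X.carrier y)).ne_zero
    have hne : s.coeff i * cf q j ≠ 0 := by rw [← htr]; exact mul_ne_zero ht0 hb.1
    refine ⟨left_ne_zero_of_mul hne, ?_⟩
    have hA := fun i' => (hq y β b hb).1 i' j
    choose A hA using hA
    obtain ⟨t, rfl⟩ := ht
    refine ⟨fun i' => A i' * (t⁻¹ : _), left_ne_zero_of_mul hne, fun i' => ?_⟩
    have hinv : tK X.carrier y (t⁻¹ : _) * tK X.carrier y t = 1 := by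
      rw [← map_mul, Units.inv_mul, map_one]
    apply mul_right_cancel₀ (right_ne_zero_of_mul hne)
    rw [← hA i', mul_assoc, ← htr, map_mul]
    linear_combination (tK X.carrier y (A i') * cf f β) * hinv
  obtain ⟨W, hW, hWu⟩ := M6_affine (cf_finite f) hc hr (hU i (hsub x hux).1) (fun y hy => (hsub y hy).2)
  obtain ⟨σ, hσ, hσ'⟩ := exists_section (cf_finite f) hc R hr
  refine ⟨σ, hσ, W, hW, (hWu x).mpr hux, ?_⟩
  ext y
  exact (hWu y).trans (hσ' y).symm

end PartM7j

section PartM8a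

variable {X : Scheme.{u}} [IsIntegral X]

/-- the generic point as a morphism -/
abbrev etaX (X : Scheme.{u}) [IsIntegral X] : Spec X.functionField ⟶ X := X.fromSpecStalk (genericPoint X)

/-- constants on the generic point -/
abbrev gi (X : Scheme.{u}) [IsIntegral X] : X.functionField →+* Γ(Spec X.functionField, ⊤) := (Scheme.ΓSpecIso X.functionField).inv.hom

theorem gi_bij : Function.Bijective (gi X) :=
  (Scheme.ΓSpecIso X.functionField).symm.commRingCatIsoToRingEquiv.bijective

theorem pb_eta {U : X.Opens} (h : Lands (etaX X) U) (W : Γ(X, U)) (y : X) (hy : y ∈ U) :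
    pb (etaX X) h W = gi X (tK X y (X.presheaf.germ U y hy W)) := by
  haveI : Nonempty U := ⟨⟨y, hy⟩⟩
  have hη : genericPoint X ∈ U := (genericPoint_spec X).mem_open_set_iff U.2 |>.mpr ⟨y, trivial, hy⟩
  have e : tK X y (X.presheaf.germ U y hy W) = X.germToFunctionField U W := Scheme.algebraMap_germ_eq_germToFunctionField X _ _
  rw [e]
  unfold pb Scheme.Hom.appLE
  rw [Scheme.fromSpecStalk_app hη, Category.assoc, Category.assoc, ← Functor.map_comp]
  rw [show ((homOfLE (le_top : (etaX X) ⁻¹ᵁ U ≤ ⊤)).op ≫ (homOfLE h).op) = 𝟙 _ from rfl, CategoryTheory.Functor.map_id, Category.comp_id]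
  rfl

/-- a frame near `y` with given generic restriction -/
def GenFr (E : VecBundleData X) (e0 : Spec X.functionField ⟶ E.tot) (y : X) (v : Γ(Spec X.functionField, ⊤)) : Prop :=
  ∃ (U : X.Opens) (e : Fin 1 → (U.toScheme ⟶ E.tot)) (x : Spec X.functionField ⟶ U.toScheme), y ∈ U ∧ E.IsFrame U e ∧ x ≫ U.ι = etaX X ∧
    x ≫ e 0 = E.smul v e0

theorem sec_gen {E : VecBundleData X} {e0 : Spec X.functionField ⟶ E.tot} {v : X → Γ(Spec X.functionField, ⊤)}
    (hv : ∀ y, IsUnit (v y)) (he : ∀ y, GenFr E e0 y (v y)) (s : X ⟶ E.tot) (hs : s ≫ E.π = 𝟙 X) :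
    ∃ r, ∀ y, ∃ t, gi X (tK X y t) * v y = r ∧ (IsUnit t ↔ s y ≠ E.zero y) := by
  obtain ⟨r, hr⟩ : ∃ r, etaX X ≫ s = E.smul r e0 := by
    obtain ⟨U, e, x, hy, hf, hx, hxe⟩ := he (genericPoint X)
    obtain ⟨c, hc⟩ := frame_coef hf x (etaX X ≫ s) (by rw [Category.assoc, hs, hx, Category.comp_id])
    refine ⟨c * v (genericPoint X), ?_⟩
    rw [hc, hxe, E.mul_smul]
  refine ⟨r, fun y => ?_⟩
  obtain ⟨U, e, x, hy, hf, hx, hxe⟩ := he y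
  obtain ⟨w, hw⟩ := frame_coef hf (𝟙 _) (U.ι ≫ s) (by rw [Category.assoc, hs, Category.comp_id, Category.id_comp])
  rw [Category.id_comp] at hw
  have h1 : r = x.appTop w * v y := by
    obtain ⟨z, hz⟩ := hv y
    have hz1 : (z⁻¹ : (Γ(Spec X.functionField, ⊤))ˣ) * v y = 1 := by rw [← hz, Units.inv_mul]
    have e0' : e0 = E.smul (z⁻¹ : (Γ(Spec X.functionField, ⊤))ˣ) (x ≫ e 0) := by
      rw [hxe, ← E.mul_smul, hz1, E.one_smul]
    have h2 : E.smul r e0 = E.smul (x.appTop w * v y) e0 := by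
      rw [← hr, ← hx, Category.assoc, hw, E.smul_natural, hxe, E.mul_smul]
    rw [e0', ← E.mul_smul, ← E.mul_smul] at h2
    have h3 := frame_inj hf x h2
    exact (Units.isUnit (z⁻¹)).mul_right_cancel h3
  have hsurj : ∃ W : Γ(X, U), pb U.ι (lands_ι U) W = w := by
    have hiso : IsIso (U.ι.appLE U ⊤ (lands_ι U)) := inferInstanceAs (IsIso (U.ι.appLE U ⊤ U.ι_preimage_self.ge))
    exact ((ConcreteCategory.isIso_iff_bijective _).mp hiso).2 w
  obtain ⟨W, hW⟩ := hsurj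
  refine ⟨X.presheaf.germ U y hy W, ?_, ?_⟩
  · rw [h1, ← hW]
    have hl : Lands (etaX X) U := by rw [← hx]; exact (lands_ι U).comp x
    rw [pb_nat x U.ι _ ((lands_ι U).comp x), pb_congr hx _ hl, pb_eta hl W y hy]
  · refine Iff.trans ?_ (vanish_iff hf s hs w hw ⟨y, hy⟩).symm
    have hg := gm_pb U.ι (lands_ι U) W ⟨y, hy⟩
    rw [hW] at hg
    rw [hg]
    have hiso : IsIso (U.ι.stalkMap ⟨y, hy⟩) :=
      (fun (v : U.toScheme) => (inferInstance : IsIso (U.ι.stalkMap v))) _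
    exact (isUnit_map_iff (U.ι.stalkMap ⟨y, hy⟩).hom _).symm

end PartM8a

section PartM8b

variable {X : Scheme.{u}} [IsIntegral X]

theorem frame_res {X : Scheme.{u}} {E : VecBundleData X} {n : ℕ} {U V : X.Opens} (h : V ≤ U) {e : Fin n → (U.toScheme ⟶ E.tot)} (he : E.IsFrame U e) :
    E.IsFrame V (fun i => X.homOfLE h ≫ e i) := by
  obtain ⟨h1, h2⟩ := he
  refine ⟨fun i => by rw [Category.assoc, h1, Scheme.homOfLE_ι], ?_⟩
  intro T x
  have hb := h2 (x ≫ X.homOfLE h)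
  have key : ∀ (y : T ⟶ X) (hy : (x ≫ X.homOfLE h) ≫ U.ι = y) (p : ∀ i, (x ≫ X.homOfLE h ≫ e i) ≫ E.π = y), Function.Bijective (fun f : Fin n → Γ(T, ⊤) =>
        (∑ i, f i • (⟨x ≫ X.homOfLE h ≫ e i, p i⟩ : E.Fiber y))) := by
    rintro y rfl p
    simpa only [Category.assoc] using hb
  exact key _ (by rw [Category.assoc, Scheme.homOfLE_ι]) _

theorem eta_lift (U : X.Opens) (y : X) (hy : y ∈ U) : ∃ x : Spec X.functionField ⟶ U.toScheme, x ≫ U.ι = etaX X := by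
  have hη : genericPoint X ∈ U := (genericPoint_spec X).mem_open_set_iff U.2 |>.mpr ⟨y, trivial, hy⟩
  refine ⟨IsOpenImmersion.lift U.ι (etaX X) ?_, IsOpenImmersion.lift_fac _ _ _⟩
  intro z hz
  rw [Scheme.range_fromSpecStalk] at hz
  exact ⟨⟨z, hz.mem_open U.2 hη⟩, rfl⟩

theorem exists_genFr (L : LineBundle X) : ∃ (e0 : Spec X.functionField ⟶ L.tot) (v : X → Γ(Spec X.functionField, ⊤)),
    e0 ≫ L.π = etaX X ∧ (∀ y, IsUnit (v y)) ∧ ∀ y, GenFr L.toVecBundleData e0 y (v y) := by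
  obtain ⟨U, e, hy, he⟩ := L.locTriv (genericPoint X)
  obtain ⟨x, hx⟩ := eta_lift U _ hy
  have hπ : (x ≫ e 0) ≫ L.π = etaX X := by rw [Category.assoc, he.1, hx]
  have key : ∀ y, ∃ v, IsUnit v ∧ GenFr L.toVecBundleData (x ≫ e 0) y v := by
    intro y
    obtain ⟨U', e', hy', he'⟩ := L.locTriv y
    obtain ⟨x', hx'⟩ := eta_lift U' _ hy'
    have hπ' : (x' ≫ e' 0) ≫ L.π = etaX X := by rw [Category.assoc, he'.1, hx']
    obtain ⟨c, hc⟩ := frame_coef he x (x' ≫ e' 0) (by rw [hπ', hx])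
    obtain ⟨d, hd⟩ := frame_coef he' x' (x ≫ e 0) (by rw [hπ, hx'])
    refine ⟨c, ?_, U', e', x', hy', he', hx', hc⟩
    have : d * c = 1 := by
      apply frame_inj he x
      rw [L.mul_smul, ← hc, ← hd, L.one_smul]
    exact IsUnit.of_mul_eq_one_right d this
  choose v hv hg using key
  exact ⟨_, v, hπ, hv, hg⟩

theorem GenFr.of_le {E : VecBundleData X} {e0 : Spec X.functionField ⟶ E.tot} {v} {U : X.Opens} {e : Fin 1 → (U.toScheme ⟶ E.tot)}
    (hf : E.IsFrame U e) {x : Spec X.functionField ⟶ U.toScheme} (hx : x ≫ U.ι = etaX X) (hxe : x ≫ e 0 = E.smul v e0) {V : X.Opens} (h : V ≤ U) 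
    {x' : Spec X.functionField ⟶ V.toScheme} (hx' : x' ≫ V.ι = etaX X) :
    E.IsFrame V (fun i => X.homOfLE h ≫ e i) ∧ x' ≫ X.homOfLE h ≫ e 0 = E.smul v e0 := by
  refine ⟨frame_res h hf, ?_⟩
  have : x' ≫ X.homOfLE h = x := by
    rw [← cancel_mono U.ι, Category.assoc, Scheme.homOfLE_ι, hx, hx']
  rw [← Category.assoc, this, hxe]

theorem genFr_pow (L : LineBundle X) (e0 : Spec X.functionField ⟶ L.tot) (v : X → Γ(Spec X.functionField, ⊤)) (hπ : e0 ≫ L.π = etaX X)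
    (hg : ∀ y, GenFr L.toVecBundleData e0 y (v y)) (m : ℕ) : ∀ N : LineBundle X, IsTensorPow L m N →
      ∃ e1 : Spec X.functionField ⟶ N.tot, e1 ≫ N.π = etaX X ∧ ∀ y, GenFr N.toVecBundleData e1 y (v y ^ m) := by
  induction m with
  | zero =>
    rintro N ⟨e, h1, h2⟩
    refine ⟨etaX X ≫ e 0, by rw [Category.assoc, h1, Category.comp_id], fun y => ?_⟩
    obtain ⟨x, hx⟩ := eta_lift (⊤ : X.Opens) y trivial
    refine ⟨⊤, fun i => (⊤ : X.Opens).ι ≫ e i, x, trivial, ⟨fun i => by rw [Category.assoc, h1, Category.comp_id], ?_⟩, hx, ?_⟩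
    · intro T z
      simpa only [Category.assoc] using h2 (z ≫ (⊤ : X.Opens).ι)
    · rw [pow_zero, N.one_smul, ← hx, Category.assoc]
  | succ m ih =>
    rintro N ⟨M, hM, β, bπ, bnat, -, -, bs1, bs2, bf⟩
    obtain ⟨e1, hπ1, hg1⟩ := ih M hM
    have hh : e1 ≫ M.π = e0 ≫ L.π := by rw [hπ1, hπ]
    refine ⟨β e1 e0 hh, by rw [bπ, hπ1], fun y => ?_⟩
    obtain ⟨U, e, x, hy, hf, hx, hxe⟩ := hg y
    obtain ⟨U', e', x', hy', hf', hx', hxe'⟩ := hg1 y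
    obtain ⟨z, hz⟩ := eta_lift (U ⊓ U') y ⟨hy, hy'⟩
    obtain ⟨a1, a2⟩ := GenFr.of_le hf hx hxe (inf_le_left : U ⊓ U' ≤ U) hz
    obtain ⟨b1, b2⟩ := GenFr.of_le hf' hx' hxe' (inf_le_right : U ⊓ U' ≤ U') hz
    have hb : (X.homOfLE (inf_le_right : U ⊓ U' ≤ U') ≫ e' 0) ≫ M.π = (X.homOfLE (inf_le_left : U ⊓ U' ≤ U) ≫ e 0) ≫ L.π := (b1.1 0).trans (a1.1 0).symm
    refine ⟨U ⊓ U', _, z, ⟨hy, hy'⟩, bf _ _ _ b1 a1 hb, hz, ?_⟩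
    have q : ∀ (p : Spec X.functionField ⟶ M.tot) (p' : Spec X.functionField ⟶ L.tot) (hp : p = M.smul (v y ^ m) e1) (hp' : p' = L.smul (v y) e0) (h),
        β p p' h = N.smul (v y ^ (m + 1)) (β e1 e0 hh) := by
      rintro _ _ rfl rfl h
      rw [bs1 _ _ _ h (by rw [L.smul_π, hh]), bs2 _ _ _ _ hh, ← N.mul_smul, pow_succ]
    exact (bnat z _ _ hb ((Category.assoc _ _ _).trans ((congrArg (z ≫ ·) hb).trans (Category.assoc _ _ _).symm))).trans (q _ _ b2 a2 _)

end PartM8b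

section PartM8c

variable {X : Scheme.{u}} [IsIntegral X]

theorem exists_poly (L : LineBundle X) (hL : IsAmple L) : ∃ s : Polynomial X.functionField,
    (∀ p, ∃ α b, Chart s.coeff p α b) ∧ ∀ i, s.coeff i ≠ 0 → IsAffineOpen (cU s.coeff (poly_fin s) i) := by
  classical
  obtain ⟨hc, -, hx⟩ := hL
  obtain ⟨e0, v', hπ, hv', hg⟩ := exists_genFr L
  have hgv : ∀ y, ∃ v, gi X v = v' y := fun y => gi_bij.2 _
  choose v hv using hgv
  have hv0 : ∀ y, v y ≠ 0 := by
    intro y h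
    have := hv' y
    rw [← hv, h, map_zero] at this
    have h0 : (0 : X.functionField) = 1 := gi_bij.1 (by
      rw [map_zero, map_one]
      exact (isUnit_zero_iff.mp this))
    exact zero_ne_one h0
  have key : ∀ x : X, ∃ (m : ℕ) (r : X.functionField) (U : X.Opens), 0 < m ∧ IsAffineOpen U ∧ x ∈ U ∧ 
      ∀ y, ∃ t, tK X y t * v y ^ m = r ∧ (IsUnit t ↔ y ∈ U) := by
    intro x
    obtain ⟨m, hm, N, hN, s, hs, U, hU, hxU, hUs⟩ := hx x
    obtain ⟨e1, hπ1, hg1⟩ := genFr_pow L e0 v' hπ hg m N hN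
    obtain ⟨r', hr'⟩ := sec_gen (fun y => (hv' y).pow m) hg1 s hs
    obtain ⟨r, rfl⟩ := gi_bij.2 r'
    refine ⟨m, r, U, hm, hU, hxU, fun y => ?_⟩
    obtain ⟨t, ht, htu⟩ := hr' y
    refine ⟨t, gi_bij.1 ?_, htu.trans ?_⟩
    · rw [map_mul, map_pow, hv, ht]
    · exact (Set.ext_iff.mp hUs y).symm
  choose m r U hm hU hxU ht using key
  obtain ⟨F, hF⟩ := isCompact_univ.elim_finite_subcover (fun x => (U x : Set X)) (fun x => (U x).2)
    (fun y _ => Set.mem_iUnion.mpr ⟨y, hxU y⟩)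
  have hcovF : ∀ y, ∃ x ∈ F, y ∈ U x := by
    intro y
    have := hF (Set.mem_univ y)
    simpa using this
  let M := ∏ x ∈ F, m x
  have hM : ∀ x ∈ F, ∃ a, 0 < a ∧ M = m x * a := by
    intro x hx
    refine ⟨∏ z ∈ F.erase x, m z, Finset.prod_pos fun z _ => hm z, (Finset.mul_prod_erase F m hx).symm⟩
  let E := F.equivFin
  -- the elements
  have hS : ∀ i : Fin F.card, ∃ S : X.functionField, ∀ y, ∃ t, tK X y t * v y ^ M = S ∧ (IsUnit t ↔ y ∈ U (E.symm i)) := by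
    intro i
    obtain ⟨a, ha, haM⟩ := hM _ (E.symm i).2
    refine ⟨r (E.symm i) ^ a, fun y => ?_⟩
    obtain ⟨t, h1, h2⟩ := ht (E.symm i) y
    refine ⟨t ^ a, ?_, (isUnit_pow_iff ha.ne').trans h2⟩
    rw [haM, map_pow, pow_mul, ← mul_pow, h1]
  choose S hS using hS
  let s : Polynomial X.functionField := ∑ i : Fin F.card, Polynomial.monomial (i : ℕ) (S i)
  have hs1 : ∀ i : Fin F.card, s.coeff i = S i := by
    intro i
    simp only [s, Polynomial.finsetSum_coeff, Polynomial.coeff_monomial]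
    simp [Fin.val_inj]
  have hs2 : ∀ i, s.coeff i ≠ 0 → i < F.card := by
    intro i hi
    by_contra hlt
    apply hi
    simp only [s, Polynomial.finsetSum_coeff, Polynomial.coeff_monomial]
    refine Finset.sum_eq_zero fun j _ => if_neg ?_
    intro h
    exact hlt (h ▸ j.2)
  have hloc : ∀ (y : X) (i : ℕ), ∃ t, tK X y t * v y ^ M = s.coeff i := by
    intro y i
    by_cases hi : s.coeff i = 0
    · exact ⟨0, by rw [hi, map_zero, zero_mul]⟩
    · obtain ⟨t, h1, h2⟩ := hS ⟨i, hs2 i hi⟩ y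
      exact ⟨t, h1.trans (hs1 ⟨i, hs2 i hi⟩).symm⟩
  have chart_of : ∀ (y : X) (i : Fin F.card), y ∈ U (E.symm i) → ∃ b, Chart s.coeff y i b := by
    intro y i hy
    obtain ⟨t, h1, h2⟩ := hS i y
    obtain ⟨t, rfl⟩ := h2.mpr hy
    have hA := hloc y
    choose A hA using hA
    have hinv : tK X y (t⁻¹ : _) * tK X y t = 1 := by
      rw [← map_mul, Units.inv_mul, map_one]
    refine ⟨fun j => A j * (t⁻¹ : _), ?_, fun j => ?_⟩
    · rw [hs1, ← h1]
      exact mul_ne_zero ((Units.isUnit t).map (tK X y)).ne_zero (pow_ne_zero _ (hv0 y))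
    · rw [hs1, ← h1, ← hA j, map_mul]
      linear_combination (tK X y (A j) * v y ^ M) * hinv
  refine ⟨s, fun y => ?_, fun i hi => ?_⟩
  · obtain ⟨x, hx, hy⟩ := hcovF y
    obtain ⟨b, hb⟩ := chart_of y (E ⟨x, hx⟩) (by simpa using hy)
    exact ⟨_, b, hb⟩
  · have : cU s.coeff (poly_fin s) i = U (E.symm ⟨i, hs2 i hi⟩) := by
      ext y
      refine ⟨fun h => ?_, fun h => chart_of y ⟨i, hs2 i hi⟩ h⟩
      obtain ⟨b, hb⟩ := h
      obtain ⟨x, hx, hy⟩ := hcovF y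
      obtain ⟨t, h1, h2⟩ := hS (E ⟨x, hx⟩) y
      obtain ⟨t', h1', h2'⟩ := hS ⟨i, hs2 i hi⟩ y
      have hu : IsUnit t := h2.mpr (by simpa using hy)
      have e : t = b (E ⟨x, hx⟩) * t' := by
        apply tK_inj X
        apply mul_right_cancel₀ (pow_ne_zero M (hv0 y))
        rw [h1, map_mul, mul_assoc, h1', ← hs1, ← hs1, ← hb.2]
      rw [e] at hu
      exact h2'.mp (isUnit_of_mul_isUnit_right hu)
    rw [this]
    exact hU _

end PartM8c

section PartFin

theorem gh_ft {k : Type u} [Field k] (G : GroupSchemeOver k) (hGalg : G.IsAlgebraic) [IsAffine G.carrier] : Algebra.FiniteType k (GH G) := by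
  haveI := hGalg.1
  have h1 : LocallyOfFiniteType (smap (kH G)) := by
    rw [kH, smap_pre]; infer_instance
  have h2 := (HasRingHomProperty.Spec_iff (P := @LocallyOfFiniteType)).mp h1
  exact h2

theorem main_final
    {k : Type u} [Field k] (G : GroupSchemeOver k) (hGalg : G.IsAlgebraic)
    (hGaff : IsAffine G.carrier)
    (X : SchemeOver k) (hXvar : X.IsVariety) (hXnorm : IsNormalScheme X.carrier)
    (hXqp : X.IsQuasiProjective) (α : ActionOver G X) :
    ∃ L : LineBundle X.carrier, IsAmple L ∧ α.IsLinearized L := by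
  haveI := hXvar.1
  haveI := gh_ft G hGalg
  obtain ⟨-, -, L₀, hL₀⟩ := hXqp
  obtain ⟨s, hcov, hU⟩ := exists_poly L₀ hL₀
  obtain ⟨n, ⟨gd⟩⟩ := exists_gdata (G := G)
  haveI : Nontrivial (GH G) := (rone G (RingHom.id k)).domain_nontrivial
  obtain ⟨d, hd⟩ := exists_genAlg (k := k) gd.ε gd.gen
  obtain ⟨GA⟩ := hd (FractionRing (MvPolynomial (Fin d × Option (Fin n)) k))
  obtain ⟨f, hf⟩ := exists_isGen (α := α) (gd := gd) (GA := GA) hcov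
  have hc := gen_chart hcov hXnorm hf
  have he : EqvF α gd f := fun R _ h x hh a a' ha ha' => eq_main hcov hXnorm hf h x hh ha ha'
  exact ⟨(theLRep (fC hc)).bundle, ample_gen hcov hXnorm hf hU hL₀.1 hL₀.2.1 hc _, isLinearized he _⟩

end PartFin

/-- Let `k` be a field, `G` an affine algebraic group over `k` (not
necessarily smooth or connected), and `X` a normal quasi-projective `G`-variety. Then `X`
admits an ample `G`-linearized line bundle (equivalently, a `G`-equivariant immersion into
the projectivization of a finite-dimensional `G`-module). -/
theorem affine_group_ample_linearized_line_bundle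
    {k : Type u} [Field k] (G : GroupSchemeOver k) (hGalg : G.IsAlgebraic)
    (hGaff : IsAffine G.carrier)
    (X : SchemeOver k) (hXvar : X.IsVariety) (hXnorm : IsNormalScheme X.carrier)
    (hXqp : X.IsQuasiProjective) (α : ActionOver G X) :
    ∃ L : LineBundle X.carrier, IsAmple L ∧ α.IsLinearized L := by
  exact main_final G hGalg hGaff X hXvar hXnorm hXqp α
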